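/- Let D = (P, B) be a nontrivial 2-(v,k,λ) design with λ ≤ 4 that admits a group G of automorphisms acting flag-transitively and point-imprimitively (i.e., G is transitive on flags and leaves invariant a partition of P with at least 2 classes, each class of size at least 2). Then v ∈ {15, 16, 36, 45, 96}. -/

import Mathlib

section Counting

open Finset
open scoped Classical

variable {X Y : Type*} [Fintype X] [Fintype Y]

/-- The number of elements with a property. -/
noncomputable def cnt (p : X → Prop) : ℕ := #{x | p x}

theorem cnt_congr {p q : X → Prop} (h : ∀ x, p x ↔ q x) : cnt p = cnt q := by
  rw [funext fun x => propext (h x)]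

theorem cnt_mono {p q : X → Prop} (h : ∀ x, p x → q x) : cnt p ≤ cnt q :=
  card_le_card (monotone_filter_right univ fun x _ => h x)

theorem cnt_eq_zero {p : X → Prop} : cnt p = 0 ↔ ∀ x, ¬ p x := by
  simp [cnt, filter_eq_empty_iff]

theorem cnt_pos {p : X → Prop} : 0 < cnt p ↔ ∃ x, p x := by
  simp [cnt, Finset.card_pos, Finset.Nonempty]

theorem cnt_true : cnt (fun _ : X => True) = Fintype.card X := by
  simp [cnt]

theorem cnt_eq_one_of {p : X → Prop} (x : X) (hx : p x) (h : ∀ y, p y → y = x) : cnt p = 1 :=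
  Finset.card_eq_one.2 ⟨x, by ext y; simp; exact ⟨h y, by rintro rfl; exact hx⟩⟩

theorem exists_of_cnt_eq_one {p : X → Prop} (h : cnt p = 1) : ∃ x, p x ∧ ∀ y, p y → y = x := by
  obtain ⟨x, hx⟩ := Finset.card_eq_one.1 h
  simp only [Finset.ext_iff, mem_filter, mem_univ, true_and, mem_singleton] at hx
  exact ⟨x, (hx x).2 rfl, fun y => (hx y).1⟩

theorem cnt_and_add_not (p q : X → Prop) :
    cnt (fun x => p x ∧ q x) + cnt (fun x => p x ∧ ¬ q x) = cnt p := by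
  have := card_filter_add_card_filter_not (s := univ.filter p) q
  rw [filter_filter, filter_filter] at this
  unfold cnt
  convert this

theorem cnt_add_not (q : X → Prop) : cnt q + cnt (fun x => ¬ q x) = Fintype.card X := by
  have := cnt_and_add_not (fun _ => True) q
  simpa [cnt_true] using this

theorem cnt_or {p q : X → Prop} (h : ∀ x, p x → ¬ q x) :
    cnt (fun x => p x ∨ q x) = cnt p + cnt q := by
  rw [← cnt_and_add_not _ p]
  congr 1 <;> exact cnt_congr fun x => by have := h x; tauto

theorem cnt_le_card (p : X → Prop) : cnt p ≤ Fintype.card X := by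
  rw [← cnt_true]; exact cnt_mono (by simp)

theorem cnt_ne_add_one {p : X → Prop} {x : X} (hx : p x) :
    cnt (fun y => p y ∧ y ≠ x) + 1 = cnt p := by
  rw [← cnt_and_add_not p (fun y => y = x), add_comm]
  congr 1
  exact (cnt_eq_one_of x ⟨hx, rfl⟩ fun y hy => hy.2).symm

theorem exists_ne_of_one_lt_cnt {p : X → Prop} (h : 1 < cnt p) (x : X) : ∃ y, p y ∧ y ≠ x := by
  obtain ⟨y, hy, h⟩ := exists_mem_ne h x
  exact ⟨y, (mem_filter.1 hy).2, h⟩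

theorem eq_of_cnt_le {p q : X → Prop} (h : ∀ x, p x → q x) (hc : cnt q ≤ cnt p) (x : X)
    (hx : q x) : p x := by
  have := eq_of_subset_of_card_le (monotone_filter_right univ fun x _ => h x) hc
  have hx' : x ∈ univ.filter q := by simpa using hx
  rw [← this] at hx'
  exact (mem_filter.1 hx').2

theorem cnt_eq_sum (p : X → Prop) : cnt p = ∑ x, if p x then 1 else 0 := card_filter ..

theorem sum_cnt_comm (R : X → Y → Prop) :
    ∑ x, cnt (fun y => R x y) = ∑ y, cnt (fun x => R x y) := by
  simp only [cnt_eq_sum]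
  exact sum_comm

theorem cnt_mul_eq_sum (p : X → Prop) (R : X → Y → Prop) {m : ℕ}
    (hp : ∀ x y, R x y → p x) (h : ∀ x, p x → cnt (fun y => R x y) = m) :
    cnt p * m = ∑ y, cnt (fun x => R x y) := by
  rw [← sum_cnt_comm, cnt_eq_sum, sum_mul]
  refine sum_congr rfl fun x _ => ?_
  split_ifs with hx
  · rw [h x hx, one_mul]
  · rw [zero_mul, eq_comm, cnt_eq_zero]
    exact fun y hy => hx (hp x y hy)

theorem cnt_mul_eq_cnt_mul (p : X → Prop) (q : Y → Prop) (R : X → Y → Prop) {m n : ℕ}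
    (hp : ∀ x y, R x y → p x) (hq : ∀ x y, R x y → q y) (h : ∀ x, p x → cnt (fun y => R x y) = m)
    (h' : ∀ y, q y → cnt (fun x => R x y) = n) :
    cnt p * m = cnt q * n := by
  rw [cnt_mul_eq_sum p R hp h, sum_cnt_comm, ← cnt_mul_eq_sum q (fun y x => R x y)
    (fun y x => hq x y) h']

theorem cnt_equiv (e : X ≃ Y) (p : X → Prop) (q : Y → Prop) (h : ∀ x, p x ↔ q (e x)) :
    cnt p = cnt q := by
  refine card_bij (fun x _ => e x) ?_ (fun _ _ _ _ h => e.injective h) ?_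
  · intro x hx
    simpa [← h] using hx
  · intro y hy
    exact ⟨e.symm y, by simpa [h] using hy, by simp⟩

theorem cnt_smul {Γ : Type*} [Group Γ] [MulAction Γ X] (g : Γ) (p q : X → Prop)
    (h : ∀ x, p x ↔ q (g • x)) : cnt p = cnt q :=
  cnt_equiv (MulAction.toPerm g) p q h

end Counting

/-- A design with points `P`, classes `C` and blocks `β`, with a group `Γ` acting faithfully on
the points and transitively on the flags; there are `d` classes of size `c`, blocks meet `s`
classes, each in `l` points, there are `r` blocks on a point and `lam` on a pair of points. -/
structure ImprimDesign (Γ P C β : Type*) [Group Γ] [Fintype P] [Fintype C] [Fintype β]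
    [MulAction Γ P] [MulAction Γ C] [MulAction Γ β] (lam c d l s r b : ℕ) where
  I : P → β → Prop
  cls : P → C
  I_smul : ∀ (g : Γ) x B, I (g • x) (g • B) ↔ I x B
  cls_smul : ∀ (g : Γ) x, cls (g • x) = g • cls x
  faithful : ∀ g : Γ, (∀ x : P, g • x = x) → g = 1
  flag : ∀ x B y B', I x B → I y B' → ∃ g : Γ, g • x = y ∧ g • B = B'
  pair : ∀ x y, x ≠ y → cnt (fun B => I x B ∧ I y B) = lam
  card_cls : ∀ Δ, cnt (fun x => cls x = Δ) = c
  card_C : Fintype.card C = d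
  card_B : Fintype.card β = b
  card_pt : ∀ x, cnt (fun B => I x B) = r
  card_inter : ∀ x B, I x B → cnt (fun y => I y B ∧ cls y = cls x) = l
  card_S : ∀ B, cnt (fun Δ => ∃ x, I x B ∧ cls x = Δ) = s
  lam_pos : 0 < lam
  two_le_c : 2 ≤ c
  two_le_d : 2 ≤ d

namespace ImprimDesign

open Finset MulAction

variable {Γ P C β : Type*} [Group Γ] [Fintype P] [Fintype C] [Fintype β]
    [MulAction Γ P] [MulAction Γ C] [MulAction Γ β] {lam c d l s r b : ℕ}
    (D : ImprimDesign Γ P C β lam c d l s r b)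

/-- The block `B` meets the class `Δ`. -/
def Meets (B : β) (Δ : C) : Prop := ∃ x, D.I x B ∧ D.cls x = Δ

/-- The number of points common to two blocks. -/
noncomputable def a (B B' : β) : ℕ := cnt fun x => D.I x B ∧ D.I x B'

/-- The number of classes met by both of two blocks. -/
noncomputable def e (B B' : β) : ℕ := cnt fun Δ => D.Meets B Δ ∧ D.Meets B' Δ

theorem meets_smul (g : Γ) (B : β) (Δ : C) : D.Meets (g • B) (g • Δ) ↔ D.Meets B Δ := by
  constructor
  · rintro ⟨x, hx, hΔ⟩
    refine ⟨g⁻¹ • x, ?_, ?_⟩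
    · rw [← D.I_smul g]; simpa using hx
    · rw [D.cls_smul, hΔ]; simp
  · rintro ⟨x, hx, hΔ⟩
    exact ⟨g • x, (D.I_smul g x B).2 hx, by rw [D.cls_smul, hΔ]⟩

theorem exists_cls (Δ : C) : ∃ x, D.cls x = Δ :=
  cnt_pos.1 (by have := D.card_cls Δ; have := D.two_le_c; omega)

theorem exists_ne_cls (x : P) : ∃ y, D.cls y = D.cls x ∧ y ≠ x :=
  exists_ne_of_one_lt_cnt (by have := D.card_cls (D.cls x); have := D.two_le_c; omega) x

theorem exists_block₂ (x y : P) (h : x ≠ y) : ∃ B, D.I x B ∧ D.I y B :=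
  cnt_pos.1 (by have := D.pair x y h; have := D.lam_pos; omega)

theorem exists_block (x : P) : ∃ B, D.I x B := by
  obtain ⟨y, -, hy⟩ := D.exists_ne_cls x
  obtain ⟨B, hB⟩ := D.exists_block₂ x y hy.symm
  exact ⟨B, hB.1⟩

theorem nonempty_C (D : ImprimDesign Γ P C β lam c d l s r b) : Nonempty C :=
  Fintype.card_pos_iff.1 (by have := D.card_C; have := D.two_le_d; omega)

theorem nonempty_P (D : ImprimDesign Γ P C β lam c d l s r b) : Nonempty P := by
  obtain ⟨Δ⟩ := D.nonempty_C
  exact ⟨(D.exists_cls Δ).choose⟩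

theorem nonempty_β (D : ImprimDesign Γ P C β lam c d l s r b) : Nonempty β := by
  obtain ⟨x⟩ := D.nonempty_P
  exact ⟨(D.exists_block x).choose⟩

theorem r_pos (D : ImprimDesign Γ P C β lam c d l s r b) : 0 < r := by
  obtain ⟨x⟩ := D.nonempty_P
  rw [← D.card_pt x]
  exact cnt_pos.2 (D.exists_block x)

theorem card_P (D : ImprimDesign Γ P C β lam c d l s r b) : Fintype.card P = d * c := by
  have h := cnt_mul_eq_cnt_mul (fun _ : C => True) (fun _ : P => True)
    (fun Δ x => D.cls x = Δ) (m := c) (n := 1) (by simp) (by simp)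
    (fun Δ _ => D.card_cls Δ) (fun x _ => cnt_eq_one_of (D.cls x) rfl fun y h => h.symm)
  rw [cnt_true, cnt_true, D.card_C] at h
  omega

theorem card_inter_of_meets {B : β} {Δ : C} (h : D.Meets B Δ) :
    cnt (fun y => D.I y B ∧ D.cls y = Δ) = l := by
  obtain ⟨x, hx, rfl⟩ := h
  exact D.card_inter x B hx

theorem card_meets (B : β) : cnt (fun Δ => D.Meets B Δ) = s := D.card_S B

theorem card_block (B : β) : cnt (fun x => D.I x B) = s * l := by
  have h := cnt_mul_eq_cnt_mul (fun Δ : C => D.Meets B Δ) (fun x : P => D.I x B)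
    (fun Δ x => D.I x B ∧ D.cls x = Δ) (m := l) (n := 1)
    (fun Δ x hx => ⟨x, hx⟩) (fun Δ x hx => hx.1)
    (fun Δ hΔ => D.card_inter_of_meets hΔ)
    (fun x hx => cnt_eq_one_of (D.cls x) ⟨hx, rfl⟩ fun y h => h.2.symm)
  rw [D.card_meets] at h
  omega

theorem l_pos (D : ImprimDesign Γ P C β lam c d l s r b) : 0 < l := by
  obtain ⟨x⟩ := D.nonempty_P
  obtain ⟨B, hB⟩ := D.exists_block x
  rw [← D.card_inter x B hB]
  exact cnt_pos.2 ⟨x, hB, rfl⟩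

theorem s_pos (D : ImprimDesign Γ P C β lam c d l s r b) : 0 < s := by
  obtain ⟨x⟩ := D.nonempty_P
  obtain ⟨B, hB⟩ := D.exists_block x
  rw [← D.card_S B]
  exact cnt_pos.2 ⟨D.cls x, x, hB, rfl⟩

theorem exists_pt (B : β) : ∃ x, D.I x B :=
  cnt_pos.1 (by have := D.card_block B; have := Nat.mul_pos D.s_pos D.l_pos; omega)

/-- Counting flags. -/
theorem b_mul_eq (D : ImprimDesign Γ P C β lam c d l s r b) : b * (s * l) = d * c * r := by
  have h := cnt_mul_eq_cnt_mul (fun _ : β => True) (fun _ : P => True)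
    (fun B x => D.I x B) (m := s * l) (n := r) (by simp) (by simp)
    (fun B _ => D.card_block B) (fun x _ => D.card_pt x)
  rwa [cnt_true, cnt_true, D.card_B, D.card_P] at h

theorem smul_iff_of_stabilizer {X Z : Type*} [MulAction Γ X] [MulAction Γ Z] {x : X} {Y : Z → Prop}
    (hY : ∀ g : Γ, g • x = x → ∀ y, Y y → Y (g • y)) (g : Γ) (hg : g • x = x) (y : Z) :
    Y y ↔ Y (g • y) :=
  ⟨hY g hg y, fun h => by
    have := hY g⁻¹ (by rw [inv_smul_eq_iff, hg]) _ h
    simpa using this⟩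

/-- Each `Γ_x`-invariant set `Y` of points other than `x` is met by all blocks on `x` in the same
number of points. -/
theorem exists_mul_eq_of_stabilizer (x : P) (Y : P → Prop) (hx : ¬ Y x)
    (hY : ∀ g : Γ, g • x = x → ∀ y, Y y → Y (g • y)) :
    ∃ n, r * n = lam * cnt Y ∧ ∀ B, D.I x B → cnt (fun y => D.I y B ∧ Y y) = n := by
  obtain ⟨B, hB⟩ := D.exists_block x
  have hc : ∀ B', D.I x B' → cnt (fun y => D.I y B' ∧ Y y) = cnt (fun y => D.I y B ∧ Y y) := by
    intro B' hB'
    obtain ⟨g, hg, rfl⟩ := D.flag x B x B' hB hB'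
    refine (cnt_smul g _ _ fun y => ?_).symm
    rw [D.I_smul, ← smul_iff_of_stabilizer hY g hg]
  refine ⟨_, ?_, hc⟩
  have h := cnt_mul_eq_cnt_mul (fun B' : β => D.I x B') Y
    (fun B' y => D.I x B' ∧ D.I y B' ∧ Y y) (m := cnt (fun y => D.I y B ∧ Y y)) (n := lam)
    (fun B' y h => h.1) (fun B' y h => h.2.2)
    (fun B' hB' => (cnt_congr fun y => by simp [hB']).trans (hc B' hB'))
    (fun y hy => (cnt_congr fun y => by simp [hy]).trans
      (D.pair x y (by rintro rfl; exact hx hy)))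
  rw [D.card_pt] at h
  linarith

theorem r_mul_pred_l (D : ImprimDesign Γ P C β lam c d l s r b) : r * (l - 1) = lam * (c - 1) := by
  obtain ⟨x⟩ := D.nonempty_P
  obtain ⟨n, hn, hB⟩ := D.exists_mul_eq_of_stabilizer x (fun y => D.cls y = D.cls x ∧ y ≠ x)
    (by simp) (fun g hg y hy => ⟨by rw [D.cls_smul, hy.1, ← D.cls_smul, hg], fun h => hy.2 (by
      rw [← hg] at h; exact smul_left_cancel g (by rw [h, hg]))⟩)
  obtain ⟨B, hxB⟩ := D.exists_block x
  have h1 : cnt (fun y => D.cls y = D.cls x ∧ y ≠ x) + 1 = c :=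
    (cnt_ne_add_one (p := fun y => D.cls y = D.cls x) rfl).trans (D.card_cls _)
  have h2 := hB B hxB
  have h3 : n + 1 = l := by
    rw [← h2]
    refine Eq.trans ?_ ((cnt_ne_add_one (x := x) ⟨hxB, rfl⟩).trans (D.card_inter x B hxB))
    congr 1; exact cnt_congr fun y => by tauto
  rw [show l - 1 = n by omega, hn]
  congr 1
  omega

theorem r_mul_pred_k (D : ImprimDesign Γ P C β lam c d l s r b) : r * (s * l - 1) = lam * (d * c - 1) := by
  obtain ⟨x⟩ := D.nonempty_P
  obtain ⟨n, hn, hB⟩ := D.exists_mul_eq_of_stabilizer x (fun y => y ≠ x)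
    (by simp) (fun g hg y hy => fun h => hy (by
      rw [← hg] at h; exact smul_left_cancel g (by rw [h, hg])))
  obtain ⟨B, hxB⟩ := D.exists_block x
  have h1 : cnt (fun y => y ≠ x) + 1 = d * c := by
    rw [← D.card_P, ← cnt_true, ← cnt_ne_add_one (p := fun _ => True) (x := x) trivial]
    congr 1; exact cnt_congr fun y => by tauto
  have h2 := hB B hxB
  have h3 : n + 1 = s * l := by
    rw [← h2]
    exact (cnt_ne_add_one (x := x) hxB).trans (D.card_block B)
  rw [← h1, ← h3]
  simpa using hn

/-- Blocks on a point `x` meeting a class not containing `x`. -/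
theorem card_pt_meets (x : P) (Δ : C) (h : D.cls x ≠ Δ) :
    cnt (fun B => D.I x B ∧ D.Meets B Δ) * l = c * lam := by
  have h := cnt_mul_eq_cnt_mul (fun B : β => D.I x B ∧ D.Meets B Δ)
    (fun y : P => D.cls y = Δ)
    (fun B y => D.I x B ∧ D.I y B ∧ D.cls y = Δ) (m := l) (n := lam)
    (fun B y h => ⟨h.1, y, h.2⟩) (fun B y h => h.2.2)
    (fun B hB => (cnt_congr fun y => by simp [hB.1]).trans (D.card_inter_of_meets hB.2))
    (fun y hy => (cnt_congr fun B => by simp [hy]).trans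
      (D.pair x y (by rintro rfl; exact h hy)))
  rwa [D.card_cls] at h

/-- Blocks meeting a class. -/
theorem card_blocks_meets (Δ : C) : cnt (fun B => D.Meets B Δ) * l = c * r := by
  have h := cnt_mul_eq_cnt_mul (fun B : β => D.Meets B Δ)
    (fun y : P => D.cls y = Δ)
    (fun B y => D.I y B ∧ D.cls y = Δ) (m := l) (n := r)
    (fun B y h => ⟨y, h⟩) (fun B y h => h.2)
    (fun B hB => D.card_inter_of_meets hB)
    (fun y hy => (cnt_congr fun B => by simp [hy]).trans (D.card_pt y))
  rwa [D.card_cls] at h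

/-- Blocks meeting two classes. -/
theorem card_blocks_meets₂ (Δ Δ' : C) (h : Δ ≠ Δ') :
    cnt (fun B => D.Meets B Δ ∧ D.Meets B Δ') * (l * l) = c * c * lam := by
  have h1 := cnt_mul_eq_sum (fun B : β => D.Meets B Δ ∧ D.Meets B Δ')
    (fun B y => (D.I y B ∧ D.Meets B Δ') ∧ D.cls y = Δ) (m := l)
    (fun B y h => ⟨⟨y, h.1.1, h.2⟩, h.1.2⟩)
    (fun B hB => (cnt_congr fun y => by simp [hB.2]).trans (D.card_inter_of_meets hB.1))
  have h2 : c * c * lam = cnt (fun x => D.cls x = Δ) * (c * lam) := by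
    rw [D.card_cls, mul_assoc]
  rw [← mul_assoc, h1, sum_mul, h2, cnt_eq_sum, sum_mul]
  refine sum_congr rfl fun y _ => ?_
  split_ifs with hy
  · rw [one_mul, ← D.card_pt_meets y Δ' (by rw [hy]; exact h)]
    simp [hy]
  · simp [hy, cnt]

theorem a_comm (B B' : β) : D.a B B' = D.a B' B := cnt_congr fun _ => and_comm

theorem a_self (B : β) : D.a B B = s * l :=
  (cnt_congr fun _ => and_self_iff).trans (D.card_block B)

theorem a_smul (g : Γ) (B B' : β) : D.a (g • B) (g • B') = D.a B B' :=
  (cnt_smul g _ _ fun x => by rw [D.I_smul, D.I_smul]).symm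

theorem e_smul (g : Γ) (B B' : β) : D.e (g • B) (g • B') = D.e B B' :=
  (cnt_smul g _ _ fun x => by rw [D.meets_smul, D.meets_smul]).symm

theorem sum_a (B : β) : ∑ B', D.a B B' = s * l * r := by
  have h := cnt_mul_eq_sum (fun x : P => D.I x B)
    (fun x B' => D.I x B ∧ D.I x B') (m := r) (fun x B' h => h.1)
    (fun x hx => (cnt_congr fun B' => by simp [hx]).trans (D.card_pt x))
  rw [D.card_block] at h
  exact h.symm

theorem cnt_pairs {X : Type*} [Fintype X] (p : X → Prop) :
    cnt (fun z : X × X => (p z.1 ∧ p z.2) ∧ z.1 ≠ z.2) = cnt p * (cnt p - 1) := by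
  have h := cnt_mul_eq_cnt_mul p (fun z : X × X => (p z.1 ∧ p z.2) ∧ z.1 ≠ z.2)
    (fun x z => ((p z.1 ∧ p z.2) ∧ z.1 ≠ z.2) ∧ z.1 = x) (m := cnt p - 1) (n := 1)
    (fun x z h => h.2 ▸ h.1.1.1) (fun x z h => h.1) ?_ ?_
  · omega
  · intro x hx
    rw [← cnt_ne_add_one hx, Nat.add_sub_cancel]
    refine (Finset.card_bij (fun y _ => (x, y)) ?_ ?_ ?_).symm
    · intro y hy
      simp at hy
      simpa [hx, hy.1] using fun h => hy.2 h.symm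
    · simp
    · rintro ⟨y, z⟩ h
      simp only [mem_filter, mem_univ, true_and] at h
      obtain ⟨h, rfl⟩ := h
      exact ⟨z, by simpa [h.1.2] using fun h' => h.2 h'.symm, rfl⟩
  · rintro z hz
    exact cnt_eq_one_of z.1 ⟨hz, rfl⟩ fun y h => h.2.symm

theorem sum_a_mul_pred (B : β) :
    ∑ B', D.a B B' * (D.a B B' - 1) = (s * l) * (s * l - 1) * lam := by
  have h := cnt_mul_eq_sum (fun z : P × P => (D.I z.1 B ∧ D.I z.2 B) ∧ z.1 ≠ z.2)
    (fun z B' => ((D.I z.1 B ∧ D.I z.1 B') ∧ (D.I z.2 B ∧ D.I z.2 B')) ∧ z.1 ≠ z.2) (m := lam)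
    (fun z B' h => ⟨⟨h.1.1.1, h.1.2.1⟩, h.2⟩)
    (fun z hz => (cnt_congr fun B' => by simp [hz]).trans (D.pair z.1 z.2 hz.2))
  rw [cnt_pairs (fun x => D.I x B), D.card_block] at h
  rw [h]
  exact sum_congr rfl fun B' _ => (cnt_pairs (fun x => D.I x B ∧ D.I x B')).symm

end ImprimDesign

namespace ImprimDesign

open Finset MulAction

variable {Γ P C β : Type*} [Group Γ] [Fintype P] [Fintype C] [Fintype β]
    [MulAction Γ P] [MulAction Γ C] [MulAction Γ β] {lam c d l s r b : ℕ}

theorem l_lt_c (D : ImprimDesign Γ P C β lam c d l s r b) (hk : s * l < d * c) : l < c := by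
  have h1 := D.r_mul_pred_l
  have h2 := D.r_mul_pred_k
  have hl := D.l_pos
  have hs := D.s_pos
  have hr := D.r_pos
  have hc := D.two_le_c
  have hlam := D.lam_pos
  have h3 : lam < r := by
    by_contra h
    have : r * (s * l - 1) < lam * (d * c - 1) := by
      have : 0 < s * l := Nat.mul_pos hs hl
      calc r * (s * l - 1) ≤ lam * (s * l - 1) := Nat.mul_le_mul_right _ (by omega)
        _ < lam * (d * c - 1) := Nat.mul_lt_mul_of_pos_left (by omega) hlam
    omega
  by_contra h
  have : lam * (c - 1) < r * (l - 1) := by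
    calc lam * (c - 1) < r * (c - 1) := Nat.mul_lt_mul_of_pos_right h3 (by omega)
        _ ≤ r * (l - 1) := Nat.mul_le_mul_left _ (by omega)
  omega

theorem sum_a_ne (D : ImprimDesign Γ P C β lam c d l s r b) (B : β) [DecidableEq β]
    (f : ℕ → ℤ) : ∑ B' ∈ univ.erase B, f (D.a B B') = ∑ B', f (D.a B B') - f (s * l) := by
  rw [← add_sum_erase univ _ (mem_univ B), D.a_self]; ring

theorem sum_a_int (D : ImprimDesign Γ P C β lam c d l s r b) (B : β) :
    ∑ B', (D.a B B' : ℤ) = s * l * r := by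
  exact_mod_cast D.sum_a B

theorem sum_a_sq_int (D : ImprimDesign Γ P C β lam c d l s r b) (B : β) :
    ∑ B', (D.a B B' : ℤ) ^ 2 = s * l * r + (s * l) * (s * l - 1) * lam := by
  have h := D.sum_a_mul_pred B
  have h1 : ∀ n : ℕ, ((n * (n - 1) : ℕ) : ℤ) = (n : ℤ) ^ 2 - n := by
    intro n
    cases n with
    | zero => simp
    | succ n => simp only [Nat.add_sub_cancel]; push_cast; ring
  have h2 : ((∑ B', D.a B B' * (D.a B B' - 1) : ℕ) : ℤ) = ((s * l) * (s * l - 1) * lam : ℕ) := by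
    rw [h]
  rw [Nat.cast_sum, sum_congr rfl fun B' _ => h1 (D.a B B'), sum_sub_distrib, sum_a_int,
    Nat.cast_mul, h1] at h2
  push_cast at h2
  linarith

/-- Fisher's inequality. -/
theorem k_le_r (D : ImprimDesign Γ P C β lam c d l s r b) (hk : s * l < d * c) : s * l ≤ r := by
  classical
  obtain ⟨B⟩ := D.nonempty_β
  have h1 := D.sum_a_ne B (fun n => (n : ℤ))
  have h2 := D.sum_a_ne B (fun n => (n : ℤ) ^ 2)
  have h3 := sq_sum_le_card_mul_sum_sq (s := univ.erase B) (f := fun B' => (D.a B B' : ℤ))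
  rw [h1, h2, sum_a_int, sum_a_sq_int, card_erase_of_mem (mem_univ B), card_univ, D.card_B] at h3
  have hb := D.b_mul_eq
  have hr := D.r_mul_pred_k
  have hkp : 0 < s * l := Nat.mul_pos D.s_pos D.l_pos
  have hrp := D.r_pos
  have hlam := D.lam_pos
  have hbp : 0 < b := by
    rw [← D.card_B]; exact Fintype.card_pos_iff.2 ⟨B⟩
  push_cast at h3
  rw [Nat.cast_sub (by omega)] at h3
  zify at hb hk hkp hrp hlam ⊢
  zify [show 1 ≤ s * l from Nat.mul_pos D.s_pos D.l_pos,
    show 1 ≤ d * c by have := Nat.mul_le_mul D.two_le_d D.two_le_c; omega] at hr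
  generalize hK : (s : ℤ) * l = k at *
  generalize (d : ℤ) * c = v at *
  generalize (b : ℤ) = b at *
  generalize (r : ℤ) = r at *
  generalize (lam : ℤ) = t at *
  by_contra hlt
  push Not at hlt
  have hrt : t < r := by
    by_contra h
    nlinarith
  have hk1 : 1 < k := by omega
  have e1 : t * (b * k - k) = t * r + r ^ 2 * (k - 1) - t * k := by
    rw [hb]; linear_combination (-r) * hr
  have h4 : t * k * (k * r - k) ^ 2 ≤ t * k * ((b - 1) * (k * r + k * (k - 1) * t - k ^ 2)) := by
    apply mul_le_mul_of_nonneg_left _ (by positivity)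
    push_cast at h3
    linarith
  have h5 : t * k * ((b - 1) * (k * r + k * (k - 1) * t - k ^ 2)) - t * k * (k * r - k) ^ 2
    = k * ((r - k) * ((k - 1) * (r - t) * (r - t))) := by
    have : t * k * (b - 1) = t * r + r ^ 2 * (k - 1) - t * k := by linarith
    linear_combination (k * r + k * (k - 1) * t - k ^ 2) * this
  have h6 : 0 < (k - 1) * (r - t) * (r - t) := by
    have : 0 < k - 1 := by linarith
    have : 0 < r - t := by linarith
    positivity
  nlinarith [mul_pos hkp (mul_pos (sub_pos.2 hlt) h6)]

end ImprimDesign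

/-- Parameters surviving the elementary counting arguments. -/
def exceptionalParameters : List (ℕ × ℕ × ℕ × ℕ × ℕ × ℕ × ℕ) :=
  [(2, 10, 10, 2, 6, 18, 150), (2, 22, 22, 2, 12, 42, 847), (3, 10, 10, 2, 6, 27, 225),
    (3, 16, 16, 2, 9, 45, 640), (3, 34, 34, 2, 18, 99, 3179), (3, 8, 15, 2, 9, 21, 140),
    (3, 15, 8, 3, 6, 21, 140), (3, 33, 17, 3, 12, 48, 748), (4, 10, 10, 2, 6, 36, 300),
    (4, 14, 14, 2, 8, 52, 637), (4, 22, 22, 2, 12, 84, 1694), (4, 46, 46, 2, 24, 180, 7935),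
    (4, 11, 21, 2, 12, 40, 385), (4, 10, 28, 2, 16, 36, 315), (4, 26, 76, 2, 40, 100, 2470),
    (4, 21, 11, 3, 8, 40, 385), (4, 28, 10, 4, 8, 36, 315), (4, 76, 26, 4, 20, 100, 2470)]

/-- Writing the parameters through `gcd r lam`. -/
theorem exists_parameters {lam c d l s r : ℕ} (hlam : 0 < lam) (hl : 1 < l) (hlc : l < c)
    (hd : 2 ≤ d) (hs : 0 < s)
    (h1 : r * (l - 1) = lam * (c - 1)) (h2 : r * (s * l - 1) = lam * (d * c - 1)) :
    ∃ g t q x y w, 0 < x ∧ 0 < y ∧ 0 < t ∧ lam = g * t ∧ r = g * q ∧ l = 1 + t * x ∧ c = 1 + q * x ∧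
      d = 1 + q * y ∧ s = 1 + t * (y + x * w) ∧ (1 + t * x) * w + t * y = q * y := by
  obtain ⟨l, rfl⟩ : ∃ m, l = 1 + m := ⟨l - 1, by omega⟩
  obtain ⟨c, rfl⟩ : ∃ m, c = 1 + m := ⟨c - 1, by omega⟩
  obtain ⟨d, rfl⟩ : ∃ m, d = 1 + m := ⟨d - 1, by omega⟩
  obtain ⟨s, rfl⟩ : ∃ m, s = 1 + m := ⟨s - 1, by omega⟩
  rw [show (1 + s) * (1 + l) - 1 = l + s * (1 + l) by
      rw [show (1 + s) * (1 + l) = l + s * (1 + l) + 1 by ring]; simp,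
    show (1 + d) * (1 + c) - 1 = c + d * (1 + c) by
      rw [show (1 + d) * (1 + c) = c + d * (1 + c) + 1 by ring]; simp] at h2
  simp only [Nat.add_sub_cancel_left] at h1
  obtain ⟨q, t, hcop, hr, hlam'⟩ := Nat.exists_coprime r lam
  set g := Nat.gcd r lam
  have hg : 0 < g := Nat.gcd_pos_of_pos_right _ hlam
  have ht : 0 < t := by
    rcases Nat.eq_zero_or_pos t with h | h
    · subst h; omega
    · exact h
  have h1' : q * l = t * c := by
    apply Nat.eq_of_mul_eq_mul_left hg
    rw [← mul_assoc, ← mul_assoc, mul_comm g q, mul_comm g t, ← hr, ← hlam', h1]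
  have h2' : q * (s * (1 + l)) = t * (d * (1 + c)) := by
    have h3 : r * (s * (1 + l)) = lam * (d * (1 + c)) := by linarith
    apply Nat.eq_of_mul_eq_mul_left hg
    rw [hr, hlam'] at h3
    linarith
  have hq : 0 < q := by
    rcases Nat.eq_zero_or_pos q with h | h
    · subst h
      have := Nat.mul_pos ht (show 0 < c by omega)
      omega
    · exact h
  obtain ⟨x, rfl⟩ : t ∣ l := hcop.symm.dvd_of_dvd_mul_left ⟨c, h1'⟩
  have hc : c = q * x := Nat.eq_of_mul_eq_mul_left ht (by linarith)
  subst hc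
  have hx : 0 < x := by
    rcases Nat.eq_zero_or_pos x with h | h
    · subst h; omega
    · exact h
  have hts : t ∣ s := by
    have h3 : t ∣ s * (1 + t * x) := hcop.symm.dvd_of_dvd_mul_left ⟨_, h2'⟩
    have h4 : t ∣ s * (1 + t * x) - s * t * x := Nat.dvd_sub h3 ⟨s * x, by ring⟩
    rwa [show s * (1 + t * x) - s * t * x = s by
      rw [show s * (1 + t * x) = s + s * t * x by ring]; simp] at h4
  obtain ⟨z, rfl⟩ := hts
  have h3 : q * (z * (1 + t * x)) = d * (1 + q * x) := by
    apply Nat.eq_of_mul_eq_mul_left ht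
    linarith
  have hqd : q ∣ d := by
    have h4 : q ∣ d * (1 + q * x) - d * q * x := Nat.dvd_sub ⟨_, h3.symm⟩ ⟨d * x, by ring⟩
    rwa [show d * (1 + q * x) - d * q * x = d by
      rw [show d * (1 + q * x) = d + d * q * x by ring]; simp] at h4
  obtain ⟨y, rfl⟩ := hqd
  have h4 : z * (1 + t * x) = y * (1 + q * x) := by
    apply Nat.eq_of_mul_eq_mul_left hq
    linarith
  have hy : 0 < y := by
    rcases Nat.eq_zero_or_pos y with h | h
    · subst h; omega
    · exact h
  have htq : t < q := by
    by_contra h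
    have := Nat.mul_le_mul_right x (not_lt.1 h)
    omega
  have hyz : y ≤ z := by
    by_contra h
    have h5 : z * (1 + t * x) < y * (1 + t * x) := Nat.mul_lt_mul_of_pos_right (by omega) (by omega)
    have h6 : y * (1 + t * x) ≤ y * (1 + q * x) :=
      Nat.mul_le_mul_left _ (by have := Nat.mul_le_mul_right x htq.le; omega)
    omega
  obtain ⟨u, rfl⟩ := Nat.exists_eq_add_of_le hyz
  obtain ⟨p, rfl⟩ := Nat.exists_eq_add_of_le htq.le
  have h5 : u * (1 + t * x) = y * p * x := by
    have : u * (1 + t * x) + y * (1 + t * x) = y * p * x + y * (1 + t * x) := by linarith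
    omega
  have hxu : x ∣ u := by
    have h4 : x ∣ u * (1 + t * x) - u * t * x := Nat.dvd_sub ⟨y * p, by linarith⟩ ⟨u * t, by ring⟩
    rwa [show u * (1 + t * x) - u * t * x = u by
      rw [show u * (1 + t * x) = u + u * t * x by ring]; simp] at h4
  obtain ⟨w, rfl⟩ := hxu
  refine ⟨g, t, t + p, x, y, w, hx, hy, ht, by linarith, by linarith, rfl, rfl, rfl, rfl, ?_⟩
  have h6 : w * (1 + t * x) = y * p := by
    apply Nat.eq_of_mul_eq_mul_left hx
    linarith
  linarith

theorem fisher_bound {g t q x y w : ℕ}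
    (hq : (1 + t * x) * w + t * y = q * y)
    (h : (1 + t * (y + x * w)) * (1 + t * x) ≤ g * q) :
    (1 + t * (y + x * w)) * (1 + t * x) * y ≤ g * ((1 + t * x) * w + t * y) := by
  rw [hq, ← mul_assoc]
  exact Nat.mul_le_mul_right y h

theorem gt_of_fisher {g t x y w : ℕ} (hx : 0 < x) (hy : 0 < y) (ht : 0 < t)
    (h : (1 + t * (y + x * w)) * (1 + t * x) * y ≤ g * ((1 + t * x) * w + t * y)) : t < g := by
  by_contra hg
  push Not at hg
  have h1 : g * ((1 + t * x) * w + t * y) ≤ t * ((1 + t * x) * w + t * y) :=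
    Nat.mul_le_mul_right _ hg
  have h2 : (1 + t * (y + x * w)) * (1 + t * x) * y
    = t * ((1 + t * x) * w) * (x * y) + t * (t * y) * (x * y) + (1 + t * x + t * y) * y := by ring
  have h3 : 1 ≤ x * y := Nat.mul_pos hx hy
  have h4 : t * ((1 + t * x) * w) * 1 ≤ t * ((1 + t * x) * w) * (x * y) := Nat.mul_le_mul_left _ h3
  have h5 : t * (t * y) * 1 ≤ t * (t * y) * (x * y) := Nat.mul_le_mul_left _ h3
  have h6 : 0 < (1 + t * x + t * y) * y := by positivity
  linarith

theorem mul_lt_of_fisher {g x y w : ℕ}  (hy : 0 < y)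
    (h : (1 + 1 * (y + x * w)) * (1 + 1 * x) * y ≤ g * ((1 + 1 * x) * w + 1 * y)) : x * y < g := by
  by_contra hg
  push Not at hg
  have h1 : g * ((1 + 1 * x) * w + 1 * y) ≤ (x * y) * ((1 + 1 * x) * w + 1 * y) :=
    Nat.mul_le_mul_right _ hg
  have h2 : (1 + 1 * (y + x * w)) * (1 + 1 * x) * y
    = (x * y) * ((1 + 1 * x) * w + 1 * y) + (1 + x + y) * y := by ring
  have h6 : 0 < (1 + x + y) * y := by positivity
  linarith

theorem dvd_of_int_dvd {m n : ℕ} {z : ℤ} (u : ℤ) (h : (m : ℤ) ∣ z) (e : z = m * u + n ∨ z = m * u - n) :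
    m ∣ n := by
  have : (m : ℤ) ∣ n := by
    rcases e with e | e
    · rw [show (n : ℤ) = z - m * u by linarith]; exact dvd_sub h ⟨u, rfl⟩
    · rw [show (n : ℤ) = m * u - z by linarith]; exact dvd_sub ⟨u, rfl⟩ h
  exact_mod_cast this

set_option maxHeartbeats 1000000 in
theorem parameters_mem {lam c d l s r b : ℕ} (hlam : 0 < lam) (hlam4 : lam ≤ 4) (hl : 1 < l)
    (hlc : l < c) (hd : 2 ≤ d) (hs : 0 < s) (hk : s * l < d * c)
    (h1 : r * (l - 1) = lam * (c - 1)) (h2 : r * (s * l - 1) = lam * (d * c - 1))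
    (h3 : s * l ≤ r) (h4 : b * (s * l) = d * c * r) (h5 : l * l ∣ c * c * lam) :
    d * c ∈ [15, 16, 36, 45, 96] ∨ (lam, c, d, l, s, r, b) ∈ exceptionalParameters := by
  obtain ⟨g, t, q, x, y, w, hx, hy, ht, hgt, hr, hl', hc', hd', hs', hq⟩ :=
    exists_parameters hlam hl hlc hd hs h1 h2
  have hf := fisher_bound (g := g) hq (by rw [← hl', ← hs', ← hr]; exact h3)
  have htg := gt_of_fisher hx hy ht hf
  obtain rfl : t = 1 := by
    by_contra h
    have : 2 * 3 ≤ t * g := Nat.mul_le_mul (by omega) (by omega)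
    have : g * t = t * g := mul_comm _ _
    omega
  have hxy := mul_lt_of_fisher hy hf
  simp only [one_mul, mul_one] at *
  clear h1 h2 h3
  subst hgt
  have hx3 : x ≤ 3 := by have := Nat.le_mul_of_pos_right x hy; omega
  have hy3 : y ≤ 3 := by have := Nat.le_mul_of_pos_left y hx; omega
  have hg1 : 2 ≤ lam := by have := Nat.mul_pos hx hy; omega
  clear hl hlc hd hs
  have hw0 : w ≠ 0 := by
    rintro rfl
    have : q = 1 := Nat.eq_of_mul_eq_mul_right hy (by linarith)
    subst this hl' hc' hd' hs'
    simp at hk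
  have hcases : (x = 1 ∧ y = 1) ∨ (x = 1 ∧ y = 2) ∨ (x = 2 ∧ y = 1) ∨ (x = 1 ∧ y = 3 ∧ lam = 4) ∨
      (x = 3 ∧ y = 1 ∧ lam = 4) := by
    clear hf hq h4 h5 hk hc' hd' hs' hl' hw0 hr
    interval_cases x <;> interval_cases y <;> omega
  have hb : b = d * c * r / (s * l) := by
    rw [← h4, Nat.mul_div_cancel]
    rw [hs', hl']; positivity
  clear hf hxy hx hy hx3 hy3 hk hlam
  rcases hcases with ⟨rfl, rfl⟩ | ⟨rfl, rfl⟩ | ⟨rfl, rfl⟩ | ⟨rfl, rfl, rfl⟩ | ⟨rfl, rfl, rfl⟩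
  · obtain rfl : q = 2 * w + 1 := by omega
    subst hl' hc' hd' hs' hr
    have hw : w + 2 ∣ 6 * lam := dvd_of_int_dvd (z := (w + 2) * b) (lam * (4 * w ^ 2 + 2 * w + 4))
      ⟨b, by push_cast; ring⟩ (Or.inr (by push_cast; zify at h4; linarith))
    have := Nat.le_of_dvd (by omega) hw
    have : w ≤ 22 := by omega
    subst hb
    interval_cases lam <;> interval_cases w <;>
      first | exact absurd hw (by decide) | exact absurd rfl hw0 | exact absurd h5 (by decide) |
        exact absurd h4 (by decide) | decide
  · obtain rfl : q = w + 1 := by omega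
    subst hl' hc' hd' hs' hr
    have hw : w + 3 ∣ 6 * lam := dvd_of_int_dvd (z := (w + 3) * (2 * b)) (lam * (2 * w ^ 2 + 3 * w + 4))
      ⟨2 * b, by push_cast; ring⟩ (Or.inr (by push_cast; zify at h4; linarith))
    have := Nat.le_of_dvd (by omega) hw
    have : w ≤ 21 := by omega
    subst hb
    interval_cases lam <;> interval_cases w <;>
      first | exact absurd hw (by decide) | exact absurd rfl hw0 | exact absurd h5 (by decide) |
        exact absurd h4 (by decide) | decide
  · obtain rfl : q = 3 * w + 1 := by omega
    subst hl' hc' hd' hs' hr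
    have hw : w + 1 ∣ 2 * lam := dvd_of_int_dvd (z := (w + 1) * (2 * b)) (lam * (18 * w ^ 2 + 9 * w + 4))
      ⟨2 * b, by push_cast; ring⟩ (Or.inr (by push_cast; zify at h4; linarith))
    have := Nat.le_of_dvd (by omega) hw
    have : w ≤ 7 := by omega
    subst hb
    interval_cases lam <;> interval_cases w <;>
      first | exact absurd hw (by decide) | exact absurd rfl hw0 | exact absurd h5 (by decide) |
        exact absurd h4 (by decide) | decide
  · obtain ⟨u, rfl, rfl⟩ : ∃ u, w = 3 * u ∧ q = 2 * u + 1 := ⟨q / 2, by omega, by omega⟩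
    subst hl' hc' hd' hs' hr
    have hw : 3 * u + 4 ∣ 80 := dvd_of_int_dvd (z := (3 * u + 4) * (9 * b))
      (4 * (4 * (3 * u + 4) ^ 2 - 22 * (3 * u + 4) + 38))
      ⟨9 * b, by push_cast; ring⟩ (Or.inr (by push_cast; zify at h4; linarith))
    have := Nat.le_of_dvd (by omega) hw
    have : u ≤ 25 := by omega
    subst hb
    interval_cases u <;>
      first | exact absurd hw (by decide) | exact absurd rfl hw0 | exact absurd h5 (by decide) |
        exact absurd h4 (by decide) | decide
  · obtain rfl : q = 4 * w + 1 := by omega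
    subst hl' hc' hd' hs' hr
    have hw : 3 * w + 2 ∣ 40 := dvd_of_int_dvd (z := (3 * w + 2) * (9 * b))
      (4 * (16 * (3 * w + 2) ^ 2 - 44 * (3 * w + 2) + 38))
      ⟨9 * b, by push_cast; ring⟩ (Or.inr (by push_cast; zify at h4; linarith))
    have := Nat.le_of_dvd (by omega) hw
    have : w ≤ 12 := by omega
    subst hb
    interval_cases w <;>
      first | exact absurd hw (by decide) | exact absurd rfl hw0 | exact absurd h5 (by decide) |
        exact absurd h4 (by decide) | decide

theorem dvd_cnt_of_equivalence {X : Type*} [Fintype X] {E : X → X → Prop} (hE : Equivalence E)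
    {p : X → Prop} {m : ℕ} (hp : ∀ x y, E x y → p x → p y) (hm : ∀ x, p x → cnt (E x) = m) :
    m ∣ cnt p := by
  classical
  let S : Setoid X := ⟨E, hE⟩
  have h := cnt_mul_eq_cnt_mul p (fun q : Quotient S => ∃ x, p x ∧ Quotient.mk S x = q)
    (fun x q => p x ∧ Quotient.mk S x = q) (m := 1) (n := m) (fun x q h => h.1)
    (fun x q h => ⟨x, h⟩)
    (fun x hx => cnt_eq_one_of (Quotient.mk S x) ⟨hx, rfl⟩ fun y h => h.2.symm) ?_
  · exact ⟨_, by rw [mul_one] at h; rw [h, mul_comm]⟩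
  · rintro q ⟨x, hx, rfl⟩
    refine (cnt_congr fun y => ?_).trans (hm x hx)
    constructor
    · rintro ⟨hy, h⟩
      exact Quotient.exact h.symm
    · intro h
      exact ⟨hp x y h hx, Quotient.sound (hE.symm h)⟩

namespace ImprimDesign

open Finset MulAction

variable {Γ P C β : Type*} [Group Γ] [Fintype P] [Fintype C] [Fintype β]
    [MulAction Γ P] [MulAction Γ C] [MulAction Γ β] {lam c d l s r b : ℕ}
    (D : ImprimDesign Γ P C β lam c d l s r b)

theorem exists_smul_block (D : ImprimDesign Γ P C β lam c d l s r b) (B B' : β) :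
    ∃ g : Γ, g • B = B' := by
  obtain ⟨x, hx⟩ := D.exists_pt B
  obtain ⟨y, hy⟩ := D.exists_pt B'
  obtain ⟨g, -, hg⟩ := D.flag x B y B' hx hy
  exact ⟨g, hg⟩

theorem exists_smul_point (D : ImprimDesign Γ P C β lam c d l s r b) (x y : P) :
    ∃ g : Γ, g • x = y := by
  obtain ⟨B, hB⟩ := D.exists_block x
  obtain ⟨B', hB'⟩ := D.exists_block y
  obtain ⟨g, hg, -⟩ := D.flag x B y B' hB hB'
  exact ⟨g, hg⟩

theorem exists_smul_class (D : ImprimDesign Γ P C β lam c d l s r b) (Δ Δ' : C) :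
    ∃ g : Γ, g • Δ = Δ' := by
  obtain ⟨x, rfl⟩ := D.exists_cls Δ
  obtain ⟨y, rfl⟩ := D.exists_cls Δ'
  obtain ⟨g, rfl⟩ := D.exists_smul_point x y
  exact ⟨g, (D.cls_smul g x).symm⟩

/-- A `Γ_B`-invariant set of blocks covers the points of `B` equally often. -/
theorem sum_a_of_stabilizer (B : β) (A : β → Prop) [DecidablePred A]
    (hA : ∀ g : Γ, g • B = B → ∀ B', A B' → A (g • B')) :
    ∃ n, ∑ B' with A B', D.a B B' = s * l * n := by
  obtain ⟨x, hx⟩ := D.exists_pt B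
  refine ⟨cnt fun B' => D.I x B' ∧ A B', ?_⟩
  rw [← D.card_block B, cnt_mul_eq_sum (fun x => D.I x B) (fun x B' => (D.I x B ∧ D.I x B') ∧ A B')
    (fun y B' h => h.1.1), sum_filter]
  · refine sum_congr rfl fun B' _ => ?_
    split_ifs with h
    · exact cnt_congr fun _ => by simp [h]
    · simp [h, cnt]
  · intro y hy
    obtain ⟨g, rfl, hg⟩ := D.flag x B y B hx hy
    refine (cnt_smul g _ _ fun B' => ?_).symm
    rw [D.I_smul, ← smul_iff_of_stabilizer hA g hg]
    simp [hy]

/-- A `Γ_B`-invariant set of blocks covers the classes met by `B` equally often. -/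
theorem sum_e_of_stabilizer (B : β) (A : β → Prop) [DecidablePred A]
    (hA : ∀ g : Γ, g • B = B → ∀ B', A B' → A (g • B')) :
    ∃ n, (∑ B' with A B', D.e B B' = s * n) ∧
      ∀ Δ, D.Meets B Δ → cnt (fun B' => D.Meets B' Δ ∧ A B') = n := by
  obtain ⟨x, hx⟩ := D.exists_pt B
  have h1 : ∀ Δ, D.Meets B Δ → cnt (fun B' => D.Meets B' Δ ∧ A B') =
      cnt (fun B' => D.Meets B' (D.cls x) ∧ A B') := by
    rintro Δ ⟨y, hy, rfl⟩
    obtain ⟨g, rfl, hg⟩ := D.flag x B y B hx hy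
    refine (cnt_smul g _ _ fun B' => ?_).symm
    rw [D.cls_smul, D.meets_smul, ← smul_iff_of_stabilizer hA g hg]
  refine ⟨cnt fun B' => D.Meets B' (D.cls x) ∧ A B', ?_, h1⟩
  have h2 := cnt_mul_eq_sum (fun Δ => D.Meets B Δ)
    (fun Δ B' => (D.Meets B Δ ∧ D.Meets B' Δ) ∧ A B') (fun y B' h => h.1.1) (fun Δ hΔ =>
      (cnt_congr fun B' => by simp [hΔ]).trans (h1 Δ hΔ))
  rw [D.card_meets] at h2
  rw [h2, sum_filter]
  refine sum_congr rfl fun B' _ => ?_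
  split_ifs with h
  · exact cnt_congr fun _ => by simp [h]
  · simp [h, cnt]

/-- The blocks meeting `B` in a given number of points. -/
theorem dvd_mul_cnt_a (B : β) (j : ℕ) : s * l ∣ j * cnt (fun B' => B' ≠ B ∧ D.a B B' = j) := by
  classical
  obtain ⟨n, hn⟩ := D.sum_a_of_stabilizer B (fun B' => B' ≠ B ∧ D.a B B' = j)
    (fun g hg B' h => ⟨fun h' => h.1 (smul_left_cancel g (h'.trans hg.symm)), by
      have := D.a_smul g B B'
      rw [hg] at this
      rw [this, h.2]⟩)
  refine ⟨n, ?_⟩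
  rw [← hn, sum_congr rfl (g := fun _ => j) (fun B' h => (mem_filter.1 h).2.2), sum_const,
    smul_eq_mul, mul_comm]
  unfold cnt
  congr!

theorem sum_ne_quadratic (B : β) [DecidableEq β] (u : ℤ) :
    ∑ B' ∈ univ.erase B, ((D.a B B' : ℤ) - u) * ((D.a B B' : ℤ) - (u + 1)) =
      s * l * (s * l - 1) * (lam - 1) - 2 * u * (s * l) * (r - 1) + u * (u + 1) * (b - 1) := by
  have h1 := D.sum_a_ne B (fun n => (n : ℤ))
  have h2 := D.sum_a_ne B (fun n => (n : ℤ) ^ 2)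
  rw [sum_a_int] at h1
  rw [sum_a_sq_int] at h2
  have h3 : ∀ B', ((D.a B B' : ℤ) - u) * ((D.a B B' : ℤ) - (u + 1)) =
      (D.a B B' : ℤ) ^ 2 - (2 * u + 1) * (D.a B B' : ℤ) + u * (u + 1) := fun B' => by ring
  have hb : 1 ≤ b := by rw [← D.card_B]; exact Fintype.card_pos_iff.2 ⟨B⟩
  rw [sum_congr rfl fun B' _ => h3 B', sum_add_distrib, sum_sub_distrib, ← mul_sum, h1, h2,
    sum_const, card_erase_of_mem (mem_univ B), card_univ, D.card_B, nsmul_eq_mul,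
    Nat.cast_sub hb]
  push_cast
  ring

theorem consecutive_nonneg (n u : ℤ) : 0 ≤ (n - u) * (n - (u + 1)) := by
  rcases le_or_gt n u with h | h
  · exact mul_nonneg_of_nonpos_of_nonpos (by linarith) (by linarith)
  · exact mul_nonneg (by linarith) (by linarith [Int.add_one_le_iff.2 h])

/-- Weighted number of blocks meeting `B` in exactly `j` points. -/
theorem cnt_a_mul_le (B : β) [DecidableEq β] (u : ℤ) (j : ℕ) :
    (cnt (fun B' => B' ≠ B ∧ D.a B B' = j) : ℤ) * ((j - u) * (j - (u + 1))) ≤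
      ∑ B' ∈ univ.erase B, ((D.a B B' : ℤ) - u) * ((D.a B B' : ℤ) - (u + 1)) := by
  have h : (cnt (fun B' => B' ≠ B ∧ D.a B B' = j) : ℤ) * ((j - u) * (j - (u + 1))) =
      ∑ B' ∈ (univ.erase B).filter (fun B' => D.a B B' = j),
        ((D.a B B' : ℤ) - u) * ((D.a B B' : ℤ) - (u + 1)) := by
    rw [sum_congr rfl (g := fun _ => ((j : ℤ) - u) * (j - (u + 1)))
      (fun B' h => by rw [(mem_filter.1 h).2]), sum_const, nsmul_eq_mul]
    congr 2
    unfold cnt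
    congr 1
    ext B'
    simp
  rw [h]
  exact sum_le_sum_of_subset_of_nonneg (filter_subset _ _) fun _ _ _ => consecutive_nonneg _ _

theorem e_ge (B B' : β) : 2 * s ≤ D.e B B' + d := by
  have h1 := cnt_and_add_not (fun Δ => D.Meets B Δ) (fun Δ => D.Meets B' Δ)
  have h2 := cnt_add_not (fun Δ => D.Meets B' Δ)
  have h3 : cnt (fun Δ => D.Meets B Δ ∧ ¬ D.Meets B' Δ) ≤ cnt (fun Δ => ¬ D.Meets B' Δ) :=
    cnt_mono fun Δ h => h.2
  rw [D.card_meets] at h1 h2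
  rw [D.card_C] at h2
  unfold e
  omega

theorem e_le (B B' : β) : D.e B B' ≤ s :=
  (cnt_mono fun _ h => h.1).trans_eq (D.card_meets B)

theorem meets_of_e_eq {B B' : β} (h : D.e B B' = s) (Δ : C) (hB : D.Meets B Δ) : D.Meets B' Δ :=
  (eq_of_cnt_le (p := fun Δ => D.Meets B Δ ∧ D.Meets B' Δ) (q := fun Δ => D.Meets B Δ)
    (fun _ h => h.1) (by rw [D.card_meets]; exact h.ge) Δ hB).2

theorem a_eq_zero_iff {B B' : β} : D.a B B' = 0 ↔ ∀ x, D.I x B → ¬ D.I x B' := by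
  unfold a
  rw [cnt_eq_zero]
  simp

theorem ne_of_a_eq_zero {B B' : β} (h : D.a B B' = 0) : B' ≠ B := by
  rintro rfl
  rw [D.a_self] at h
  exact absurd h (Nat.mul_pos D.s_pos D.l_pos).ne'

/-- Intersection numbers for `k = 18`, `r = 21`, `b = 140`, `lam = 3`. -/
theorem intersections₁₈ (D : ImprimDesign Γ P C β 3 c d l s 21 140) (hk : s * l = 18) (B : β) :
    cnt (fun B' => D.a B B' = 0) = 1 ∧ ∀ B', B' ≠ B → D.a B B' = 0 ∨ D.a B B' = 2 ∨ D.a B B' = 3 := by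
  classical
  have hsum := D.sum_ne_quadratic B 2
  have hK : (s : ℤ) * l = 18 := by exact_mod_cast hk
  rw [hK] at hsum
  have key : ∀ j, (cnt (fun B' => B' ≠ B ∧ D.a B B' = j) : ℤ) * ((j - 2) * (j - (2 + 1))) ≤ 6 := by
    intro j
    have := D.cnt_a_mul_le B 2 j
    rw [hsum] at this
    exact this.trans_eq (by norm_num)
  have hdvd : ∀ j, 18 ∣ j * cnt (fun B' => B' ≠ B ∧ D.a B B' = j) := fun j => hk ▸ D.dvd_mul_cnt_a B j
  have h2 : ∀ B', B' ≠ B → D.a B B' = 0 ∨ D.a B B' = 2 ∨ D.a B B' = 3 := by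
    intro B' hB'
    by_contra hcon
    push Not at hcon
    obtain ⟨h0, h2, h3⟩ := hcon
    have hpos : 0 < cnt (fun B'' => B'' ≠ B ∧ D.a B B'' = D.a B B') := cnt_pos.2 ⟨B', hB', rfl⟩
    have h4 := key (D.a B B')
    have h5 := hdvd (D.a B B')
    generalize cnt (fun B'' => B'' ≠ B ∧ D.a B B'' = D.a B B') = n at *
    generalize D.a B B' = j at *
    have : j < 6 := by
      by_contra h
      push Not at h
      zify at h hpos
      nlinarith [mul_pos (show (0 : ℤ) < j - 2 by linarith) (show (0 : ℤ) < j - 3 by linarith)]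
    interval_cases j <;> omega
  refine ⟨?_, h2⟩
  have h6 : ∑ B' ∈ univ.erase B, ((D.a B B' : ℤ) - 2) * ((D.a B B' : ℤ) - (2 + 1)) =
      6 * cnt (fun B' => B' ≠ B ∧ D.a B B' = 0) := by
    rw [cnt, card_filter]
    push_cast
    rw [mul_sum, ← add_sum_erase univ _ (mem_univ B)]
    simp only [ne_eq, not_true_eq_false, false_and, if_false, mul_zero, zero_add]
    refine sum_congr rfl fun B' h => ?_
    have hB' := ne_of_mem_erase h
    rcases h2 B' hB' with h | h | h <;> simp [h, hB']
  have h7 : cnt (fun B' => D.a B B' = 0) = cnt (fun B' => B' ≠ B ∧ D.a B B' = 0) :=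
    cnt_congr fun B' => ⟨fun h => ⟨D.ne_of_a_eq_zero h, h⟩, fun h => h.2⟩
  rw [hsum] at h6
  rw [h7]
  generalize cnt (fun B' => B' ≠ B ∧ D.a B B' = 0) = n at h6 ⊢
  norm_num at h6
  omega

/-- Intersection numbers for `k = 32`, `r = 36`, `b = 315`, `lam = 4`. -/
theorem intersections₃₂ (D : ImprimDesign Γ P C β 4 c d l s 36 315) (hk : s * l = 32) (B : β) :
    cnt (fun B' => D.a B B' = 0) = 2 ∧ ∀ B', B' ≠ B → D.a B B' = 0 ∨ D.a B B' = 3 ∨ D.a B B' = 4 := by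
  classical
  have hsum := D.sum_ne_quadratic B 3
  have hK : (s : ℤ) * l = 32 := by exact_mod_cast hk
  rw [hK] at hsum
  have key : ∀ j, (cnt (fun B' => B' ≠ B ∧ D.a B B' = j) : ℤ) * ((j - 3) * (j - (3 + 1))) ≤ 24 := by
    intro j
    have := D.cnt_a_mul_le B 3 j
    rw [hsum] at this
    exact this.trans_eq (by norm_num)
  have hdvd : ∀ j, 32 ∣ j * cnt (fun B' => B' ≠ B ∧ D.a B B' = j) := fun j => hk ▸ D.dvd_mul_cnt_a B j
  have h2 : ∀ B', B' ≠ B → D.a B B' = 0 ∨ D.a B B' = 3 ∨ D.a B B' = 4 := by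
    intro B' hB'
    by_contra hcon
    push Not at hcon
    obtain ⟨h0, h2, h3⟩ := hcon
    have hpos : 0 < cnt (fun B'' => B'' ≠ B ∧ D.a B B'' = D.a B B') := cnt_pos.2 ⟨B', hB', rfl⟩
    have h4 := key (D.a B B')
    have h5 := hdvd (D.a B B')
    generalize cnt (fun B'' => B'' ≠ B ∧ D.a B B'' = D.a B B') = n at *
    generalize D.a B B' = j at *
    have : j < 9 := by
      by_contra h
      push Not at h
      zify at h hpos
      nlinarith [mul_pos (show (0 : ℤ) < j - 3 by linarith) (show (0 : ℤ) < j - 4 by linarith)]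
    interval_cases j <;> omega
  refine ⟨?_, h2⟩
  have h6 : ∑ B' ∈ univ.erase B, ((D.a B B' : ℤ) - 3) * ((D.a B B' : ℤ) - (3 + 1)) =
      12 * cnt (fun B' => B' ≠ B ∧ D.a B B' = 0) := by
    rw [cnt, card_filter]
    push_cast
    rw [mul_sum, ← add_sum_erase univ _ (mem_univ B)]
    simp only [ne_eq, not_true_eq_false, false_and, if_false, mul_zero, zero_add]
    refine sum_congr rfl fun B' h => ?_
    have hB' := ne_of_mem_erase h
    rcases h2 B' hB' with h | h | h <;> simp [h, hB']
  have h7 : cnt (fun B' => D.a B B' = 0) = cnt (fun B' => B' ≠ B ∧ D.a B B' = 0) :=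
    cnt_congr fun B' => ⟨fun h => ⟨D.ne_of_a_eq_zero h, h⟩, fun h => h.2⟩
  rw [hsum] at h6
  rw [h7]
  generalize cnt (fun B' => B' ≠ B ∧ D.a B B' = 0) = n at h6 ⊢
  norm_num at h6
  omega

/-- Being equal or disjoint. -/
def Parallel (B B' : β) : Prop := B' = B ∨ D.a B B' = 0

theorem cnt_parallel (B : β) : cnt (D.Parallel B) = cnt (fun B' => D.a B B' = 0) + 1 := by
  rw [← cnt_ne_add_one (p := D.Parallel B) (x := B) (Or.inl rfl)]
  congr 1
  refine cnt_congr fun B' => ⟨fun h => h.1.resolve_left h.2, fun h => ⟨Or.inr h, D.ne_of_a_eq_zero h⟩⟩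

theorem parallel_equivalence₁₈ (D : ImprimDesign Γ P C β 3 c d l s 21 140) (hk : s * l = 18) :
    Equivalence D.Parallel where
  refl B := Or.inl rfl
  symm {B B'} h := by
    rcases h with rfl | h
    · exact Or.inl rfl
    · exact Or.inr (by rw [D.a_comm]; exact h)
  trans {B B' B''} h h' := by
    rcases h with rfl | h
    · exact h'
    rcases h' with rfl | h'
    · exact Or.inr h
    obtain ⟨X, hX, hX'⟩ := exists_of_cnt_eq_one (D.intersections₁₈ hk B').1
    rw [D.a_comm] at h
    exact Or.inl ((hX' _ h').trans (hX' _ h).symm)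

theorem no_15_8 (D : ImprimDesign Γ P C β 3 15 8 3 6 21 140) : False := by
  classical
  have hS : ∀ B B', D.Parallel B B' → ∀ Δ, D.Meets B Δ → D.Meets B' Δ := by
    rintro B B' (rfl | h)
    · exact fun Δ h => h
    apply D.meets_of_e_eq
    obtain ⟨n, hn, -⟩ := D.sum_e_of_stabilizer B (fun B' => D.a B B' = 0) (fun g hg B' h => by
      have := D.a_smul g B B'
      rw [hg] at this
      rw [this, h])
    obtain ⟨X, hX, hX'⟩ := exists_of_cnt_eq_one (D.intersections₁₈ rfl B).1
    have h1 : univ.filter (fun B' => D.a B B' = 0) = {B'} := by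
      ext Y
      simp only [mem_filter, mem_univ, true_and, mem_singleton]
      exact ⟨fun hY => (hX' Y hY).trans (hX' B' h).symm, by rintro rfl; exact h⟩
    rw [h1, sum_singleton] at hn
    have := D.e_ge B B'
    have := D.e_le B B'
    omega
  obtain ⟨Δ, Δ', hne⟩ := Fintype.exists_pair_of_one_lt_card (α := C) (by rw [D.card_C]; norm_num)
  have h1 := D.card_blocks_meets₂ Δ Δ' hne
  have h2 : 2 ∣ cnt (fun B => D.Meets B Δ ∧ D.Meets B Δ') :=
    dvd_cnt_of_equivalence (D.parallel_equivalence₁₈ rfl)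
      (fun B B' h hB => ⟨hS B B' h _ hB.1, hS B B' h _ hB.2⟩)
      (fun B _ => by rw [D.cnt_parallel, (D.intersections₁₈ rfl B).1])
  omega

theorem sum_a_mul_a {B B₁ : β} (h : D.a B B₁ = 0) :
    ∑ B', D.a B B' * D.a B₁ B' = (s * l) * (s * l) * lam := by
  have hpairs : ∀ p q : P → Prop, cnt (fun z : P × P => p z.1 ∧ q z.2) = cnt p * cnt q := by
    intro p q
    classical
    unfold cnt
    rw [← card_product]
    congr 1
    ext z
    simp
  have h1 := cnt_mul_eq_sum (fun z : P × P => D.I z.1 B ∧ D.I z.2 B₁)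
    (fun z B' => (D.I z.1 B ∧ D.I z.1 B') ∧ (D.I z.2 B₁ ∧ D.I z.2 B')) (m := lam)
    (fun z B' h => ⟨h.1.1, h.2.1⟩)
    (fun z hz => (cnt_congr fun B' => by simp [hz]).trans (D.pair z.1 z.2 (by
      intro hz'
      rw [a_eq_zero_iff] at h
      exact h z.1 hz.1 (hz' ▸ hz.2))))
  rw [hpairs (fun x => D.I x B) (fun x => D.I x B₁), D.card_block, D.card_block] at h1
  rw [h1]
  exact sum_congr rfl fun B' _ => (hpairs (fun x => D.I x B ∧ D.I x B') _).symm

theorem exists_common_disjoint₃₂ (D : ImprimDesign Γ P C β 4 c d l s 36 315) (hk : s * l = 32)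
    {B B₁ : β} (h : D.a B B₁ = 0) : ∃ B', D.a B B' = 0 ∧ D.a B₁ B' = 0 := by
  classical
  by_contra! hcon
  have h1 : ∑ B', (D.a B B' * D.a B₁ B' : ℤ) = 4096 := by
    have := D.sum_a_mul_a h
    rw [hk] at this
    exact_mod_cast this
  have hK : (s : ℤ) * l = 32 := by exact_mod_cast hk
  have h2 := D.sum_a_int B
  have h3 := D.sum_a_int B₁
  rw [hK] at h2 h3
  have h4 : ∀ B, ∑ B', (if D.a B B' = 0 then (1 : ℤ) else 0) = 2 := by
    intro B
    have := (D.intersections₃₂ hk B).1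
    rw [sum_boole]
    unfold cnt at this
    convert this
    norm_cast
    congr!
  have h5 : ∀ B', (if B' = B then (200 : ℤ) else 0) + (if B' = B₁ then 200 else 0)
      - 3 * (if D.a B B' = 0 then (1 : ℤ) else 0) - 3 * (if D.a B₁ B' = 0 then (1 : ℤ) else 0) ≤
      7 * D.a B B' + 7 * D.a B₁ B' - 2 * (D.a B B' * D.a B₁ B') - 24 := by
    intro B'
    have hne := D.ne_of_a_eq_zero h
    by_cases hB : B' = B
    · subst hB
      have h' := D.a_comm B₁ B'
      rw [D.a_self, h', h, hk]
      simp [hne.symm]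
    by_cases hB₁ : B' = B₁
    · subst hB₁
      rw [D.a_self, h, hk]
      simp [hne]
    rw [if_neg hB, if_neg hB₁]
    have := hcon B'
    rcases (D.intersections₃₂ hk B).2 B' hB with h | h | h <;>
    rcases (D.intersections₃₂ hk B₁).2 B' hB₁ with h' | h' | h' <;> simp_all
  have h6 := sum_le_sum (s := univ) fun B' _ => h5 B'
  simp only [sum_add_distrib, sum_sub_distrib, ← mul_sum, h4, h2, h3, h1, sum_ite_eq', mem_univ,
    if_true, sum_const, card_univ, D.card_B] at h6
  norm_num at h6

theorem parallel_equivalence₃₂ (D : ImprimDesign Γ P C β 4 c d l s 36 315) (hk : s * l = 32) :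
    Equivalence D.Parallel where
  refl B := Or.inl rfl
  symm {B B'} h := by
    rcases h with rfl | h
    · exact Or.inl rfl
    · exact Or.inr (by rw [D.a_comm]; exact h)
  trans {B B' B''} h h' := by
    rcases h with rfl | h
    · exact h'
    rcases h' with rfl | h'
    · exact Or.inr h
    by_contra hcon
    unfold Parallel at hcon
    push Not at hcon
    obtain ⟨X, hX, hX'⟩ := D.exists_common_disjoint₃₂ hk h
    have h2 := (D.intersections₃₂ hk B').1
    rw [D.a_comm] at h
    have h3 := cnt_ne_add_one (p := fun Y => D.a B' Y = 0) hX'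
    have h4 := cnt_ne_add_one (p := fun Y => D.a B' Y = 0 ∧ Y ≠ X) (x := B)
      ⟨h, by rintro rfl; exact D.ne_of_a_eq_zero hX rfl⟩
    have h5 := cnt_pos (p := fun y => (D.a B' y = 0 ∧ y ≠ X) ∧ y ≠ B) |>.2 ⟨B'', (⟨⟨h', by rintro rfl; exact hcon.2 hX⟩, hcon.1⟩ :
      (D.a B' B'' = 0 ∧ B'' ≠ X) ∧ B'' ≠ B)⟩
    omega

/-- The two blocks disjoint from `B`. -/
theorem exists_mates₃₂ (D : ImprimDesign Γ P C β 4 c d l s 36 315) (hk : s * l = 32) (B : β) :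
    ∃ B₁ B₂, B₁ ≠ B₂ ∧ D.a B B₁ = 0 ∧ D.a B B₂ = 0 ∧ (∀ B', D.a B B' = 0 → B' = B₁ ∨ B' = B₂) ∧
      ∃ n, D.e B B₁ + D.e B B₂ = s * n ∧
        ∀ Δ, D.Meets B Δ → cnt (fun B' => D.Meets B' Δ ∧ D.a B B' = 0) = n := by
  classical
  obtain ⟨n, hn, hn'⟩ := D.sum_e_of_stabilizer B (fun B' => D.a B B' = 0) (fun g hg B' h => by
      have := D.a_smul g B B'
      rw [hg] at this
      rw [this, h])
  obtain ⟨B₁, B₂, hne, h⟩ := Finset.card_eq_two.1 (D.intersections₃₂ hk B).1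
  have h1 : ∀ B', D.a B B' = 0 ↔ B' = B₁ ∨ B' = B₂ := fun B' => by
    have := Finset.ext_iff.1 h B'
    simpa using this
  refine ⟨B₁, B₂, hne, (h1 _).2 (Or.inl rfl), (h1 _).2 (Or.inr rfl), fun B' => (h1 B').1, n, ?_,
    hn'⟩
  rw [← hn, ← sum_pair hne]
  congr 1
  rw [← h]
  congr!

theorem no_28_10 (D : ImprimDesign Γ P C β 4 28 10 4 8 36 315) : False := by
  classical
  have hS : ∀ B B', D.Parallel B B' → ∀ Δ, D.Meets B Δ → D.Meets B' Δ := by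
    rintro B B' (rfl | h)
    · exact fun Δ h => h
    apply D.meets_of_e_eq
    obtain ⟨B₁, B₂, hne, -, -, h3, n, hn, -⟩ := D.exists_mates₃₂ rfl B
    have := D.e_ge B B₁
    have := D.e_le B B₁
    have := D.e_ge B B₂
    have := D.e_le B B₂
    rcases h3 B' h with rfl | rfl <;> omega
  obtain ⟨Δ, Δ', hne⟩ := Fintype.exists_pair_of_one_lt_card (α := C) (by rw [D.card_C]; norm_num)
  have h1 := D.card_blocks_meets₂ Δ Δ' hne
  have h2 : 3 ∣ cnt (fun B => D.Meets B Δ ∧ D.Meets B Δ') :=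
    dvd_cnt_of_equivalence (D.parallel_equivalence₃₂ rfl)
      (fun B B' h hB => ⟨hS B B' h _ hB.1, hS B B' h _ hB.2⟩)
      (fun B _ => by rw [D.cnt_parallel, (D.intersections₃₂ rfl B).1])
  omega

end ImprimDesign

section Actions

open Finset MulAction

variable {Γ X : Type*} [Group Γ] [MulAction Γ X]

theorem isPGroup_zpowers {p : ℕ} {g : Γ} (hg : g ^ p = 1) :
    IsPGroup p (Subgroup.zpowers g) := by
  rintro ⟨_, i, rfl⟩
  refine ⟨1, Subtype.ext ?_⟩
  simp only [pow_one, SubmonoidClass.coe_pow, OneMemClass.coe_one]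
  rw [← zpow_natCast, ← zpow_mul, mul_comm, zpow_mul, zpow_natCast, hg, one_zpow]

theorem zpow_smul_mem {g : Γ} {q : X → Prop} (hq : ∀ x, q (g • x) ↔ q x) (i : ℤ) (x : X) :
    q (g ^ i • x) ↔ q x := by
  induction i with
  | zero => simp
  | succ i ih => rw [add_comm, zpow_add, zpow_one, mul_smul, hq, ih]
  | pred i ih =>
    rw [← ih, ← hq, smul_smul, ← zpow_one_add]
    congr! 3
    ring

theorem zpow_smul_eq {g : Γ} {x : X} (hx : g • x = x) (i : ℤ) : g ^ i • x = x :=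
  MulAction.mem_stabilizer_iff.1 (zpow_mem (MulAction.mem_stabilizer_iff.2 hx) i)

theorem smul_ne_iff (g : Γ) (x : X) : g • g • x ≠ g • x ↔ g • x ≠ x :=
  (MulAction.injective g).ne_iff

variable [Fintype X]

theorem cnt_eq_natCard (p : X → Prop) : cnt p = Nat.card {x // p x} := by
  classical
  rw [Nat.card_eq_fintype_card, Fintype.card_subtype, cnt]

/-- Fixed points of a `p`-group. -/
theorem cnt_modEq_cnt_fixed {p : ℕ} [Fact p.Prime] {H : Subgroup Γ} (hH : IsPGroup p H)
    {q : X → Prop} (hq : ∀ h ∈ H, ∀ x, q x → q (h • x)) :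
    cnt q ≡ cnt (fun x => q x ∧ ∀ h ∈ H, h • x = x) [MOD p] := by
  let S : SubMulAction H X := ⟨{x | q x}, fun h x hx => hq h h.2 x hx⟩
  have : Finite S := Subtype.finite
  have h1 := hH.card_modEq_card_fixedPoints S
  have h2 : Nat.card S = cnt q := (cnt_eq_natCard q).symm
  have h3 : Nat.card (fixedPoints H S) = cnt (fun x => q x ∧ ∀ h ∈ H, h • x = x) := by
    rw [cnt_eq_natCard]
    refine Nat.card_congr ⟨fun x => ⟨x.1.1, x.1.2, fun h hh => congrArg Subtype.val (x.2 ⟨h, hh⟩)⟩,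
      fun x => ⟨⟨x.1, x.2.1⟩, fun h => Subtype.ext (x.2.2 h.1 h.2)⟩, fun x => rfl, fun x => rfl⟩
  rwa [h2, h3] at h1

theorem cnt_modEq_cnt_fixed_of_pow {p : ℕ} (hp : p.Prime) {g : Γ} (hg : g ^ p = 1)
    {q : X → Prop} (hq : ∀ x, q (g • x) ↔ q x) :
    cnt q ≡ cnt (fun x => q x ∧ g • x = x) [MOD p] := by
  have := Fact.mk hp
  have h1 := cnt_modEq_cnt_fixed (isPGroup_zpowers hg) (q := q) (by
    rintro _ ⟨i, rfl⟩ x hx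
    exact (zpow_smul_mem hq i x).2 hx)
  refine h1.trans (congrArg (· % p) (cnt_congr fun x => and_congr_right fun _ => ?_))
  exact ⟨fun h => h g (Subgroup.mem_zpowers g), fun h _ ⟨i, hi⟩ => hi ▸ zpow_smul_eq h i⟩

theorem smul_eq_of_cnt_lt {p : ℕ} (hp : p.Prime) {g : Γ} (hg : g ^ p = 1)
    {q : X → Prop} (hq : ∀ x, q (g • x) ↔ q x) (h : cnt q < p) (x : X) (hx : q x) : g • x = x := by
  have h1 := cnt_modEq_cnt_fixed_of_pow hp hg hq
  have h2 : cnt (fun x => q x ∧ g • x = x) ≤ cnt q := cnt_mono fun x h => h.1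
  have h3 := Nat.ModEq.eq_of_lt_of_lt h1 h (h2.trans_lt h)
  exact (eq_of_cnt_le (fun x h => h.1) h3.le x hx).2

theorem le_cnt_zpow_orbit {p : ℕ} (hp : p.Prime) {g : Γ} (hg : g ^ p = 1) {x : X}
    (hx : g • x ≠ x) : p ≤ cnt (fun y => ∃ i : ℤ, g ^ i • x = y) := by
  by_contra! h
  refine hx (smul_eq_of_cnt_lt hp hg (q := fun y => ∃ i : ℤ, g ^ i • x = y) (fun y => ?_) h x
    ⟨0, by simp⟩)
  constructor
  · rintro ⟨i, hi⟩
    exact ⟨-1 + i, by rw [zpow_add, mul_smul, hi, zpow_neg_one, inv_smul_smul]⟩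
  · rintro ⟨i, hi⟩
    exact ⟨1 + i, by rw [zpow_add, mul_smul, hi, zpow_one]⟩

/-- An element of prime order `p` moving exactly `p` points is a cycle. -/
theorem exists_zpow_smul_eq {p : ℕ} (hp : p.Prime) {g : Γ} (hg : g ^ p = 1)
    {q : X → Prop} (hq : ∀ x, q (g • x) ↔ q x) (h : cnt q ≤ p) {x y : X} (hqx : q x)
    (hx : g • x ≠ x) (hy : q y) : ∃ i : ℤ, g ^ i • x = y :=
  eq_of_cnt_le (p := fun y => ∃ i : ℤ, g ^ i • x = y) (q := q)
    (by rintro _ ⟨i, rfl⟩; exact (zpow_smul_mem hq i x).2 hqx)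
    (h.trans (le_cnt_zpow_orbit hp hg hx)) y hy

/-- Jordan's theorem for a doubly transitive group containing a cycle of prime length. -/
theorem isMultiplyPretransitive_of_prime_cycle (h2 : IsMultiplyPretransitive Γ X 2) {p : ℕ}
    (hp : p.Prime) {g : Γ} (hg : g ^ p = 1) (hm : cnt (fun x : X => g • x ≠ x) = p)
    (hlt : p < Fintype.card X) : IsMultiplyPretransitive Γ X (Fintype.card X - p + 1) := by
  have hprim : IsPreprimitive Γ X := isPreprimitive_of_is_two_pretransitive h2
  obtain ⟨n, hn⟩ := Nat.exists_eq_add_of_lt hlt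
  have hs : Set.ncard {x : X | g • x = x} = n + 1 := by
    have h1 := cnt_add_not (fun x : X => g • x = x)
    have h3 : Set.ncard {x : X | g • x = x} = cnt (fun x : X => g • x = x) := by
      rw [cnt_eq_natCard]; rfl
    rw [h3]
    change cnt (fun x : X => g • x = x) + cnt (fun x : X => g • x ≠ x) = _ at h1
    omega
  have hmem : g ∈ fixingSubgroup Γ {x : X | g • x = x} := by
    rw [mem_fixingSubgroup_iff]; exact fun x hx => hx
  have htr : IsPretransitive (fixingSubgroup Γ {x : X | g • x = x})
      (SubMulAction.ofFixingSubgroup Γ {x : X | g • x = x}) := by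
    refine ⟨fun x y => ?_⟩
    have hx : g • x.1 ≠ x.1 := x.2
    have hy : g • y.1 ≠ y.1 := y.2
    obtain ⟨i, hi⟩ := exists_zpow_smul_eq hp hg (q := fun x : X => g • x ≠ x)
      (fun x => smul_ne_iff g x) hm.le hx hx hy
    exact ⟨⟨g, hmem⟩ ^ i, Subtype.ext hi⟩
  have hpr : IsPreprimitive (fixingSubgroup Γ {x : X | g • x = x})
      (SubMulAction.ofFixingSubgroup Γ {x : X | g • x = x}) := by
    apply IsPreprimitive.of_prime_card
    have h1 : Nat.card (SubMulAction.ofFixingSubgroup Γ {x : X | g • x = x}) = p := by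
      rw [← hm, cnt_eq_natCard]
      rfl
    rwa [h1]
  have h3 := hprim.isMultiplyPreprimitive hs
    (by rw [Nat.card_eq_fintype_card]; have := hp.two_le; omega) hpr
  rw [show Fintype.card X - p + 1 = n + 2 by omega]
  exact h3.isMultiplyPretransitive

end Actions

namespace ImprimDesign

open Finset MulAction

variable {Γ P C β : Type*} [Group Γ] [Fintype P] [Fintype C] [Fintype β]
    [MulAction Γ P] [MulAction Γ C] [MulAction Γ β] {lam c d l s r b : ℕ}
    (D : ImprimDesign Γ P C β lam c d l s r b)

theorem finite (D : ImprimDesign Γ P C β lam c d l s r b) : Finite Γ := by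
  refine Finite.of_injective (MulAction.toPermHom Γ P)
    ((injective_iff_map_eq_one _).2 fun g hg => D.faithful g fun x => ?_)
  exact Equiv.Perm.ext_iff.1 hg x

/-- Each `Γ_Δ`-invariant set `O` of classes other than `Δ` is met by all blocks on a point of `Δ`
in the same number of classes. -/
theorem exists_mul_eq_of_class_stabilizer (x : P) (O : C → Prop) (hx : ¬ O (D.cls x))
    (hO : ∀ g : Γ, g • D.cls x = D.cls x → ∀ Δ, O Δ → O (g • Δ)) :
    ∃ n, r * n * l = cnt O * (c * lam) ∧
      ∀ y B, D.cls y = D.cls x → D.I y B → cnt (fun Δ => D.Meets B Δ ∧ O Δ) = n := by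
  obtain ⟨B, hB⟩ := D.exists_block x
  have hc : ∀ y B', D.cls y = D.cls x → D.I y B' →
      cnt (fun Δ => D.Meets B' Δ ∧ O Δ) = cnt (fun Δ => D.Meets B Δ ∧ O Δ) := by
    intro y B' hy hB'
    obtain ⟨g, rfl, rfl⟩ := D.flag x B y B' hB hB'
    rw [D.cls_smul] at hy
    refine (cnt_smul g _ _ fun Δ => ?_).symm
    rw [D.meets_smul, ← smul_iff_of_stabilizer hO g hy]
  refine ⟨_, ?_, hc⟩
  by_cases hne : ∃ Δ, O Δ
  · obtain ⟨Δ, hΔ⟩ := hne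
    have h := cnt_mul_eq_cnt_mul (fun B' => D.I x B') O
      (fun B' Δ => D.I x B' ∧ (D.Meets B' Δ ∧ O Δ)) (n := c * lam / l) (fun _ _ h => h.1)
      (fun _ _ h => h.2.2) (fun B' hB' => (cnt_congr fun Δ => by simp [hB']).trans
        (hc x B' rfl hB')) (fun Δ hΔ => by
        have h1 := D.card_pt_meets x Δ (by rintro rfl; exact hx hΔ)
        rw [← h1, Nat.mul_div_cancel _ D.l_pos]
        exact cnt_congr fun B' => by simp [hΔ])
    have hd : l ∣ c * lam := ⟨_, by
      rw [← D.card_pt_meets x Δ (by rintro rfl; exact hx hΔ), mul_comm]⟩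
    rw [D.card_pt] at h
    rw [h, mul_assoc, Nat.div_mul_cancel hd]
  · have h0 : ∀ p : C → Prop, cnt (fun Δ => p Δ ∧ O Δ) = 0 := fun p =>
      cnt_eq_zero.2 fun Δ h => hne ⟨Δ, h.2⟩
    have h1 : cnt O = 0 := cnt_eq_zero.2 fun Δ h => hne ⟨Δ, h⟩
    rw [h0, h1]
    simp

theorem isMultiplyPretransitive_two (D : ImprimDesign Γ P C β lam c d l s r b)
    (h : ∀ n < d, 0 < n → r * l ∣ n * (c * lam) → n = d - 1) :
    IsMultiplyPretransitive Γ C 2 := by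
  have key : ∀ Δ Δ₁ Δ₂ : C, Δ₁ ≠ Δ → Δ₂ ≠ Δ → ∃ g : Γ, g • Δ = Δ ∧ g • Δ₁ = Δ₂ := by
    intro Δ Δ₁ Δ₂ h₁ h₂
    obtain ⟨x, rfl⟩ := D.exists_cls Δ
    let O : C → Prop := fun Δ' => ∃ g : Γ, g • D.cls x = D.cls x ∧ g • Δ₁ = Δ'
    have hO : ¬ O (D.cls x) := by
      rintro ⟨g, hg, hg'⟩
      exact h₁ (smul_left_cancel g (hg'.trans hg.symm))
    obtain ⟨n, hn, -⟩ := D.exists_mul_eq_of_class_stabilizer x O hO (by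
      rintro g hg _ ⟨g', hg', rfl⟩
      exact ⟨g * g', by rw [mul_smul, hg', hg], mul_smul _ _ _⟩)
    have h3 := cnt_ne_add_one (p := fun _ : C => True) (x := D.cls x) trivial
    rw [cnt_true, D.card_C] at h3
    have hsub : ∀ Δ, O Δ → True ∧ Δ ≠ D.cls x := fun Δ hΔ => ⟨trivial, by rintro rfl; exact hO hΔ⟩
    have h4 := cnt_mono hsub
    have h5 := h (cnt O) (by omega) (cnt_pos.2 ⟨Δ₁, 1, by simp⟩)
      ⟨n, by rw [← hn]; ring⟩
    exact eq_of_cnt_le hsub (by omega) Δ₂ ⟨trivial, h₂⟩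
  rw [is_two_pretransitive_iff]
  intro a b a' b' hab hab'
  obtain ⟨g, hg⟩ := D.exists_smul_class a a'
  obtain ⟨g', hg', hg''⟩ := key a' (g • b) b' (by rw [← hg]; exact (MulAction.injective g).ne hab.symm) hab'.symm
  exact ⟨g' * g, by rw [mul_smul, hg, hg'], by rw [mul_smul, hg'']⟩

/-- Counting blocks with tuples of classes. -/
theorem descFactorial_dvd (D : ImprimDesign Γ P C β lam c d l s r b) {t : ℕ}
    (h : IsMultiplyPretransitive Γ C t) : d.descFactorial t ∣ b * s.descFactorial t := by
  classical
  by_cases hne : Nonempty (Fin t ↪ C)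
  · obtain ⟨f₀⟩ := hne
    have h1 := cnt_mul_eq_cnt_mul (fun _ : Fin t ↪ C => True) (fun _ : β => True)
      (fun f B => ∀ i, D.Meets B (f i)) (m := cnt fun B => ∀ i, D.Meets B (f₀ i))
      (n := s.descFactorial t) (by simp) (by simp) (fun f _ => by
        obtain ⟨g, rfl⟩ := h.exists_smul_eq f₀ f
        refine (cnt_smul g _ _ fun B => ?_).symm
        simp only [Function.Embedding.smul_apply, D.meets_smul]) (fun B _ => by
        rw [cnt_eq_natCard]
        have e : {f : Fin t ↪ C // ∀ i, D.Meets B (f i)} ≃ (Fin t ↪ {Δ // D.Meets B Δ}) :=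
          ⟨fun f => ⟨fun i => ⟨f.1 i, f.2 i⟩, fun i j hij => f.1.injective (congrArg Subtype.val hij)⟩,
            fun f => ⟨f.trans (Function.Embedding.subtype _), fun i => (f i).2⟩,
            fun f => rfl, fun f => rfl⟩
        rw [Nat.card_congr e, Nat.card_eq_fintype_card, Fintype.card_embedding_eq, Fintype.card_fin,
          ← Nat.card_eq_fintype_card, ← cnt_eq_natCard, D.card_meets])
    rw [cnt_true, cnt_true, Fintype.card_embedding_eq, Fintype.card_fin, D.card_C, D.card_B] at h1
    exact ⟨_, h1.symm⟩
  · have h1 : d < t := by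
      by_contra! h2
      exact hne (Function.Embedding.nonempty_of_card_le (by simpa [D.card_C] using h2))
    have h2 : s ≤ d := by rw [← D.card_C, ← D.card_meets (D.nonempty_β.some)]; exact cnt_le_card _
    simp [Nat.descFactorial_eq_zero_iff_lt.2 (h2.trans_lt h1)]

end ImprimDesign

section Actions

open Finset MulAction

variable {Γ X : Type*} [Group Γ] [MulAction Γ X]

/-- Two points are in the same orbit of a subgroup. -/
def Conn (H : Subgroup Γ) (x y : X) : Prop := ∃ h ∈ H, h • x = y

theorem conn_equivalence (H : Subgroup Γ) : Equivalence (Conn H : X → X → Prop) where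
  refl x := ⟨1, H.one_mem, one_smul _ x⟩
  symm := by
    rintro x _ ⟨h, hh, rfl⟩
    exact ⟨h⁻¹, H.inv_mem hh, inv_smul_smul h x⟩
  trans := by
    rintro x _ _ ⟨h, hh, rfl⟩ ⟨h', hh', rfl⟩
    exact ⟨h' * h, H.mul_mem hh' hh, mul_smul _ _ _⟩

theorem conn_smul {H : Subgroup Γ} {g : Γ} (hg : ∀ h ∈ H, g * h * g⁻¹ ∈ H)
    (hg' : ∀ h ∈ H, g⁻¹ * h * g ∈ H) (x y : X) : Conn H (g • x) (g • y) ↔ Conn H x y := by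
  constructor
  · rintro ⟨h, hh, e⟩
    refine ⟨g⁻¹ * h * g, hg' h hh, ?_⟩
    rw [mul_smul, mul_smul, e, inv_smul_smul]
  · rintro ⟨h, hh, rfl⟩
    refine ⟨g * h * g⁻¹, hg h hh, ?_⟩
    rw [mul_smul, mul_smul, inv_smul_smul]

theorem conn_smul_of_normal {H : Subgroup Γ} (hH : H.Normal) (g : Γ) (x y : X) :
    Conn H (g • x) (g • y) ↔ Conn H x y :=
  conn_smul (fun h hh => hH.conj_mem h hh g)
    (fun h hh => by simpa using hH.conj_mem h hh g⁻¹) x y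

theorem conn_smul_right {H : Subgroup Γ} {h : Γ} (hh : h ∈ H) (x y : X) :
    Conn H x (h • y) ↔ Conn H x y :=
  ⟨fun e => (conn_equivalence H).trans e ⟨h⁻¹, H.inv_mem hh, inv_smul_smul h y⟩,
    fun e => (conn_equivalence H).trans e ⟨h, hh, rfl⟩⟩

variable [Fintype X]

theorem cnt_conn_eq {H : Subgroup Γ} {x y : X} (h : Conn H x y) :
    cnt (Conn H x) = cnt (Conn H y) :=
  cnt_congr fun _ => ⟨(conn_equivalence H).trans ((conn_equivalence H).symm h),
    (conn_equivalence H).trans h⟩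

theorem cnt_conn_dvd_card [Finite Γ] (H : Subgroup Γ) (x : X) :
    cnt (Conn H x) ∣ Nat.card H := by
  have h : cnt (Conn H x) = (stabilizer H x).index := by
    rw [index_stabilizer, cnt_eq_natCard]
    refine Nat.card_congr (Equiv.setCongr (s := {y | Conn H x y}) ?_)
    ext y
    exact ⟨fun ⟨h, hh, e⟩ => ⟨⟨h, hh⟩, e⟩, fun ⟨h, e⟩ => ⟨h.1, h.2, e⟩⟩
  rw [h]
  exact Subgroup.index_dvd_card _

theorem exists_pow_eq_one_of_dvd_card [Finite Γ] {H : Subgroup Γ} {p : ℕ} (hp : p.Prime)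
    (h : p ∣ Nat.card H) : ∃ g ∈ H, g ≠ 1 ∧ g ^ p = 1 := by
  have := Fact.mk hp
  obtain ⟨g, hg⟩ := exists_prime_orderOf_dvd_card' p h
  refine ⟨g, g.2, fun h1 => ?_, ?_⟩
  · rw [← Subgroup.orderOf_coe, h1, orderOf_one] at hg
    exact hp.one_lt.ne hg
  · rw [← hg, ← Subgroup.orderOf_coe]
    exact pow_orderOf_eq_one _

theorem cnt_zpow_orbit {p : ℕ} (hp : p.Prime) {g : Γ} (hg : g ^ p = 1) {x : X}
    (hx : g • x ≠ x) : cnt (fun y => ∃ i : ℤ, g ^ i • x = y) = p := by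
  classical
  refine le_antisymm ?_ (le_cnt_zpow_orbit hp hg hx)
  calc cnt (fun y => ∃ i : ℤ, g ^ i • x = y) ≤ #((range p).image fun i => g ^ i • x) := by
        refine card_le_card fun y hy => ?_
        obtain ⟨i, rfl⟩ := (mem_filter.1 hy).2
        have hp0 : (p : ℤ) ≠ 0 := by exact_mod_cast hp.ne_zero
        refine mem_image.2 ⟨(i % p).toNat, ?_, ?_⟩
        · have := Int.emod_lt_of_pos i (by exact_mod_cast hp.pos : (0 : ℤ) < p)
          have := Int.emod_nonneg i hp0
          rw [mem_range]; omega
        · congr 1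
          rw [← zpow_natCast, Int.toNat_of_nonneg (Int.emod_nonneg i hp0)]
          conv_rhs => rw [← Int.emod_add_mul_ediv i p]
          rw [zpow_add, zpow_mul, zpow_natCast g p, hg, one_zpow, mul_one]
    _ ≤ p := by simpa using card_image_le (s := range p) (f := fun i => g ^ i • x)

theorem dvd_sum_of_equivalence {E : X → X → Prop} (hE : Equivalence E)
    {p : X → Prop} {m : ℕ} (hm : ∀ x, p x → cnt (E x) = m) (f : X → ℕ)
    (hf : ∀ x y, E x y → f x = f y) (hfp : ∀ x, ¬ p x → f x = 0) :
    m ∣ ∑ x, f x := by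
  classical
  rw [← sum_fiberwise_of_maps_to (t := univ.image f) (g := f) (fun x _ => by simp)]
  refine dvd_sum fun j _ => ?_
  rw [sum_congr rfl (g := fun _ => j) (fun x hx => (mem_filter.1 hx).2), sum_const, smul_eq_mul]
  by_cases hj : j = 0
  · simp [hj]
  refine Dvd.dvd.mul_right ?_ _
  have := dvd_cnt_of_equivalence hE (p := fun x => f x = j) (m := m)
    (fun x y h hx => (hf x y h).symm.trans hx)
    (fun x hx => hm x (by by_contra h; exact hj (hx ▸ hfp x h)))
  have e : #{x | f x = j} = cnt (fun x => f x = j) := by unfold cnt; congr!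
  rw [e]
  exact this

end Actions

namespace ImprimDesign

open Finset MulAction

variable {Γ P C β : Type*} [Group Γ] [Fintype P] [Fintype C] [Fintype β]
    [MulAction Γ P] [MulAction Γ C] [MulAction Γ β] {lam c d l s r b : ℕ}
    (D : ImprimDesign Γ P C β lam c d l s r b)

theorem lam_lt_r (D : ImprimDesign Γ P C β lam c d l s r b) (hlc : l < c) : lam < r := by
  have h1 := D.r_mul_pred_l
  have := D.lam_pos
  by_contra! h
  have h2 : 0 < l - 1 := by
    by_contra h3
    rw [show l - 1 = 0 by omega, mul_zero, eq_comm, mul_eq_zero] at h1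
    have := D.two_le_c
    omega
  have h3 : r * (l - 1) ≤ lam * (l - 1) := Nat.mul_le_mul_right _ h
  have h4 : lam * (l - 1) < lam * (c - 1) := Nat.mul_lt_mul_of_pos_left (by omega) D.lam_pos
  omega

theorem one_lt_l (D : ImprimDesign Γ P C β lam c d l s r b) : 1 < l := by
  have h1 := D.r_mul_pred_l
  have := D.lam_pos
  have := D.two_le_c
  have := D.l_pos
  by_contra h
  rw [show l - 1 = 0 by omega, mul_zero, eq_comm, mul_eq_zero] at h1
  omega

theorem I_smul_of_eq {g : Γ} {B : β} (h : g • B = B) {x : P} (hx : D.I x B) : D.I (g • x) B := by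
  have := (D.I_smul g x B).2 hx
  rwa [h] at this

theorem I_smul_iff_of_eq {g : Γ} {B : β} (h : g • B = B) {x : P} : D.I (g • x) B ↔ D.I x B := by
  have := D.I_smul g x B
  rwa [h] at this

theorem I_smul_block {g : Γ} {x : P} (h : g • x = x) {B : β} : D.I x (g • B) ↔ D.I x B := by
  have := D.I_smul g x B
  rwa [h] at this

/-- At most `lam` blocks contain two given points. -/
theorem smul_eq_of_blocks {g : Γ} {x : P} {A : β → Prop} (hA : lam < cnt (fun B => D.I x B ∧ A B))
    (h : ∀ B, D.I x B → A B → g • B = B) : g • x = x := by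
  by_contra hne
  have h1 := D.pair x (g • x) (Ne.symm hne)
  have h2 : cnt (fun B => D.I x B ∧ A B) ≤ cnt (fun B => D.I x B ∧ D.I (g • x) B) :=
    cnt_mono fun B hB => ⟨hB.1, D.I_smul_of_eq (h B hB.1 hB.2) hB.1⟩
  omega

theorem eq_one_of_fix_blocks (hlc : l < c) {g : Γ} {Δ : C}
    (h : ∀ B, D.Meets B Δ → g • B = B) : g = 1 := by
  refine D.faithful g fun x => D.smul_eq_of_blocks (A := fun B => D.Meets B Δ) ?_
    fun B _ => h B
  by_cases hx : D.cls x = Δ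
  · have h1 := D.card_pt x
    have h2 : cnt (fun B => D.I x B ∧ D.Meets B Δ) = cnt (fun B => D.I x B) :=
      cnt_congr fun B => ⟨fun h => h.1, fun h => ⟨h, x, h, hx⟩⟩
    have := D.lam_lt_r hlc
    omega
  · have h1 := D.card_pt_meets x Δ hx
    by_contra! h2
    have h3 := Nat.mul_le_mul_right l h2
    have h4 : lam * l < c * lam := by
      rw [mul_comm c]; exact Nat.mul_lt_mul_of_pos_left hlc D.lam_pos
    omega

theorem smul_block_eq_of_pow {p : ℕ} (hp : p.Prime) (hlp : lam < p) {g : Γ} (hg : g ^ p = 1)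
    {x y : P} (hne : x ≠ y) (hx : g • x = x) (hy : g • y = y) {B : β} (hxB : D.I x B)
    (hyB : D.I y B) : g • B = B :=
  smul_eq_of_cnt_lt hp hg (q := fun B => D.I x B ∧ D.I y B)
    (fun B => by rw [D.I_smul_block hx, D.I_smul_block hy]) (by rw [D.pair x y hne]; exact hlp)
    B ⟨hxB, hyB⟩

theorem exists_ne_of_meets {B : β} {x : P} (hx : D.I x B) :
    ∃ y, D.I y B ∧ D.cls y = D.cls x ∧ y ≠ x := by
  obtain ⟨y, hy, hne⟩ := exists_ne_of_one_lt_cnt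
    (by rw [D.card_inter x B hx]; exact D.one_lt_l) x
  exact ⟨y, hy.1, hy.2, hne⟩

/-- An element of prime order greater than `lam` acts nontrivially on each class. -/
theorem eq_one_of_fix_class (hlc : l < c) {p : ℕ} (hp : p.Prime) (hlp : lam < p) {g : Γ}
    (hg : g ^ p = 1) {Δ : C} (h : ∀ x, D.cls x = Δ → g • x = x) : g = 1 := by
  refine D.eq_one_of_fix_blocks hlc (Δ := Δ) ?_
  rintro B ⟨x, hx, rfl⟩
  obtain ⟨y, hy, hyx, hne⟩ := D.exists_ne_of_meets hx
  exact D.smul_block_eq_of_pow hp hlp hg hne.symm (h x rfl) (h y hyx) hx hy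

theorem exists_pow_eq_one_class (D : ImprimDesign Γ P C β lam c d l s r b) {p : ℕ} (hp : p.Prime)
    (hpc : p ∣ c) (Δ : C) : ∃ g : Γ, g ≠ 1 ∧ g ^ p = 1 ∧ g • Δ = Δ := by
  have := D.finite
  obtain ⟨x, rfl⟩ := D.exists_cls Δ
  have h1 := cnt_conn_dvd_card (stabilizer Γ (D.cls x)) x
  have h2 : cnt (Conn (stabilizer Γ (D.cls x)) x) = c := by
    refine (cnt_congr fun y => ?_).trans (D.card_cls (D.cls x))
    constructor
    · rintro ⟨g, hg, rfl⟩
      rw [D.cls_smul, mem_stabilizer_iff.1 hg]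
    · intro hy
      obtain ⟨g, rfl⟩ := D.exists_smul_point x y
      exact ⟨g, by rw [mem_stabilizer_iff, ← D.cls_smul, hy], rfl⟩
  rw [h2] at h1
  obtain ⟨g, hg, h⟩ := exists_pow_eq_one_of_dvd_card hp (hpc.trans h1)
  exact ⟨g, h.1, h.2, mem_stabilizer_iff.1 hg⟩

/-- If all elements of order `p` move some class, the group is highly transitive on the classes. -/
theorem exists_kernel_pow (D : ImprimDesign Γ P C β lam c d l s r b) {p : ℕ} (hp : p.Prime)
    (hpc : p ∣ c) (hpd : p < d) (hdp : d ≤ 2 * p)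
    (h2 : ∀ n < d, 0 < n → r * l ∣ n * (c * lam) → n = d - 1)
    (hdvd : ¬ d.descFactorial (d - p + 1) ∣ b * s.descFactorial (d - p + 1)) :
    ∃ g : Γ, g ≠ 1 ∧ g ^ p = 1 ∧ ∀ Δ : C, g • Δ = Δ := by
  obtain ⟨Δ⟩ := D.nonempty_C
  obtain ⟨g, hg1, hg, hΔ⟩ := D.exists_pow_eq_one_class hp hpc Δ
  refine ⟨g, hg1, hg, ?_⟩
  by_contra! hne
  obtain ⟨Δ', hΔ'⟩ := hne
  refine hdvd (D.descFactorial_dvd ?_)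
  rw [← D.card_C]
  refine isMultiplyPretransitive_of_prime_cycle (D.isMultiplyPretransitive_two h2) hp hg ?_
    (by rw [D.card_C]; exact hpd)
  have h3 := cnt_modEq_cnt_fixed_of_pow hp hg (q := fun Δ : C => g • Δ ≠ Δ)
    (fun x => smul_ne_iff g x)
  have h4 : cnt (fun Δ : C => g • Δ ≠ Δ ∧ g • Δ = Δ) = 0 := cnt_eq_zero.2 fun x h => h.1 h.2
  rw [h4] at h3
  obtain ⟨k, hk⟩ := (Nat.modEq_zero_iff_dvd).1 h3
  have h5 : 0 < cnt (fun Δ : C => g • Δ ≠ Δ) := cnt_pos.2 ⟨Δ', hΔ'⟩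
  have h6 := cnt_add_not (fun Δ : C => g • Δ = Δ)
  have h7 : 0 < cnt (fun Δ : C => g • Δ = Δ) := cnt_pos.2 ⟨Δ, hΔ⟩
  rw [D.card_C] at h6
  change cnt (fun Δ : C => g • Δ = Δ) + cnt (fun Δ : C => g • Δ ≠ Δ) = d at h6
  rw [hk]
  have hk2 : k < 2 := by by_contra! h; have := Nat.mul_le_mul_left p h; omega
  interval_cases k
  · omega
  · simp

end ImprimDesign

namespace ImprimDesign

open Finset MulAction

section Kernel

variable {Γ C : Type*} [Group Γ] [MulAction Γ C]

variable (Γ C) in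
/-- The group of elements fixing all classes. -/
def classKernel : Subgroup Γ := (toPermHom Γ C).ker

theorem mem_classKernel {g : Γ} : g ∈ classKernel Γ C ↔ ∀ Δ : C, g • Δ = Δ := by
  rw [classKernel, MonoidHom.mem_ker, Equiv.Perm.ext_iff]
  rfl

theorem classKernel_normal : (classKernel Γ C).Normal := MonoidHom.normal_ker _

theorem conj_mem_classKernel {g h : Γ} (hh : h ∈ classKernel Γ C) :
    g * h * g⁻¹ ∈ classKernel Γ C :=
  classKernel_normal.conj_mem h hh g

end Kernel

variable {Γ P C β : Type*} [Group Γ] [Fintype P] [Fintype C] [Fintype β]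
    [MulAction Γ P] [MulAction Γ C] [MulAction Γ β] {lam c d l s r b : ℕ}
    (D : ImprimDesign Γ P C β lam c d l s r b)

theorem cls_kernel {k : Γ} (hk : k ∈ classKernel Γ C) (x : P) : D.cls (k • x) = D.cls x := by
  rw [D.cls_smul, mem_classKernel.1 hk]

theorem meets_kernel {k : Γ} (hk : k ∈ classKernel Γ C) (B : β) (Δ : C) :
    D.Meets (k • B) Δ ↔ D.Meets B Δ := by
  rw [← D.meets_smul k B Δ, mem_classKernel.1 hk]

/-- A nontrivial kernel is transitive on the points of each class. -/
theorem kernel_transitive (hn : ∀ n ≤ c, n ∣ c → r ∣ lam * (n - 1) → n = 1 ∨ n = c) {κ : Γ}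
    (hκ : κ ≠ 1) (hκK : κ ∈ classKernel Γ C) {x y : P} (hxy : D.cls y = D.cls x) :
    Conn (classKernel Γ C) x y := by
  have hnormal : (classKernel Γ C).Normal := classKernel_normal
  have hconst : ∀ x y : P, cnt (Conn (classKernel Γ C) x) = cnt (Conn (classKernel Γ C) y) := by
    intro x y
    obtain ⟨g, rfl⟩ := D.exists_smul_point x y
    exact cnt_smul g _ _ fun z => (conn_smul_of_normal hnormal g x z).symm
  have hsub : ∀ x y : P, Conn (classKernel Γ C) x y → D.cls y = D.cls x := by
    rintro x _ ⟨k, hk, rfl⟩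
    exact D.cls_kernel hk x
  have h1 : cnt (Conn (classKernel Γ C) x) ∣ c := by
    have := dvd_cnt_of_equivalence (conn_equivalence (classKernel Γ C))
      (p := fun y => D.cls y = D.cls x) (m := cnt (Conn (classKernel Γ C) x))
      (fun y z h hy => (hsub y z h).trans hy) (fun y _ => hconst y x)
    rwa [D.card_cls] at this
  obtain ⟨n, h2, -⟩ := D.exists_mul_eq_of_stabilizer x
    (fun y => Conn (classKernel Γ C) x y ∧ y ≠ x) (fun h => h.2 rfl) (by
      rintro g hg y ⟨hy, hne⟩
      refine ⟨?_, fun h => hne (smul_left_cancel g (h.trans hg.symm))⟩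
      have := (conn_smul_of_normal hnormal g x y).2 hy
      rwa [hg] at this)
  have h3 := cnt_ne_add_one (p := Conn (classKernel Γ C) x) ((conn_equivalence _).refl x)
  have h4 : cnt (Conn (classKernel Γ C) x) ≤ c := by
    have := cnt_mono (hsub x); rwa [D.card_cls] at this
  rcases hn _ h4 h1 ⟨n, by rw [h2, ← h3]; simp⟩ with h5 | h5
  · exfalso
    refine hκ (D.faithful κ fun z => ?_)
    obtain ⟨w, hw, hw'⟩ := exists_of_cnt_eq_one ((hconst z x).trans h5)
    exact (hw' _ ⟨κ, hκK, rfl⟩).trans (hw' _ ((conn_equivalence _).refl z)).symm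
  · exact eq_of_cnt_le (hsub x) (by rw [D.card_cls, h5]) y hxy

/-- Orbits of a nontrivial kernel on blocks. -/
theorem kernel_blocks
    (hK : ∀ x y : P, D.cls y = D.cls x → Conn (classKernel Γ C) x y) :
    ∃ m t, 0 < t ∧ m * l = c * t ∧ m ∣ b.gcd ((c * r / l).gcd (c * c * lam / (l * l))) ∧
      (∀ B : β, cnt (Conn (classKernel Γ C) B) = m) ∧
      ∀ B x, D.Meets B (D.cls x) →
        cnt (fun B' => Conn (classKernel Γ C) B B' ∧ D.I x B') = t := by
  have hnormal : (classKernel Γ C).Normal := classKernel_normal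
  obtain ⟨B₀⟩ := D.nonempty_β
  obtain ⟨x₀, hx₀⟩ := D.exists_pt B₀
  have hconst : ∀ B : β, cnt (Conn (classKernel Γ C) B) = cnt (Conn (classKernel Γ C) B₀) := by
    intro B
    obtain ⟨g, rfl⟩ := D.exists_smul_block B₀ B
    exact (cnt_smul g _ _ fun z => (conn_smul_of_normal hnormal g B₀ z).symm).symm
  have ht : ∀ B x, D.Meets B (D.cls x) →
      cnt (fun B' => Conn (classKernel Γ C) B B' ∧ D.I x B') =
      cnt (fun B' => Conn (classKernel Γ C) B₀ B' ∧ D.I x₀ B') := by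
    rintro B x ⟨y, hy, hyx⟩
    obtain ⟨k, hk, rfl⟩ := hK y x hyx.symm
    have e : cnt (fun B' => Conn (classKernel Γ C) B B' ∧ D.I (k • y) B') =
        cnt (fun B' => Conn (classKernel Γ C) B B' ∧ D.I y B') :=
      (cnt_smul k _ _ fun B' => by rw [conn_smul_right hk, D.I_smul]).symm
    rw [e]
    obtain ⟨g, rfl, rfl⟩ := D.flag x₀ B₀ y B hx₀ hy
    exact (cnt_smul g _ _ fun B' => by rw [conn_smul_of_normal hnormal, D.I_smul]).symm
  have hmeet : ∀ B B' : β, Conn (classKernel Γ C) B B' → ∀ Δ, D.Meets B Δ → D.Meets B' Δ := by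
    rintro B _ ⟨k, hk, rfl⟩ Δ h
    exact (D.meets_kernel hk B Δ).2 h
  refine ⟨_, _, ?_, ?_, ?_, hconst, ht⟩
  · exact cnt_pos.2 ⟨B₀, (conn_equivalence _).refl B₀, hx₀⟩
  · have h := cnt_mul_eq_cnt_mul (Conn (classKernel Γ C) B₀) (fun x => D.cls x = D.cls x₀)
      (fun B x => Conn (classKernel Γ C) B₀ B ∧ (D.I x B ∧ D.cls x = D.cls x₀))
      (n := cnt (fun B' => Conn (classKernel Γ C) B₀ B' ∧ D.I x₀ B'))
      (fun B x h => h.1) (fun B x h => h.2.2)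
      (fun B hB => (cnt_congr fun x => by simp [hB]).trans
        (D.card_inter_of_meets (hmeet _ _ hB _ ⟨x₀, hx₀, rfl⟩)))
      (fun x hx => (cnt_congr fun B => by simp [hx]).trans (ht B₀ x ⟨x₀, hx₀, hx.symm⟩))
    rwa [D.card_cls] at h
  · have hl := D.l_pos
    refine Nat.dvd_gcd ?_ (Nat.dvd_gcd ?_ ?_)
    · have := dvd_cnt_of_equivalence (conn_equivalence (classKernel Γ C))
        (p := fun _ : β => True) (fun _ _ _ h => h) (fun B _ => hconst B)
      rwa [cnt_true, D.card_B] at this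
    · rw [← D.card_blocks_meets (D.cls x₀), Nat.mul_div_cancel _ hl]
      exact dvd_cnt_of_equivalence (conn_equivalence (classKernel Γ C))
        (fun B B' h => hmeet B B' h _) (fun B _ => hconst B)
    · obtain ⟨Δ, hΔ⟩ := Fintype.exists_ne_of_one_lt_card
        (by rw [D.card_C]; have := D.two_le_d; omega) (D.cls x₀)
      rw [← D.card_blocks_meets₂ (D.cls x₀) Δ hΔ.symm, Nat.mul_div_cancel _ (Nat.mul_pos hl hl)]
      exact dvd_cnt_of_equivalence (conn_equivalence (classKernel Γ C))
        (fun B B' h hB => ⟨hmeet B B' h _ hB.1, hmeet B B' h _ hB.2⟩) (fun B _ => hconst B)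

theorem zpow_kernel_cls {k : Γ} (hk : k ∈ classKernel Γ C) (i : ℤ) (x : P) :
    D.cls (k ^ i • x) = D.cls x := D.cls_kernel (zpow_mem hk i) x

/-- If the kernel acts on a class as a group of order less than `p²`, then its elements of order
`p` generate a normal subgroup there. -/
theorem dvd_of_kernel_small (hlc : l < c) {p : ℕ} (hp : p.Prime) (hlp : lam < p) (hpc : p ≤ c)
    {κ : Γ} (hκ1 : κ ≠ 1) (hκp : κ ^ p = 1) (hκ : κ ∈ classKernel Γ C) {α β' : P}
    (H : ∀ k ∈ classKernel Γ C, k • α = α → k • β' = β' → ∀ x, D.cls x = D.cls α → k • x = x)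
    {q : ℕ} (hq : cnt (Conn (classKernel Γ C ⊓ stabilizer Γ α) β') ≤ q) (hcq : c * q < p * p) :
    r ∣ lam * (p - 1) := by
  classical
  have hqp : q < p := by
    by_contra! h
    have := Nat.mul_le_mul hpc h
    omega
  have hκα : κ • α ≠ α := by
    intro h
    refine hκ1 (D.eq_one_of_fix_class hlc hp hlp hκp (H κ hκ h ?_))
    refine smul_eq_of_cnt_lt hp hκp (q := Conn (classKernel Γ C ⊓ stabilizer Γ α) β')
      (fun x => conn_smul_right (H := classKernel Γ C ⊓ stabilizer Γ α)
        (Subgroup.mem_inf.2 ⟨hκ, mem_stabilizer_iff.2 h⟩) _ _) (by omega) β' ((conn_equivalence _).refl _)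
  have := Fact.mk hp
  have hord : orderOf κ = p := orderOf_eq_prime hκp hκ1
  have claim : ∀ κ' ∈ classKernel Γ C, κ' ^ p = 1 → ∃ i : ℤ, κ ^ i • α = κ' • α := by
    intro κ' hκ' hκp'
    have hch : ∀ x : P, ∃ k : Γ, Conn (classKernel Γ C) α x → k ∈ classKernel Γ C ∧ k • α = x := by
      intro x
      by_cases h : Conn (classKernel Γ C) α x
      · obtain ⟨k, hk⟩ := h
        exact ⟨k, fun _ => hk⟩
      · exact ⟨1, fun h' => absurd h' h⟩
    choose k hk using hch
    have hmem : ∀ z : Fin p × Fin p, κ ^ (z.1 : ℕ) * κ' ^ (z.2 : ℕ) ∈ classKernel Γ C :=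
      fun z => mul_mem (pow_mem hκ _) (pow_mem hκ' _)
    let F : Fin p × Fin p → P × P := fun z =>
      ((κ ^ (z.1 : ℕ) * κ' ^ (z.2 : ℕ)) • α,
        (k ((κ ^ (z.1 : ℕ) * κ' ^ (z.2 : ℕ)) • α))⁻¹ • (κ ^ (z.1 : ℕ) * κ' ^ (z.2 : ℕ)) • β')
    obtain ⟨z, -, z', -, hne, heq⟩ := exists_ne_map_eq_of_card_lt_of_maps_to
      (s := (univ : Finset (Fin p × Fin p)))
      (t := (univ.filter fun x => D.cls x = D.cls α) ×ˢ
        univ.filter (Conn (classKernel Γ C ⊓ stabilizer Γ α) β')) (f := F) (by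
        rw [card_product, card_univ, Fintype.card_prod, Fintype.card_fin]
        refine lt_of_le_of_lt (Nat.mul_le_mul (le_of_eq ?_) (le_trans (le_of_eq ?_) hq)) hcq
        · exact (by unfold cnt; congr! : _ = cnt _).trans (D.card_cls (D.cls α))
        · unfold cnt; congr!) (by
        intro z _
        have h1 := hk _ ⟨_, hmem z, rfl⟩
        simp only [F, mem_coe, mem_product, mem_filter, mem_univ, true_and]
        refine ⟨D.cls_kernel (hmem z) _, (k ((κ ^ (z.1 : ℕ) * κ' ^ (z.2 : ℕ)) • α))⁻¹ *
          (κ ^ (z.1 : ℕ) * κ' ^ (z.2 : ℕ)), Subgroup.mem_inf.2 ⟨mul_mem (inv_mem h1.1) (hmem z),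
            mem_stabilizer_iff.2 ?_⟩, mul_smul _ _ _⟩
        rw [mul_smul, inv_smul_eq_iff, h1.2])
    obtain ⟨i, j⟩ := z
    obtain ⟨i', j'⟩ := z'
    simp only [F, Prod.mk.injEq] at heq
    obtain ⟨e1, e2⟩ := heq
    rw [e1] at e2
    have e2 := smul_left_cancel _ e2
    have key : ∀ x, D.cls x = D.cls α →
        κ ^ ((i : ℤ) - i') • x = κ' ^ ((j' : ℤ) - j) • x := by
      intro x hx
      have h1 := H ((κ ^ (i' : ℕ) * κ' ^ (j' : ℕ))⁻¹ * (κ ^ (i : ℕ) * κ' ^ (j : ℕ)))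
        (mul_mem (inv_mem (hmem (i', j'))) (hmem (i, j)))
        (by rw [mul_smul, inv_smul_eq_iff, e1]) (by rw [mul_smul, inv_smul_eq_iff, e2])
        (κ' ^ (-(j : ℤ)) • x) (by rw [D.zpow_kernel_cls hκ', hx])
      rw [mul_smul, inv_smul_eq_iff, smul_smul, smul_smul, mul_assoc, mul_assoc,
        ← zpow_natCast, ← zpow_natCast, ← zpow_natCast, ← zpow_natCast, ← zpow_add, ← zpow_add,
        add_neg_cancel, zpow_zero, mul_one, mul_smul] at h1
      rw [sub_eq_neg_add, zpow_add, mul_smul, h1, zpow_neg, inv_smul_smul, sub_eq_add_neg]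
    by_cases hj : j = j'
    · exfalso
      subst hj
      have h1 : κ ^ ((i : ℤ) - i') = 1 := by
        refine D.eq_one_of_fix_class hlc hp hlp (Δ := D.cls α) ?_ fun x hx => ?_
        · rw [← zpow_natCast, ← zpow_mul, mul_comm, zpow_mul, zpow_natCast, hκp, one_zpow]
        · rw [key x hx, sub_self, zpow_zero, one_smul]
      have h2 := orderOf_dvd_iff_zpow_eq_one.2 h1
      rw [hord] at h2
      have h3 : (i : ℤ) - i' = 0 := Int.eq_zero_of_abs_lt_dvd h2 (by
        have := i.2; have := i'.2; rw [abs_lt]; omega)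
      exact hne (by rw [Prod.mk.injEq]; exact ⟨Fin.ext (by omega), rfl⟩)
    · have hcop : IsCoprime ((j' : ℤ) - j) p := by
        rw [isCoprime_comm, (Nat.prime_iff_prime_int.1 hp).coprime_iff_not_dvd]
        intro h2
        have h3 : (j' : ℤ) - j = 0 := Int.eq_zero_of_abs_lt_dvd h2 (by
          have := j.2; have := j'.2; rw [abs_lt]; omega)
        exact hj (Fin.ext (by omega))
      obtain ⟨u, v, huv⟩ := hcop
      refine ⟨((i : ℤ) - i') * u, ?_⟩
      have h1 : ∀ u : ℤ, ∀ x, D.cls x = D.cls α →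
          (κ ^ ((i : ℤ) - i')) ^ u • x = (κ' ^ ((j' : ℤ) - j)) ^ u • x := by
        intro u
        induction u with
        | zero => simp
        | succ u ih =>
          intro x hx
          rw [zpow_add_one, zpow_add_one, mul_smul, mul_smul, key x hx,
            ih _ (by rw [D.zpow_kernel_cls hκ', hx])]
        | pred u ih =>
          intro x hx
          have h5 : (κ ^ ((i : ℤ) - i'))⁻¹ • x = (κ' ^ ((j' : ℤ) - j))⁻¹ • x := by
            rw [inv_smul_eq_iff, key _ (by rw [← zpow_neg, D.zpow_kernel_cls hκ', hx]),
              smul_inv_smul]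
          rw [zpow_sub_one, zpow_sub_one, mul_smul, mul_smul, h5,
            ih _ (by rw [← zpow_neg, D.zpow_kernel_cls hκ', hx])]
      rw [zpow_mul, h1 u α rfl, ← zpow_mul,
        show ((j' : ℤ) - j) * u = 1 + p * (-v) by linear_combination huv, zpow_add, zpow_mul,
        zpow_natCast, hκp', one_zpow, mul_one, zpow_one]
  obtain ⟨n, hn, -⟩ := D.exists_mul_eq_of_stabilizer α
    (fun y => (∃ i : ℤ, κ ^ i • α = y) ∧ y ≠ α) (fun h => h.2 rfl) (by
      rintro g hg _ ⟨⟨i, rfl⟩, hne⟩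
      refine ⟨?_, fun h => hne (smul_left_cancel g (h.trans hg.symm))⟩
      obtain ⟨i', hi'⟩ := claim (g * κ ^ i * g⁻¹) (conj_mem_classKernel (zpow_mem hκ i)) (by
        rw [conj_pow, ← zpow_natCast, ← zpow_mul, mul_comm (i : ℤ), zpow_mul, zpow_natCast, hκp,
          one_zpow, mul_one, mul_inv_cancel])
      refine ⟨i', ?_⟩
      rw [hi', mul_smul, mul_smul, inv_smul_eq_iff.2 hg.symm])
  have h3 := cnt_ne_add_one (p := fun y => ∃ i : ℤ, κ ^ i • α = y) (x := α) ⟨0, by simp⟩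
  rw [cnt_zpow_orbit hp hκp hκα] at h3
  exact ⟨n, by rw [hn]; congr 1; omega⟩

end ImprimDesign

namespace ImprimDesign

open Finset MulAction

variable {Γ P C β : Type*} [Group Γ] [Fintype P] [Fintype C] [Fintype β]
    [MulAction Γ P] [MulAction Γ C] [MulAction Γ β] {lam c d l s r b : ℕ}
    (D : ImprimDesign Γ P C β lam c d l s r b)

variable (Γ C) in
/-- The elements fixing all classes and a given point. -/
abbrev kernelStab (α : P) : Subgroup Γ := classKernel Γ C ⊓ stabilizer Γ α

theorem mem_kernelStab {g : Γ} {α : P} :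
    g ∈ kernelStab Γ C α ↔ g ∈ classKernel Γ C ∧ g • α = α := by
  rw [Subgroup.mem_inf, mem_stabilizer_iff]

theorem conn_kernelStab_smul {g : Γ} {α : P} (hg : g • α = α) (x y : P) :
    Conn (kernelStab Γ C α) (g • x) (g • y) ↔ Conn (kernelStab Γ C α) x y := by
  have h : ∀ g : Γ, g • α = α → ∀ k ∈ kernelStab Γ C α, g * k * g⁻¹ ∈ kernelStab Γ C α := by
    intro g hg k hk
    rw [mem_kernelStab] at hk ⊢
    exact ⟨conj_mem_classKernel hk.1, by rw [mul_smul, mul_smul, inv_smul_eq_iff.2 hg.symm, hk.2, hg]⟩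
  refine conn_smul (h g hg) (fun k hk => ?_) x y
  simpa using h g⁻¹ (inv_smul_eq_iff.2 hg.symm) k hk

theorem cnt_conn_kernelStab_self (α : P) : cnt (Conn (kernelStab Γ C α) α) = 1 :=
  cnt_eq_one_of α ((conn_equivalence _).refl α) (by
    rintro _ ⟨k, hk, rfl⟩
    exact (mem_kernelStab.1 hk).2)

theorem cls_of_conn_kernelStab {α x y : P} (h : Conn (kernelStab Γ C α) x y) :
    D.cls y = D.cls x := by
  obtain ⟨k, hk, rfl⟩ := h
  exact D.cls_kernel (mem_kernelStab.1 hk).1 x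

theorem ne_of_conn_kernelStab {α x y : P} (h : Conn (kernelStab Γ C α) x y) (hx : x ≠ α) :
    y ≠ α := by
  obtain ⟨k, hk, rfl⟩ := h
  exact fun h => hx (smul_left_cancel k (h.trans (mem_kernelStab.1 hk).2.symm))

theorem I_of_pair_subset {x y x' y' : P} (h : x ≠ y) (h' : x' ≠ y')
    (H : ∀ B, D.I x B → D.I y B → D.I x' B ∧ D.I y' B) {B : β} (hx : D.I x' B) (hy : D.I y' B) :
    D.I x B ∧ D.I y B :=
  eq_of_cnt_le (p := fun B => D.I x B ∧ D.I y B) (q := fun B => D.I x' B ∧ D.I y' B)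
    (fun B hB => H B hB.1 hB.2) (by rw [D.pair x y h, D.pair x' y' h']) B ⟨hx, hy⟩

/-- If each block is invariant within a class under kernel elements fixing a point of it in that
class, then kernel elements fixing two points of a class fix it pointwise. -/
theorem smul_eq_of_fix_pair (hlc : l < c)
    (H : ∀ k ∈ classKernel Γ C, ∀ α B x, k • α = α → D.I α B → D.I x B → D.cls x = D.cls α →
      D.I (k • x) B)
    {k : Γ} (hk : k ∈ classKernel Γ C) {α β' : P} (hne : α ≠ β') (hβ : D.cls β' = D.cls α)
    (hkα : k • α = α) (hkβ : k • β' = β') (x : P) (hx : D.cls x = D.cls α) : k • x = x := by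
  by_contra hkx
  have h1 : ∀ x z, D.cls x = D.cls α → D.cls z = D.cls α → k • x ≠ x → k • z = z →
      ∀ B, D.I x B → D.I (k • x) B → D.I z B := by
    intro x z hx hz hkx hkz B hB hB'
    refine (D.I_of_pair_subset (x := x) (y := z) (x' := x) (y' := k • x) ?_ (Ne.symm hkx) ?_
      hB hB').2
    · rintro rfl; exact hkx hkz
    · exact fun B hxB hzB => ⟨hxB, H k hk z B x hkz hzB hxB (hx.trans hz.symm)⟩
  have h2 : ∀ x, D.cls x = D.cls α → k • x ≠ x → ∀ B, D.I α B → D.I β' B →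
      D.I x B ∧ D.I (k • x) B := by
    intro x hx hkx B hα hβB
    exact D.I_of_pair_subset (x := x) (y := k • x) (x' := α) (y' := β') (Ne.symm hkx) hne
      (fun B hB hB' => ⟨h1 x α hx rfl hkx hkα B hB hB', h1 x β' hx hβ hkx hkβ B hB hB'⟩) hα hβB
  obtain ⟨B, hαB, hβB⟩ := D.exists_block₂ α β' hne
  have h3 : ∀ z, D.cls z = D.cls α → D.I z B := by
    intro z hz
    by_cases hkz : k • z = z
    · have := h2 x hx hkx B hαB hβB
      exact h1 x z hx hz hkx hkz B this.1 this.2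
    · exact (h2 z hz hkz B hαB hβB).1
  have h4 := cnt_mono (p := fun z => D.cls z = D.cls α) (q := fun z => D.I z B ∧ D.cls z = D.cls α)
    fun z hz => ⟨h3 z hz, hz⟩
  rw [D.card_cls, D.card_inter α B hαB] at h4
  omega

theorem smul_block_eq_of_unique
    (h1 : ∀ B x, D.Meets B (D.cls x) → cnt (fun B' => Conn (classKernel Γ C) B B' ∧ D.I x B') = 1)
    {k : Γ} (hk : k ∈ classKernel Γ C) {α : P} (hα : k • α = α) {B : β} (hB : D.I α B) :
    k • B = B := by
  obtain ⟨B', -, h⟩ := exists_of_cnt_eq_one (h1 B α ⟨α, hB, rfl⟩)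
  exact (h (k • B) ⟨⟨k, hk, rfl⟩, (D.I_smul_block hα).2 hB⟩).trans
    (h B ⟨(conn_equivalence _).refl B, hB⟩).symm

theorem not_unique (hlc : l < c) {p : ℕ} (hp : p.Prime) (hlp : lam < p) (hpc : p ≤ c)
    {κ : Γ} (hκ1 : κ ≠ 1) (hκp : κ ^ p = 1) (hκ : κ ∈ classKernel Γ C)
    (hcp : c * (l - 1) < p * p) (hr : ¬ r ∣ lam * (p - 1))
    (h1 : ∀ B x, D.Meets B (D.cls x) →
      cnt (fun B' => Conn (classKernel Γ C) B B' ∧ D.I x B') = 1) : False := by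
  obtain ⟨α⟩ := D.nonempty_P
  obtain ⟨β', hβ, hne⟩ := D.exists_ne_cls α
  refine hr (D.dvd_of_kernel_small hlc hp hlp hpc hκ1 hκp hκ (α := α) (β' := β')
    (fun k hk hkα hkβ => D.smul_eq_of_fix_pair hlc ?_ hk hne.symm hβ hkα hkβ) ?_ hcp)
  · intro k hk α B x hα hB hx _
    exact D.I_smul_of_eq (D.smul_block_eq_of_unique h1 hk hα hB) hx
  · obtain ⟨B, hαB, hβB⟩ := D.exists_block₂ α β' hne.symm
    have h2 := cnt_ne_add_one (p := fun y => D.I y B ∧ D.cls y = D.cls α) (x := α) ⟨hαB, rfl⟩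
    rw [D.card_inter α B hαB] at h2
    have h3 : cnt (Conn (kernelStab Γ C α) β') ≤ cnt fun y => (D.I y B ∧ D.cls y = D.cls α) ∧ y ≠ α := by
      refine cnt_mono fun y hy => ⟨⟨?_, (D.cls_of_conn_kernelStab hy).trans hβ⟩,
        ne_of_conn_kernelStab hy hne⟩
      obtain ⟨k, hk, rfl⟩ := hy
      rw [mem_kernelStab] at hk
      exact D.I_smul_of_eq (D.smul_block_eq_of_unique h1 hk.1 hk.2 hαB) hβB
    change cnt (Conn (kernelStab Γ C α) β') ≤ _
    omega

/-- The points of a class whose orbit under the stabilizer of `α` in the kernel has length `q`. -/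
def Suborbit (α : P) (q : ℕ) (y : P) : Prop :=
  (D.cls y = D.cls α ∧ y ≠ α) ∧ cnt (Conn (kernelStab Γ C α) y) = q

theorem dvd_cnt_suborbit (α : P) (q : ℕ) : q ∣ cnt (D.Suborbit α q) :=
  dvd_cnt_of_equivalence (conn_equivalence (kernelStab Γ C α))
    (fun _ _ h hx => ⟨⟨(D.cls_of_conn_kernelStab h).trans hx.1.1, ne_of_conn_kernelStab h hx.1.2⟩,
      (cnt_conn_eq h).symm.trans hx.2⟩) (fun _ hx => hx.2)

theorem r_dvd_cnt_suborbit (α : P) (q : ℕ) : r ∣ lam * cnt (D.Suborbit α q) := by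
  obtain ⟨n, hn, -⟩ := D.exists_mul_eq_of_stabilizer α (D.Suborbit α q) (fun h => h.1.2 rfl) (by
    rintro g hg y ⟨⟨hy1, hy2⟩, hy3⟩
    refine ⟨⟨by rw [D.cls_smul, hy1, ← D.cls_smul, hg],
      fun h => hy2 (smul_left_cancel g (h.trans hg.symm))⟩, ?_⟩
    rw [← hy3]
    exact (cnt_smul g _ _ fun z => (conn_kernelStab_smul hg y z).symm).symm)
  exact ⟨n, hn.symm⟩

theorem cnt_ne_of_cls (α : P) : cnt (fun y => D.cls y = D.cls α ∧ y ≠ α) + 1 = c := by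
  have := cnt_ne_add_one (p := fun y => D.cls y = D.cls α) (x := α) rfl
  rwa [D.card_cls] at this

theorem cnt_suborbit_lt (α : P) (q : ℕ) : cnt (D.Suborbit α q) < c := by
  have h1 := D.cnt_ne_of_cls α
  have h2 := cnt_mono (p := D.Suborbit α q) fun _ h => h.1
  omega

theorem suborbit_pos {α y : P} (hy : D.cls y = D.cls α) (hne : y ≠ α) :
    0 < cnt (D.Suborbit α (cnt (Conn (kernelStab Γ C α) y))) :=
  cnt_pos.2 ⟨y, ⟨hy, hne⟩, rfl⟩

theorem suborbit_of_cnt {α : P} {q : ℕ} (h : cnt (D.Suborbit α q) = c - 1) {y : P}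
    (hy : D.cls y = D.cls α) (hne : y ≠ α) : cnt (Conn (kernelStab Γ C α) y) = q :=
  (eq_of_cnt_le (p := D.Suborbit α q) (fun _ h => h.1)
    (by have := D.cnt_ne_of_cls α; omega) y ⟨hy, hne⟩).2

theorem smul_eq_of_orbit_one {α y : P} (h : cnt (Conn (kernelStab Γ C α) y) = 1) {k : Γ}
    (hk : k ∈ classKernel Γ C) (hα : k • α = α) : k • y = y := by
  obtain ⟨z, -, hz⟩ := exists_of_cnt_eq_one h
  exact (hz _ ⟨k, mem_kernelStab.2 ⟨hk, hα⟩, rfl⟩).trans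
    (hz _ ((conn_equivalence _).refl y)).symm

/-- The number of blocks of a kernel orbit through two points. -/
theorem sum_orbit_blocks {t : ℕ} {α : P} {B : β}
    (ht : cnt (fun B' => Conn (classKernel Γ C) B B' ∧ D.I α B') = t) :
    ∑ y, cnt (fun B' => (Conn (classKernel Γ C) B B' ∧ D.I α B') ∧
      (D.I y B' ∧ D.cls y = D.cls α) ∧ y ≠ α) = t * (l - 1) := by
  rw [← ht]
  refine (cnt_mul_eq_sum _ (fun B' y => (Conn (classKernel Γ C) B B' ∧ D.I α B') ∧
      (D.I y B' ∧ D.cls y = D.cls α) ∧ y ≠ α) (fun _ _ h => h.1) fun B' hB' => ?_).symm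
  have h2 := cnt_ne_add_one (p := fun y => D.I y B' ∧ D.cls y = D.cls α) (x := α) ⟨hB'.2, rfl⟩
  rw [D.card_inter α B' hB'.2] at h2
  refine (cnt_congr fun y => ⟨fun h => h.2, fun h => ⟨hB', h⟩⟩).trans (Nat.eq_sub_of_add_eq h2)

theorem dvd_orbit_blocks {q t : ℕ} {α : P}
    (hq : ∀ y, D.cls y = D.cls α → y ≠ α → cnt (Conn (kernelStab Γ C α) y) = q) {B : β}
    (ht : cnt (fun B' => Conn (classKernel Γ C) B B' ∧ D.I α B') = t) : q ∣ t * (l - 1) := by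
  rw [← D.sum_orbit_blocks ht]
  refine dvd_sum_of_equivalence (conn_equivalence (kernelStab Γ C α))
    (p := fun y => D.cls y = D.cls α ∧ y ≠ α) (fun y hy => hq y hy.1 hy.2) _ ?_ ?_
  · rintro x _ ⟨k, hk, rfl⟩
    rw [mem_kernelStab] at hk
    refine cnt_smul k _ _ fun B' => ?_
    rw [conn_smul_right hk.1, D.I_smul_block hk.2, D.I_smul, D.cls_kernel hk.1,
      show (k • x ≠ α ↔ x ≠ α) by
        rw [Ne, Ne, smul_eq_iff_eq_inv_smul, inv_smul_eq_iff.2 hk.2.symm]]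
  · intro x hx
    exact cnt_eq_zero.2 fun B' h => hx ⟨h.2.1.2, h.2.2⟩

theorem exists_suborbit_two (D : ImprimDesign Γ P C β lam c d 2 s r b) (α : P) :
    ∃ q, 0 < q ∧ q ∣ c - 1 ∧
      ∀ y, D.cls y = D.cls α → y ≠ α → cnt (Conn (kernelStab Γ C α) y) = q := by
  obtain ⟨y, hy, hne⟩ := D.exists_ne_cls α
  have h1 := D.r_dvd_cnt_suborbit α (cnt (Conn (kernelStab Γ C α) y))
  have h2 := D.cnt_suborbit_lt α (cnt (Conn (kernelStab Γ C α) y))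
  have h3 := D.suborbit_pos hy hne
  have h4 := D.dvd_cnt_suborbit α (cnt (Conn (kernelStab Γ C α) y))
  have h5 := D.r_mul_pred_l
  replace h1 := (dvd_of_eq (show lam * (c - 1) = r by simpa using h5.symm)).trans h1
  have h6 := Nat.le_of_dvd h3 (Nat.dvd_of_mul_dvd_mul_left D.lam_pos h1)
  have h7 : cnt (D.Suborbit α (cnt (Conn (kernelStab Γ C α) y))) = c - 1 := by omega
  refine ⟨_, cnt_pos.2 ⟨y, (conn_equivalence _).refl y⟩, h7 ▸ h4, fun z hz hz' =>
    D.suborbit_of_cnt h7 hz hz'⟩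

theorem not_orbit_one (hlc : l < c) {p : ℕ} (hp : p.Prime) (hlp : lam < p) (hpc : p ≤ c)
    {κ : Γ} (hκ1 : κ ≠ 1) (hκp : κ ^ p = 1) (hκ : κ ∈ classKernel Γ C)
    (hcp : c < p * p) (hr : ¬ r ∣ lam * (p - 1)) {α : P}
    (h1 : ∀ y, D.cls y = D.cls α → y ≠ α → cnt (Conn (kernelStab Γ C α) y) = 1) : False := by
  refine hr (D.dvd_of_kernel_small hlc hp hlp hpc hκ1 hκp hκ (α := α) (β' := α)
    (fun k hk hα _ x hx => ?_) (cnt_conn_kernelStab_self α).le (by omega))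
  by_cases hxα : x = α
  · rw [hxα, hα]
  · exact smul_eq_of_orbit_one (h1 x hx hxα) hk hα

theorem no_kernel_two (D : ImprimDesign Γ P C β lam c d 2 s r b) {p : ℕ} (hc : 2 < c)
    (hp : p.Prime) (hlp : lam < p) (hpc : p ≤ c)
    {κ : Γ} (hκ1 : κ ≠ 1) (hκp : κ ^ p = 1) (hκ : κ ∈ classKernel Γ C)
    (hcp : c < p * p) (hr : ¬ r ∣ lam * (p - 1))
    (hn : ∀ n ≤ c, n ∣ c → r ∣ lam * (n - 1) → n = 1 ∨ n = c)
    (hg : ∀ t ≤ b, 0 < t → c * t / 2 ∣ b.gcd ((c * r / 2).gcd (c * c * lam / 4)) →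
      (c - 1).gcd t = 1) : False := by
  obtain ⟨m, t, ht, hm, hdvd, hcnt, hB⟩ := D.kernel_blocks
    fun x y => D.kernel_transitive hn hκ1 hκ
  obtain ⟨α⟩ := D.nonempty_P
  obtain ⟨B, hαB⟩ := D.exists_block α
  obtain ⟨q, hq, hqc, hq'⟩ := D.exists_suborbit_two α
  have h1 : q ∣ t := by
    simpa using D.dvd_orbit_blocks hq' (hB B α ⟨α, hαB, rfl⟩)
  have h2 := hg t (by
    rw [← hB B α ⟨α, hαB, rfl⟩]; exact (cnt_le_card _).trans D.card_B.le) ht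
    (by rw [← hm, Nat.mul_div_cancel _ two_pos]; exact hdvd)
  have h3 : q = 1 := Nat.eq_one_of_dvd_one (h2 ▸ Nat.dvd_gcd hqc h1)
  subst h3
  exact D.not_orbit_one hc hp hlp hpc hκ1 hκp hκ hcp hr hq'

end ImprimDesign

section Actions

open Finset MulAction

variable {Γ X : Type*} [Group Γ] [MulAction Γ X] [Fintype X]

theorem eq_or_eq_of_cnt_le_two {X : Type*} [Fintype X] {p : X → Prop} (h : cnt p ≤ 2) {x y z : X} (hx : p x) (hy : p y)
    (hz : p z) : x = y ∨ x = z ∨ y = z := by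
  classical
  by_contra! hne
  have := Finset.two_lt_card (s := univ.filter p) |>.2 ⟨x, mem_filter.2 ⟨mem_univ x, hx⟩, y, mem_filter.2 ⟨mem_univ y, hy⟩,
    z, mem_filter.2 ⟨mem_univ z, hz⟩, hne⟩
  refine absurd h (not_le.2 (this.trans_eq ?_))
  unfold cnt
  congr!

/-- An odd orbit is also an orbit of any subgroup of index two. -/
theorem conn_of_index_two {H K : Subgroup Γ} (hHK : H ≤ K)
    (hmul : ∀ g ∈ K, ∀ h ∈ K, g ∉ H → h ∉ H → g * h ∈ H) {x : X} (hodd : ¬ 2 ∣ cnt (Conn K x))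
    {k : Γ} (hk : k ∈ K) : Conn H x (k • x) := by
  by_contra hkx
  have hkH : k ∉ H := fun h => hkx ⟨k, h, rfl⟩
  refine hodd ⟨cnt (Conn H x), ?_⟩
  have h1 : cnt (Conn H x) = cnt (fun y => Conn H x (k⁻¹ • y)) :=
    cnt_smul k _ _ fun y => by rw [inv_smul_smul]
  rw [two_mul]
  nth_rewrite 2 [h1]
  rw [← cnt_or]
  · refine cnt_congr fun y => ⟨?_, ?_⟩
    · rintro ⟨g, hg, rfl⟩
      by_cases hgH : g ∈ H
      · exact Or.inl ⟨g, hgH, rfl⟩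
      · refine Or.inr ⟨k⁻¹ * g, hmul _ (inv_mem hk) _ hg (by simpa using hkH) hgH, mul_smul _ _ _⟩
    · rintro (⟨g, hg, rfl⟩ | ⟨g, hg, e⟩)
      · exact ⟨g, hHK hg, rfl⟩
      · exact ⟨k * g, mul_mem hk (hHK hg), by rw [mul_smul, e, smul_inv_smul]⟩
  · rintro _ ⟨h, hh, rfl⟩ ⟨h', hh', e⟩
    have hu : h⁻¹ * k * h' ∉ H := fun hu => hkH (by
      have := mul_mem (mul_mem hh hu) (inv_mem hh')
      simpa [mul_assoc] using this)
    have huK : h⁻¹ * k * h' ∈ K := mul_mem (mul_mem (inv_mem (hHK hh)) hk) (hHK hh')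
    refine hkx ⟨k * (h⁻¹ * k * h'), hmul _ hk _ huK hkH hu, ?_⟩
    rw [mul_smul, mul_smul, mul_smul, e, smul_inv_smul, inv_smul_smul]

end Actions

namespace ImprimDesign

open Finset MulAction

variable {Γ P C β : Type*} [Group Γ] [Fintype P] [Fintype C] [Fintype β]
    [MulAction Γ P] [MulAction Γ C] [MulAction Γ β] {lam c d l s r b : ℕ}
    (D : ImprimDesign Γ P C β lam c d l s r b)

theorem cnt_suborbit_one_dvd
    (hK : ∀ x y : P, D.cls y = D.cls x → Conn (classKernel Γ C) x y) (α : P) :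
    cnt (D.Suborbit α 1) + 1 ∣ c := by
  have := D.finite
  let E : P → P → Prop := fun x y => D.cls y = D.cls x ∧ ∀ k ∈ classKernel Γ C, k • x = x ↔ k • y = y
  have hE : Equivalence E := ⟨fun x => ⟨rfl, fun _ _ => Iff.rfl⟩,
    fun h => ⟨h.1.symm, fun k hk => (h.2 k hk).symm⟩,
    fun h h' => ⟨h'.1.trans h.1, fun k hk => (h.2 k hk).trans (h'.2 k hk)⟩⟩
  have hEg : ∀ (g : Γ) x y, E x y → E (g • x) (g • y) := by
    intro g x y h
    refine ⟨by rw [D.cls_smul, D.cls_smul, h.1], fun k hk => ?_⟩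
    have := h.2 (g⁻¹ * k * g) (by simpa using conj_mem_classKernel (g := g⁻¹) hk)
    simpa [mul_smul, inv_smul_eq_iff] using this
  have hEg' : ∀ (g : Γ) x y, E (g • x) (g • y) ↔ E x y := fun g x y =>
    ⟨fun h => by simpa using hEg g⁻¹ _ _ h, hEg g x y⟩
  have h1 : ∀ x, cnt (E x) = cnt (E α) := by
    intro x
    obtain ⟨g, rfl⟩ := D.exists_smul_point α x
    exact (cnt_smul g _ _ fun y => (hEg' g α y).symm).symm
  have h2 := dvd_cnt_of_equivalence hE (p := fun x => D.cls x = D.cls α)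
    (fun x y h hx => h.1.trans hx) (fun x _ => h1 x)
  rw [D.card_cls] at h2
  have h3 := cnt_ne_add_one (p := E α) (hE.refl α)
  rw [← h3] at h2
  refine (dvd_of_eq ?_).trans h2
  congr 1
  refine cnt_congr fun y => ⟨fun h => ⟨⟨h.1.1, fun k hk => ?_⟩, h.1.2⟩, fun h => ⟨⟨h.1.1, h.2⟩, ?_⟩⟩
  · refine ⟨fun e => smul_eq_of_orbit_one h.2 hk e, fun e => ?_⟩
    obtain ⟨h', hh', rfl⟩ := hK α y h.1.1
    have key : ∀ j : ℕ, (h' ^ j)⁻¹ • (h'⁻¹ * k * h') • h' ^ j • α = α := by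
      intro j
      induction j with
      | zero => simp only [pow_zero, inv_one, one_smul, mul_smul, e, inv_smul_smul]
      | succ j ih =>
        have h4 := smul_eq_of_orbit_one h.2
          (k := (h' ^ j)⁻¹ * ((h'⁻¹ * k * h') * h' ^ j)) (by
            have h5 := conj_mem_classKernel (g := (h' ^ j)⁻¹ * h'⁻¹) hk
            simpa [mul_assoc] using h5) (by rw [mul_smul, mul_smul]; exact ih)
        rw [mul_smul, mul_smul] at h4
        rw [pow_succ, mul_inv_rev, mul_smul, mul_smul (h' ^ j) h' α, h4, inv_smul_smul]
    have h6 := key (orderOf h' - 1)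
    have h7 : h' ^ (orderOf h' - 1) = h'⁻¹ := by
      rw [eq_inv_iff_mul_eq_one, ← pow_succ, Nat.sub_add_cancel (orderOf_pos h'), pow_orderOf_eq_one]
    rw [h7, inv_inv] at h6
    simpa [mul_smul] using h6
  · refine cnt_eq_one_of y ((conn_equivalence _).refl y) ?_
    rintro _ ⟨k, hk, rfl⟩
    rw [mem_kernelStab] at hk
    exact (h.1.2 k hk.1).1 hk.2

theorem smul_eq_of_pow_fix {t : ℕ} (hB : ∀ B x, D.Meets B (D.cls x) →
      cnt (fun B' => Conn (classKernel Γ C) B B' ∧ D.I x B') = t) (hlc : l < c) {p : ℕ}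
    (hp : p.Prime) (hlp : lam < p) (htp : t < p) (hl : l < p) {k : Γ} (hkp : k ^ p = 1)
    (hk : k ∈ classKernel Γ C) {α : P} (hα : k • α = α) : k = 1 := by
  refine D.eq_one_of_fix_class hlc hp hlp hkp (Δ := D.cls α) fun x hx => ?_
  by_cases hxα : x = α
  · rw [hxα, hα]
  obtain ⟨B, hxB, hαB⟩ := D.exists_block₂ x α hxα
  have h1 : k • B = B := smul_eq_of_cnt_lt hp hkp
    (q := fun B' => Conn (classKernel Γ C) B B' ∧ D.I α B')
    (fun B' => by rw [conn_smul_right hk, D.I_smul_block hα])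
    (by rw [hB B α ⟨α, hαB, rfl⟩]; exact htp) B ⟨(conn_equivalence _).refl B, hαB⟩
  exact smul_eq_of_cnt_lt hp hkp (q := fun y => D.I y B ∧ D.cls y = D.cls α)
    (fun y => by rw [D.I_smul_iff_of_eq h1, D.cls_kernel hk])
    (by rw [D.card_inter α B hαB]; exact hl) x ⟨hxB, hx⟩

theorem no_kernel_76_26 (D : ImprimDesign Γ P C β 4 76 26 4 20 100 2470) {κ : Γ}
    (hκ1 : κ ≠ 1) (hκp : κ ^ 19 = 1) (hκ : κ ∈ classKernel Γ C) : False := by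
  have := D.finite
  have hp : Nat.Prime 19 := by norm_num
  have hKt : ∀ x y : P, D.cls y = D.cls x → Conn (classKernel Γ C) x y := fun x y =>
    D.kernel_transitive (by decide) hκ1 hκ
  obtain ⟨m, t, ht, hm, hdvd, hcnt, hB⟩ := D.kernel_blocks hKt
  have ht2 : t ≤ 2 := by
    have := Nat.le_of_dvd (by decide) hdvd
    have : m ≤ 38 := this.trans (by decide)
    omega
  have main : ∀ α : P, cnt (D.Suborbit α 3) = 75 := by
    intro α
    have h5 : ∀ y : P, ¬ 5 ∣ cnt (Conn (kernelStab Γ C α) y) := by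
      intro y hy
      obtain ⟨g, hg, hg1, hg5⟩ := exists_pow_eq_one_of_dvd_card (p := 5) (by norm_num)
        (hy.trans (cnt_conn_dvd_card _ y))
      rw [mem_kernelStab] at hg
      exact hg1 (D.smul_eq_of_pow_fix hB (by norm_num) (p := 5) (by norm_num) (by norm_num)
        (by omega) (by norm_num) hg5 hg.1 hg.2)
    have hY : ∀ q, ∃ j ≤ 3, cnt (D.Suborbit α q) = 25 * j ∧ q ∣ 25 * j := by
      intro q
      have h1 := D.r_dvd_cnt_suborbit α q
      have h2 := D.cnt_suborbit_lt α q
      have h3 := D.dvd_cnt_suborbit α q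
      obtain ⟨j, hj⟩ : 25 ∣ cnt (D.Suborbit α q) := by
        generalize cnt (D.Suborbit α q) = n at *; omega
      exact ⟨j, by generalize cnt (D.Suborbit α q) = n at *; omega, hj, hj ▸ h3⟩
    have hq : ∀ y, D.cls y = D.cls α → y ≠ α → cnt (Conn (kernelStab Γ C α) y) = 1 ∨
        cnt (Conn (kernelStab Γ C α) y) = 2 ∨ cnt (Conn (kernelStab Γ C α) y) = 3 := by
      intro y hy hne
      obtain ⟨j, hj, hj1, hj2⟩ := hY (cnt (Conn (kernelStab Γ C α) y))
      have h1 := D.suborbit_pos hy hne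
      have h2 := h5 y
      generalize cnt (Conn (kernelStab Γ C α) y) = q at *
      have h3 : q.Coprime 25 := by
        rw [show 25 = 5 ^ 2 by norm_num]
        exact Nat.Coprime.pow_right 2 ((Nat.Prime.coprime_iff_not_dvd (by norm_num)).2 h2).symm
      have h4 := h3.dvd_of_dvd_mul_left hj2
      have h6 := Nat.le_of_dvd (by omega) h4
      have h7 : q ≠ 0 := by rintro rfl; simp at h2
      omega
    have hsum : cnt (D.Suborbit α 1) + cnt (D.Suborbit α 2) + cnt (D.Suborbit α 3) = 75 := by
      have h1 := D.cnt_ne_of_cls α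
      rw [← cnt_or (by rintro x h h'; exact absurd (h.2.symm.trans h'.2) (by norm_num)),
        ← cnt_or (by rintro x (h | h) h' <;> exact absurd (h.2.symm.trans h'.2) (by norm_num))]
      have h2 : cnt (fun y => D.cls y = D.cls α ∧ y ≠ α) = 75 := by omega
      refine (cnt_congr fun y => ?_).trans h2
      constructor
      · rintro ((h | h) | h) <;> exact h.1
      · intro h
        rcases hq y h.1 h.2 with h' | h' | h'
        exacts [Or.inl (Or.inl ⟨h, h'⟩), Or.inl (Or.inr ⟨h, h'⟩), Or.inr ⟨h, h'⟩]
    have h1 : cnt (D.Suborbit α 1) = 0 ∨ cnt (D.Suborbit α 1) = 75 := by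
      obtain ⟨j, hj, hj1, -⟩ := hY 1
      have h1 := D.cnt_suborbit_one_dvd hKt α
      rw [hj1] at h1 ⊢
      interval_cases j <;> revert h1 <;> decide
    have h2 : cnt (D.Suborbit α 1) = 75 ∨ cnt (D.Suborbit α 3) = 75 := by
      obtain ⟨j, hj, hj1, hj2⟩ := hY 2
      obtain ⟨i, hi, hi1, hi2⟩ := hY 3
      generalize cnt (D.Suborbit α 1) = n₁ at *
      generalize cnt (D.Suborbit α 2) = n₂ at *
      generalize cnt (D.Suborbit α 3) = n₃ at *
      omega
    rcases h2 with h2 | h2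
    · exfalso
      exact D.not_orbit_one (by norm_num) hp (by norm_num) (by norm_num) hκ1 hκp hκ (by norm_num)
        (by norm_num) fun y => D.suborbit_of_cnt (q := 1) (by rw [h2])
    · exact h2
  obtain ⟨α⟩ := D.nonempty_P
  obtain ⟨β', hβ, hne⟩ := D.exists_ne_cls α
  refine absurd (D.dvd_of_kernel_small (by norm_num) hp (by norm_num) (by norm_num) hκ1 hκp hκ
    (α := α) (β' := β') (q := 3) (fun k hk hkα hkβ => D.smul_eq_of_fix_pair (by norm_num) ?_ hk
      hne.symm hβ hkα hkβ) (D.suborbit_of_cnt (main α) hβ hne).le (by norm_num)) (by norm_num)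
  intro k hk α B x hα hαB hxB hx
  by_cases hxα : x = α
  · rw [hxα, hα]; exact hαB
  obtain ⟨h, hh, e⟩ := conn_of_index_two (H := kernelStab Γ C α ⊓ stabilizer Γ B)
    (K := kernelStab Γ C α) inf_le_left (by
      intro g hg h hh hgB hhB
      have hgh := mul_mem hg hh
      refine Subgroup.mem_inf.2 ⟨hgh, mem_stabilizer_iff.2 ?_⟩
      have h1 : ∀ g ∈ kernelStab Γ C α, Conn (classKernel Γ C) B (g • B) ∧ D.I α (g • B) := by
        intro g hg
        rw [mem_kernelStab] at hg
        exact ⟨⟨g, hg.1, rfl⟩, (D.I_smul_block hg.2).2 hαB⟩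
      have h2 : ∀ g ∈ kernelStab Γ C α, g ∉ kernelStab Γ C α ⊓ stabilizer Γ B → g • B ≠ B :=
        fun g hg h h' => h (Subgroup.mem_inf.2 ⟨hg, mem_stabilizer_iff.2 h'⟩)
      rcases eq_or_eq_of_cnt_le_two
        (p := fun B' => Conn (classKernel Γ C) B B' ∧ D.I α B') (by rw [hB B α ⟨α, hαB, rfl⟩]; exact ht2)
        (h1 1 (one_mem _)) (h1 g hg) (h1 _ hgh) with h3 | h3 | h3
      · exact absurd (by rw [← h3, one_smul]) (h2 g hg hgB)
      · rw [← h3, one_smul]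
      · rw [mul_smul] at h3
        exact absurd (smul_left_cancel g h3).symm (h2 h hh hhB))
    (x := x) (by rw [D.suborbit_of_cnt (main α) hx hxα]; norm_num)
    (mem_kernelStab.2 ⟨hk, hα⟩)
  rw [← e]
  exact D.I_smul_of_eq (mem_stabilizer_iff.1 (Subgroup.mem_inf.1 hh).2) hxB

/-- Two points of a class are adjacent if they are on a block in a given orbit of the kernel. -/
def Adj (B : β) (x y : P) : Prop :=
  (D.cls y = D.cls x ∧ y ≠ x) ∧ ∃ B', Conn (classKernel Γ C) B B' ∧ D.I x B' ∧ D.I y B'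

theorem Adj.symm {B : β} {x y : P} (h : D.Adj B x y) : D.Adj B y x :=
  ⟨⟨h.1.1.symm, h.1.2.symm⟩, h.2.imp fun _ h => ⟨h.1, h.2.2, h.2.1⟩⟩

theorem adj_of_I {B : β} {x y : P} (hx : D.I x B) (hy : D.I y B) (h : D.cls y = D.cls x)
    (hne : y ≠ x) : D.Adj B x y :=
  ⟨⟨h, hne⟩, B, (conn_equivalence _).refl B, hx, hy⟩

theorem Adj.smul {B : β} {x y : P} (h : D.Adj B x y) (g : Γ) : D.Adj (g • B) (g • x) (g • y) := by
  obtain ⟨h1, B', h2, h3, h4⟩ := h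
  exact ⟨⟨by rw [D.cls_smul, D.cls_smul, h1.1], fun h => h1.2 (smul_left_cancel g h)⟩,
    g • B', (conn_smul_of_normal classKernel_normal g B B').2 h2, (D.I_smul g x B').2 h3,
    (D.I_smul g y B').2 h4⟩

theorem Adj.smul_kernel {B : β} {x y : P} (h : D.Adj B x y) {k : Γ} (hk : k ∈ classKernel Γ C) :
    D.Adj B (k • x) (k • y) := by
  obtain ⟨h1, B', h2, h3, h4⟩ := h
  exact ⟨⟨by rw [D.cls_kernel hk, D.cls_kernel hk, h1.1], fun h => h1.2 (smul_left_cancel k h)⟩,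
    k • B', (conn_smul_right hk B B').2 h2, (D.I_smul k x B').2 h3, (D.I_smul k y B').2 h4⟩

theorem Adj.conn {B : β} {x y z : P} (h : D.Adj B x y) (hz : Conn (kernelStab Γ C x) y z) :
    D.Adj B x z := by
  obtain ⟨k, hk, rfl⟩ := hz
  rw [mem_kernelStab] at hk
  have := h.smul_kernel D hk.1
  rwa [hk.2] at this

theorem Adj.zpow {B : β} {x y : P} (h : D.Adj B x y) {k : Γ} (hk : k ∈ classKernel Γ C) (i : ℤ) :
    D.Adj B (k ^ i • x) (k ^ i • y) := h.smul_kernel D (zpow_mem hk i)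

theorem Adj.zpow_neg {B : β} {x : P} {k : Γ} (hk : k ∈ classKernel Γ C) {i : ℤ}
    (h : D.Adj B x (k ^ i • x)) : D.Adj B x (k ^ (-i) • x) := by
  have := h.zpow D hk (-i)
  rw [smul_smul, ← _root_.zpow_add, neg_add_cancel, zpow_zero, one_smul] at this
  exact this.symm

theorem cnt_adj_le (D : ImprimDesign Γ P C β lam c d 2 s r b) {t : ℕ} {x : P} {B : β}
    (ht : cnt (fun B' => Conn (classKernel Γ C) B B' ∧ D.I x B') = t) : cnt (D.Adj B x) ≤ t := by
  classical
  have h1 := D.sum_orbit_blocks ht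
  rw [show t * (2 - 1) = t by omega] at h1
  rw [← h1, cnt_eq_sum]
  refine sum_le_sum fun y _ => ?_
  split_ifs with h
  · obtain ⟨h1, B', h2, h3, h4⟩ := h
    exact cnt_pos.2 ⟨B', ⟨h2, h3⟩, ⟨h4, h1.1⟩, h1.2⟩
  · exact Nat.zero_le _

theorem zpow_smul_ne {k : Γ} {p : ℕ} (hp : p.Prime) (hkp : k ^ p = 1) {x : P} (hx : k • x ≠ x)
    {i : ℤ} (hi : ¬ (p : ℤ) ∣ i) : k ^ i • x ≠ x := by
  intro h
  have hcop : IsCoprime i p := by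
    rw [isCoprime_comm, (Nat.prime_iff_prime_int.1 hp).coprime_iff_not_dvd]
    exact hi
  obtain ⟨u, v, huv⟩ := hcop
  have h1 : k = (k ^ i) ^ u := by
    rw [← zpow_mul, show i * u = 1 + p * (-v) by linear_combination huv, _root_.zpow_add, zpow_mul,
      zpow_natCast, hkp, one_zpow, mul_one, zpow_one]
  exact hx (by rw [h1]; exact zpow_smul_eq h u)

theorem parity_false {f : ℤ → Prop} (hf : ∀ i, f (i + 1) ↔ ¬ f i) (h0 : f 0) (h5 : f 5) :
    False := by
  have h1 : f 1 ↔ ¬ f 0 := hf 0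
  have h2 : f 2 ↔ ¬ f 1 := hf 1
  have h3 : f 3 ↔ ¬ f 2 := hf 2
  have h4 : f 4 ↔ ¬ f 3 := hf 3
  have h5' : f 5 ↔ ¬ f 4 := hf 4
  rw [h5', h4, h3, h2, h1] at h5
  simp only [not_not] at h5
  exact h5 h0

theorem no_kernel_10_10 (D : ImprimDesign Γ P C β 3 10 10 2 6 27 225) {κ : Γ}
    (hκ1 : κ ≠ 1) (hκp : κ ^ 5 = 1) (hκ : κ ∈ classKernel Γ C) : False := by
  have hp : Nat.Prime 5 := by norm_num
  have hKt : ∀ x y : P, D.cls y = D.cls x → Conn (classKernel Γ C) x y := fun x y =>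
    D.kernel_transitive (by decide) hκ1 hκ
  obtain ⟨m, t, ht, hm, hdvd, hcnt, hB⟩ := D.kernel_blocks hKt
  have ht3 : t = 1 ∨ t = 3 := by
    replace hdvd : m ∣ 15 := hdvd
    obtain rfl : m = 5 * t := by omega
    have : t ∣ 3 := Nat.dvd_of_mul_dvd_mul_left (by norm_num : 0 < 5) hdvd
    exact (Nat.dvd_prime (by norm_num)).1 this
  have hq : ∀ α y, D.cls y = D.cls α → y ≠ α → cnt (Conn (kernelStab Γ C α) y) = 3 := by
    intro α
    obtain ⟨q, hq, -, hq'⟩ := D.exists_suborbit_two α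
    obtain ⟨B, hαB⟩ := D.exists_block α
    have h1 : q ∣ t * 1 := D.dvd_orbit_blocks hq' (hB B α ⟨α, hαB, rfl⟩)
    have h2 : q = 1 ∨ q = 3 := by
      rw [mul_one] at h1
      exact (Nat.dvd_prime (by norm_num)).1 (h1.trans (by rcases ht3 with rfl | rfl <;> norm_num))
    rcases h2 with rfl | rfl
    · exact (D.not_orbit_one (by norm_num) hp (by norm_num) (by norm_num) hκ1 hκp hκ (by norm_num)
        (by norm_num) hq').elim
    · exact hq'
  have hfix : ∀ x : P, κ • x ≠ x := fun x hx => hκ1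
    (D.smul_eq_of_pow_fix hB (by norm_num) hp (by norm_num) (by omega) (by norm_num) hκp hκ hx)
  have hN : ∀ B x y, D.Adj B x y → ∀ z, D.Adj B x z → Conn (kernelStab Γ C x) y z := by
    intro B x y hy z hz
    obtain ⟨⟨h1, h2⟩, B', h3, h4, h5⟩ := hy
    refine eq_of_cnt_le (p := Conn (kernelStab Γ C x) y) (q := D.Adj B x)
      (fun z hz => Adj.conn D ⟨⟨h1, h2⟩, B', h3, h4, h5⟩ hz) ?_ z hz
    rw [hq x y h1 h2]
    refine (D.cnt_adj_le (hB B x ?_)).trans (by omega)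
    obtain ⟨k, hk, rfl⟩ := h3
    exact (D.meets_kernel hk B _).1 ⟨x, h4, rfl⟩
  have hcard : ∀ B x y, D.Adj B x y → cnt (D.Adj B x) = 3 := by
    intro B x y h
    exact (cnt_congr fun z => ⟨hN B x y h z, h.conn D⟩).trans (hq x y h.1.1 h.1.2)
  obtain ⟨α⟩ := D.nonempty_P
  have hcls : ∀ i : ℤ, D.cls (κ ^ i • α) = D.cls α := fun i => D.zpow_kernel_cls hκ i α
  have hne : ∀ i : ℤ, ¬ (5 : ℤ) ∣ i → κ ^ i • α ≠ α := fun i hi =>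
    zpow_smul_ne hp hκp (hfix α) hi
  obtain ⟨B₁, h1α, h1κ⟩ := D.exists_block₂ α (κ ^ (1 : ℤ) • α) (hne 1 (by norm_num)).symm
  obtain ⟨B₂, h2α, h2κ⟩ := D.exists_block₂ α (κ ^ (2 : ℤ) • α) (hne 2 (by norm_num)).symm
  have hA₁ := D.adj_of_I h1α h1κ (hcls 1) (hne 1 (by norm_num))
  have hA₂ := D.adj_of_I h2α h2κ (hcls 2) (hne 2 (by norm_num))
  obtain ⟨y, ⟨hyα, hy⟩, hyA⟩ : ∃ y, (D.cls y = D.cls α ∧ y ≠ α) ∧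
      ¬ (D.Adj B₁ α y ∨ D.Adj B₂ α y) := by
    by_contra! h
    have h1 := cnt_mono h
    have h2 := D.cnt_ne_of_cls α
    have h3 := cnt_and_add_not (fun y => D.Adj B₁ α y ∨ D.Adj B₂ α y) (D.Adj B₁ α)
    have h4 := cnt_mono (p := fun y => (D.Adj B₁ α y ∨ D.Adj B₂ α y) ∧ D.Adj B₁ α y)
      (q := D.Adj B₁ α) (fun y h => h.2)
    have h5 := cnt_mono (p := fun y => (D.Adj B₁ α y ∨ D.Adj B₂ α y) ∧ ¬ D.Adj B₁ α y)
      (q := D.Adj B₂ α) (fun y h => h.1.resolve_left h.2)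
    rw [hcard B₁ α _ hA₁] at h4
    rw [hcard B₂ α _ hA₂] at h5
    omega
  obtain ⟨B₃, h3α, h3y⟩ := D.exists_block₂ α y hy.symm
  have hA₃ := D.adj_of_I h3α h3y hyα hy
  have hno : ∀ B z, D.Adj B α z → ¬ D.Adj B α y → ¬ D.Adj B₃ α z := by
    intro B z h1 h2 h3
    exact h2 (h1.conn D (hN B₃ α z h3 y hA₃))
  push Not at hyA
  have hno5 : ∀ i : ℤ, ¬ D.Adj B₃ α (κ ^ i • α) := by
    intro i
    have e : κ ^ i = κ ^ (i % 5) := by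
      nth_rewrite 1 [← Int.mul_ediv_add_emod i 5]
      rw [_root_.zpow_add, zpow_mul, show κ ^ (5 : ℤ) = 1 by exact_mod_cast hκp, one_zpow, one_mul]
    rw [e]
    have e' : ∀ i : ℤ, κ ^ i = κ ^ (i + 5) := fun i => by
      rw [_root_.zpow_add, show κ ^ (5 : ℤ) = 1 by exact_mod_cast hκp, mul_one]
    have h0 := Int.emod_nonneg i (by norm_num : (5 : ℤ) ≠ 0)
    have h1 := Int.emod_lt_of_pos i (by norm_num : (0 : ℤ) < 5)
    generalize i % 5 = j at *
    interval_cases j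
    · rw [zpow_zero, one_smul]
      exact fun h => h.1.2 rfl
    · exact hno _ _ hA₁ hyA.1
    · exact hno _ _ hA₂ hyA.2
    · have := hA₂.zpow_neg D hκ
      rw [e'] at this
      exact hno _ _ this hyA.2
    · have := hA₁.zpow_neg D hκ
      rw [e'] at this
      exact hno _ _ this hyA.1
  let U : P → Prop := fun z => ∃ i : ℤ, κ ^ i • α = z
  have hU : cnt U = 5 := cnt_zpow_orbit hp hκp (hfix α)
  have hUκ : ∀ (i : ℤ) z, U (κ ^ i • z) ↔ U z := by
    intro i z
    refine zpow_smul_mem (q := U) (fun z => ⟨?_, ?_⟩) i z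
    · rintro ⟨i, hi⟩
      exact ⟨-1 + i, by rw [_root_.zpow_add, mul_smul, hi, zpow_neg_one, inv_smul_smul]⟩
    · rintro ⟨i, rfl⟩
      exact ⟨1 + i, by rw [_root_.zpow_add, mul_smul, zpow_one]⟩
  have hUU : ∀ x y, U x → D.Adj B₃ x y → ¬ U y := by
    rintro _ _ ⟨i, rfl⟩ h ⟨j, rfl⟩
    have := h.zpow D hκ (-i)
    rw [smul_smul, smul_smul, ← _root_.zpow_add, ← _root_.zpow_add, neg_add_cancel, zpow_zero,
      one_smul] at this
    exact hno5 _ this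
  have hUα : U α := ⟨0, by simp⟩
  have hmeet : ∀ x, D.cls x = D.cls α → cnt (D.Adj B₃ x) = 3 := by
    intro x hx
    obtain ⟨k, hk, rfl⟩ := hKt α x hx
    exact hcard _ _ _ (hA₃.smul_kernel D hk)
  have hV : cnt (fun x => D.cls x = D.cls α ∧ ¬ U x) = 5 := by
    have h1 := cnt_and_add_not (fun x => D.cls x = D.cls α) U
    have h2 : cnt (fun x => D.cls x = D.cls α ∧ U x) = 5 := by
      rw [← hU]
      refine cnt_congr fun x => ⟨fun h => h.2, fun h => ⟨?_, h⟩⟩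
      obtain ⟨i, rfl⟩ := h
      exact hcls i
    rw [D.card_cls, h2] at h1
    omega
  have hVV : ∀ x y, D.cls x = D.cls α → ¬ U x → D.Adj B₃ x y → U y := by
    intro x y hx hxU hxy
    have h1 : ∀ z, D.cls z = D.cls α ∧ ¬ U z →
        cnt (fun w => (U w ∧ D.Adj B₃ w z)) = cnt (fun w => U w ∧ D.Adj B₃ w x) := by
      intro z hz
      obtain ⟨i, rfl⟩ := exists_zpow_smul_eq hp hκp
        (q := fun x => D.cls x = D.cls α ∧ ¬ U x) (fun x => by
          have := hUκ 1 x
          rw [zpow_one] at this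
          rw [D.cls_kernel hκ, this]) hV.le (x := x) ⟨hx, hxU⟩ (hfix x) hz
      refine (cnt_smul (κ ^ i) _ _ fun w => ?_).symm
      rw [hUκ]
      refine and_congr_right fun _ => ⟨fun h => h.zpow D hκ i, fun h => ?_⟩
      have := h.zpow D hκ (-i)
      simpa using this
    have h2 := cnt_mul_eq_cnt_mul U (fun x => D.cls x = D.cls α ∧ ¬ U x)
      (fun w z => U w ∧ D.Adj B₃ w z) (m := 3) (fun _ _ h => h.1)
      (fun w z h => ⟨by
        obtain ⟨⟨i, rfl⟩, h⟩ := h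
        exact h.1.1.trans (hcls i), hUU w z h.1 h.2⟩)
      (fun w hw => (cnt_congr fun z => by simp [hw]).trans (hmeet w (by
        obtain ⟨i, rfl⟩ := hw
        exact hcls i))) h1
    rw [hU, hV] at h2
    have h3 : cnt (D.Adj B₃ x) ≤ cnt (fun w => U w ∧ D.Adj B₃ w x) := by
      rw [hmeet x hx]; omega
    exact (eq_of_cnt_le (p := fun w => U w ∧ D.Adj B₃ w x) (q := D.Adj B₃ x)
      (fun w h => h.2.symm) h3 y hxy).1
  obtain ⟨g, hg, hgB⟩ := D.flag α B₁ α B₃ h1α h3α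
  have hpath : ∀ i : ℤ, D.Adj B₃ (g • κ ^ i • α) (g • κ ^ (i + 1) • α) := by
    intro i
    have h1 := hA₁.zpow D hκ i
    rw [smul_smul (κ ^ i), ← _root_.zpow_add] at h1
    have h2 := h1.smul D g
    rwa [hgB] at h2
  have hstep : ∀ i : ℤ, U (g • κ ^ (i + 1) • α) ↔ ¬ U (g • κ ^ i • α) := by
    intro i
    refine ⟨fun h h' => hUU _ _ h' (hpath i) h, fun h => hVV _ _ ?_ h (hpath i)⟩
    rw [D.cls_smul, hcls, ← D.cls_smul, hg]
  have h0 : U (g • κ ^ (0 : ℤ) • α) := by rwa [zpow_zero, one_smul, hg]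
  have h5 : U (g • κ ^ (5 : ℤ) • α) := by
    rwa [show κ ^ (5 : ℤ) = κ ^ (0 : ℤ) by rw [zpow_zero]; exact_mod_cast hκp]
  exact parity_false (f := fun i => U (g • κ ^ i • α)) hstep h0 h5

end ImprimDesign

section Circulant

theorem exists_pow_zpow_eq {Γ : Type*} [Group Γ] {k : Γ} {p : ℕ} (hp : p.Prime) (hkp : k ^ p = 1)
    {i : ℤ} (hi : ¬ (p : ℤ) ∣ i) : ∃ u : ℕ, (k ^ i) ^ u = k := by
  have hcop : IsCoprime i p := by
    rw [isCoprime_comm, (Nat.prime_iff_prime_int.1 hp).coprime_iff_not_dvd]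
    exact hi
  obtain ⟨u, v, huv⟩ := hcop
  have h1 : (k ^ i) ^ u = k := by
    rw [← zpow_mul, show i * u = 1 + p * (-v) by linear_combination huv, zpow_add, zpow_mul,
      zpow_natCast, hkp, one_zpow, mul_one, zpow_one]
  refine ⟨(u % p).toNat, ?_⟩
  have h2 : ((u % p).toNat : ℤ) = u % p :=
    Int.toNat_of_nonneg (Int.emod_nonneg _ (by exact_mod_cast hp.ne_zero))
  have h3 : (k ^ i) ^ (p : ℤ) = 1 := by
    rw [← zpow_mul, mul_comm, zpow_mul, zpow_natCast, hkp, one_zpow]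
  rw [← zpow_natCast, h2]
  nth_rewrite 2 [← h1]
  rw [← Int.emod_add_mul_ediv u p, zpow_add, zpow_mul _ (p : ℤ), h3, one_zpow, mul_one,
    Int.emod_add_mul_ediv]

theorem zmod_eleven_generate : ∀ j : ZMod 11, j ≠ 0 → j ≠ 1 → j ≠ -1 → ∀ n : ZMod 11, n ≠ 0 →
    ∃ e : Fin 5, n = j ^ (e : ℕ) ∨ n = -j ^ (e : ℕ) := by
  decide

theorem sum_zmod_eleven {M : Type*} [AddCommMonoid M] (F : ZMod 11 → M) :
    ∑ n, F n = F 0 + F 1 + F 2 + F 3 + F 4 + F 5 + F 6 + F 7 + F 8 + F 9 + F 10 := by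
  refine (Fin.sum_univ_castSucc (n := 10) F).trans ?_
  rw [Fin.sum_univ_castSucc, Fin.sum_univ_castSucc, Fin.sum_univ_eight]
  rfl

theorem circulant_false (F : ZMod 11 → ℕ) (h0 : F 0 = 24) (hsum : ∑ n, F n = 48)
    (hneg : ∀ n, F (-n) = F n) (hmul : ∀ j, j ≠ 0 → F j ≠ 0 → ∀ m, F (j * m) = F m)
    (hquad : ∑ n, ((F n : ℤ) - 2) * (F n - 3) ≤ 22 * 21 + 216) : False := by
  by_cases h : ∃ j, j ≠ 0 ∧ j ≠ 1 ∧ j ≠ -1 ∧ F j ≠ 0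
  · obtain ⟨j, hj0, hj1, hj2, hj⟩ := h
    have hpow : ∀ e : ℕ, F (j ^ e) = F 1 := by
      intro e
      induction e with
      | zero => rw [pow_zero]
      | succ e ih => rw [pow_succ', hmul j hj0 hj, ih]
    have hall : ∀ n, n ≠ 0 → F n = F 1 := by
      intro n hn
      obtain ⟨e, rfl | rfl⟩ := zmod_eleven_generate j hj0 hj1 hj2 n hn
      · exact hpow e
      · rw [hneg, hpow]
    rw [sum_zmod_eleven, h0, hall 2 (by decide), hall 3 (by decide), hall 4 (by decide),
      hall 5 (by decide), hall 6 (by decide), hall 7 (by decide), hall 8 (by decide),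
      hall 9 (by decide), hall 10 (by decide)] at hsum
    omega
  · push Not at h
    have h10 : F 10 = F 1 := hneg 1
    rw [sum_zmod_eleven, h0, h10, h 2 (by decide) (by decide) (by decide),
      h 3 (by decide) (by decide) (by decide), h 4 (by decide) (by decide) (by decide),
      h 5 (by decide) (by decide) (by decide), h 6 (by decide) (by decide) (by decide),
      h 7 (by decide) (by decide) (by decide), h 8 (by decide) (by decide) (by decide),
      h 9 (by decide) (by decide) (by decide)] at hsum
    have h1 : F 1 = 12 := by omega
    rw [sum_zmod_eleven, h0, h10, h 2 (by decide) (by decide) (by decide),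
      h 3 (by decide) (by decide) (by decide), h 4 (by decide) (by decide) (by decide),
      h 5 (by decide) (by decide) (by decide), h 6 (by decide) (by decide) (by decide),
      h 7 (by decide) (by decide) (by decide), h 8 (by decide) (by decide) (by decide),
      h 9 (by decide) (by decide) (by decide), h1] at hquad
    norm_num at hquad

end Circulant

namespace ImprimDesign

open Finset MulAction

variable {Γ P C β : Type*} [Group Γ] [Fintype P] [Fintype C] [Fintype β]
    [MulAction Γ P] [MulAction Γ C] [MulAction Γ β] {lam c d l s r b : ℕ}
    (D : ImprimDesign Γ P C β lam c d l s r b)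

/-- Kernel elements of prime order acting on polygons commute. -/
theorem commute_of_adj (D : ImprimDesign Γ P C β lam c d 2 s r b) {p : ℕ} (hp : p.Prime)
    (hp2 : p ≠ 2) (hpc : c ≤ p)
    (hB : ∀ B x, D.Meets B (D.cls x) →
      cnt (fun B' => Conn (classKernel Γ C) B B' ∧ D.I x B') = 2) {κ κ' : Γ}
    (hκp : κ ^ p = 1) (hκp' : κ' ^ p = 1) (hκ : κ ∈ classKernel Γ C) (hκ' : κ' ∈ classKernel Γ C)
    (hf : ∀ x : P, κ • x ≠ x) (hf' : ∀ x : P, κ' • x ≠ x) : κ * κ' = κ' * κ := by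
  have hN : ∀ k ∈ classKernel Γ C, k ^ p = 1 → (∀ x : P, k • x ≠ x) → ∀ x y : P,
      D.cls y = D.cls x → ∃ i : ℤ, k ^ i • x = y := by
    intro k hk hkp hf x y hxy
    exact exists_zpow_smul_eq hp hkp (q := fun y => D.cls y = D.cls x)
      (fun y => by rw [D.cls_kernel hk]) ((D.card_cls _).trans_le hpc) rfl (hf x) hxy
  have hpt : ∀ x : P, κ • κ' • x = κ' • κ • x := by
    intro x
    obtain ⟨B, hxB⟩ := D.exists_block x
    obtain ⟨y, hyB, hyx, hne⟩ := D.exists_ne_of_meets hxB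
    have hA := D.adj_of_I hxB hyB hyx hne
    have hle : ∀ z, D.cls z = D.cls x → cnt (D.Adj B z) ≤ 2 := fun z hz =>
      D.cnt_adj_le (hB B z ⟨x, hxB, hz.symm⟩)
    have key : ∀ k ∈ classKernel Γ C, k ^ p = 1 → (∀ x : P, k • x ≠ x) → ∃ g ∈ classKernel Γ C,
        (∃ u : ℕ, g ^ u = k) ∧ g • x = y ∧ ∀ z, D.cls z = D.cls x →
          D.Adj B z (g • z) ∧ D.Adj B z (g⁻¹ • z) ∧ g • z ≠ g⁻¹ • z := by
      intro k hk hkp hf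
      obtain ⟨i, rfl⟩ := hN k hk hkp hf x y hyx
      have hpi : ¬ (p : ℤ) ∣ i := by
        rintro ⟨j, rfl⟩
        exact hne (by rw [zpow_mul, zpow_natCast, hkp, one_zpow, one_smul])
      refine ⟨k ^ i, zpow_mem hk i, exists_pow_zpow_eq hp hkp hpi, rfl, fun z hz => ?_⟩
      obtain ⟨j, rfl⟩ := hN k hk hkp hf x z hz
      have e : ∀ i j : ℤ, k ^ i • k ^ j • x = k ^ j • k ^ i • x := fun i j => by
        rw [smul_smul, smul_smul, ← _root_.zpow_add, ← _root_.zpow_add, add_comm]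
      refine ⟨?_, ?_, fun h => ?_⟩
      · rw [e]
        exact hA.zpow D hk j
      · rw [← _root_.zpow_neg, e]
        exact (hA.zpow_neg D hk).zpow D hk j
      · rw [eq_inv_smul_iff, smul_smul, ← _root_.zpow_add] at h
        refine zpow_smul_ne hp hkp (hf (k ^ j • x)) (fun h2 => hpi ?_) h
        rw [← two_mul] at h2
        refine (Int.Prime.dvd_mul' hp h2).resolve_left fun h3 => hp2 ?_
        exact (Nat.prime_dvd_prime_iff_eq hp Nat.prime_two).1 (by exact_mod_cast h3)
    obtain ⟨g, hg, ⟨u, rfl⟩, hgx, hgA⟩ := key κ hκ hκp hf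
    obtain ⟨g', hg', ⟨u', rfl⟩, hgx', hgA'⟩ := key κ' hκ' hκp' hf'
    have hstep : ∀ z, D.cls z = D.cls x → g • z = g' • z → g • g • z = g' • g • z := by
      intro z hz h
      have hw : D.cls (g • z) = D.cls x := by rw [D.cls_kernel hg, hz]
      obtain ⟨h1, h2, h3⟩ := hgA _ hw
      obtain ⟨h4, h5, h6⟩ := hgA' _ hw
      rcases eq_or_eq_of_cnt_le_two (hle _ hw) h1 h2 h4 with h7 | h7 | h7
      · exact (h3 h7).elim
      · exact h7
      · refine (h6 ?_).elim
        rw [← h7, inv_smul_smul, h, inv_smul_smul]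
    have hpow : ∀ n : ℕ, g • g ^ n • x = g' • g ^ n • x := by
      intro n
      induction n with
      | zero => rw [pow_zero, one_smul, hgx, hgx']
      | succ n ih =>
        rw [pow_succ', mul_smul]
        exact hstep _ (by rw [D.cls_kernel (pow_mem hg n)]) ih
    have hpow' : ∀ n m : ℕ, g' ^ m • g ^ n • x = g ^ (m + n) • x := by
      intro n m
      induction m with
      | zero => rw [pow_zero, one_smul, zero_add]
      | succ m ih => rw [pow_succ', mul_smul, ih, ← hpow, smul_smul, ← pow_succ', add_right_comm]
    have h1 := hpow' u u'
    have h2 := hpow' 0 u'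
    rw [pow_zero, one_smul, add_zero] at h2
    rw [h1, h2, smul_smul, ← pow_add, add_comm]
  have := D.faithful ((κ' * κ)⁻¹ * (κ * κ')) fun x => by
    rw [mul_smul, inv_smul_eq_iff, mul_smul, mul_smul]
    exact hpt x
  rw [inv_mul_eq_one] at this
  exact this.symm

end ImprimDesign

namespace ImprimDesign

open Finset MulAction

variable {Γ P C β : Type*} [Group Γ] [Fintype P] [Fintype C] [Fintype β]
    [MulAction Γ P] [MulAction Γ C] [MulAction Γ β] {lam c d l s r b : ℕ}

theorem no_kernel_11_21 (D : ImprimDesign Γ P C β 4 11 21 2 12 40 385) {κ₀ : Γ}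
    (hκ₀1 : κ₀ ≠ 1) (hκ₀p : κ₀ ^ 11 = 1) (hκ₀ : κ₀ ∈ classKernel Γ C) : False := by
  classical
  have hp : Nat.Prime 11 := by norm_num
  have : Fact (Nat.Prime 11) := ⟨hp⟩
  have hKt : ∀ x y : P, D.cls y = D.cls x → Conn (classKernel Γ C) x y := fun x y =>
    D.kernel_transitive (by decide) hκ₀1 hκ₀
  obtain ⟨m, t, ht, hm, hdvd, hcnt, hB⟩ := D.kernel_blocks hKt
  obtain ⟨rfl, rfl⟩ : m = 11 ∧ t = 2 := by
    replace hdvd : m ∣ 11 := hdvd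
    rcases (Nat.dvd_prime hp).1 hdvd with rfl | rfl <;> omega
  have hfix : ∀ k ∈ classKernel Γ C, k ^ 11 = 1 → ∀ x : P, k • x = x → k = 1 :=
    fun k hk hkp x hx => D.smul_eq_of_pow_fix hB (by norm_num) hp (by norm_num) (by norm_num)
      (by norm_num) hkp hk hx
  have hfixB : ∀ k ∈ classKernel Γ C, k ^ 11 = 1 → ∀ B : β, k • B = B → k = 1 := by
    intro k hk hkp B hkB
    obtain ⟨x, hx⟩ := D.exists_pt B
    refine hfix k hk hkp x (smul_eq_of_cnt_lt hp hkp
      (q := fun y => D.I y B ∧ D.cls y = D.cls x) (fun y => ?_) ?_ x ⟨hx, rfl⟩)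
    · rw [D.cls_kernel hk, D.I_smul_iff_of_eq hkB]
    · rw [D.card_inter_of_meets ⟨x, hx, rfl⟩]
      norm_num
  have horb : ∀ k ∈ classKernel Γ C, k ^ 11 = 1 → k ≠ 1 → ∀ B B' : β,
      Conn (classKernel Γ C) B B' → ∃ i : ℤ, k ^ i • B = B' := fun k hk hkp hk1 B B' h =>
    exists_zpow_smul_eq hp hkp (q := Conn (classKernel Γ C) B) (fun B' => conn_smul_right hk B B')
      (hcnt B).le ((conn_equivalence _).refl B) (fun h => hk1 (hfixB k hk hkp B h)) h
  obtain ⟨B⟩ := D.nonempty_β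
  obtain ⟨x₀, hx₀⟩ := D.exists_pt B
  have htwo : ∀ x, D.I x B → cnt (fun B' => Conn (classKernel Γ C) B B' ∧ D.I x B') = 2 :=
    fun x hx => hB B x ⟨x, hx, rfl⟩
  obtain ⟨B₁, ⟨hB₁, hx₀B₁⟩, hBB₁⟩ := exists_ne_of_one_lt_cnt
    (p := fun B' => Conn (classKernel Γ C) B B' ∧ D.I x₀ B') (by rw [htwo x₀ hx₀]; norm_num) B
  obtain ⟨i₀, rfl⟩ := horb κ₀ hκ₀ hκ₀p hκ₀1 B B₁ hB₁
  obtain ⟨κ, hκ, hκp, hκ1, hκB⟩ : ∃ κ ∈ classKernel Γ C, κ ^ 11 = 1 ∧ κ ≠ 1 ∧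
      κ₀ ^ i₀ • B = κ • B :=
    ⟨κ₀ ^ i₀, zpow_mem hκ₀ i₀, by rw [← zpow_natCast, zpow_comm, zpow_natCast, hκ₀p, one_zpow],
      fun h => hBB₁ (by rw [h, one_smul]), rfl⟩
  rw [hκB] at hB₁ hx₀B₁ hBB₁
  clear hκB
  have hnf : ∀ x : P, κ • x ≠ x := fun x hx => hκ1 (hfix κ hκ hκp x hx)
  have hord : orderOf κ = 11 := orderOf_eq_prime hκp hκ1
  have hval : ∀ i : ℤ, κ ^ ((i : ZMod 11).val : ℤ) = κ ^ i := by
    intro i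
    rw [zpow_eq_zpow_iff_modEq, hord, ZMod.val_intCast]
    exact Int.mod_modEq i 11
  have hnorm : ∀ y : Γ, y • B = B → ∃ i : ℤ, y * κ * y⁻¹ = κ ^ i := by
    intro y hy
    have h1 : y * κ * y⁻¹ ∈ classKernel Γ C := conj_mem_classKernel hκ
    have h2 : (y * κ * y⁻¹) ^ 11 = 1 := by rw [conj_pow, hκp, mul_one, mul_inv_cancel]
    have h3 : y * κ * y⁻¹ ≠ 1 := by simpa using hκ1
    obtain ⟨i, hi⟩ := horb κ hκ hκp hκ1 B ((y * κ * y⁻¹) • B) ⟨_, h1, rfl⟩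
    have hcomm : Commute κ (y * κ * y⁻¹) := D.commute_of_adj hp (by norm_num) le_rfl hB hκp h2 hκ
      h1 hnf (fun x hx => h3 (hfix _ h1 h2 x hx))
    refine ⟨i, ?_⟩
    have h4 := hfixB ((κ ^ i)⁻¹ * (y * κ * y⁻¹)) (mul_mem (inv_mem (zpow_mem hκ i)) h1) (by
      rw [((hcomm.zpow_left i).inv_left).mul_pow, h2, mul_one, inv_pow, ← zpow_natCast, zpow_comm,
        zpow_natCast, hκp, one_zpow, inv_one]) B (by rw [mul_smul, inv_smul_eq_iff, hi])
    exact (inv_mul_eq_one.1 h4).symm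
  have hvc : ∀ n : ZMod 11, (((n.val : ℕ) : ℤ) : ZMod 11) = n := fun n => by
    rw [Int.cast_natCast, ZMod.natCast_zmod_val]
  let F : ZMod 11 → ℕ := fun n => D.a B (κ ^ (n.val : ℤ) • B)
  have hF : ∀ i : ℤ, F i = D.a B (κ ^ i • B) := fun i => by
    simp only [F, hval]
  have hinj : Function.Injective fun n : ZMod 11 => κ ^ (n.val : ℤ) • B := by
    intro n n' h
    have h1 := hfixB (κ ^ (-(n'.val : ℤ) + n.val)) (zpow_mem hκ _)
      (by rw [← zpow_natCast, zpow_comm, zpow_natCast, hκp, one_zpow]) B (by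
        rw [_root_.zpow_add, mul_smul]
        simp only at h
        rw [h, smul_smul, ← _root_.zpow_add, neg_add_cancel, zpow_zero, one_smul])
    rw [← orderOf_dvd_iff_zpow_eq_one, hord] at h1
    have h2 : (((-(n'.val : ℤ) + n.val : ℤ)) : ZMod 11) = 0 :=
      (ZMod.intCast_zmod_eq_zero_iff_dvd _ 11).2 h1
    rw [Int.cast_add, Int.cast_neg, hvc, hvc] at h2
    linear_combination h2
  have himg : univ.image (fun n : ZMod 11 => κ ^ (n.val : ℤ) • B) =
      univ.filter (Conn (classKernel Γ C) B) := by
    ext B'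
    simp only [mem_image, mem_univ, true_and, mem_filter]
    constructor
    · rintro ⟨n, rfl⟩
      exact ⟨_, zpow_mem hκ _, rfl⟩
    · intro h
      obtain ⟨i, rfl⟩ := horb κ hκ hκp hκ1 B B' h
      exact ⟨i, by rw [hval]⟩
  have hF0 : F 0 = 24 := by
    have := hF 0
    rw [Int.cast_zero, zpow_zero, one_smul, D.a_self] at this
    exact this
  refine circulant_false F hF0 ?_ ?_ ?_ ?_
  · have h1 : ∑ n, F n = ∑ B' ∈ univ.filter (Conn (classKernel Γ C) B), D.a B B' := by
      rw [← himg, sum_image (fun _ _ _ _ h => hinj h)]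
    have h2 := sum_cnt_comm (fun x B' => (Conn (classKernel Γ C) B B' ∧ D.I x B') ∧ D.I x B)
    rw [h1, sum_filter]
    have h3 : ∀ x, cnt (fun B' => (Conn (classKernel Γ C) B B' ∧ D.I x B') ∧ D.I x B) =
        (if D.I x B then 1 else 0) * 2 := by
      intro x
      split_ifs with h
      · rw [one_mul]
        exact (cnt_congr fun B' => by simp [h]).trans (htwo x h)
      · rw [zero_mul]
        exact cnt_eq_zero.2 fun B' hB' => h hB'.2
    rw [sum_congr rfl fun x _ => h3 x, ← sum_mul, ← cnt_eq_sum, D.card_block] at h2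
    refine Eq.trans (sum_congr rfl fun B' _ => ?_) h2.symm
    split_ifs with h
    · exact cnt_congr fun x => by tauto
    · exact (cnt_eq_zero.2 fun x hx => h hx.1.1).symm
  · intro n
    have h1 := hF (-(n.val : ℤ))
    rw [Int.cast_neg, hvc] at h1
    rw [h1, ← D.a_smul (κ ^ (n.val : ℤ)), smul_smul, ← _root_.zpow_add, add_neg_cancel, zpow_zero,
      one_smul, D.a_comm]
  · intro j hj hFj m
    obtain ⟨x, hx, hxj⟩ := cnt_pos.1 (Nat.pos_of_ne_zero hFj)
    obtain ⟨y, hyx, hyB⟩ := D.flag x₀ B x B hx₀ hx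
    obtain ⟨i, hi⟩ := hnorm y hyB
    have hyi : ∀ n : ℤ, y • κ ^ n • B = κ ^ (i * n) • B := by
      intro n
      rw [zpow_mul, ← hi, conj_zpow, mul_smul, mul_smul, inv_smul_eq_iff.2 hyB.symm]
    have hij : (i : ZMod 11) = j := by
      apply hinj
      simp only [hval]
      have h1 := hyi 1
      rw [mul_one, zpow_one] at h1
      rw [← h1]
      have hne : y • κ • B ≠ B := by
        intro h
        nth_rewrite 2 [← hyB] at h
        exact hBB₁ (smul_left_cancel y h)
      have hne' : κ ^ (j.val : ℤ) • B ≠ B := by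
        intro h
        refine hj (hinj ?_)
        simp only [ZMod.val_zero, Nat.cast_zero, zpow_zero, one_smul]
        exact h
      rcases eq_or_eq_of_cnt_le_two (htwo x hx).le (x := y • κ • B) (y := κ ^ (j.val : ℤ) • B)
        (z := B) ⟨by rw [h1]; exact ⟨_, zpow_mem hκ _, rfl⟩, by rw [← hyx, D.I_smul]; exact hx₀B₁⟩
        ⟨⟨_, zpow_mem hκ _, rfl⟩, hxj⟩ ⟨(conn_equivalence _).refl B, hx⟩ with
        h | h | h
      · exact h
      · exact (hne h).elim
      · exact (hne' h).elim
    have h1 := hF (i * m.val)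
    rw [Int.cast_mul, hvc, hij] at h1
    rw [h1, ← hyi]
    nth_rewrite 1 [← hyB]
    exact D.a_smul y B _
  · have h1 : ∑ B' ∈ univ.erase B, ((D.a B B' : ℤ) - 2) * (D.a B B' - 3) = 216 :=
      (D.sum_ne_quadratic B 2).trans (by norm_num)
    have h2 : ∑ n, ((F n : ℤ) - 2) * (F n - 3) =
        ∑ B' ∈ univ.filter (Conn (classKernel Γ C) B), ((D.a B B' : ℤ) - 2) * (D.a B B' - 3) := by
      rw [← himg, sum_image (fun _ _ _ _ h => hinj h)]
    have h3 := add_sum_erase univ (fun B' => ((D.a B B' : ℤ) - 2) * (D.a B B' - 3)) (mem_univ B)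
    rw [h2]
    refine (sum_le_sum_of_subset_of_nonneg (filter_subset _ univ) fun B' _ _ =>
      consecutive_nonneg _ 2).trans ?_
    rw [h1] at h3
    simp only [D.a_self] at h3
    exact h3.symm.trans_le (by norm_num)

end ImprimDesign

namespace ImprimDesign

open Finset MulAction

variable {Γ P C β : Type*} [Group Γ] [Fintype P] [Fintype C] [Fintype β]
    [MulAction Γ P] [MulAction Γ C] [MulAction Γ β]

theorem no_2_10_10 (D : ImprimDesign Γ P C β 2 10 10 2 6 18 150) : False := by
  obtain ⟨κ, hκ1, hκp, hκ⟩ := D.exists_kernel_pow (p := 5) (by norm_num) (by norm_num)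
    (by norm_num) (by norm_num) (by decide +kernel) (by decide +kernel)
  exact D.no_kernel_two (by norm_num) (by norm_num) (by norm_num) (by norm_num) hκ1 hκp
    (mem_classKernel.2 hκ) (by norm_num) (by norm_num) (by decide +kernel) (by decide +kernel)

theorem no_2_22_22 (D : ImprimDesign Γ P C β 2 22 22 2 12 42 847) : False := by
  obtain ⟨κ, hκ1, hκp, hκ⟩ := D.exists_kernel_pow (p := 11) (by norm_num) (by norm_num)
    (by norm_num) (by norm_num) (by decide +kernel) (by decide +kernel)
  exact D.no_kernel_two (by norm_num) (by norm_num) (by norm_num) (by norm_num) hκ1 hκp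
    (mem_classKernel.2 hκ) (by norm_num) (by norm_num) (by decide +kernel) (by decide +kernel)

theorem no_3_34_34 (D : ImprimDesign Γ P C β 3 34 34 2 18 99 3179) : False := by
  obtain ⟨κ, hκ1, hκp, hκ⟩ := D.exists_kernel_pow (p := 17) (by norm_num) (by norm_num)
    (by norm_num) (by norm_num) (by decide +kernel) (by decide +kernel)
  exact D.no_kernel_two (by norm_num) (by norm_num) (by norm_num) (by norm_num) hκ1 hκp
    (mem_classKernel.2 hκ) (by norm_num) (by norm_num) (by decide +kernel) fun t _ ht h => by
      replace h : 34 * t / 2 ∣ 17 := h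
      have := Nat.le_of_dvd (by norm_num) h
      obtain rfl : t = 1 := by omega
      norm_num

theorem no_4_10_10 (D : ImprimDesign Γ P C β 4 10 10 2 6 36 300) : False := by
  obtain ⟨κ, hκ1, hκp, hκ⟩ := D.exists_kernel_pow (p := 5) (by norm_num) (by norm_num)
    (by norm_num) (by norm_num) (by decide +kernel) (by decide +kernel)
  exact D.no_kernel_two (by norm_num) (by norm_num) (by norm_num) (by norm_num) hκ1 hκp
    (mem_classKernel.2 hκ) (by norm_num) (by norm_num) (by decide +kernel) (by decide +kernel)

theorem no_4_14_14 (D : ImprimDesign Γ P C β 4 14 14 2 8 52 637) : False := by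
  obtain ⟨κ, hκ1, hκp, hκ⟩ := D.exists_kernel_pow (p := 7) (by norm_num) (by norm_num)
    (by norm_num) (by norm_num) (by decide +kernel) (by decide +kernel)
  exact D.no_kernel_two (by norm_num) (by norm_num) (by norm_num) (by norm_num) hκ1 hκp
    (mem_classKernel.2 hκ) (by norm_num) (by norm_num) (by decide +kernel) (by decide +kernel)

theorem no_4_22_22 (D : ImprimDesign Γ P C β 4 22 22 2 12 84 1694) : False := by
  obtain ⟨κ, hκ1, hκp, hκ⟩ := D.exists_kernel_pow (p := 11) (by norm_num) (by norm_num)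
    (by norm_num) (by norm_num) (by decide +kernel) (by decide +kernel)
  exact D.no_kernel_two (by norm_num) (by norm_num) (by norm_num) (by norm_num) hκ1 hκp
    (mem_classKernel.2 hκ) (by norm_num) (by norm_num) (by decide +kernel) (by decide +kernel)

theorem no_4_46_46 (D : ImprimDesign Γ P C β 4 46 46 2 24 180 7935) : False := by
  obtain ⟨κ, hκ1, hκp, hκ⟩ := D.exists_kernel_pow (p := 23) (by norm_num) (by norm_num)
    (by norm_num) (by norm_num) (by decide +kernel) (by decide +kernel)
  exact D.no_kernel_two (by norm_num) (by norm_num) (by norm_num) (by norm_num) hκ1 hκp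
    (mem_classKernel.2 hκ) (by norm_num) (by norm_num) (by decide +kernel) fun t _ ht h => by
      replace h : 46 * t / 2 ∣ 23 := h
      have := Nat.le_of_dvd (by norm_num) h
      obtain rfl : t = 1 := by omega
      norm_num

theorem no_3_10_10 (D : ImprimDesign Γ P C β 3 10 10 2 6 27 225) : False := by
  obtain ⟨κ, hκ1, hκp, hκ⟩ := D.exists_kernel_pow (p := 5) (by norm_num) (by norm_num)
    (by norm_num) (by norm_num) (by decide +kernel) (by decide +kernel)
  exact D.no_kernel_10_10 hκ1 hκp (mem_classKernel.2 hκ)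

theorem no_4_76_26 (D : ImprimDesign Γ P C β 4 76 26 4 20 100 2470) : False := by
  obtain ⟨κ, hκ1, hκp, hκ⟩ := D.exists_kernel_pow (p := 19) (by norm_num) (by norm_num)
    (by norm_num) (by norm_num) (by decide +kernel) (by decide +kernel)
  exact D.no_kernel_76_26 hκ1 hκp (mem_classKernel.2 hκ)

theorem no_4_11_21 (D : ImprimDesign Γ P C β 4 11 21 2 12 40 385) : False := by
  obtain ⟨κ, hκ1, hκp, hκ⟩ := D.exists_kernel_pow (p := 11) (by norm_num) (by norm_num)
    (by norm_num) (by norm_num) (by decide +kernel) (by decide +kernel)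
  exact D.no_kernel_11_21 hκ1 hκp (mem_classKernel.2 hκ)

theorem no_3_33_17 (D : ImprimDesign Γ P C β 3 33 17 3 12 48 748) : False := by
  obtain ⟨κ, hκ1, hκp, hκ⟩ := D.exists_kernel_pow (p := 11) (by norm_num) (by norm_num)
    (by norm_num) (by norm_num) (by decide +kernel) (by decide +kernel)
  obtain ⟨m, t, ht, hm, hdvd, -, hB⟩ := D.kernel_blocks fun x y =>
    D.kernel_transitive (by decide +kernel) hκ1 (mem_classKernel.2 hκ)
  replace hdvd : m ∣ 11 := hdvd
  obtain rfl : t = 1 := by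
    rcases (Nat.dvd_prime (by norm_num)).1 hdvd with rfl | rfl <;> omega
  exact D.not_unique (by norm_num) (p := 11) (by norm_num) (by norm_num) (by norm_num) hκ1 hκp
    (mem_classKernel.2 hκ) (by norm_num) (by norm_num) hB

theorem no_4_21_11 (D : ImprimDesign Γ P C β 4 21 11 3 8 40 385) : False := by
  obtain ⟨κ, hκ1, hκp, hκ⟩ := D.exists_kernel_pow (p := 7) (by norm_num) (by norm_num)
    (by norm_num) (by norm_num) (by decide +kernel) (by decide +kernel)
  obtain ⟨m, t, ht, hm, hdvd, -, hB⟩ := D.kernel_blocks fun x y =>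
    D.kernel_transitive (by decide +kernel) hκ1 (mem_classKernel.2 hκ)
  replace hdvd : m ∣ 7 := hdvd
  obtain rfl : t = 1 := by
    rcases (Nat.dvd_prime (by norm_num)).1 hdvd with rfl | rfl <;> omega
  exact D.not_unique (by norm_num) (p := 7) (by norm_num) (by norm_num) (by norm_num) hκ1 hκp
    (mem_classKernel.2 hκ) (by norm_num) (by norm_num) hB

end ImprimDesign

section SylowSubgroups

open MulAction
open scoped Pointwise

variable {Γ X : Type*} [Group Γ] [MulAction Γ X]

/-- `Q` is a Sylow `p`-subgroup of the subgroup `S`. -/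
structure SylowIn (p : ℕ) (Q S : Subgroup Γ) : Prop where
  le : Q ≤ S
  isPGroup : IsPGroup p Q
  not_dvd : ¬ p ∣ Q.relIndex S

theorem SylowIn.mono {p : ℕ} {Q S S' : Subgroup Γ} (h : SylowIn p Q S) (h1 : Q ≤ S')
    (h2 : S' ≤ S) : SylowIn p Q S' :=
  ⟨h1, h.isPGroup, fun h3 => h.not_dvd (h3.trans (Dvd.intro _ (Subgroup.relIndex_mul_relIndex _ _ _ h1 h2)))⟩

theorem exists_sylowIn [Finite Γ] {p : ℕ} (hp : p.Prime) {R S : Subgroup Γ} (hR : IsPGroup p R)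
    (hRS : R ≤ S) : ∃ Q, SylowIn p Q S ∧ R ≤ Q := by
  have : Fact p.Prime := ⟨hp⟩
  have h1 : IsPGroup p (R.subgroupOf S) := hR.comap_subtype
  obtain ⟨Q, hQ⟩ := h1.exists_le_sylow
  refine ⟨(Q : Subgroup S).map S.subtype, ⟨Subgroup.map_subtype_le _, Q.isPGroup'.map _, ?_⟩, ?_⟩
  · rw [Subgroup.relIndex, Subgroup.subgroupOf, Subgroup.comap_map_eq_self_of_injective S.subtype_injective]
    exact Q.not_dvd_index
  · intro x hx
    exact ⟨⟨x, hRS hx⟩, hQ (Subgroup.mem_subgroupOf.2 hx), rfl⟩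

theorem SylowIn.exists_conj [Finite Γ] {p : ℕ} (hp : p.Prime) {Q Q' S : Subgroup Γ}
    (h : SylowIn p Q S) (h' : SylowIn p Q' S) : ∃ t ∈ S, ∀ g, g ∈ Q ↔ t * g * t⁻¹ ∈ Q' := by
  have : Fact p.Prime := ⟨hp⟩
  have h1 : IsPGroup p (Q.subgroupOf S) := h.isPGroup.comap_subtype
  have h1' : IsPGroup p (Q'.subgroupOf S) := h'.isPGroup.comap_subtype
  obtain ⟨t, ht⟩ := exists_smul_eq S (h1.toSylow h.not_dvd) (h1'.toSylow h'.not_dvd)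
  have h2 : ∀ g : S, g ∈ Q.subgroupOf S ↔ t * g * t⁻¹ ∈ Q'.subgroupOf S := by
    intro g
    have h3 : (t * g * t⁻¹ ∈ MulAut.conj t • Q.subgroupOf S) = (t * g * t⁻¹ ∈ Q'.subgroupOf S) :=
      congrArg (fun R : Sylow p S => t * g * t⁻¹ ∈ (R : Subgroup S)) ht
    rw [← h3, show t * g * t⁻¹ = MulAut.conj t • g from rfl, Subgroup.smul_mem_pointwise_smul_iff]
  refine ⟨t, t.2, fun g => ⟨fun hg => ?_, fun hg => ?_⟩⟩
  · simpa [Subgroup.mem_subgroupOf] using (h2 ⟨g, h.le hg⟩).1 (Subgroup.mem_subgroupOf.2 hg)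
  · have hgS : g ∈ S := by
      have := mul_mem (mul_mem (inv_mem t.2) (h'.le hg)) t.2
      simpa [mul_assoc] using this
    simpa [Subgroup.mem_subgroupOf] using (h2 ⟨g, hgS⟩).2 (by
      simpa [Subgroup.mem_subgroupOf] using hg)

/-- The image of a subgroup under conjugation. -/
def conjSubgroup (t : Γ) (Q : Subgroup Γ) : Subgroup Γ := Q.comap (MulAut.conj t⁻¹).toMonoidHom

theorem mem_conjSubgroup {t g : Γ} {Q : Subgroup Γ} : g ∈ conjSubgroup t Q ↔ t⁻¹ * g * t ∈ Q := by
  simp [conjSubgroup]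

theorem SylowIn.conj {p : ℕ} {Q S : Subgroup Γ} (h : SylowIn p Q S) (t : Γ) :
    SylowIn p (conjSubgroup t Q) (conjSubgroup t S) := by
  refine ⟨fun g hg => mem_conjSubgroup.2 (h.le (mem_conjSubgroup.1 hg)),
    h.isPGroup.comap_of_injective _ (MulEquiv.injective _), ?_⟩
  rw [conjSubgroup, conjSubgroup, Subgroup.relIndex_comap, Subgroup.map_comap_eq_self_of_surjective (MulEquiv.surjective _)]
  exact h.not_dvd

/-- The normalizer of a Sylow subgroup of a point stabilizer is transitive on its fixed points. -/
theorem SylowIn.exists_normalizer [Finite Γ] {p : ℕ} (hp : p.Prime) {Q H : Subgroup Γ} {x : X}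
    {h : Γ} (hQ : SylowIn p Q (H ⊓ stabilizer Γ x)) (hh : h ∈ H) (hx : ∀ g ∈ Q, g • h • x = h • x) :
    ∃ n ∈ H, n • x = h • x ∧ ∀ g, g ∈ Q ↔ n * g * n⁻¹ ∈ Q := by
  have hle : conjSubgroup h⁻¹ Q ≤ H ⊓ stabilizer Γ x := by
    intro g hg
    rw [mem_conjSubgroup, inv_inv] at hg
    refine ⟨?_, ?_⟩
    · have := mul_mem (mul_mem (inv_mem hh) (hQ.le hg).1) hh
      simpa [mul_assoc] using this
    · have := hx _ hg
      rw [mul_smul, mul_smul, inv_smul_smul] at this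
      exact smul_left_cancel h this
  have hS : SylowIn p (conjSubgroup h⁻¹ Q) (H ⊓ stabilizer Γ x) := by
    refine ⟨hle, (hQ.conj h⁻¹).isPGroup, ?_⟩
    have : Nat.card (conjSubgroup h⁻¹ Q) = Nat.card Q :=
      Nat.card_congr (((MulAut.conj h⁻¹⁻¹).toEquiv.subtypeEquiv fun g => Iff.rfl))
    intro hdvd
    have h1 := Subgroup.card_mul_index ((conjSubgroup h⁻¹ Q).subgroupOf (H ⊓ stabilizer Γ x))
    have h2 := Subgroup.card_mul_index (Q.subgroupOf (H ⊓ stabilizer Γ x))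
    rw [Nat.card_congr (Subgroup.subgroupOfEquivOfLe hle).toEquiv, this] at h1
    rw [Nat.card_congr (Subgroup.subgroupOfEquivOfLe hQ.le).toEquiv, ← h1] at h2
    refine hQ.not_dvd ?_
    rw [Subgroup.relIndex, Nat.eq_of_mul_eq_mul_left Nat.card_pos h2]
    exact hdvd
  obtain ⟨t, ht, hconj⟩ := hQ.exists_conj hp hS
  refine ⟨h * t, mul_mem hh ht.1, by rw [mul_smul, ht.2], fun g => ?_⟩
  rw [hconj, mem_conjSubgroup]
  simp [mul_assoc]

variable [Fintype X]

theorem cnt_conn_mul_card [Finite Γ] (H : Subgroup Γ) (x : X) :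
    cnt (Conn H x) * Nat.card (H ⊓ stabilizer Γ x : Subgroup Γ) = Nat.card H := by
  have h : cnt (Conn H x) = (stabilizer H x).index := by
    rw [index_stabilizer, cnt_eq_natCard]
    refine Nat.card_congr (Equiv.setCongr (s := {y | Conn H x y}) ?_)
    ext y
    exact ⟨fun ⟨h, hh, e⟩ => ⟨⟨h, hh⟩, e⟩, fun ⟨h, e⟩ => ⟨h.1, h.2, e⟩⟩
  rw [h, mul_comm, ← Subgroup.card_mul_index (stabilizer H x)]
  congr 1
  exact Nat.card_congr ⟨fun g => ⟨⟨g.1, g.2.1⟩, g.2.2⟩, fun g => ⟨g.1.1, g.1.2, g.2⟩, fun _ => rfl,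
    fun _ => rfl⟩

theorem SylowIn.pow_dvd [Finite Γ] {p k : ℕ} (hp : p.Prime) {Q S : Subgroup Γ} (hQ : SylowIn p Q S)
    {x : X} (h : p ^ k ∣ cnt (Conn S x)) : p ^ k ∣ cnt (Conn Q x) := by
  have h1 := cnt_conn_mul_card S x
  have h2 := cnt_conn_mul_card Q x
  obtain ⟨i, hi⟩ := Subgroup.card_dvd_of_le (inf_le_inf_right (stabilizer Γ x) hQ.le)
  have h3 : Nat.card Q * Q.relIndex S = Nat.card S := by
    rw [Subgroup.relIndex, ← Subgroup.card_mul_index (Q.subgroupOf S),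
      Nat.card_congr (Subgroup.subgroupOfEquivOfLe hQ.le).toEquiv]
  have h4 : cnt (Conn S x) * i = cnt (Conn Q x) * Q.relIndex S := by
    refine Nat.eq_of_mul_eq_mul_left (Nat.card_pos (α := (Q ⊓ stabilizer Γ x : Subgroup Γ))) ?_
    rw [hi] at h1
    calc _ = cnt (Conn S x) * (Nat.card (Q ⊓ stabilizer Γ x : Subgroup Γ) * i) := by ring
      _ = (cnt (Conn Q x) * Nat.card (Q ⊓ stabilizer Γ x : Subgroup Γ)) * Q.relIndex S := by
        rw [h1, ← h3, h2]
      _ = _ := by ring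
  exact (Nat.Coprime.pow_left k ((Nat.Prime.coprime_iff_not_dvd hp).2 hQ.not_dvd)).dvd_of_dvd_mul_right
    (h4 ▸ h.mul_right i)

theorem SylowIn.exists_ne [Finite Γ] {p : ℕ} (hp : p.Prime) {Q S : Subgroup Γ} (hQ : SylowIn p Q S)
    {x : X} (h : p ∣ cnt (Conn S x)) : ∃ g ∈ Q, g • x ≠ x := by
  by_contra! hx
  have h1 := hQ.pow_dvd hp (k := 1) (x := x) (by rwa [pow_one])
  rw [pow_one, cnt_eq_one_of x ((conn_equivalence Q).refl x) (by rintro _ ⟨g, hg, rfl⟩; exact hx g hg)] at h1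
  exact hp.one_lt.ne' (Nat.dvd_one.1 h1)

end SylowSubgroups

section Actions

open Finset MulAction

variable {Γ X : Type*} [Group Γ] [MulAction Γ X] [Fintype X]

theorem smul_eq_of_isPGroup {p : ℕ} (hp : p.Prime) {H : Subgroup Γ} (hH : IsPGroup p H)
    {q : X → Prop} (hq : ∀ h ∈ H, ∀ x, q x → q (h • x)) (hlt : cnt q < p) {h : Γ} (hh : h ∈ H)
    {x : X} (hx : q x) : h • x = x := by
  have := Fact.mk hp
  have h1 := cnt_modEq_cnt_fixed hH hq
  have h2 : cnt (fun x => q x ∧ ∀ h ∈ H, h • x = x) ≤ cnt q := cnt_mono fun x h => h.1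
  have h3 := Nat.ModEq.eq_of_lt_of_lt h1 hlt (h2.trans_lt hlt)
  exact (eq_of_cnt_le (fun x h => h.1) h3.le x hx).2 h hh

theorem exists_fixed_of_pow {p : ℕ} (hp : p.Prime) {g : Γ} (hg : g ^ p = 1)
    {q : X → Prop} (hq : ∀ x, q (g • x) ↔ q x) (h : ¬ p ∣ cnt q) : ∃ x, q x ∧ g • x = x := by
  by_contra! hne
  have h1 := cnt_modEq_cnt_fixed_of_pow hp hg hq
  rw [(cnt_eq_zero (p := fun x => q x ∧ g • x = x)).2 fun x h => hne x h.1 h.2] at h1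
  exact h ((Nat.modEq_zero_iff_dvd).1 h1)

theorem exists_fixed_of_isPGroup {p : ℕ} (hp : p.Prime) {H : Subgroup Γ} (hH : IsPGroup p H)
    {q : X → Prop} (hq : ∀ h ∈ H, ∀ x, q x → q (h • x)) (h : ¬ p ∣ cnt q) :
    ∃ x, q x ∧ ∀ h ∈ H, h • x = x := by
  have := Fact.mk hp
  by_contra! hne
  have h1 := cnt_modEq_cnt_fixed hH hq
  rw [(cnt_eq_zero (p := fun x => q x ∧ ∀ h ∈ H, h • x = x)).2 fun x h => (hne x h.1).elim fun g hg => hg.2 (h.2 g hg.1)] at h1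
  exact h ((Nat.modEq_zero_iff_dvd).1 h1)

theorem dvd_cnt_of_dvd_equivalence {E : X → X → Prop} (hE : Equivalence E)
    {p : X → Prop} {m : ℕ} (hp : ∀ x y, E x y → p x → p y) (hm : ∀ x, p x → m ∣ cnt (E x)) :
    m ∣ cnt p := by
  classical
  let S : Setoid X := ⟨E, hE⟩
  rw [cnt, card_eq_sum_card_fiberwise (f := Quotient.mk S) (t := univ) (fun x _ => by simp)]
  refine dvd_sum fun q _ => ?_
  obtain ⟨x, rfl⟩ := Quotient.exists_rep q
  by_cases hx : p x
  · refine (hm x hx).trans (dvd_of_eq ?_)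
    unfold cnt
    congr 1
    ext y
    simp only [mem_filter, mem_univ, true_and]
    symm
    exact ⟨fun h => Quotient.exact h.2.symm, fun h => ⟨hp x y h hx, Quotient.sound (hE.symm h)⟩⟩
  · convert dvd_zero m
    rw [card_eq_zero, filter_eq_empty_iff]
    intro y hy h
    exact hx (hp y x (Quotient.exact h) (mem_filter.1 hy).2)

theorem conn_smul_of_mem_normalizer {H : Subgroup Γ} {n : Γ} (hn : n ∈ Subgroup.normalizer (H : Set Γ))
    (x y : X) : Conn H (n • x) (n • y) ↔ Conn H x y :=
  conn_smul (fun h hh => (Subgroup.mem_normalizer_iff.1 hn h).1 hh)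
    (fun h hh => (Subgroup.mem_normalizer_iff''.1 hn h).1 hh) x y

/-- An element of prime order `q` normalizing a `p`-group and fixing a point of an orbit of
length `p` fixes the orbit pointwise, unless `q` divides `p - 1`. -/
theorem smul_eq_of_normalizes {p q : ℕ} (hp : p.Prime) (hq : q.Prime) (hqp : ¬ q ∣ p - 1)
    {Q : Subgroup Γ} (hQ : IsPGroup p Q) {n : Γ} (hn : n ∈ Subgroup.normalizer (Q : Set Γ))
    (hnq : n ^ q = 1) {x : X} (hx : n • x = x) (hcard : cnt (Conn Q x) = p) {z : X}
    (hz : Conn Q x z) : n • z = z := by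
  have hnc : ∀ z, Conn Q x (n • z) ↔ Conn Q x z := fun z => by
    have := conn_smul_of_mem_normalizer hn x z
    rwa [hx] at this
  have h1 := cnt_ne_add_one (p := Conn Q x) ((conn_equivalence Q).refl x)
  obtain ⟨_, ⟨⟨g, hg, rfl⟩, hne⟩, hy⟩ := exists_fixed_of_pow hq hnq
    (q := fun z => Conn Q x z ∧ z ≠ x) (fun z => by
      rw [hnc, ← hx, (MulAction.injective n).ne_iff, hx]) (by
      rwa [show cnt (fun z => Conn Q x z ∧ z ≠ x) = p - 1 by omega])
  have hw : g⁻¹ * (n * g * n⁻¹) ∈ Q := mul_mem (inv_mem hg) ((Subgroup.mem_normalizer_iff.1 hn g).1 hg)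
  have hwx : (g⁻¹ * (n * g * n⁻¹)) • x = x := by
    rw [mul_smul, mul_smul, mul_smul, show n⁻¹ • x = x by rw [inv_smul_eq_iff, hx], hy, inv_smul_smul]
  have hwz : ∀ z, Conn Q x z → (g⁻¹ * (n * g * n⁻¹)) • z = z := by
    intro z hz
    by_cases hzx : z = x
    · rw [hzx, hwx]
    have hle : Subgroup.zpowers (g⁻¹ * (n * g * n⁻¹)) ≤ Q := by rwa [Subgroup.zpowers_le]
    refine smul_eq_of_isPGroup hp (hQ.to_le hle) (q := fun z => Conn Q x z ∧ z ≠ x) ?_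
      (by omega) (Subgroup.mem_zpowers _) ⟨hz, hzx⟩
    rintro _ ⟨i, rfl⟩ y ⟨hy, hyx⟩
    refine ⟨(conn_smul_right (hle ⟨i, rfl⟩) x y).2 hy, fun h => hyx ?_⟩
    exact smul_left_cancel _ (h.trans (zpow_smul_eq hwx i).symm)
  have hcomm : ∀ z, Conn Q x z → n • g • z = g • n • z := by
    intro z hz
    have := hwz (n • z) ((hnc z).2 hz)
    rwa [mul_smul, inv_smul_eq_iff, mul_smul, mul_smul, inv_smul_smul] at this
  have hinv : ∀ z, (Conn Q x (g • z) ∧ n • g • z = g • z) ↔ (Conn Q x z ∧ n • z = z) := by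
    intro z
    rw [conn_smul_right hg]
    refine and_congr_right fun hz => ?_
    rw [hcomm z hz, smul_left_cancel_iff]
  have hle : Subgroup.zpowers g ≤ Q := by rwa [Subgroup.zpowers_le]
  have hge : p ≤ cnt (fun z => Conn Q x z ∧ n • z = z) := by
    by_contra! hlt
    refine hne (smul_eq_of_isPGroup hp (hQ.to_le hle) (q := fun z => Conn Q x z ∧ n • z = z) ?_
      hlt (Subgroup.mem_zpowers g) ⟨(conn_equivalence Q).refl x, hx⟩)
    rintro _ ⟨i, rfl⟩ y hy
    exact (zpow_smul_mem (q := fun z => Conn Q x z ∧ n • z = z) hinv i y).2 hy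
  exact (eq_of_cnt_le (p := fun z => Conn Q x z ∧ n • z = z) (fun _ h => h.1) (hcard.trans_le hge) z hz).2

/-- The fixed points of a Sylow subgroup of a point stabilizer in an orbit. -/
theorem SylowIn.cnt_fixed [Finite Γ] {p : ℕ} (hp : p.Prime) {Q H : Subgroup Γ} {x : X}
    (hQ : SylowIn p Q (H ⊓ stabilizer Γ x)) :
    cnt (fun y => Conn H x y ∧ ∀ g ∈ Q, g • y = y) =
      cnt (Conn (Subgroup.normalizer (Q : Set Γ) ⊓ H) x) := by
  refine cnt_congr fun y => ⟨?_, ?_⟩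
  · rintro ⟨⟨h, hh, rfl⟩, hy⟩
    obtain ⟨n, hn, hx, hnQ⟩ := hQ.exists_normalizer hp hh hy
    exact ⟨n, ⟨Subgroup.mem_normalizer_iff.2 hnQ, hn⟩, hx⟩
  · rintro ⟨n, ⟨hn, hnH⟩, rfl⟩
    refine ⟨⟨n, hnH, rfl⟩, fun g hg => ?_⟩
    have h1 := (hQ.le ((Subgroup.mem_normalizer_iff''.1 hn g).1 hg)).2
    have h2 : (n⁻¹ * g * n) • x = x := h1
    rwa [mul_smul, mul_smul, inv_smul_eq_iff] at h2

end Actions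

namespace ImprimDesign

open Finset MulAction

variable {Γ P C β : Type*} [Group Γ] [Fintype P] [Fintype C] [Fintype β]
    [MulAction Γ P] [MulAction Γ C] [MulAction Γ β] {lam c d l s r b : ℕ}
    (D : ImprimDesign Γ P C β lam c d l s r b)

theorem cnt_conn_class (D : ImprimDesign Γ P C β lam c d l s r b) (x : P) :
    cnt (Conn (stabilizer Γ (D.cls x)) x) = c := by
  refine (cnt_congr fun y => ?_).trans (D.card_cls (D.cls x))
  constructor
  · rintro ⟨g, hg, rfl⟩
    rw [D.cls_smul, mem_stabilizer_iff.1 hg]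
  · intro hy
    obtain ⟨g, rfl⟩ := D.exists_smul_point x y
    exact ⟨g, by rw [mem_stabilizer_iff, ← D.cls_smul, hy], rfl⟩

theorem eq_one_of_normalizes_26 (D : ImprimDesign Γ P C β 4 26 76 2 40 100 2470)
    {Q : Subgroup Γ} (hQ : SylowIn 13 Q ⊤) {Δ : C} (hΔ : ∀ g ∈ Q, g • Δ = Δ) {n : Γ}
    (hn : n ∈ Subgroup.normalizer (Q : Set Γ)) (hnΔ : n • Δ = Δ) {q : ℕ} (hq : q.Prime)
    (hq3 : 3 < q) (hq13 : q ≠ 13) (hnq : n ^ q = 1) : n = 1 := by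
  have := D.finite
  have h13 : Nat.Prime 13 := by norm_num
  have hcls : ∀ x y : P, D.cls x = Δ → Conn Q x y → D.cls y = Δ := by
    rintro x _ rfl ⟨g, hg, rfl⟩
    rw [D.cls_smul, hΔ g hg]
  have hcard : ∀ x : P, D.cls x = Δ → cnt (Conn Q x) = 13 := by
    intro x hx
    have hSt : SylowIn 13 Q (stabilizer Γ Δ) := hQ.mono (fun g hg => hΔ g hg) le_top
    have h1 := hSt.pow_dvd h13 (k := 1) (x := x) (by subst hx; rw [D.cnt_conn_class]; norm_num)
    have := Fact.mk h13
    obtain ⟨k, hk⟩ := IsPGroup.iff_card.1 hQ.isPGroup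
    obtain ⟨j, -, hj⟩ := (Nat.dvd_prime_pow h13).1 (hk ▸ cnt_conn_dvd_card Q x)
    have h2 : cnt (Conn Q x) ≤ 26 := by
      have := cnt_mono (p := Conn Q x) (q := fun y => D.cls y = Δ) fun y => hcls x y hx
      rwa [D.card_cls] at this
    rw [hj] at h1 h2 ⊢
    match j with
    | 0 => norm_num at h1
    | 1 => rfl
    | j + 2 => have := Nat.pow_le_pow_right (show 13 > 0 by norm_num) (show 2 ≤ j + 2 by omega); omega
  have hqd : ¬ q ∣ 13 - 1 := by
    intro h
    have : q ≤ 12 := Nat.le_of_dvd (by norm_num) h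
    interval_cases q <;> revert hq h <;> decide
  have hqd13 : ¬ q ∣ 13 := fun h => hq13 ((Nat.prime_dvd_prime_iff_eq hq h13).1 h)
  have hqd26 : ¬ q ∣ 26 := by
    intro h
    rcases (Nat.Prime.dvd_mul hq (m := 2) (n := 13)).1 h with h | h
    · have := Nat.le_of_dvd (by norm_num) h; omega
    · exact hqd13 h
  have hninv : ∀ x : P, D.cls (n • x) = Δ ↔ D.cls x = Δ := by
    intro x
    rw [D.cls_smul]
    exact ⟨fun h => smul_left_cancel n (h.trans hnΔ.symm), fun h => h ▸ h.symm ▸ hnΔ⟩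
  obtain ⟨x, hx, hnx⟩ := exists_fixed_of_pow hq hnq (q := fun x => D.cls x = Δ) hninv
    (by rwa [D.card_cls])
  have hnc : ∀ z, Conn Q x (n • z) ↔ Conn Q x z := fun z => by
    have := conn_smul_of_mem_normalizer hn x z
    rwa [hnx] at this
  have h1 := cnt_and_add_not (fun z => D.cls z = Δ) (Conn Q x)
  have h2 : cnt (fun z => D.cls z = Δ ∧ Conn Q x z) = cnt (Conn Q x) :=
    cnt_congr fun z => ⟨fun h => h.2, fun h => ⟨hcls x z hx h, h⟩⟩
  rw [h2, hcard x hx, D.card_cls] at h1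
  have h3 : cnt (fun z => D.cls z = Δ ∧ ¬ Conn Q x z) = 13 := by omega
  obtain ⟨x', ⟨hx', hxx'⟩, hnx'⟩ := exists_fixed_of_pow hq hnq
    (q := fun z => D.cls z = Δ ∧ ¬ Conn Q x z) (fun z => by rw [hninv, hnc]) (by rwa [h3])
  refine D.eq_one_of_fix_class (by norm_num) hq (by
    by_contra! h
    have : q = 4 := by omega
    subst this
    exact absurd hq (by norm_num)) hnq (Δ := Δ) fun z hz => ?_
  by_cases hxz : Conn Q x z
  · exact smul_eq_of_normalizes h13 hq hqd hQ.isPGroup hn hnq hnx (hcard x hx) hxz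
  · refine smul_eq_of_normalizes h13 hq hqd hQ.isPGroup hn hnq hnx' (hcard x' hx') ?_
    refine eq_of_cnt_le (p := Conn Q x') (q := fun z => D.cls z = Δ ∧ ¬ Conn Q x z) ?_
      (by rw [h3, hcard x' hx']) z ⟨hz, hxz⟩
    exact fun z hz => ⟨hcls x' z hx' hz, fun h =>
      hxx' ((conn_equivalence Q).trans h ((conn_equivalence Q).symm hz))⟩

theorem no_4_26_76 (D : ImprimDesign Γ P C β 4 26 76 2 40 100 2470) : False := by
  have := D.finite
  have h13 : Nat.Prime 13 := by norm_num
  have hf13 := Fact.mk h13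
  obtain ⟨Q, hQ, -⟩ := exists_sylowIn h13 (R := (⊥ : Subgroup Γ)) (S := ⊤) IsPGroup.of_bot bot_le
  obtain ⟨Δ, -, hΔ⟩ := exists_fixed_of_isPGroup (X := C) h13 hQ.isPGroup (q := fun _ => True)
    (fun _ _ _ _ => trivial) (by rw [cnt_true, D.card_C]; norm_num)
  set N := Subgroup.normalizer (Q : Set Γ) with hN
  have hprime : ∀ q : ℕ, q.Prime → 3 < q → q ≠ 13 →
      ¬ q ∣ Nat.card (N ⊓ stabilizer Γ Δ : Subgroup Γ) := by
    intro q hq hq3 hq13 h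
    obtain ⟨n, hn, hn1, hnq⟩ := exists_pow_eq_one_of_dvd_card hq h
    exact hn1 (D.eq_one_of_normalizes_26 hQ hΔ hn.1 hn.2 hq hq3 hq13 hnq)
  -- the fixed classes in each suborbit
  have horb : ∀ Δ' : C, (Δ' ≠ Δ ∧ ∀ g ∈ Q, g • Δ' = Δ') →
      12 ∣ cnt (Conn (N ⊓ stabilizer Γ Δ) Δ') := by
    rintro Δ' ⟨hne, hΔ'⟩
    have h1 : SylowIn 13 Q (stabilizer Γ Δ ⊓ stabilizer Γ Δ') :=
      hQ.mono (fun g hg => ⟨hΔ g hg, hΔ' g hg⟩) le_top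
    have h2 := h1.cnt_fixed h13
    have h3 := cnt_modEq_cnt_fixed hQ.isPGroup (q := Conn (stabilizer Γ Δ) Δ')
      (fun h hh x hx => (conn_smul_right (hΔ h hh) _ _).2 hx)
    rw [h2] at h3
    have h4 := cnt_conn_dvd_card (N ⊓ stabilizer Γ Δ) Δ'
    have h5 : cnt (Conn (N ⊓ stabilizer Γ Δ) Δ') ≤ cnt (Conn (stabilizer Γ Δ) Δ') :=
      cnt_mono fun z ⟨g, hg, e⟩ => ⟨g, hg.2, e⟩
    obtain ⟨x, rfl⟩ := D.exists_cls Δ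
    have h6 : ¬ Conn (stabilizer Γ (D.cls x)) Δ' (D.cls x) := by
      rintro ⟨g, hg, e⟩
      exact hne (smul_left_cancel g (e.trans (mem_stabilizer_iff.1 hg).symm))
    obtain ⟨n, hn, -⟩ := D.exists_mul_eq_of_class_stabilizer x
      (Conn (stabilizer Γ (D.cls x)) Δ') h6
      (fun g hg Δ'' h => (conn_smul_right (mem_stabilizer_iff.2 hg) _ _).2 h)
    have h7 := cnt_ne_add_one (p := fun _ : C => True) (x := D.cls x) trivial
    rw [cnt_true, D.card_C] at h7
    have h8 := cnt_mono (p := Conn (stabilizer Γ (D.cls x)) Δ') (q := fun y => True ∧ y ≠ D.cls x)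
      fun y hy => ⟨trivial, by rintro rfl; exact h6 hy⟩
    have h9 : 0 < cnt (Conn (N ⊓ stabilizer Γ (D.cls x)) Δ') :=
      cnt_pos.2 ⟨Δ', (conn_equivalence _).refl _⟩
    have hnd : ∀ q : ℕ, q.Prime → 3 < q → q ≠ 13 →
        ¬ q ∣ cnt (Conn (N ⊓ stabilizer Γ (D.cls x)) Δ') :=
      fun q hq hq3 hq13 h => hprime q hq hq3 hq13 (h.trans h4)
    have n5 := hnd 5 (by norm_num) (by norm_num) (by norm_num)
    have n7 := hnd 7 (by norm_num) (by norm_num) (by norm_num)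
    have n11 := hnd 11 (by norm_num) (by norm_num) (by norm_num)
    have n23 := hnd 23 (by norm_num) (by norm_num) (by norm_num)
    have n31 := hnd 31 (by norm_num) (by norm_num) (by norm_num)
    have n37 := hnd 37 (by norm_num) (by norm_num) (by norm_num)
    clear hnd h4 h6 hprime
    generalize cnt (Conn (N ⊓ stabilizer Γ (D.cls x)) Δ') = F at *
    generalize cnt (Conn (stabilizer Γ (D.cls x)) Δ') = m at *
    rw [Nat.ModEq] at h3
    have hm : m = 25 ∨ m = 50 ∨ m = 75 := by omega
    have hF : F ∈ [12, 25, 11, 24, 37, 50, 10, 23, 36, 49, 62, 75] := by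
      simp only [List.mem_cons, List.not_mem_nil, or_false]
      rcases hm with rfl | rfl | rfl <;> omega
    simp only [List.mem_cons, List.not_mem_nil, or_false] at hF
    rcases hF with rfl | rfl | rfl | rfl | rfl | rfl | rfl | rfl | rfl | rfl | rfl | rfl <;> omega
  have htot : cnt (fun Δ' : C => ∀ g ∈ Q, g • Δ' = Δ') = 37 := by
    have h1 := dvd_cnt_of_dvd_equivalence (conn_equivalence (N ⊓ stabilizer Γ Δ))
      (p := fun Δ' : C => Δ' ≠ Δ ∧ ∀ g ∈ Q, g • Δ' = Δ') (m := 12) (by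
        rintro Δ' _ ⟨n, ⟨hn, hnΔ⟩, rfl⟩ ⟨hne, h⟩
        refine ⟨fun e => hne (smul_left_cancel n (e.trans (mem_stabilizer_iff.1 hnΔ).symm)), fun g hg => ?_⟩
        have h1 := h _ ((Subgroup.mem_normalizer_iff''.1 hn g).1 hg)
        rwa [mul_smul, mul_smul, inv_smul_eq_iff] at h1) horb
    have h2 := cnt_modEq_cnt_fixed (X := C) hQ.isPGroup (q := fun _ => True)
      (fun _ _ _ _ => trivial)
    have h3 := cnt_ne_add_one (p := fun Δ' : C => ∀ g ∈ Q, g • Δ' = Δ') (x := Δ) hΔ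
    have h4 : cnt (fun Δ' : C => Δ' ≠ Δ ∧ ∀ g ∈ Q, g • Δ' = Δ') =
        cnt (fun Δ' : C => (∀ g ∈ Q, g • Δ' = Δ') ∧ Δ' ≠ Δ) := cnt_congr fun _ => and_comm
    have h5 := cnt_le_card (fun Δ' : C => ∀ g ∈ Q, g • Δ' = Δ')
    rw [cnt_true, D.card_C, cnt_congr (q := fun Δ' : C => ∀ g ∈ Q, g • Δ' = Δ')
      fun _ => by simp, Nat.ModEq] at h2
    rw [D.card_C] at h5
    rw [h4] at h1
    generalize cnt (fun Δ' : C => (∀ g ∈ Q, g • Δ' = Δ') ∧ Δ' ≠ Δ) = u at *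
    generalize cnt (fun Δ' : C => ∀ g ∈ Q, g • Δ' = Δ') = w at *
    omega
  have h37 : Nat.Prime 37 := by norm_num
  have h1 : SylowIn 13 Q (⊤ ⊓ stabilizer Γ Δ) :=
    hQ.mono (fun g hg => ⟨trivial, hΔ g hg⟩) le_top
  have h2 := h1.cnt_fixed h13
  rw [cnt_congr (q := fun Δ' : C => ∀ g ∈ Q, g • Δ' = Δ') (fun Δ' => ⟨fun h => h.2, fun h =>
    ⟨(D.exists_smul_class Δ Δ').imp fun g hg => ⟨trivial, hg⟩, h⟩⟩), htot] at h2
  have h3 := cnt_conn_dvd_card (N ⊓ ⊤) Δ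
  rw [← h2] at h3
  obtain ⟨g, -, hg1, hg⟩ := exists_pow_eq_one_of_dvd_card h37 h3
  obtain ⟨Δ', -, hgΔ⟩ := exists_fixed_of_pow (X := C) h37 hg (q := fun _ => True) (fun _ => Iff.rfl)
    (by rw [cnt_true, D.card_C]; norm_num)
  refine hg1 (D.eq_one_of_fix_class (by norm_num) h37 (by norm_num) hg (Δ := Δ') ?_)
  refine smul_eq_of_cnt_lt h37 hg (q := fun x => D.cls x = Δ') (fun x => ?_)
    (by rw [D.card_cls]; norm_num)
  rw [D.cls_smul]
  exact ⟨fun h => smul_left_cancel g (h.trans hgΔ.symm), fun h => h ▸ h.symm ▸ hgΔ⟩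

theorem parallel_smul (g : Γ) (B B' : β) : D.Parallel (g • B) (g • B') ↔ D.Parallel B B' := by
  unfold Parallel
  rw [D.a_smul, smul_left_cancel_iff]

/-- The class `Δ` is missed by all blocks parallel to `B`. -/
def Missed (B : β) (Δ : C) : Prop := ∀ B', D.Parallel B B' → ¬ D.Meets B' Δ

theorem missed_smul (g : Γ) (B : β) (Δ : C) : D.Missed (g • B) (g • Δ) ↔ D.Missed B Δ := by
  constructor
  · intro h B' hB' hm
    exact h (g • B') ((D.parallel_smul g B B').2 hB') ((D.meets_smul g B' Δ).2 hm)
  · intro h B' hB' hm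
    refine h (g⁻¹ • B') ((D.parallel_smul g B _).1 (by rwa [smul_inv_smul])) ?_
    rw [← D.meets_smul g, smul_inv_smul]
    exact hm

theorem Missed.parallel {D : ImprimDesign Γ P C β lam c d l s r b} (hE : Equivalence D.Parallel)
    {B B' : β} {Δ : C} (h : D.Missed B Δ) (hB : D.Parallel B B') : D.Missed B' Δ :=
  fun B'' hB'' => h B'' (hE.trans hB hB'')

theorem parallel_equivalence_28 (D : ImprimDesign Γ P C β 4 10 28 2 16 36 315) :
    Equivalence D.Parallel := D.parallel_equivalence₃₂ rfl

theorem cnt_parallel_28 (D : ImprimDesign Γ P C β 4 10 28 2 16 36 315) (B : β) :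
    cnt (D.Parallel B) = 3 := by
  rw [D.cnt_parallel, (D.intersections₃₂ rfl B).1]

theorem cnt_mates_meets (D : ImprimDesign Γ P C β 4 10 28 2 16 36 315) {B : β} {Δ : C}
    (h : D.Meets B Δ) : cnt (fun B' => D.Meets B' Δ ∧ D.a B B' = 0) = 1 := by
  obtain ⟨B₁, B₂, hne, h1, h2, h3, n, hn, hn'⟩ := D.exists_mates₃₂ rfl B
  rw [hn' Δ h]
  have := D.e_ge B B₁
  have := D.e_le B B₁
  have := D.e_ge B B₂
  have := D.e_le B B₂
  have hn12 : n = 1 ∨ n = 2 := by omega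
  refine hn12.resolve_right fun hn2 => ?_
  have hB : ∀ B', D.a B B' = 0 → D.e B B' = 16 := by
    intro B' hB'
    rcases h3 B' hB' with rfl | rfl <;> omega
  have hS : ∀ B B', D.Parallel B B' → ∀ Δ, D.Meets B Δ → D.Meets B' Δ := by
    rintro B' B'' (rfl | h)
    · exact fun Δ h => h
    apply D.meets_of_e_eq
    obtain ⟨g, rfl⟩ := D.exists_smul_block B B'
    rw [← smul_inv_smul g B'', D.e_smul]
    refine hB _ ?_
    rw [← D.a_smul g, smul_inv_smul]
    exact h
  obtain ⟨Δ, Δ', hne⟩ := Fintype.exists_pair_of_one_lt_card (α := C) (by rw [D.card_C]; norm_num)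
  have h1 := D.card_blocks_meets₂ Δ Δ' hne
  have h2 : 3 ∣ cnt (fun B => D.Meets B Δ ∧ D.Meets B Δ') :=
    dvd_cnt_of_equivalence D.parallel_equivalence_28
      (fun B B' h hB => ⟨hS B B' h _ hB.1, hS B B' h _ hB.2⟩)
      (fun B _ => D.cnt_parallel_28 B)
  omega

theorem cnt_parallel_meets (D : ImprimDesign Γ P C β 4 10 28 2 16 36 315) {B : β} {Δ : C}
    (h : ¬ D.Missed B Δ) : cnt (fun B' => D.Parallel B B' ∧ D.Meets B' Δ) = 2 := by
  unfold Missed at h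
  push Not at h
  obtain ⟨B₁, hB₁, hm⟩ := h
  have hE := D.parallel_equivalence_28
  have h1 := cnt_ne_add_one (p := fun B' => D.Parallel B B' ∧ D.Meets B' Δ) (x := B₁) ⟨hB₁, hm⟩
  have h2 : cnt (fun B' => (D.Parallel B B' ∧ D.Meets B' Δ) ∧ B' ≠ B₁) = 1 := by
    refine (cnt_congr fun B' => ?_).trans (D.cnt_mates_meets hm)
    constructor
    · rintro ⟨⟨h, h'⟩, hne⟩
      exact ⟨h', (hE.trans (hE.symm hB₁) h).resolve_left hne⟩
    · rintro ⟨h, h'⟩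
      exact ⟨⟨hE.trans hB₁ (Or.inr h'), h⟩, D.ne_of_a_eq_zero h'⟩
  omega

theorem cnt_missed (D : ImprimDesign Γ P C β 4 10 28 2 16 36 315) (B : β) :
    cnt (D.Missed B) = 4 := by
  have h := cnt_mul_eq_cnt_mul (fun B' => D.Parallel B B') (fun Δ => ¬ D.Missed B Δ)
    (fun B' Δ => D.Parallel B B' ∧ D.Meets B' Δ) (m := 16) (n := 2) (fun _ _ h => h.1)
    (fun B' Δ h h' => h' B' h.1 h.2)
    (fun B' hB' => (cnt_congr fun Δ => by simp [hB']).trans (D.card_meets B'))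
    (fun Δ hΔ => D.cnt_parallel_meets hΔ)
  rw [D.cnt_parallel_28] at h
  have h1 := cnt_add_not (D.Missed B)
  rw [D.card_C] at h1
  omega

theorem cnt_blocks_missed (D : ImprimDesign Γ P C β 4 10 28 2 16 36 315) (Δ : C) :
    cnt (fun B => D.Missed B Δ) = 45 := by
  have h := cnt_mul_eq_cnt_mul (fun _ : β => True) (fun _ : C => True) (fun B Δ => D.Missed B Δ)
    (m := 4) (n := cnt (fun B => D.Missed B Δ)) (fun _ _ _ => trivial) (fun _ _ _ => trivial)
    (fun B _ => D.cnt_missed B) (fun Δ' _ => by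
      obtain ⟨g, rfl⟩ := D.exists_smul_class Δ Δ'
      exact (cnt_smul g _ _ fun B => (D.missed_smul g B Δ).symm).symm)
  rw [cnt_true, cnt_true, D.card_B, D.card_C] at h
  omega

/-- Distinct classes missed by a common block. -/
def CoMissed (Δ Δ' : C) : Prop := Δ' ≠ Δ ∧ ∃ B, D.Missed B Δ ∧ D.Missed B Δ'

theorem coMissed_smul (g : Γ) (Δ Δ' : C) :
    D.CoMissed (g • Δ) (g • Δ') ↔ D.CoMissed Δ Δ' := by
  unfold CoMissed
  refine and_congr (smul_left_cancel_iff g).not ⟨?_, ?_⟩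
  · rintro ⟨B, h⟩
    refine ⟨g⁻¹ • B, ?_⟩
    rwa [← D.missed_smul g, ← D.missed_smul g (g⁻¹ • B) Δ', smul_inv_smul]
  · rintro ⟨B, h⟩
    exact ⟨g • B, by rwa [D.missed_smul, D.missed_smul]⟩

theorem coMissed_suborbit (D : ImprimDesign Γ P C β 4 10 28 2 16 36 315) (Δ : C) :
    cnt (D.CoMissed Δ) = 9 ∧
      ∀ B, ¬ D.Missed B Δ → cnt (fun Δ' => D.Missed B Δ' ∧ D.CoMissed Δ Δ') = 1 := by
  have hE := D.parallel_equivalence_28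
  obtain ⟨x, rfl⟩ := D.exists_cls Δ
  have h45 := D.cnt_blocks_missed (D.cls x)
  obtain ⟨B₀, hB₀⟩ := cnt_pos.1 (h45 ▸ (by norm_num : 0 < 45))
  obtain ⟨Δ₁, hΔ₁, hne⟩ := exists_ne_of_one_lt_cnt (D.cnt_missed B₀ ▸ (by norm_num : 1 < 4)) (D.cls x)
  set O : C → Prop := Conn (stabilizer Γ (D.cls x)) Δ₁ with hO
  have hOx : ¬ O (D.cls x) := by
    rintro ⟨g, hg, e⟩
    exact hne (smul_left_cancel g (e.trans (mem_stabilizer_iff.1 hg).symm))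
  have hOg : ∀ g : Γ, g • D.cls x = D.cls x → ∀ Δ, O (g • Δ) ↔ O Δ := fun g hg Δ =>
    conn_smul_right (mem_stabilizer_iff.2 hg) _ _
  have hsub : ∀ Δ, O Δ → D.CoMissed (D.cls x) Δ := by
    rintro _ ⟨g, hg, rfl⟩
    have hg' : g • D.cls x = D.cls x := hg
    have h := (D.coMissed_smul g (D.cls x) Δ₁).2 ⟨hne, B₀, hB₀, hΔ₁⟩
    rwa [hg'] at h
  obtain ⟨n, hn, -⟩ := D.exists_mul_eq_of_class_stabilizer x O hOx (fun g hg Δ h => (hOg g hg Δ).2 h)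
  -- the intersection numbers with the orbit
  obtain ⟨B₁, hB₁⟩ := D.exists_block x
  have hω : ∀ B, D.Meets B (D.cls x) → cnt (fun Δ => D.Missed B Δ ∧ O Δ) =
      cnt (fun Δ => D.Missed B₁ Δ ∧ O Δ) := by
    rintro B ⟨y, hy, hyx⟩
    obtain ⟨g, rfl, rfl⟩ := D.flag x B₁ y B hB₁ hy
    rw [D.cls_smul] at hyx
    exact (cnt_smul g _ _ fun Δ => by rw [D.missed_smul, hOg g hyx]).symm
  set X := cnt (fun B => D.Missed B (D.cls x) ∧ D.Missed B Δ₁) with hX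
  have hX' : ∀ Δ, O Δ → cnt (fun B => D.Missed B (D.cls x) ∧ D.Missed B Δ) = X := by
    rintro _ ⟨g, hg, rfl⟩
    have hg' : g • D.cls x = D.cls x := hg
    refine (cnt_smul g _ _ fun B => ?_).symm
    have h := D.missed_smul g B (D.cls x)
    rw [hg'] at h
    rw [h, D.missed_smul]
  have hX3 : 3 ∣ X := dvd_cnt_of_equivalence hE
    (fun B B' h hB => ⟨hB.1.parallel hE h, hB.2.parallel hE h⟩) fun B _ => D.cnt_parallel_28 B
  have hXpos : 0 < X := cnt_pos.2 ⟨B₀, hB₀, hΔ₁⟩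
  have hM : ∀ Δ, O Δ → cnt (fun B => D.Meets B (D.cls x) ∧ D.Missed B Δ) * 3 = 2 * (45 - X) := by
    intro Δ hΔ
    have h1 := cnt_and_add_not (fun B => D.Missed B Δ) (fun B => D.Missed B (D.cls x))
    rw [D.cnt_blocks_missed, cnt_congr (q := fun B => D.Missed B (D.cls x) ∧ D.Missed B Δ)
      fun B => and_comm, hX' Δ hΔ] at h1
    have h := cnt_mul_eq_cnt_mul (fun B => D.Missed B Δ ∧ ¬ D.Missed B (D.cls x))
      (fun B => D.Meets B (D.cls x) ∧ D.Missed B Δ)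
      (fun B B' => D.Missed B Δ ∧ D.Parallel B B' ∧ D.Meets B' (D.cls x)) (m := 2) (n := 3)
      (fun B B' h => ⟨h.1, fun h' => h' B' h.2.1 h.2.2⟩)
      (fun B B' h => ⟨h.2.2, h.1.parallel hE h.2.1⟩)
      (fun B hB => (cnt_congr fun B' => by simp [hB.1]).trans (D.cnt_parallel_meets hB.2))
      (fun B' hB' => (cnt_congr fun B => ⟨fun h => hE.symm h.2.1, fun h =>
        ⟨hB'.2.parallel hE h, hE.symm h, hB'.1⟩⟩).trans (D.cnt_parallel_28 B'))
    omega
  have h180 : cnt (fun B => D.Meets B (D.cls x)) = 180 := by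
    have := D.card_blocks_meets (D.cls x)
    omega
  have hcount := cnt_mul_eq_cnt_mul (fun B => D.Meets B (D.cls x)) O
    (fun B Δ => D.Meets B (D.cls x) ∧ (D.Missed B Δ ∧ O Δ))
    (n := cnt (fun B => D.Meets B (D.cls x) ∧ D.Missed B Δ₁)) (fun _ _ h => h.1)
    (fun _ _ h => h.2.2) (fun B hB => (cnt_congr fun Δ => by simp [hB]).trans (hω B hB))
    (fun Δ hΔ => (cnt_congr (q := fun B => D.Meets B (D.cls x) ∧ D.Missed B Δ)
        fun B => by simp [hΔ]).trans (by
      have h1 := hM Δ hΔ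
      have h2 := hM Δ₁ ((conn_equivalence _).refl _)
      omega))
  rw [h180] at hcount
  have hM₁ := hM Δ₁ ((conn_equivalence _).refl _)
  classical
  have hpairs := cnt_mul_eq_sum (fun B => D.Missed B (D.cls x))
    (fun B Δ => D.Missed B (D.cls x) ∧ (D.Missed B Δ ∧ Δ ≠ D.cls x)) (m := 3) (fun _ _ h => h.1)
    (fun B hB => by
      have h1 := cnt_ne_add_one (p := D.Missed B) hB
      rw [D.cnt_missed] at h1
      rw [cnt_congr (q := fun Δ => D.Missed B Δ ∧ Δ ≠ D.cls x) fun Δ => by simp [hB]]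
      omega)
  rw [h45] at hpairs
  have hOsum : ∑ Δ with O Δ, cnt (fun B => D.Missed B (D.cls x) ∧ (D.Missed B Δ ∧ Δ ≠ D.cls x)) =
      cnt O * X := by
    rw [sum_congr rfl (g := fun _ => X), sum_const, smul_eq_mul]
    · unfold cnt; congr!
    intro Δ hΔ
    have hΔ' := (mem_filter.1 hΔ).2
    rw [← hX' Δ hΔ']
    exact cnt_congr fun B => by simp [(hsub Δ hΔ').1]
  have hle : ∀ Δ, ¬ O Δ → cnt O * X +
      cnt (fun B => D.Missed B (D.cls x) ∧ (D.Missed B Δ ∧ Δ ≠ D.cls x)) ≤ 135 := by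
    intro Δ hΔ
    rw [← hOsum, add_comm, ← sum_insert (s := univ.filter O)
      (f := fun Δ => cnt (fun B => D.Missed B (D.cls x) ∧ (D.Missed B Δ ∧ Δ ≠ D.cls x)))
      (by simpa using hΔ)]
    exact (sum_le_sum_of_subset (subset_univ _)).trans_eq hpairs.symm
  have hmain : cnt O = 9 ∧ X = 15 ∧ cnt (fun Δ => D.Missed B₁ Δ ∧ O Δ) = 1 := by
    have h1 := hle _ hOx
    have h2 : 0 < cnt O := cnt_pos.2 ⟨Δ₁, (conn_equivalence _).refl _⟩
    have h3 : cnt O ≤ 28 := D.card_C ▸ cnt_le_card O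
    generalize cnt (fun Δ => D.Missed B₁ Δ ∧ O Δ) = ω at *
    generalize cnt (fun B => D.Meets B (D.cls x) ∧ D.Missed B Δ₁) = M at *
    generalize cnt O = m at *
    clear_value X
    have hm : m = 9 ∨ m = 18 ∨ m = 27 := by omega
    rcases hm with rfl | rfl | rfl <;> omega
  have hiff : ∀ Δ, D.CoMissed (D.cls x) Δ ↔ O Δ := by
    refine fun Δ => ⟨fun ⟨hne, B, hB⟩ => ?_, hsub Δ⟩
    by_contra hΔ
    have h1 := hle Δ hΔ
    have h2 : 0 < cnt (fun B => D.Missed B (D.cls x) ∧ (D.Missed B Δ ∧ Δ ≠ D.cls x)) :=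
      cnt_pos.2 ⟨B, hB.1, hB.2, hne⟩
    rw [hmain.1, hmain.2.1] at h1
    omega
  refine ⟨(cnt_congr hiff).trans hmain.1, fun B hB => ?_⟩
  unfold Missed at hB
  push Not at hB
  obtain ⟨B', hB', hm⟩ := hB
  refine (cnt_congr fun Δ => ?_).trans ((hω B' hm).trans hmain.2.2)
  rw [hiff]
  exact and_congr_left fun _ => ⟨fun h => h.parallel hE hB', fun h => h.parallel hE (hE.symm hB')⟩

/-- Two blocks missing two common classes miss the same classes. -/
theorem Missed.of_two {D : ImprimDesign Γ P C β 4 10 28 2 16 36 315} {B B' : β} {Δ₁ Δ₂ Δ : C}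
    (hne : Δ₁ ≠ Δ₂) (h1 : D.Missed B Δ₁) (h2 : D.Missed B Δ₂) (h1' : D.Missed B' Δ₁)
    (h2' : D.Missed B' Δ₂) (h : D.Missed B Δ) : D.Missed B' Δ := by
  by_contra hB'
  obtain ⟨Z, -, hZ⟩ := exists_of_cnt_eq_one ((D.coMissed_suborbit Δ).2 B' hB')
  refine hne ((hZ Δ₁ ⟨h1', ?_, B, h, h1⟩).trans (hZ Δ₂ ⟨h2', ?_, B, h, h2⟩).symm)
  · rintro rfl
    exact hB' h1'
  · rintro rfl
    exact hB' h2'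

theorem smul_eq_of_coMissed (D : ImprimDesign Γ P C β 4 10 28 2 16 36 315) {g : Γ}
    (hg : g ^ 5 = 1) {Δ Δ' : C} (hΔ : g • Δ = Δ) (h : D.CoMissed Δ Δ') : g • Δ' = Δ' := by
  have h5 : Nat.Prime 5 := by norm_num
  have hN := (D.coMissed_suborbit Δ).1
  have hinv : ∀ Δ', D.CoMissed Δ (g • Δ') ↔ D.CoMissed Δ Δ' := fun Δ' => by
    have := D.coMissed_smul g Δ Δ'
    rwa [hΔ] at this
  have hmod := cnt_modEq_cnt_fixed_of_pow h5 hg hinv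
  have hdvd : 3 ∣ cnt (fun Δ' => D.CoMissed Δ Δ' ∧ g • Δ' = Δ') := by
    let E : C → C → Prop := fun Δ₁ Δ₂ => Δ₁ = Δ₂ ∨
      (Δ₁ ≠ Δ ∧ Δ₂ ≠ Δ ∧ ∃ B, D.Missed B Δ ∧ D.Missed B Δ₁ ∧ D.Missed B Δ₂)
    have hE : Equivalence E := by
      refine ⟨fun Δ₁ => Or.inl rfl, ?_, ?_⟩
      · rintro Δ₁ Δ₂ (rfl | ⟨h1, h2, B, hB⟩)
        · exact Or.inl rfl
        · exact Or.inr ⟨h2, h1, B, hB.1, hB.2.2, hB.2.1⟩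
      · rintro Δ₁ Δ₂ Δ₃ (rfl | ⟨h1, h2, B, hB⟩) h'
        · exact h'
        rcases h' with rfl | ⟨h1', h2', B', hB'⟩
        · exact Or.inr ⟨h1, h2, B, hB⟩
        · exact Or.inr ⟨h1, h2', B, hB.1, hB.2.1,
            Missed.of_two h1'.symm hB'.1 hB'.2.1 hB.1 hB.2.2 hB'.2.2⟩
    have hE3 : ∀ Δ₁, D.CoMissed Δ Δ₁ → cnt (E Δ₁) = 3 := by
      rintro Δ₁ ⟨hne, B, hB, hB₁⟩
      have h1 := cnt_ne_add_one (p := D.Missed B) hB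
      rw [D.cnt_missed] at h1
      have h2 : cnt (E Δ₁) = cnt (fun Δ₂ => D.Missed B Δ₂ ∧ Δ₂ ≠ Δ) := by
        refine cnt_congr fun Δ₂ => ⟨?_, fun h => Or.inr ⟨hne, h.2, B, hB, hB₁, h.1⟩⟩
        rintro (rfl | ⟨-, h2, B', hB'⟩)
        · exact ⟨hB₁, hne⟩
        · exact ⟨Missed.of_two hne hB'.2.1 hB'.1 hB₁ hB hB'.2.2, h2⟩
      omega
    have hEg : ∀ Δ₁ Δ₂, E (g • Δ₁) (g • Δ₂) ↔ E Δ₁ Δ₂ := by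
      intro Δ₁ Δ₂
      have hneg : ∀ Δ₁ : C, g • Δ₁ ≠ Δ ↔ Δ₁ ≠ Δ := fun Δ₁ => by
        conv_lhs => rw [← hΔ]
        exact (smul_left_cancel_iff g).not
      refine or_congr (smul_left_cancel_iff g) (and_congr (hneg _) (and_congr (hneg _) ⟨?_, ?_⟩))
      · rintro ⟨B, h⟩
        refine ⟨g⁻¹ • B, ?_⟩
        rwa [← D.missed_smul g, ← D.missed_smul g _ Δ₁, ← D.missed_smul g _ Δ₂, smul_inv_smul, hΔ]
      · rintro ⟨B, h⟩
        refine ⟨g • B, ?_⟩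
        have := D.missed_smul g B Δ
        rw [hΔ] at this
        rwa [this, D.missed_smul, D.missed_smul]
    refine dvd_cnt_of_equivalence hE (fun Δ₁ Δ₂ h12 h1 => ⟨?_, ?_⟩) (fun Δ₁ h1 => hE3 Δ₁ h1.1)
    · rcases h12 with rfl | ⟨-, h2, B, hB⟩
      · exact h1.1
      · exact ⟨h2, B, hB.1, hB.2.2⟩
    · refine smul_eq_of_cnt_lt h5 hg (q := E Δ₁) (fun Δ₂ => ?_) (by rw [hE3 Δ₁ h1.1]; norm_num) Δ₂ h12
      have := hEg Δ₁ Δ₂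
      rwa [h1.2] at this
  have hle : cnt (fun Δ' => D.CoMissed Δ Δ' ∧ g • Δ' = Δ') ≤ cnt (D.CoMissed Δ) :=
    cnt_mono fun _ h => h.1
  rw [hN, Nat.ModEq] at hmod
  refine (eq_of_cnt_le (p := fun Δ' => D.CoMissed Δ Δ' ∧ g • Δ' = Δ') (fun _ h => h.1) ?_ Δ' h).2
  omega

theorem no_4_10_28 (D : ImprimDesign Γ P C β 4 10 28 2 16 36 315) : False := by
  obtain ⟨Δ⟩ := D.nonempty_C
  obtain ⟨g, hg1, hg, hΔ⟩ := D.exists_pow_eq_one_class (p := 5) (by norm_num) (by norm_num) Δ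
  have hK : g ∈ classKernel Γ C := by
    refine mem_classKernel.2 fun Δ' => ?_
    obtain ⟨B, hB⟩ := cnt_pos.1 (D.cnt_blocks_missed Δ' ▸ (by norm_num : 0 < 45))
    by_cases hBΔ : D.Missed B Δ
    · by_cases hne : Δ' = Δ
      · rw [hne, hΔ]
      · exact D.smul_eq_of_coMissed hg hΔ ⟨hne, B, hBΔ, hB⟩
    · obtain ⟨Δ₁, h1, -⟩ := exists_of_cnt_eq_one ((D.coMissed_suborbit Δ).2 B hBΔ)
      have h2 := D.smul_eq_of_coMissed hg hΔ h1.2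
      by_cases hne : Δ' = Δ₁
      · rw [hne, h2]
      · exact D.smul_eq_of_coMissed hg h2 ⟨hne, B, h1.1, hB⟩
  obtain ⟨m, t, ht, hmt, hm, hm', ht'⟩ := D.kernel_blocks fun x y hxy =>
    D.kernel_transitive (by decide) hg1 hK hxy
  have hm5 : m ∣ 5 := by simpa using hm
  have := Nat.le_of_dvd (by norm_num) hm5
  have hm5 : m = 5 := by omega
  have ht1 : t = 1 := by omega
  obtain ⟨B⟩ := D.nonempty_β
  have h1 := cnt_ne_add_one (p := Conn (classKernel Γ C) B) ((conn_equivalence _).refl B)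
  rw [hm'] at h1
  have h2 := (D.intersections₃₂ rfl B).1
  have h3 : cnt (fun B' => Conn (classKernel Γ C) B B' ∧ B' ≠ B) ≤ cnt (fun B' => D.a B B' = 0) := by
    refine cnt_mono fun B' hB' => D.a_eq_zero_iff.2 fun x hx hx' => hB'.2 ?_
    obtain ⟨Z, -, hZ⟩ := exists_of_cnt_eq_one ((ht' B x ⟨x, hx, rfl⟩).trans ht1)
    exact (hZ B' ⟨hB'.1, hx'⟩).trans (hZ B ⟨(conn_equivalence _).refl B, hx⟩).symm
  omega

end ImprimDesign

section Actions

open Finset MulAction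

variable {Γ X : Type*} [Group Γ] [MulAction Γ X]

theorem cnt_le_of_injOn {Y Z : Type*} [Fintype Y] [Fintype Z] {p : Y → Prop} {q : Z → Prop}
    (f : Y → Z) (hf : ∀ y, p y → q (f y)) (hinj : ∀ y y', p y → p y' → f y = f y' → y = y') :
    cnt p ≤ cnt q :=
  card_le_card_of_injOn f (fun y hy => by simpa using hf y (by simpa using hy))
    fun y hy y' hy' h => hinj y y' (by simpa using hy) (by simpa using hy') h

theorem exists_subgroup_card [Finite Γ] {H : Subgroup Γ} {p k : ℕ} (hp : p.Prime)
    (h : p ^ k ∣ Nat.card H) : ∃ R ≤ H, Nat.card R = p ^ k := by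
  have := Fact.mk hp
  obtain ⟨R, hR⟩ := Sylow.exists_subgroup_card_pow_prime p h
  refine ⟨R.map H.subtype, Subgroup.map_subtype_le R, ?_⟩
  rw [← hR]
  exact Nat.card_congr (R.equivMapOfInjective _ H.subtype_injective).toEquiv.symm

theorem smul_smul_smul_of_pow {h : Γ} (hh : h ^ 3 = 1) (x : X) : h • h • h • x = x := by
  rw [smul_smul, smul_smul, ← pow_three', hh, one_smul]

theorem smul_smul_ne_of_pow {h : Γ} (hh : h ^ 3 = 1) {x : X} (hx : h • x ≠ x) : h • h • x ≠ x := by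
  intro e
  have := smul_smul_smul_of_pow hh x
  rw [e] at this
  exact hx this

/-- A product of two three-cycles sharing one point is a cycle of length five. -/
theorem five_cycle {h h' : Γ} (hh : h ^ 3 = 1) (hh' : h' ^ 3 = 1) {W : X → Prop}
    (hW : ∀ x, W (h • x) ↔ W x) (hW' : ∀ x, W (h' • x) ↔ W x) {p : X} (hWp : W p)
    (hp : h • p ≠ p) (hp' : h' • p ≠ p)
    (hc : ∀ x, W x → h • x ≠ x → x = p ∨ x = h • p ∨ x = h • h • p)
    (hc' : ∀ x, W x → h' • x ≠ x → x = p ∨ x = h' • p ∨ x = h' • h' • p)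
    (hi : ∀ x, W x → h • x ≠ x → h' • x ≠ x → x = p) :
    (h' * h) • p ≠ p ∧ ∀ x, W x → (h' * h) ^ 5 • x = x := by
  have hp2 := smul_smul_ne_of_pow hh hp
  have hp2' := smul_smul_ne_of_pow hh' hp'
  have e3 := smul_smul_smul_of_pow hh p
  have e3' := smul_smul_smul_of_pow hh' p
  have hy : h' • h • p = h • p := by
    by_contra hne
    exact hp (hi _ ((hW p).2 hWp) ((smul_ne_iff h p).2 hp) hne)
  have hz : h' • h • h • p = h • h • p := by
    by_contra hne
    exact hp2 (hi _ ((hW _).2 ((hW p).2 hWp)) ((smul_ne_iff h _).2 ((smul_ne_iff h p).2 hp)) hne)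
  have hq : h • h' • p = h' • p := by
    by_contra hne
    exact hp' (hi _ ((hW' p).2 hWp) hne ((smul_ne_iff h' p).2 hp'))
  have hr : h • h' • h' • p = h' • h' • p := by
    by_contra hne
    exact hp2' (hi _ ((hW' _).2 ((hW' p).2 hWp)) hne
      ((smul_ne_iff h' _).2 ((smul_ne_iff h' p).2 hp')))
  have c1 : (h' * h) • p = h • p := by rw [mul_smul, hy]
  have c2 : (h' * h) • h • p = h • h • p := by rw [mul_smul, hz]
  have c3 : (h' * h) • h • h • p = h' • p := by rw [mul_smul, e3]
  have c4 : (h' * h) • h' • p = h' • h' • p := by rw [mul_smul, hq]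
  have c5 : (h' * h) • h' • h' • p = p := by rw [mul_smul, hr, e3']
  refine ⟨by rwa [c1], fun x hx => ?_⟩
  have e5 : ∀ x : X, (h' * h) ^ 5 • x = (h' * h) • (h' * h) • (h' * h) • (h' * h) • (h' * h) • x := by
    intro x
    simp only [pow_succ, pow_zero, one_mul, mul_smul]
  rw [e5]
  by_cases hx1 : h • x = x
  · by_cases hx2 : h' • x = x
    · simp only [mul_smul, hx1, hx2]
    · rcases hc' x hx hx2 with rfl | rfl | rfl
      · exact absurd hx1 hp
      · rw [c4, c5, c1, c2, c3]
      · rw [c5, c1, c2, c3, c4]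
  · rcases hc x hx hx1 with rfl | rfl | rfl
    · rw [c1, c2, c3, c4, c5]
    · rw [c2, c3, c4, c5, c1]
    · rw [c3, c4, c5, c1, c2]

end Actions

namespace ImprimDesign

open Finset MulAction

variable {Γ P C β : Type*} [Group Γ] [Fintype P] [Fintype C] [Fintype β]
    [MulAction Γ P] [MulAction Γ C] [MulAction Γ β] {lam c d l s r b : ℕ}
    (D : ImprimDesign Γ P C β lam c d l s r b)

theorem cls_smul_iff_of_eq {g : Γ} {Δ : C} (h : g • Δ = Δ) (x : P) :
    D.cls (g • x) = Δ ↔ D.cls x = Δ := by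
  rw [D.cls_smul]
  exact ⟨fun e => smul_left_cancel g (e.trans h.symm), fun e => e ▸ e.symm ▸ h⟩

theorem meets_smul_iff_of_eq {g : Γ} {B : β} (h : g • B = B) (Δ : C) :
    D.Meets B (g • Δ) ↔ D.Meets B Δ := by
  have := D.meets_smul g B Δ
  rwa [h] at this

/-- Counting the pairs `(x, B)` with `x` in both `B` and `g • B`. -/
theorem sum_a_smul (g : Γ) :
    ∑ B, D.a B (g • B) = r * cnt (fun x : P => g • x = x) + lam * cnt (fun x : P => g • x ≠ x) := by
  classical
  have h1 : ∑ B, D.a B (g • B) = ∑ x, cnt (fun B => D.I x B ∧ D.I x (g • B)) :=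
    sum_cnt_comm (fun (B : β) (x : P) => D.I x B ∧ D.I x (g • B))
  have h2 : ∀ x : P, g⁻¹ • x = x ↔ g • x = x := fun x => by
    rw [inv_smul_eq_iff, eq_comm]
  have h3 : ∀ x, cnt (fun B => D.I x B ∧ D.I x (g • B)) =
      r * (if g • x = x then 1 else 0) + lam * (if g • x ≠ x then 1 else 0) := by
    intro x
    have h4 : cnt (fun B => D.I x B ∧ D.I x (g • B)) = cnt (fun B => D.I x B ∧ D.I (g⁻¹ • x) B) :=
      cnt_congr fun B => by rw [← D.I_smul g (g⁻¹ • x) B, smul_inv_smul]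
    rw [h4]
    by_cases hx : g • x = x
    · rw [(h2 x).2 hx]
      simp [hx, D.card_pt x]
    · have := D.pair x (g⁻¹ • x) (fun e => hx ((h2 x).1 e.symm))
      simp [hx, this]
  rw [h1, sum_congr rfl fun x _ => h3 x, sum_add_distrib, ← mul_sum, ← mul_sum, cnt_eq_sum, cnt_eq_sum]
  congr!

section FixedPoints

variable (D : ImprimDesign Γ P C β lam c d 2 s r b) {p : ℕ}

/-- In a fixed block, all points in fixed classes are fixed. -/
theorem smul_eq_of_block (hp : p.Prime) (hp2 : 2 < p) {g : Γ} (hg : g ^ p = 1) {B : β}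
    (hB : g • B = B) {x : P} (hx : D.I x B) (hΔ : g • D.cls x = D.cls x) : g • x = x :=
  smul_eq_of_cnt_lt hp hg (q := fun y => D.I y B ∧ D.cls y = D.cls x)
    (fun y => by rw [D.I_smul_iff_of_eq hB, D.cls_smul_iff_of_eq hΔ])
    (by rw [D.card_inter x B hx]; exact hp2) x ⟨hx, rfl⟩

theorem cnt_fixed_block (hp : p.Prime) (hp2 : 2 < p) {g : Γ} (hg : g ^ p = 1) {B : β}
    (hB : g • B = B) : cnt (fun y => D.I y B ∧ g • y = y) =
      2 * cnt (fun Δ => D.Meets B Δ ∧ g • Δ = Δ) := by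
  have h := cnt_mul_eq_cnt_mul (fun y => D.I y B ∧ g • y = y) (fun Δ => D.Meets B Δ ∧ g • Δ = Δ)
    (fun y Δ => (D.I y B ∧ g • y = y) ∧ Δ = D.cls y) (m := 1) (n := 2) (fun _ _ h => h.1)
    (by rintro y _ ⟨⟨h, h'⟩, rfl⟩; exact ⟨⟨y, h, rfl⟩, by rw [← D.cls_smul, h']⟩)
    (fun y hy => cnt_eq_one_of (D.cls y) ⟨hy, rfl⟩ fun _ h => h.2)
    (fun Δ hΔ => (cnt_congr fun y => ⟨fun h => ⟨h.1.1, h.2.symm⟩, fun h =>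
      ⟨⟨h.1, D.smul_eq_of_block hp hp2 hg hB h.1 (by rw [h.2]; exact hΔ.2)⟩, h.2.symm⟩⟩).trans
      (D.card_inter_of_meets hΔ.1))
  omega

theorem cnt_fixed_meets_modEq (D : ImprimDesign Γ P C β lam c d 2 s r b) (hp : p.Prime) {g : Γ}
    (hg : g ^ p = 1) {B : β} (hB : g • B = B) :
    s ≡ cnt (fun Δ => D.Meets B Δ ∧ g • Δ = Δ) [MOD p] := by
  have := cnt_modEq_cnt_fixed_of_pow hp hg (q := fun Δ => D.Meets B Δ)
    (D.meets_smul_iff_of_eq hB)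
  rwa [D.card_meets] at this

/-- The number of fixed blocks on a fixed point. -/
theorem cnt_fixed_blocks (hp : p.Prime) (hp2 : 2 < p) (hlp : lam < p) {g : Γ} (hg : g ^ p = 1)
    {x : P} (hx : g • x = x) : cnt (fun B => D.I x B ∧ g • B = B) =
      cnt (fun y => (D.cls y = D.cls x ∧ g • y = y) ∧ y ≠ x) * lam := by
  have hΔ : g • D.cls x = D.cls x := by rw [← D.cls_smul, hx]
  have h := cnt_mul_eq_cnt_mul (fun B => D.I x B ∧ g • B = B)
    (fun y => (D.cls y = D.cls x ∧ g • y = y) ∧ y ≠ x)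
    (fun B y => D.I x B ∧ D.I y B ∧ ((D.cls y = D.cls x ∧ g • y = y) ∧ y ≠ x)) (m := 1) (n := lam)
    (fun B y h => ⟨h.1, D.smul_block_eq_of_pow hp hlp hg h.2.2.2.symm hx h.2.2.1.2 h.1 h.2.1⟩)
    (fun _ _ h => h.2.2)
    (fun B hB => by
      have h1 := cnt_ne_add_one (p := fun y => D.I y B ∧ D.cls y = D.cls x) (x := x) ⟨hB.1, rfl⟩
      rw [D.card_inter x B hB.1] at h1
      rw [cnt_congr (q := fun y => (D.I y B ∧ D.cls y = D.cls x) ∧ y ≠ x)]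
      · omega
      · exact fun y => ⟨fun h => ⟨⟨h.2.1, h.2.2.1.1⟩, h.2.2.2⟩, fun h => ⟨hB.1, h.1.1, ⟨h.1.2,
          D.smul_eq_of_block hp hp2 hg hB.2 h.1.1 (by rw [h.1.2, hΔ])⟩, h.2⟩⟩)
    (fun y hy => (cnt_congr fun B => by simp [hy.1.1, hy.1.2, hy.2]).trans (D.pair x y hy.2.symm))
  rwa [mul_one] at h

/-- If fixed blocks have `u` or `w` fixed points, count pairs of a fixed point and a fixed block
on the fixed point `x`. -/
theorem fixed_blocks_equation (hp : p.Prime) (hlp : lam < p) {g : Γ} (hg : g ^ p = 1)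
    {u w : ℕ} (hu : 0 < u) (huw : u < w)
    (h : ∀ B : β, g • B = B → cnt (fun y => D.I y B ∧ g • y = y) = u ∨
      cnt (fun y => D.I y B ∧ g • y = y) = w) {x : P} (hx : g • x = x) :
    (u - 1) * cnt (fun B => D.I x B ∧ g • B = B) +
      (w - u) * cnt (fun B => (D.I x B ∧ g • B = B) ∧ cnt (fun y => D.I y B ∧ g • y = y) = w) + lam =
      lam * cnt (fun y : P => g • y = y) := by
  classical
  have h0 := cnt_ne_add_one (p := fun y : P => g • y = y) (x := x) hx
  have h1 := cnt_mul_eq_sum (fun y : P => g • y = y ∧ y ≠ x)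
    (fun y B => (g • y = y ∧ y ≠ x) ∧ (D.I x B ∧ D.I y B)) (m := lam) (fun _ _ h => h.1)
    (fun y hy => (cnt_congr fun B => by simp [hy.1, hy.2]).trans (D.pair x y hy.2.symm))
  have h2 : ∀ B, cnt (fun y => (g • y = y ∧ y ≠ x) ∧ (D.I x B ∧ D.I y B)) =
      (u - 1) * (if D.I x B ∧ g • B = B then 1 else 0) + (w - u) *
      (if (D.I x B ∧ g • B = B) ∧ cnt (fun y => D.I y B ∧ g • y = y) = w then 1 else 0) := by
    intro B
    by_cases hB : D.I x B ∧ g • B = B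
    · have h3 := cnt_ne_add_one (p := fun y => D.I y B ∧ g • y = y) (x := x) ⟨hB.1, hx⟩
      have h4 : cnt (fun y => (g • y = y ∧ y ≠ x) ∧ (D.I x B ∧ D.I y B)) =
          cnt (fun y => (D.I y B ∧ g • y = y) ∧ y ≠ x) := cnt_congr fun y => by
        have := hB.1
        tauto
      rw [h4, if_pos hB]
      rcases h B hB.2 with h5 | h5
      · rw [if_neg (by rintro ⟨-, h6⟩; omega)]
        omega
      · rw [if_pos ⟨hB, h5⟩]
        omega
    · rw [if_neg hB, if_neg (fun h => hB h.1), mul_zero, mul_zero, add_zero, cnt_eq_zero]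
      rintro y ⟨⟨hy, hne⟩, hxB, hyB⟩
      exact hB ⟨hxB, D.smul_block_eq_of_pow hp hlp hg hne.symm hx hy hxB hyB⟩
  rw [sum_congr rfl fun B _ => h2 B, sum_add_distrib, ← mul_sum, ← mul_sum] at h1
  rw [← h0, mul_add, mul_one, mul_comm lam, h1, cnt_eq_sum, cnt_eq_sum]
  congr!

end FixedPoints

end ImprimDesign

namespace ImprimDesign

open Finset MulAction

variable {Γ P C β : Type*} [Group Γ] [Fintype P] [Fintype C] [Fintype β]
    [MulAction Γ P] [MulAction Γ C] [MulAction Γ β]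

theorem cnt_fixed_eq {lam c d l s r b m : ℕ} (D : ImprimDesign Γ P C β lam c d l s r b) {g : Γ}
    (h : ∀ Δ : C, g • Δ = Δ → cnt (fun x => D.cls x = Δ ∧ g • x = x) = m) :
    cnt (fun x : P => g • x = x) = cnt (fun Δ : C => g • Δ = Δ) * m := by
  have := cnt_mul_eq_cnt_mul (fun x : P => g • x = x) (fun Δ : C => g • Δ = Δ)
    (fun x Δ => D.cls x = Δ ∧ g • x = x) (m := 1) (n := m) (fun _ _ h => h.2)
    (by rintro x _ ⟨rfl, h⟩; rw [← D.cls_smul, h])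
    (fun x hx => cnt_eq_one_of (D.cls x) ⟨rfl, hx⟩ fun _ h => h.1.symm) h
  omega

theorem cnt_fixed_class_modEq {lam c d l s r b p : ℕ} (D : ImprimDesign Γ P C β lam c d l s r b)
    (hp : p.Prime) {g : Γ} (hg : g ^ p = 1) {Δ : C} (hΔ : g • Δ = Δ) :
    c ≡ cnt (fun x => D.cls x = Δ ∧ g • x = x) [MOD p] := by
  have := cnt_modEq_cnt_fixed_of_pow hp hg (q := fun x => D.cls x = Δ) (D.cls_smul_iff_of_eq hΔ)
  rwa [D.card_cls] at this

theorem cnt_fixed_class_le {lam c d l s r b : ℕ} (D : ImprimDesign Γ P C β lam c d l s r b) (g : Γ)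
    (Δ : C) : cnt (fun x => D.cls x = Δ ∧ g • x = x) ≤ c :=
  (cnt_mono fun _ h => h.1).trans_eq (D.card_cls Δ)

theorem cnt_fixed_meets_le {lam c d l s r b : ℕ} (D : ImprimDesign Γ P C β lam c d l s r b) (g : Γ)
    (B : β) : cnt (fun Δ : C => D.Meets B Δ ∧ g • Δ = Δ) ≤ s :=
  (cnt_mono fun _ h => h.1).trans_eq (D.card_meets B)

theorem cnt_fixed_classes_le {lam c d l s r b : ℕ} (D : ImprimDesign Γ P C β lam c d l s r b)
    (g : Γ) : cnt (fun Δ : C => g • Δ = Δ) ≤ d :=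
  (cnt_le_card _).trans_eq D.card_C

theorem cnt_fixed_classes_modEq {lam c d l s r b p : ℕ} (D : ImprimDesign Γ P C β lam c d l s r b)
    (hp : p.Prime) {g : Γ} (hg : g ^ p = 1) : d ≡ cnt (fun Δ : C => g • Δ = Δ) [MOD p] := by
  have := cnt_modEq_cnt_fixed_of_pow (X := C) hp hg (q := fun _ => True) (fun _ => Iff.rfl)
  rw [cnt_true, D.card_C] at this
  simpa using this

variable (D : ImprimDesign Γ P C β 3 8 15 2 9 21 140)

theorem eq_one_of_fix_classes_8_15 (D : ImprimDesign Γ P C β 3 8 15 2 9 21 140) {g : Γ}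
    (hg : ∀ Δ : C, g • Δ = Δ) : g = 1 := by
  by_contra hg1
  obtain ⟨m, t, ht, hmt, hm, hm', ht'⟩ := D.kernel_blocks fun x y hxy =>
    D.kernel_transitive (by decide) hg1 (mem_classKernel.2 hg) hxy
  have hm5 : m ∣ 4 := by simpa using hm
  have := Nat.le_of_dvd (by norm_num) hm5
  have hm5 : m = 4 := by omega
  have ht1 : t = 1 := by omega
  obtain ⟨B⟩ := D.nonempty_β
  have h1 := cnt_ne_add_one (p := Conn (classKernel Γ C) B) ((conn_equivalence _).refl B)
  rw [hm'] at h1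
  have h2 := (D.intersections₁₈ rfl B).1
  have h3 : cnt (fun B' => Conn (classKernel Γ C) B B' ∧ B' ≠ B) ≤ cnt (fun B' => D.a B B' = 0) := by
    refine cnt_mono fun B' hB' => D.a_eq_zero_iff.2 fun x hx hx' => hB'.2 ?_
    obtain ⟨Z, -, hZ⟩ := exists_of_cnt_eq_one ((ht' B x ⟨x, hx, rfl⟩).trans ht1)
    exact (hZ B' ⟨hB'.1, hx'⟩).trans (hZ B ⟨(conn_equivalence _).refl B, hx⟩).symm
  omega

theorem eq_one_of_pow_five_8_15 (D : ImprimDesign Γ P C β 3 8 15 2 9 21 140) {g : Γ} (hg : g ^ 5 = 1) {Δ : C} (hΔ : g • Δ = Δ) : g = 1 := by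
  by_contra hg1
  have h5 : Nat.Prime 5 := by norm_num
  have h3 : ∀ Δ : C, g • Δ = Δ → cnt (fun x => D.cls x = Δ ∧ g • x = x) = 3 := by
    intro Δ hΔ
    have h1 := D.cnt_fixed_class_modEq h5 hg hΔ
    have h2 := D.cnt_fixed_class_le g Δ
    have h3 : cnt (fun x => D.cls x = Δ ∧ g • x = x) ≠ 8 := fun h =>
      hg1 (D.eq_one_of_fix_class (by norm_num) h5 (by norm_num) hg (Δ := Δ) fun x hx =>
        (eq_of_cnt_le (fun x (h : D.cls x = Δ ∧ g • x = x) => h.1)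
          (by rw [h, D.card_cls]) x hx).2)
    unfold Nat.ModEq at h1
    omega
  have hT := D.cnt_fixed_eq h3
  have hd := D.cnt_fixed_classes_modEq h5 hg
  have hd' := D.cnt_fixed_classes_le g
  have hd0 : 0 < cnt (fun Δ : C => g • Δ = Δ) := cnt_pos.2 ⟨Δ, hΔ⟩
  have hu : ∀ B : β, g • B = B → cnt (fun y => D.I y B ∧ g • y = y) = 8 ∨
      cnt (fun y => D.I y B ∧ g • y = y) = 18 := by
    intro B hB
    rw [D.cnt_fixed_block h5 (by norm_num) hg hB]
    have h1 := D.cnt_fixed_meets_modEq h5 hg hB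
    have h2 := D.cnt_fixed_meets_le g B
    unfold Nat.ModEq at h1
    omega
  have hN : ∀ x : P, g • x = x → cnt (fun B => D.I x B ∧ g • B = B) = 6 := by
    intro x hx
    rw [D.cnt_fixed_blocks h5 (by norm_num) (by norm_num) hg hx]
    have h1 := cnt_ne_add_one (p := fun y => D.cls y = D.cls x ∧ g • y = y) (x := x) ⟨rfl, hx⟩
    rw [h3 _ (by rw [← D.cls_smul, hx])] at h1
    omega
  have hJ : ∀ x : P, g • x = x → cnt (fun Δ : C => g • Δ = Δ) = 5 ∧
      cnt (fun B => (D.I x B ∧ g • B = B) ∧ cnt (fun y => D.I y B ∧ g • y = y) = 18) = 0 := by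
    intro x hx
    have h1 := D.fixed_blocks_equation h5 (by norm_num) hg (by norm_num) (by norm_num) hu hx
    have h2 : cnt (fun B => (D.I x B ∧ g • B = B) ∧ cnt (fun y => D.I y B ∧ g • y = y) = 18) ≤
      cnt (fun B => D.I x B ∧ g • B = B) := cnt_mono fun _ h => h.1
    rw [hN x hx] at h1 h2
    unfold Nat.ModEq at hd
    omega
  have h18 : ∀ B : β, g • B = B → cnt (fun y => D.I y B ∧ g • y = y) = 8 := by
    intro B hB
    refine (hu B hB).resolve_right fun h => ?_
    obtain ⟨x, hx⟩ := cnt_pos.1 (h.symm ▸ (by norm_num : 0 < 18))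
    exact cnt_eq_zero.1 (hJ x hx.2).2 B ⟨⟨hx.1, hB⟩, h⟩
  have h := cnt_mul_eq_cnt_mul (fun x : P => g • x = x) (fun B : β => g • B = B)
    (fun x B => D.I x B ∧ g • x = x ∧ g • B = B) (m := 6) (n := 8) (fun _ _ h => h.2.1)
    (fun _ _ h => h.2.2)
    (fun x hx => (cnt_congr fun B => by simp [hx]).trans (hN x hx))
    (fun B hB => (cnt_congr fun x => by simp [hB]).trans (h18 B hB))
  obtain ⟨x, -, hx⟩ := cnt_pos.1 ((h3 Δ hΔ).symm ▸ (by norm_num : 0 < 3))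
  have := (hJ x hx).1
  omega

theorem exists_smul_eq_of_cls_8_15 {x y y' : P} (hy : D.cls y = D.cls x) (hyx : y ≠ x)
    (hy' : D.cls y' = D.cls x) (hyx' : y' ≠ x) : ∃ g : Γ, g • x = x ∧ g • y = y' := by
  obtain ⟨n, hn, -⟩ := D.exists_mul_eq_of_stabilizer x (Conn (stabilizer Γ x) y)
    (by
      rintro ⟨g, hg, e⟩
      exact hyx (smul_left_cancel g (e.trans hg.symm)))
    (fun g hg z hz => (conn_smul_right hg y z).2 hz)
  have h1 := cnt_ne_add_one (p := fun z => D.cls z = D.cls x) (x := x) rfl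
  rw [D.card_cls] at h1
  have hsub : ∀ z, Conn (stabilizer Γ x) y z → D.cls z = D.cls x ∧ z ≠ x := by
    rintro _ ⟨g, hg, rfl⟩
    have hgx : g • x = x := hg
    refine ⟨by rw [D.cls_smul, hy, ← D.cls_smul, hgx], fun e => hyx (smul_left_cancel g (e.trans hgx.symm))⟩
  have h2 := cnt_mono hsub
  have h3 : 0 < cnt (Conn (stabilizer Γ x) y) := cnt_pos.2 ⟨y, (conn_equivalence _).refl y⟩
  exact eq_of_cnt_le hsub (by omega) y' ⟨hy', hyx'⟩

theorem exists_smul_of_fix_8_15 {h : Γ} (hh : h ^ 3 = 1) (h1 : h ≠ 1) (Δ : C) :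
    ∃ x, D.cls x = Δ ∧ h • x ≠ x := by
  by_contra! hΔ
  have := D.finite
  set L := fixingSubgroup Γ {x | D.cls x = Δ} with hL
  have hLm : ∀ g, g ∈ L ↔ ∀ x, D.cls x = Δ → g • x = x := fun g => mem_fixingSubgroup_iff Γ
  have hLΔ : ∀ g ∈ L, g • Δ = Δ := by
    intro g hg
    obtain ⟨x, rfl⟩ := D.exists_cls Δ
    rw [← D.cls_smul, (hLm g).1 hg x rfl]
  have hconj : ∀ g, g • Δ = Δ → ∀ h ∈ L, g * h * g⁻¹ ∈ L := by
    intro g hg h hh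
    refine (hLm _).2 fun x hx => ?_
    have hg' : g⁻¹ • Δ = Δ := by rw [inv_smul_eq_iff, hg]
    rw [mul_smul, mul_smul, (hLm h).1 hh _ ((D.cls_smul_iff_of_eq hg' x).2 hx), smul_inv_smul]
  refine h1 (D.eq_one_of_fix_classes_8_15 fun Δ' => ?_)
  by_cases hne : Δ' = Δ
  · rw [hne]
    exact hLΔ h ((hLm h).2 hΔ)
  have hO : ∀ Δ₁, Conn (stabilizer Γ Δ) Δ' Δ₁ → Δ₁ ≠ Δ := by
    rintro _ ⟨g, hg, rfl⟩ e
    exact hne (smul_left_cancel g (e.trans hg.symm))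
  obtain ⟨x, rfl⟩ := D.exists_cls Δ
  obtain ⟨n, hn, -⟩ := D.exists_mul_eq_of_class_stabilizer x (Conn (stabilizer Γ (D.cls x)) Δ')
    (fun h => hO _ h rfl) (fun g hg z hz => (conn_smul_right hg Δ' z).2 hz)
  have hcard := cnt_mono hO
  have h0 := cnt_ne_add_one (p := fun _ : C => True) (x := D.cls x) trivial
  rw [cnt_true, D.card_C] at h0
  have hpos : 0 < cnt (Conn (stabilizer Γ (D.cls x)) Δ') :=
    cnt_pos.2 ⟨Δ', (conn_equivalence _).refl Δ'⟩
  have hdvd := dvd_cnt_of_equivalence (conn_equivalence L) (p := Conn (stabilizer Γ (D.cls x)) Δ')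
    (m := cnt (Conn L Δ')) (by
      rintro z _ ⟨g, hg, rfl⟩ hz
      exact (conn_smul_right (hLΔ g hg) Δ' z).2 hz) (by
      rintro _ ⟨g, hg, rfl⟩
      have hg' : g⁻¹ • D.cls x = D.cls x := by rw [inv_smul_eq_iff, hg]
      refine (cnt_smul g _ _ fun z => (conn_smul (hconj g hg) (fun h hh => ?_) Δ' z).symm).symm
      simpa using hconj g⁻¹ hg' h hh)
  have h7 : ¬ 7 ∣ cnt (Conn L Δ') := by
    intro h
    obtain ⟨g, hg, hg1, hg7⟩ := exists_pow_eq_one_of_dvd_card (H := L) (p := 7) (by norm_num)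
      (h.trans (cnt_conn_dvd_card L Δ'))
    exact hg1 (D.eq_one_of_fix_class (by norm_num) (p := 7) (by norm_num) (by norm_num) hg7
      (Δ := D.cls x) ((hLm g).1 hg))
  refine smul_eq_of_cnt_lt (p := 3) (by norm_num) hh (q := Conn L Δ')
    (fun z => conn_smul_right ((hLm h).2 hΔ) Δ' z) ?_ Δ' ((conn_equivalence L).refl Δ')
  have h14 : cnt (Conn L Δ') ∣ 14 := by
    refine hdvd.trans ?_
    simp only [true_and] at h0
    have : cnt (Conn (stabilizer Γ (D.cls x)) Δ') = 7 ∨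
      cnt (Conn (stabilizer Γ (D.cls x)) Δ') = 14 := by omega
    rcases this with h | h
    · exact ⟨2, by omega⟩
    · exact ⟨1, by omega⟩
  have := Nat.le_of_dvd (by norm_num) h14
  generalize cnt (Conn L Δ') = m at *
  interval_cases m <;> omega

theorem cnt_fixed_8_15 {h : Γ} (hh : h ^ 3 = 1) (h1 : h ≠ 1) {Δ : C} (hΔ : h • Δ = Δ) :
    cnt (fun x => D.cls x = Δ ∧ h • x = x) = 2 := by
  classical
  have := D.finite
  have h2 := D.cnt_fixed_class_modEq (by norm_num) hh hΔ
  have h3 := cnt_and_add_not (fun x => D.cls x = Δ) (fun x => h • x = x)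
  obtain ⟨x, hx, hx'⟩ := D.exists_smul_of_fix_8_15 hh h1 Δ
  have h4 : 0 < cnt (fun x => D.cls x = Δ ∧ ¬ h • x = x) := cnt_pos.2 ⟨x, hx, hx'⟩
  rw [D.card_cls] at h3
  unfold Nat.ModEq at h2
  by_contra hne
  have h5 : cnt (fun x => D.cls x = Δ ∧ ¬ h • x = x) = 3 := by omega
  let X := {x // D.cls x = Δ}
  let _ : MulAction (stabilizer Γ Δ) X :=
    { smul := fun g x => ⟨g.1 • x.1, (D.cls_smul_iff_of_eq g.2 x.1).2 x.2⟩
      one_smul := fun x => Subtype.ext (one_smul Γ x.1)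
      mul_smul := fun g g' x => Subtype.ext (mul_smul g.1 g'.1 x.1) }
  have hcard : Fintype.card X = 8 := by
    rw [← Nat.card_eq_fintype_card, ← cnt_eq_natCard, D.card_cls]
  have htr : IsMultiplyPretransitive (stabilizer Γ Δ) X 2 := by
    rw [is_two_pretransitive_iff]
    rintro ⟨a, ha⟩ ⟨b, hb⟩ ⟨a', ha'⟩ ⟨b', hb'⟩ hab hab'
    have hab : b ≠ a := fun h => hab (Subtype.ext h.symm)
    have hab' : b' ≠ a' := fun h => hab' (Subtype.ext h.symm)
    obtain ⟨g, rfl⟩ := D.exists_smul_point a a'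
    have hg : g • Δ = Δ := by rw [← ha, ← D.cls_smul, ha', ha]
    obtain ⟨g', hg', rfl⟩ := D.exists_smul_eq_of_cls_8_15 (x := g • a) (y := g • b) (y' := b')
      (by rw [D.cls_smul, D.cls_smul, ha, hb]) ((MulAction.injective g).ne hab)
      (by rw [ha', hb']) hab'
    refine ⟨⟨g' * g, ?_⟩, Subtype.ext ?_, Subtype.ext (mul_smul _ _ _)⟩
    · rw [mem_stabilizer_iff, mul_smul, hg, ← ha', ← D.cls_smul, hg']
    · exact (mul_smul _ _ _).trans hg'
  have h6 := isMultiplyPretransitive_of_prime_cycle (p := 3) htr (by norm_num)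
    (g := (⟨h, hΔ⟩ : stabilizer Γ Δ)) (Subtype.ext hh) ?_ (by rw [hcard]; norm_num)
  · rw [hcard] at h6
    obtain ⟨f⟩ : Nonempty (Fin 6 ↪ X) := by
      rw [Function.Embedding.nonempty_iff_card_le, hcard, Fintype.card_fin]
      norm_num
    have h7 := cnt_conn_dvd_card (⊤ : Subgroup (stabilizer Γ Δ)) f
    rw [cnt_congr (q := fun _ => True) fun f' => iff_of_true ?_ trivial, cnt_true,
      Fintype.card_embedding_eq, Fintype.card_fin, hcard, Subgroup.card_top] at h7
    · obtain ⟨g, hg, hg1, hg5⟩ := exists_pow_eq_one_of_dvd_card (H := stabilizer Γ Δ) (p := 5)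
        (by norm_num) (Dvd.dvd.trans (by decide) h7)
      exact hg1 (D.eq_one_of_pow_five_8_15 hg5 hg)
    · obtain ⟨g, hg⟩ := h6.exists_smul_eq f f'
      exact ⟨g, Subgroup.mem_top g, hg⟩
  · refine Eq.trans ?_ h5
    refine le_antisymm (cnt_le_of_injOn Subtype.val ?_ fun _ _ _ _ => Subtype.ext) ?_
    · exact fun y hy => ⟨y.2, fun e => hy (Subtype.ext e)⟩
    · refine cnt_le_of_injOn (fun y => if hy : D.cls y = Δ then ⟨y, hy⟩ else ⟨x, hx⟩) ?_ ?_
      · intro y hy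
        simp only [hy.1, dite_true]
        exact fun e => hy.2 (congrArg Subtype.val e)
      · intro y y' hy hy' e
        simp only [hy.1, hy'.1, dite_true] at e
        exact congrArg Subtype.val e

end ImprimDesign

section Actions

open Finset MulAction

variable {Γ X : Type*} [Group Γ] [MulAction Γ X]

theorem eq_or_eq_of_pow_three [Fintype X] {h : Γ} (hh : h ^ 3 = 1) {q : X → Prop}
    (hq : ∀ x, q (h • x) ↔ q x) (h3 : cnt q ≤ 3) {p x : X} (hqp : q p) (hp : h • p ≠ p) (hx : q x) :
    x = p ∨ x = h • p ∨ x = h • h • p := by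
  obtain ⟨i, rfl⟩ := exists_zpow_smul_eq (by norm_num) hh hq h3 hqp hp hx
  have h1 : h ^ i = h ^ (i % 3) := by
    conv_lhs => rw [← Int.emod_add_mul_ediv i 3, zpow_add, zpow_mul]
    rw [show h ^ (3 : ℤ) = 1 by exact_mod_cast hh, one_zpow, mul_one]
  have h2 : i % 3 = 0 ∨ i % 3 = 1 ∨ i % 3 = 2 := by omega
  rw [h1]
  rcases h2 with h2 | h2 | h2
  · simp [h2]
  · simp [h2]
  · right; right
    rw [h2, show h ^ (2 : ℤ) = h * h by rw [← pow_two]; norm_cast, mul_smul]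

theorem prime_dvd_card_of_mem [Finite Γ] {p : ℕ} (hp : p.Prime) {H : Subgroup Γ} {h : Γ}
    (hh : h ^ p = 1) (h1 : h ≠ 1) (hH : h ∈ H) : p ∣ Nat.card H := by
  have := Fact.mk hp
  have := Subgroup.orderOf_dvd_natCard H hH
  rwa [orderOf_eq_prime hh h1] at this

end Actions

namespace ImprimDesign

open Finset MulAction

variable {Γ P C β : Type*} [Group Γ] [Fintype P] [Fintype C] [Fintype β]
    [MulAction Γ P] [MulAction Γ C] [MulAction Γ β]

theorem cnt_conn_stabilizer_meets {lam c d l s r b : ℕ} (D : ImprimDesign Γ P C β lam c d l s r b)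
    {B : β} {Δ : C} (hΔ : D.Meets B Δ) (Δ' : C) :
    Conn (stabilizer Γ B) Δ Δ' ↔ D.Meets B Δ' := by
  constructor
  · rintro ⟨g, hg, rfl⟩
    exact (D.meets_smul_iff_of_eq hg Δ).2 hΔ
  · rintro ⟨y, hy, rfl⟩
    obtain ⟨x, hx, rfl⟩ := hΔ
    obtain ⟨g, rfl, hg⟩ := D.flag x B y B hx hy
    exact ⟨g, hg, (D.cls_smul g x).symm⟩

theorem conn_stabilizer_block {lam c d l s r b : ℕ} (D : ImprimDesign Γ P C β lam c d l s r b)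
    {x : P} {B : β} (hx : D.I x B) (B' : β) : Conn (stabilizer Γ x) B B' ↔ D.I x B' := by
  constructor
  · rintro ⟨g, hg, rfl⟩
    exact (D.I_smul_block hg).2 hx
  · intro hB'
    obtain ⟨g, hg, rfl⟩ := D.flag x B x B' hx hB'
    exact ⟨g, hg, rfl⟩

theorem cnt_not_meets {lam c d l s r b : ℕ} (D : ImprimDesign Γ P C β lam c d l s r b) (B : β) :
    cnt (fun Δ => ¬ D.Meets B Δ) = d - s := by
  have h := cnt_add_not (fun Δ => D.Meets B Δ)
  rw [D.card_meets, D.card_C] at h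
  omega

variable (D : ImprimDesign Γ P C β 3 8 15 2 9 21 140)

theorem not_nine_dvd_8_15 (D : ImprimDesign Γ P C β 3 8 15 2 9 21 140) (Δ : C) :
    ¬ 9 ∣ Nat.card (stabilizer Γ Δ) := by
  intro h9
  have := D.finite
  have hp3 : Nat.Prime 3 := by norm_num
  have := Fact.mk hp3
  obtain ⟨R, hR, hcard⟩ := exists_subgroup_card (k := 2) hp3 h9
  have hRp : IsPGroup 3 R := IsPGroup.of_card hcard
  have h1 := cnt_modEq_cnt_fixed hRp (q := fun x => D.cls x = Δ)
    (fun h hh x hx => (D.cls_smul_iff_of_eq (hR hh) x).2 hx)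
  have h2 := cnt_and_add_not (fun x => D.cls x = Δ) (fun x => ∀ h ∈ R, h • x = x)
  rw [D.card_cls] at h1 h2
  unfold Nat.ModEq at h1
  by_cases h3 : cnt (fun x => D.cls x = Δ ∧ ∀ h ∈ R, h • x = x) = 2
  · obtain ⟨x, hx, hx'⟩ := cnt_pos.1
      (show 0 < cnt (fun x => D.cls x = Δ ∧ ¬ ∀ h ∈ R, h • x = x) by omega)
    have h4 := cnt_conn_mul_card R x
    rw [hcard] at h4
    have h5 : cnt (Conn R x) ≤ cnt (fun x => D.cls x = Δ ∧ ¬ ∀ h ∈ R, h • x = x) := by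
      refine cnt_mono ?_
      rintro _ ⟨g, hg, rfl⟩
      refine ⟨(D.cls_smul_iff_of_eq (hR hg) x).2 hx, fun h => hx' fun k hk => ?_⟩
      have := h (g * k * g⁻¹) (R.mul_mem (R.mul_mem hg hk) (R.inv_mem hg))
      rw [mul_smul, inv_smul_smul, mul_smul] at this
      exact smul_left_cancel g this
    have h6 : 3 ∣ Nat.card (R ⊓ stabilizer Γ x : Subgroup Γ) := by
      have h7 : cnt (Conn R x) ≤ 6 := by omega
      generalize cnt (Conn R x) = m at h4 h7
      interval_cases m <;> omega
    obtain ⟨g, hg, hg1, hg3⟩ := exists_pow_eq_one_of_dvd_card hp3 h6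
    have h7 := D.cnt_fixed_8_15 hg3 hg1 (hR hg.1)
    have h8 := eq_of_cnt_le (p := fun x => D.cls x = Δ ∧ ∀ h ∈ R, h • x = x)
      (q := fun x => D.cls x = Δ ∧ g • x = x) (fun x hx => ⟨hx.1, hx.2 g hg.1⟩)
      (by omega) x ⟨hx, hg.2⟩
    exact hx' h8.2
  · obtain ⟨g, hg, hg1, hg3⟩ := exists_pow_eq_one_of_dvd_card (H := R) hp3 (by rw [hcard]; norm_num)
    have h7 := D.cnt_fixed_8_15 hg3 hg1 (hR hg)
    have h8 : cnt (fun x => D.cls x = Δ ∧ ∀ h ∈ R, h • x = x) ≤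
      cnt (fun x => D.cls x = Δ ∧ g • x = x) := cnt_mono fun x hx => ⟨hx.1, hx.2 g hg⟩
    omega

theorem eq_one_of_fix_meets_8_15 {h : Γ} (hh : h ^ 3 = 1) {B : β} (hB : h • B = B) {Δ : C}
    (hΔ : h • Δ = Δ) (hBΔ : D.Meets B Δ) : h = 1 := by
  by_contra h1
  have := D.finite
  obtain ⟨x, hx, rfl⟩ := hBΔ
  have hx' := D.smul_eq_of_block (by norm_num) (by norm_num) hh hB hx hΔ
  have h2 := cnt_conn_mul_card (stabilizer Γ x) B
  rw [cnt_congr (D.conn_stabilizer_block hx), D.card_pt] at h2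
  obtain ⟨n, hn⟩ := prime_dvd_card_of_mem (H := stabilizer Γ x ⊓ stabilizer Γ B)
    (by norm_num : Nat.Prime 3) hh h1 ⟨hx', hB⟩
  refine D.not_nine_dvd_8_15 (D.cls x) (Dvd.dvd.trans ⟨7 * n, ?_⟩
    (Subgroup.card_dvd_of_le (H := stabilizer Γ x) fun g hg => ?_))
  · rw [← h2, hn]; ring
  · have hg' : g • x = x := hg
    rw [mem_stabilizer_iff, ← D.cls_smul, hg']

theorem fixed_classes_le_8_15 (D : ImprimDesign Γ P C β 3 8 15 2 9 21 140) {h : Γ} (hh : h ^ 3 = 1) (h1 : h ≠ 1) :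
    36 * cnt (fun Δ : C => h • Δ = Δ) ≤ 60 + 15 * cnt (fun B : β => h • B = B) := by
  classical
  have h2 := D.sum_a_smul h
  have h3 := cnt_add_not (fun x : P => h • x = x)
  have h4 := D.cnt_fixed_eq fun Δ hΔ => D.cnt_fixed_8_15 hh h1 hΔ
  have h5 : ∀ B : β, D.a B (h • B) ≤ 3 + 15 * (if h • B = B then 1 else 0) := by
    intro B
    by_cases hB : h • B = B
    · rw [if_pos hB, hB, D.a_self]
    · have := (D.intersections₁₈ rfl B).2 _ hB
      rw [if_neg hB]
      omega
  have h6 := sum_le_sum fun B (_ : B ∈ (univ : Finset β)) => h5 B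
  rw [sum_add_distrib, ← mul_sum, sum_const, card_univ, D.card_B, h2] at h6
  have h7 : ∑ B : β, (if h • B = B then 1 else 0) = cnt (fun B : β => h • B = B) := by
    rw [cnt_eq_sum]
  rw [h7] at h6
  have h8 := D.card_P
  norm_num at h6
  omega

theorem cnt_same_classes_8_15 (B : β) :
    cnt (fun B' => ∀ Δ, D.Meets B Δ ↔ D.Meets B' Δ) ≤ 4 := by
  have hE : Equivalence fun B B' : β => ∀ Δ, D.Meets B Δ ↔ D.Meets B' Δ :=
    ⟨fun _ _ => Iff.rfl, fun h Δ => (h Δ).symm, fun h h' Δ => (h Δ).trans (h' Δ)⟩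
  have hm : ∀ B' : β, cnt (fun B'' => ∀ Δ, D.Meets B' Δ ↔ D.Meets B'' Δ) =
      cnt (fun B'' => ∀ Δ, D.Meets B Δ ↔ D.Meets B'' Δ) := by
    intro B'
    obtain ⟨g, rfl⟩ := D.exists_smul_block B B'
    refine (cnt_smul g _ _ fun B'' => ⟨fun h Δ => ?_, fun h Δ => ?_⟩).symm
    · rw [← smul_inv_smul g Δ, D.meets_smul, D.meets_smul, h]
    · rw [← D.meets_smul g B, ← D.meets_smul g B'', h]
  obtain ⟨Δ⟩ := D.nonempty_C
  obtain ⟨Δ', -, hne⟩ := exists_ne_of_one_lt_cnt (p := fun _ : C => True)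
    (by rw [cnt_true, D.card_C]; norm_num) Δ
  have h1 := dvd_cnt_of_equivalence hE (p := fun B => D.Meets B Δ ∧ D.Meets B Δ')
    (fun B B' h hB => ⟨(h Δ).1 hB.1, (h Δ').1 hB.2⟩) (fun B' _ => hm B')
  have h2 := dvd_cnt_of_equivalence hE (p := fun _ => True) (fun _ _ _ _ => trivial) fun B' _ => hm B'
  rw [cnt_true, D.card_B] at h2
  have h3 := D.card_blocks_meets₂ Δ Δ' hne.symm
  have h4 : cnt (fun B => D.Meets B Δ ∧ D.Meets B Δ') = 48 := by omega
  rw [h4] at h1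
  exact Nat.le_of_dvd (by norm_num) (Nat.dvd_gcd h1 h2)

/-- Elements of order three fixing a block and a class. -/
def Rot (_ : ImprimDesign Γ P C β 3 8 15 2 9 21 140) (B : β) (h : Γ) : Prop :=
  h ≠ 1 ∧ h ^ 3 = 1 ∧ h • B = B ∧ ∃ Δ : C, h • Δ = Δ

variable {D} {B : β}

theorem Rot.not_meets {h : Γ} (hr : D.Rot B h) {Δ : C} (hΔ : h • Δ = Δ) : ¬ D.Meets B Δ :=
  fun hB => hr.1 (D.eq_one_of_fix_meets_8_15 hr.2.1 hr.2.2.1 hΔ hB)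

theorem Rot.cnt_fixed {h : Γ} (hr : D.Rot B h) : cnt (fun Δ : C => h • Δ = Δ) = 3 := by
  have h1 := D.cnt_not_meets B
  have h2 : cnt (fun Δ : C => h • Δ = Δ) ≤ cnt (fun Δ => ¬ D.Meets B Δ) :=
    cnt_mono fun Δ hΔ => hr.not_meets hΔ
  have h3 := D.cnt_fixed_classes_modEq (by norm_num) hr.2.1
  have h4 : 0 < cnt (fun Δ : C => h • Δ = Δ) := cnt_pos.2 hr.2.2.2
  unfold Nat.ModEq at h3
  by_contra hne
  have h6 : cnt (fun Δ : C => h • Δ = Δ) = 6 := by omega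
  have h7 := D.fixed_classes_le_8_15 hr.2.1 hr.1
  have h8 : cnt (fun B : β => h • B = B) ≤ cnt (fun B' => ∀ Δ, D.Meets B Δ ↔ D.Meets B' Δ) := by
    refine cnt_mono fun B' hB' Δ => ⟨fun hΔ => ?_, fun hΔ => ?_⟩
    · have hr' : D.Rot B' h := ⟨hr.1, hr.2.1, hB', hr.2.2.2⟩
      by_contra hΔ'
      refine hr.not_meets (eq_of_cnt_le (p := fun Δ : C => h • Δ = Δ)
        (q := fun Δ => ¬ D.Meets B' Δ) (fun Δ hΔ => hr'.not_meets hΔ) ?_ Δ hΔ') hΔ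
      rw [D.cnt_not_meets, h6]
    · have hr' : D.Rot B' h := ⟨hr.1, hr.2.1, hB', hr.2.2.2⟩
      by_contra hΔ'
      refine hr'.not_meets (eq_of_cnt_le (p := fun Δ : C => h • Δ = Δ)
        (q := fun Δ => ¬ D.Meets B Δ) (fun Δ hΔ => hr.not_meets hΔ) ?_ Δ hΔ') hΔ
      rw [D.cnt_not_meets, h6]
  have := D.cnt_same_classes_8_15 B
  omega

theorem Rot.cnt_moved {h : Γ} (hr : D.Rot B h) :
    cnt (fun Δ => ¬ D.Meets B Δ ∧ h • Δ ≠ Δ) = 3 := by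
  have h1 := D.cnt_not_meets B
  have h2 := cnt_and_add_not (fun Δ => ¬ D.Meets B Δ) (fun Δ => h • Δ = Δ)
  have h3 : cnt (fun Δ => ¬ D.Meets B Δ ∧ h • Δ = Δ) = cnt (fun Δ : C => h • Δ = Δ) :=
    cnt_congr fun Δ => ⟨fun h => h.2, fun h => ⟨hr.not_meets h, h⟩⟩
  have := hr.cnt_fixed
  simp only [ne_eq]
  omega

theorem Rot.not_meets_iff {h : Γ} (hr : D.Rot B h) (Δ : C) :
    ¬ D.Meets B (h • Δ) ↔ ¬ D.Meets B Δ := not_congr (D.meets_smul_iff_of_eq hr.2.2.1 Δ)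

theorem Rot.eq_or_eq {h : Γ} (hr : D.Rot B h) {p x : C} (hp : ¬ D.Meets B p) (hp' : h • p ≠ p)
    (hx : ¬ D.Meets B x) (hx' : h • x ≠ x) : x = p ∨ x = h • p ∨ x = h • h • p :=
  eq_or_eq_of_pow_three hr.2.1 (q := fun Δ => ¬ D.Meets B Δ ∧ h • Δ ≠ Δ)
    (fun Δ => and_congr (hr.not_meets_iff Δ) (smul_ne_iff h Δ)) hr.cnt_moved.le ⟨hp, hp'⟩ hp' ⟨hx, hx'⟩

variable (D)

theorem eq_one_of_fix_not_meets_8_15 {g : Γ} (hg : g • B = B)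
    (hΔ : ∀ Δ, ¬ D.Meets B Δ → g • Δ = Δ) : g = 1 := by
  have := D.finite
  set Y := stabilizer Γ B ⊓ fixingSubgroup Γ {Δ | ¬ D.Meets B Δ} with hY
  have hYm : ∀ g, g ∈ Y ↔ g • B = B ∧ ∀ Δ, ¬ D.Meets B Δ → g • Δ = Δ := fun g =>
    and_congr Iff.rfl (mem_fixingSubgroup_iff Γ)
  obtain ⟨Δ₀, hΔ₀⟩ := cnt_pos.1 (D.cnt_not_meets B ▸ (by norm_num : 0 < 15 - 9))
  have h3 : ¬ 3 ∣ Nat.card Y := by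
    intro h
    obtain ⟨h, hh, hh1, hh3⟩ := exists_pow_eq_one_of_dvd_card (by norm_num) h
    have hr : D.Rot B h := ⟨hh1, hh3, hh.1, Δ₀, ((hYm h).1 hh).2 Δ₀ hΔ₀⟩
    have h1 := hr.cnt_moved
    rw [(cnt_eq_zero (p := fun Δ => ¬ D.Meets B Δ ∧ h • Δ ≠ Δ)).2
      fun Δ hΔ => hΔ.2 (((hYm h).1 hh).2 Δ hΔ.1)] at h1
    omega
  have hconj : ∀ g, g • B = B → ∀ h ∈ Y, g * h * g⁻¹ ∈ Y := by
    intro g hg h hh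
    have hg' : g⁻¹ • B = B := by rw [inv_smul_eq_iff, hg]
    refine (hYm _).2 ⟨by rw [mul_smul, mul_smul, hg', ((hYm h).1 hh).1, hg], fun Δ hΔ => ?_⟩
    rw [mul_smul, mul_smul, ((hYm h).1 hh).2 _ (fun h => hΔ ((D.meets_smul_iff_of_eq hg' Δ).1 h)),
      smul_inv_smul]
  refine D.eq_one_of_fix_classes_8_15 fun Δ => ?_
  by_cases hBΔ : D.Meets B Δ
  swap
  · exact hΔ Δ hBΔ
  have hdvd := dvd_cnt_of_equivalence (conn_equivalence Y) (p := fun Δ => D.Meets B Δ)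
    (m := cnt (Conn Y Δ)) (by
      rintro z _ ⟨g, hg, rfl⟩ hz
      exact (D.meets_smul_iff_of_eq hg.1 z).2 hz) (by
      intro Δ' hΔ'
      obtain ⟨g, hg, rfl⟩ := (D.cnt_conn_stabilizer_meets hBΔ Δ').2 hΔ'
      have hg : g • B = B := hg
      have hg' : g⁻¹ • B = B := by rw [inv_smul_eq_iff, hg]
      refine (cnt_smul g _ _ fun z => (conn_smul (hconj g hg) (fun h hh => ?_) Δ z).symm).symm
      simpa using hconj g⁻¹ hg' h hh)
  rw [D.card_meets] at hdvd
  have h4 := cnt_conn_dvd_card Y Δ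
  have h5 : cnt (Conn Y Δ) = 1 := by
    have h6 : ¬ 3 ∣ cnt (Conn Y Δ) := fun h => h3 (h.trans h4)
    have := Nat.le_of_dvd (by norm_num) hdvd
    generalize cnt (Conn Y Δ) = m at *
    interval_cases m <;> omega
  obtain ⟨z, -, hz⟩ := exists_of_cnt_eq_one h5
  exact (hz _ ⟨g, (hYm g).2 ⟨hg, hΔ⟩, rfl⟩).trans (hz _ ((conn_equivalence Y).refl Δ)).symm

variable {D}

/-- Two elements whose supports off a block share a single class generate a five-cycle. -/
theorem Rot.cnt_ne_one {h h' : Γ} (hr : D.Rot B h) (hr' : D.Rot B h') :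
    cnt (fun Δ => (¬ D.Meets B Δ ∧ h • Δ ≠ Δ) ∧ h' • Δ ≠ Δ) ≠ 1 := by
  intro h1
  obtain ⟨p, ⟨⟨hp, hph⟩, hph'⟩, hi⟩ := exists_of_cnt_eq_one h1
  obtain ⟨h2, h3⟩ := five_cycle (W := fun Δ => ¬ D.Meets B Δ) hr.2.1 hr'.2.1 hr.not_meets_iff hr'.not_meets_iff hp hph hph'
    (fun x hx hxh => hr.eq_or_eq hp hph hx hxh) (fun x hx hxh => hr'.eq_or_eq hp hph' hx hxh)
    (fun x hx hxh hxh' => hi x ⟨⟨hx, hxh⟩, hxh'⟩)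
  have hB : (h' * h) • B = B := by rw [mul_smul, hr.2.2.1, hr'.2.2.1]
  have h5 : (h' * h) ^ 5 = 1 := D.eq_one_of_fix_not_meets_8_15
    (B := B) (MulAction.mem_stabilizer_iff.1 (pow_mem (MulAction.mem_stabilizer_iff.2 hB) 5)) h3
  have h6 := cnt_and_add_not (fun Δ => ¬ D.Meets B Δ ∧ h' • Δ ≠ Δ) (fun Δ => h • Δ ≠ Δ)
  have h7 := cnt_and_add_not (fun Δ => ¬ D.Meets B Δ ∧ ¬ h • Δ ≠ Δ) (fun Δ => h' • Δ ≠ Δ)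
  have h8 := cnt_and_add_not (fun Δ => ¬ D.Meets B Δ) (fun Δ => h • Δ ≠ Δ)
  have h9 : cnt (fun Δ => (¬ D.Meets B Δ ∧ h' • Δ ≠ Δ) ∧ h • Δ ≠ Δ) = 1 :=
    (cnt_congr fun Δ => by rw [and_right_comm]).trans h1
  have h10 : cnt (fun Δ => (¬ D.Meets B Δ ∧ h' • Δ ≠ Δ) ∧ ¬ h • Δ ≠ Δ) =
    cnt (fun Δ => (¬ D.Meets B Δ ∧ ¬ h • Δ ≠ Δ) ∧ h' • Δ ≠ Δ) :=
    cnt_congr fun Δ => by rw [and_right_comm]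
  rw [hr'.cnt_moved] at h6
  rw [hr.cnt_moved, D.cnt_not_meets] at h8
  obtain ⟨Δ, ⟨hΔ, hΔh⟩, hΔh'⟩ := cnt_pos.1
    (show 0 < cnt (fun Δ => (¬ D.Meets B Δ ∧ ¬ h • Δ ≠ Δ) ∧ ¬ h' • Δ ≠ Δ) by omega)
  have h11 := D.eq_one_of_pow_five_8_15 h5 (Δ := Δ)
    (by rw [mul_smul, not_not.1 hΔh, not_not.1 hΔh'])
  rw [h11, one_smul] at h2
  exact h2 rfl

theorem Rot.cnt_le_two [Fintype Γ] {h : Γ} (hr : D.Rot B h) :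
    cnt (fun h' : Γ => D.Rot B h' ∧ ∀ Δ : C, h • Δ = Δ → h' • Δ = Δ) ≤ 2 := by
  obtain ⟨p, hp, hph⟩ := cnt_pos.1 (hr.cnt_moved.symm ▸ (by norm_num : 0 < 3))
  have h1 := cnt_ne_add_one (p := fun Δ => ¬ D.Meets B Δ ∧ h • Δ ≠ Δ) ⟨hp, hph⟩
  rw [hr.cnt_moved] at h1
  have hfix : ∀ h' : Γ, D.Rot B h' → (∀ Δ : C, h • Δ = Δ → h' • Δ = Δ) →
      ∀ Δ, h' • Δ = Δ → h • Δ = Δ := fun h' hr' hle => eq_of_cnt_le (p := fun Δ : C => h • Δ = Δ)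
    (q := fun Δ : C => h' • Δ = Δ) hle (by rw [hr.cnt_fixed, hr'.cnt_fixed])
  refine (cnt_le_of_injOn (q := fun Δ => (¬ D.Meets B Δ ∧ h • Δ ≠ Δ) ∧ Δ ≠ p)
    (fun h' : Γ => h' • p) ?_ ?_).trans_eq (by omega)
  · rintro h' ⟨hr', hle⟩
    refine ⟨⟨(hr'.not_meets_iff p).2 hp, fun e => hph ?_⟩, fun e => hph (hfix h' hr' hle p e)⟩
    exact hfix h' hr' hle p (smul_left_cancel h' (hle _ e))
  · rintro h₁ h₂ ⟨hr₁, hle₁⟩ ⟨hr₂, hle₂⟩ e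
    have e : h₁ • p = h₂ • p := e
    have hp₁ : h₁ • p ≠ p := fun e => hph (hfix _ hr₁ hle₁ p e)
    have hp₂ : h₂ • p ≠ p := fun e => hph (hfix _ hr₂ hle₂ p e)
    have e2 : h₁ • h₁ • p = h₂ • h₂ • p := by
      have h3 := hr₁.eq_or_eq (x := h₂ • h₂ • p) hp hp₁
        ((hr₂.not_meets_iff _).2 ((hr₂.not_meets_iff p).2 hp)) (fun e' => ?_)
      · rcases h3 with h3 | h3 | h3
        · exact absurd h3 (smul_smul_ne_of_pow hr₂.2.1 hp₂)
        · rw [e] at h3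
          exact absurd (smul_left_cancel h₂ h3) hp₂
        · exact h3.symm
      · have := hle₂ _ (hfix _ hr₁ hle₁ _ e')
        exact hp₂ (smul_left_cancel h₂ (smul_left_cancel h₂ this))
    have h4 : h₁⁻¹ * h₂ = 1 := by
      refine D.eq_one_of_fix_not_meets_8_15 (B := B)
        (by rw [mul_smul, hr₂.2.2.1, inv_smul_eq_iff, hr₁.2.2.1]) fun Δ hΔ => ?_
      rw [mul_smul, inv_smul_eq_iff]
      by_cases hΔh : h • Δ = Δ
      · rw [hle₁ Δ hΔh, hle₂ Δ hΔh]
      · rcases hr₁.eq_or_eq hp hp₁ hΔ (fun e => hΔh (hfix _ hr₁ hle₁ _ e)) with rfl | rfl | rfl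
        · exact e.symm
        · rw [e2, e]
        · rw [smul_smul_smul_of_pow hr₁.2.1, e2, smul_smul_smul_of_pow hr₂.2.1]
    exact (inv_mul_eq_one.1 h4)

variable (D)

theorem exists_rot_8_15 (B : β) : ∃ h h', D.Rot B h ∧ D.Rot B h' ∧
    ∀ Δ, ¬ D.Meets B Δ → (h • Δ = Δ ↔ h' • Δ ≠ Δ) := by
  have := D.finite
  have hp3 : Nat.Prime 3 := by norm_num
  obtain ⟨Δ₀, hΔ₀⟩ := cnt_pos.1 (D.card_meets B ▸ (by norm_num : 0 < 9))
  have h9 := cnt_conn_dvd_card (stabilizer Γ B) Δ₀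
  rw [cnt_congr (D.cnt_conn_stabilizer_meets hΔ₀), D.card_meets] at h9
  obtain ⟨R, hR, hcard⟩ := exists_subgroup_card (k := 2) hp3 h9
  have hW : ∀ Δ Δ', ¬ D.Meets B Δ → Conn R Δ Δ' → ¬ D.Meets B Δ' := by
    rintro Δ _ hΔ ⟨g, hg, rfl⟩
    exact fun h => hΔ ((D.meets_smul_iff_of_eq (hR hg) Δ).1 h)
  have h3 : ∀ Δ, ¬ D.Meets B Δ → cnt (Conn R Δ) = 3 ∧
      Nat.card (R ⊓ stabilizer Γ Δ : Subgroup Γ) = 3 := by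
    intro Δ hΔ
    have h1 := cnt_conn_mul_card R Δ
    have h2 := (cnt_mono fun Δ' => hW Δ Δ' hΔ).trans_eq (D.cnt_not_meets B)
    rw [hcard] at h1
    have h3 : Nat.card (R ⊓ stabilizer Γ Δ : Subgroup Γ) ≠ 9 := fun h =>
      D.not_nine_dvd_8_15 Δ (h ▸ Subgroup.card_dvd_of_le inf_le_right)
    generalize cnt (Conn R Δ) = m at h1 h2 ⊢
    have h2 : m ≤ 6 := h2
    interval_cases m <;> omega
  have key : ∀ Δ, ¬ D.Meets B Δ → ∃ h, D.Rot B h ∧ ∀ Δ', h • Δ' = Δ' ↔ Conn R Δ Δ' := by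
    intro Δ hΔ
    obtain ⟨h, hh, h1, hh3⟩ := exists_pow_eq_one_of_dvd_card (p := 3) hp3
      (dvd_of_eq (h3 Δ hΔ).2.symm)
    have hΔh : h • Δ = Δ := hh.2
    have hr : D.Rot B h := ⟨h1, hh3, hR hh.1, Δ, hΔh⟩
    have h4 := cnt_modEq_cnt_fixed_of_pow hp3 hh3 (q := Conn R Δ)
      (fun z => conn_smul_right hh.1 Δ z)
    have h5 : 0 < cnt (fun Δ' => Conn R Δ Δ' ∧ h • Δ' = Δ') :=
      cnt_pos.2 ⟨Δ, (conn_equivalence R).refl Δ, hΔh⟩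
    have h6 : cnt (fun Δ' => Conn R Δ Δ' ∧ h • Δ' = Δ') ≤ cnt (Conn R Δ) := cnt_mono fun _ h => h.1
    rw [(h3 Δ hΔ).1] at h4 h6
    unfold Nat.ModEq at h4
    have h7 : ∀ Δ', Conn R Δ Δ' → h • Δ' = Δ' := fun Δ' hΔ' =>
      (eq_of_cnt_le (fun Δ' (h : Conn R Δ Δ' ∧ h • Δ' = Δ') => h.1)
        (by rw [(h3 Δ hΔ).1]; omega) Δ' hΔ').2
    exact ⟨h, hr, fun Δ' => ⟨eq_of_cnt_le (p := Conn R Δ) (q := fun Δ' => h • Δ' = Δ') h7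
      (by rw [hr.cnt_fixed, (h3 Δ hΔ).1]) Δ', h7 Δ'⟩⟩
  obtain ⟨Δ₁, hΔ₁⟩ := cnt_pos.1 (D.cnt_not_meets B ▸ (by norm_num : 0 < 15 - 9))
  have h4 := cnt_and_add_not (fun Δ => ¬ D.Meets B Δ) (Conn R Δ₁)
  have h5 : cnt (fun Δ => ¬ D.Meets B Δ ∧ Conn R Δ₁ Δ) = 3 :=
    (cnt_congr fun Δ => ⟨fun h => h.2, fun h => ⟨hW _ _ hΔ₁ h, h⟩⟩).trans (h3 Δ₁ hΔ₁).1
  rw [D.cnt_not_meets, h5] at h4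
  have h6 : cnt (fun Δ => ¬ D.Meets B Δ ∧ ¬ Conn R Δ₁ Δ) = 3 := by omega
  obtain ⟨Δ₂, hΔ₂, hne⟩ := cnt_pos.1 (h6.symm ▸ (by norm_num : 0 < 3))
  obtain ⟨h, hr, hh⟩ := key Δ₁ hΔ₁
  obtain ⟨h', hr', hh'⟩ := key Δ₂ hΔ₂
  refine ⟨h, h', hr, hr', fun Δ hΔ => ?_⟩
  rw [hh, ne_eq, hh']
  have hsub : ∀ Δ, Conn R Δ₂ Δ → ¬ D.Meets B Δ ∧ ¬ Conn R Δ₁ Δ := fun Δ h =>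
    ⟨hW _ _ hΔ₂ h, fun h' => hne ((conn_equivalence R).trans h' ((conn_equivalence R).symm h))⟩
  have h7 := eq_of_cnt_le hsub (by rw [h6, (h3 Δ₂ hΔ₂).1]) Δ
  exact ⟨fun h h' => (hsub Δ h').2 h, fun h => by_contra fun h' => h (h7 ⟨hΔ, h'⟩)⟩

theorem cnt_rot_le_8_15 [Fintype Γ] (B : β) : cnt (fun h : Γ => D.Rot B h) ≤ 4 := by
  obtain ⟨h, h', hr, hr', hh⟩ := D.exists_rot_8_15 B
  have key : ∀ k : Γ, D.Rot B k → (D.Rot B k ∧ ∀ Δ : C, h • Δ = Δ → k • Δ = Δ) ∨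
      (D.Rot B k ∧ ∀ Δ : C, h' • Δ = Δ → k • Δ = Δ) := by
    intro k hk
    have h1 := hr.cnt_ne_one hk
    have h2 := hr'.cnt_ne_one hk
    have h3 := cnt_and_add_not (fun Δ => ¬ D.Meets B Δ ∧ k • Δ ≠ Δ) (fun Δ => h • Δ ≠ Δ)
    have h4 : cnt (fun Δ => (¬ D.Meets B Δ ∧ k • Δ ≠ Δ) ∧ h • Δ ≠ Δ) =
        cnt (fun Δ => (¬ D.Meets B Δ ∧ h • Δ ≠ Δ) ∧ k • Δ ≠ Δ) :=
      cnt_congr fun Δ => by rw [and_right_comm]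
    have h5 : cnt (fun Δ => (¬ D.Meets B Δ ∧ k • Δ ≠ Δ) ∧ ¬ h • Δ ≠ Δ) =
        cnt (fun Δ => (¬ D.Meets B Δ ∧ h' • Δ ≠ Δ) ∧ k • Δ ≠ Δ) := by
      refine cnt_congr fun Δ => ?_
      rw [and_right_comm, not_not]
      exact and_congr_left fun _ => and_congr_right fun hΔ => hh Δ hΔ
    rw [hk.cnt_moved] at h3
    have h6 : cnt (fun Δ => (¬ D.Meets B Δ ∧ h • Δ ≠ Δ) ∧ k • Δ ≠ Δ) = 0 ∨
      cnt (fun Δ => (¬ D.Meets B Δ ∧ h' • Δ ≠ Δ) ∧ k • Δ ≠ Δ) = 0 := by omega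
    rcases h6 with h6 | h6
    · refine Or.inr ⟨hk, fun Δ hΔ => by_contra fun hΔk => ?_⟩
      have hB := hr'.not_meets hΔ
      exact cnt_eq_zero.1 h6 Δ ⟨⟨hB, fun e => (hh Δ hB).1 e hΔ⟩, hΔk⟩
    · refine Or.inl ⟨hk, fun Δ hΔ => by_contra fun hΔk => ?_⟩
      have hB := hr.not_meets hΔ
      exact cnt_eq_zero.1 h6 Δ ⟨⟨hB, (hh Δ hB).1 hΔ⟩, hΔk⟩
  have h1 := cnt_and_add_not (fun k : Γ => D.Rot B k) (fun k => ∀ Δ : C, h • Δ = Δ → k • Δ = Δ)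
  have h2 : cnt (fun k : Γ => D.Rot B k ∧ ¬ ∀ Δ : C, h • Δ = Δ → k • Δ = Δ) ≤
      cnt (fun k : Γ => D.Rot B k ∧ ∀ Δ : C, h' • Δ = Δ → k • Δ = Δ) :=
    cnt_mono fun k hk => (key k hk.1).resolve_left fun h => hk.2 h.2
  have := hr.cnt_le_two
  have := hr'.cnt_le_two
  omega

theorem no_3_8_15 (D : ImprimDesign Γ P C β 3 8 15 2 9 21 140) : False := by
  classical
  have := D.finite
  have := Fintype.ofFinite Γ
  let T : Γ → Prop := fun h => h ≠ 1 ∧ h ^ 3 = 1 ∧ ∃ Δ : C, h • Δ = Δ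
  have hT : ∀ h, T h → h ≠ 1 ∧ h ^ 3 = 1 ∧ ∃ Δ : C, h • Δ = Δ := fun h => id
  have hpair : ∀ x y : P, D.cls y = D.cls x → y ≠ x →
      2 ≤ cnt (fun h : Γ => (T h ∧ h • x = x) ∧ h • y = y) := by
    intro x y hy hyx
    obtain ⟨B⟩ := D.nonempty_β
    obtain ⟨h, -, ⟨h1, h3, -, Δ, hΔ⟩, -⟩ := D.exists_rot_8_15 B
    have h2 := D.cnt_fixed_8_15 h3 h1 hΔ
    obtain ⟨x₀, hx₀, hx₀'⟩ := cnt_pos.1 (h2.symm ▸ (by norm_num : 0 < 2))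
    obtain ⟨y₀, ⟨hy₀, hy₀'⟩, hne⟩ := exists_ne_of_one_lt_cnt (h2.symm ▸ (by norm_num : 1 < 2)) x₀
    obtain ⟨g, rfl⟩ := D.exists_smul_point x₀ x
    obtain ⟨g', hg', rfl⟩ := D.exists_smul_eq_of_cls_8_15 (x := g • x₀) (y := g • y₀) (y' := y)
      (by rw [D.cls_smul, D.cls_smul, hx₀, hy₀]) ((MulAction.injective g).ne hne) hy hyx
    set t := g' * g with ht
    have htx : g • x₀ = t • x₀ := by rw [ht, mul_smul, hg']
    have hty : g' • g • y₀ = t • y₀ := by rw [ht, mul_smul]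
    rw [htx, hty]
    set k := t * h * t⁻¹ with hk
    have hk1 : k ≠ 1 := by
      rw [hk, ne_eq, conj_eq_one_iff]
      exact h1
    have hk3 : k ^ 3 = 1 := by rw [hk, conj_pow, h3, mul_one, mul_inv_cancel]
    have hkx : k • t • x₀ = t • x₀ := by rw [hk, mul_smul, mul_smul, inv_smul_smul, hx₀']
    have hky : k • t • y₀ = t • y₀ := by rw [hk, mul_smul, mul_smul, inv_smul_smul, hy₀']
    have hkk : k⁻¹ ≠ k := by
      intro e
      have : k * k = 1 := by rw [← e, mul_inv_eq_one, e]
      rw [pow_three, this, mul_one] at hk3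
      exact hk1 hk3
    have h4 : ∀ k : Γ, k ≠ 1 → k ^ 3 = 1 → k • t • x₀ = t • x₀ → T k := fun k h1 h3 h =>
      ⟨h1, h3, D.cls (t • x₀), by rw [← D.cls_smul, h]⟩
    have h5 := cnt_ne_add_one (p := fun h : Γ => (T h ∧ h • t • x₀ = t • x₀) ∧ h • t • y₀ = t • y₀)
      (x := k) ⟨⟨h4 k hk1 hk3 hkx, hkx⟩, hky⟩
    have hkx' : k⁻¹ • t • x₀ = t • x₀ := by rw [inv_smul_eq_iff, hkx]
    have h6 : 0 < cnt (fun h : Γ => ((T h ∧ h • t • x₀ = t • x₀) ∧ h • t • y₀ = t • y₀) ∧ h ≠ k) :=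
      cnt_pos.2 ⟨k⁻¹, ⟨⟨h4 _ (inv_ne_one.2 hk1) (by rw [inv_pow, hk3, inv_one]) hkx', hkx'⟩,
        by rw [inv_smul_eq_iff, hky]⟩, hkk⟩
    omega
  have hpt : ∀ x : P, 14 ≤ cnt (fun h : Γ => T h ∧ h • x = x) := by
    intro x
    have h1 := cnt_mul_eq_sum (fun h : Γ => T h ∧ h • x = x)
      (fun h y => (T h ∧ h • x = x) ∧ (D.cls y = D.cls x ∧ h • y = y) ∧ y ≠ x) (m := 1)
      (fun _ _ h => h.1) (fun h hh => by
        have h2 := cnt_ne_add_one (p := fun y => D.cls y = D.cls x ∧ h • y = y) (x := x) ⟨rfl, hh.2⟩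
        rw [D.cnt_fixed_8_15 hh.1.2.1 hh.1.1 (by rw [← D.cls_smul, hh.2])] at h2
        refine (cnt_congr fun y => ?_).trans (Nat.succ_injective h2)
        simp only [hh.1, hh.2, and_true, true_and])
    have h2 : ∑ y, 2 * (if D.cls y = D.cls x ∧ y ≠ x then 1 else 0) ≤
        ∑ y, cnt (fun h : Γ => (T h ∧ h • x = x) ∧ (D.cls y = D.cls x ∧ h • y = y) ∧ y ≠ x) := by
      refine sum_le_sum fun y _ => ?_
      by_cases hy : D.cls y = D.cls x ∧ y ≠ x
      · rw [if_pos hy]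
        refine (hpair x y hy.1 hy.2).trans_eq (cnt_congr fun h => ?_)
        simp [hy.1, hy.2]
      · rw [if_neg hy]
        exact Nat.zero_le _
    have h3 := cnt_ne_add_one (p := fun y => D.cls y = D.cls x) (x := x) rfl
    rw [D.card_cls] at h3
    rw [← h1, ← mul_sum] at h2
    have h4 : ∑ y, (if D.cls y = D.cls x ∧ y ≠ x then 1 else 0) =
      cnt (fun y => D.cls y = D.cls x ∧ y ≠ x) := by
      rw [cnt_eq_sum]
      congr!
    omega
  have h1 := sum_cnt_comm (fun (h : Γ) (x : P) => T h ∧ h • x = x)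
  have h2 := sum_cnt_comm (fun (h : Γ) (B : β) => T h ∧ h • B = B)
  have h3 : ∑ h : Γ, 8 * cnt (fun x : P => T h ∧ h • x = x) ≤
      ∑ h : Γ, 15 * cnt (fun B : β => T h ∧ h • B = B) := by
    refine sum_le_sum fun h _ => ?_
    by_cases hh : T h
    · have h4 := D.fixed_classes_le_8_15 hh.2.1 hh.1
      have h5 := D.cnt_fixed_eq fun Δ hΔ => D.cnt_fixed_8_15 hh.2.1 hh.1 hΔ
      have h6 := D.cnt_fixed_classes_modEq (by norm_num) hh.2.1
      have h7 : 0 < cnt (fun Δ : C => h • Δ = Δ) := cnt_pos.2 hh.2.2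
      unfold Nat.ModEq at h6
      simp only [hh, true_and]
      omega
    · simp only [hh, false_and]
      rw [(cnt_eq_zero (p := fun _ : P => False)).2 (fun _ h => h)]
      exact Nat.zero_le _
  have h4 := sum_le_sum fun x (_ : x ∈ (univ : Finset P)) => hpt x
  have h5 : ∑ B : β, cnt (fun h : Γ => T h ∧ h • B = B) ≤ ∑ _B : β, 4 := by
    refine sum_le_sum fun B _ => (cnt_mono ?_).trans (D.cnt_rot_le_8_15 B)
    exact fun h hh => ⟨hh.1.1, hh.1.2.1, hh.2, hh.1.2.2⟩
  have h6 := D.card_P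
  rw [sum_const, card_univ, h6, smul_eq_mul, ← h1] at h4
  rw [sum_const, card_univ, D.card_B, smul_eq_mul, ← h2] at h5
  rw [← mul_sum, ← mul_sum] at h3
  omega

end ImprimDesign

namespace ImprimDesign

open Finset MulAction

variable {Γ P C β : Type*} [Group Γ] [Fintype P] [Fintype C] [Fintype β]
    [MulAction Γ P] [MulAction Γ C] [MulAction Γ β]
    (D : ImprimDesign Γ P C β 3 16 16 2 9 45 640)

theorem exists_smul_eq_of_cls_16_16 (D : ImprimDesign Γ P C β 3 16 16 2 9 45 640) {x y y' : P}
    (hy : D.cls y = D.cls x) (hyx : y ≠ x)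
    (hy' : D.cls y' = D.cls x) (hyx' : y' ≠ x) : ∃ g : Γ, g • x = x ∧ g • y = y' := by
  obtain ⟨n, hn, -⟩ := D.exists_mul_eq_of_stabilizer x (Conn (stabilizer Γ x) y)
    (by
      rintro ⟨g, hg, e⟩
      exact hyx (smul_left_cancel g (e.trans hg.symm)))
    (fun g hg z hz => (conn_smul_right hg y z).2 hz)
  have h1 := cnt_ne_add_one (p := fun z => D.cls z = D.cls x) (x := x) rfl
  rw [D.card_cls] at h1
  have hsub : ∀ z, Conn (stabilizer Γ x) y z → D.cls z = D.cls x ∧ z ≠ x := by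
    rintro _ ⟨g, hg, rfl⟩
    have hgx : g • x = x := hg
    refine ⟨by rw [D.cls_smul, hy, ← D.cls_smul, hgx], fun e => hyx (smul_left_cancel g (e.trans hgx.symm))⟩
  have h2 := cnt_mono hsub
  have h3 : 0 < cnt (Conn (stabilizer Γ x) y) := cnt_pos.2 ⟨y, (conn_equivalence _).refl y⟩
  exact eq_of_cnt_le hsub (by omega) y' ⟨hy', hyx'⟩

theorem eq_one_of_fix_classes_16_16 (D : ImprimDesign Γ P C β 3 16 16 2 9 45 640) {g : Γ}
    (hg : ∀ Δ : C, g • Δ = Δ) : g = 1 := by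
  classical
  by_contra hg1
  have := D.finite
  have := Fintype.ofFinite Γ
  have htr : ∀ x y : P, D.cls y = D.cls x → Conn (classKernel Γ C) x y := fun x y hxy =>
    D.kernel_transitive (by decide) hg1 (mem_classKernel.2 hg) hxy
  obtain ⟨m, t, ht, hmt, hm, hm', ht'⟩ := D.kernel_blocks htr
  have hm8 : m ∣ 8 := by simpa using hm
  have := Nat.le_of_dvd (by norm_num) hm8
  have hm8 : m = 8 := by omega
  have ht1 : t = 1 := by omega
  have hfix : ∀ k ∈ classKernel Γ C, ∀ x : P, k • x = x → ∀ B, D.I x B → k • B = B := by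
    intro k hk x hx B hB
    obtain ⟨Z, -, hZ⟩ := exists_of_cnt_eq_one ((ht' B x ⟨x, hB, rfl⟩).trans ht1)
    exact (hZ _ ⟨⟨k, hk, rfl⟩, (D.I_smul_block hx).2 hB⟩).trans
      (hZ B ⟨(conn_equivalence _).refl B, hB⟩).symm
  have hfree : ∀ k ∈ classKernel Γ C, ∀ x : P, k • x = x → k = 1 := by
    intro k hk x hx
    have hcls : ∀ y, D.cls y = D.cls x → k • y = y := by
      intro y hy
      by_cases hyx : y = x
      · rw [hyx, hx]
      obtain ⟨B, hxB, hyB⟩ := D.exists_block₂ x y (Ne.symm hyx)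
      have hB := hfix k hk x hx B hxB
      have h1 := cnt_ne_add_one (p := fun z => D.I z B ∧ D.cls z = D.cls x) (x := x) ⟨hxB, rfl⟩
      rw [D.card_inter x B hxB] at h1
      obtain ⟨z, -, hz⟩ := exists_of_cnt_eq_one (Nat.succ_injective h1)
      refine (hz (k • y) ⟨⟨D.I_smul_of_eq hB hyB, by rw [D.cls_kernel hk, hy]⟩, fun e => hyx ?_⟩).trans
        (hz y ⟨⟨hyB, hy⟩, hyx⟩).symm
      exact smul_left_cancel k (e.trans hx.symm)
    refine D.eq_one_of_fix_blocks (by norm_num) (Δ := D.cls x) ?_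
    rintro B ⟨y, hy, hyx⟩
    exact hfix k hk y (hcls y hyx) B hy
  obtain ⟨x₀⟩ := D.nonempty_P
  have hKcard : Nat.card (classKernel Γ C) = 16 := by
    have h1 := cnt_conn_mul_card (classKernel Γ C) x₀
    have h2 : (classKernel Γ C ⊓ stabilizer Γ x₀ : Subgroup Γ) = ⊥ :=
      (Subgroup.eq_bot_iff_forall _).2 fun k hk => hfree k hk.1 x₀ hk.2
    rw [h2, Subgroup.card_bot, mul_one] at h1
    rw [← h1]
    refine (cnt_congr fun y => ⟨?_, htr x₀ y⟩).trans (D.card_cls (D.cls x₀))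
    rintro ⟨k, hk, rfl⟩
    exact D.cls_kernel hk x₀
  have hcount : ∀ S : Subgroup Γ, cnt (fun k => k ∈ S ∧ k ≠ 1) + 1 = Nat.card S := by
    intro S
    rw [cnt_ne_add_one (p := fun k => k ∈ S) S.one_mem, cnt_eq_natCard]
  obtain ⟨y₀, hy₀, hne₀⟩ := D.exists_ne_cls x₀
  obtain ⟨κ, hκ, rfl⟩ := htr x₀ y₀ hy₀
  have h1 := cnt_mul_eq_cnt_mul (fun k => k ∈ classKernel Γ C ∧ k ≠ 1) (fun _ : β => True)
    (fun k B => (k ∈ classKernel Γ C ∧ k ≠ 1) ∧ k • B = B) (m := cnt fun B : β => κ • B = B) (n := 1)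
    (fun _ _ h => h.1) (fun _ _ _ => trivial) (fun k hk => by
      obtain ⟨g, hg, hgk⟩ := D.exists_smul_eq_of_cls_16_16 (D.cls_kernel hκ x₀) hne₀
        (D.cls_kernel hk.1 x₀) fun e => hk.2 (hfree k hk.1 x₀ e)
      have h2 : k⁻¹ * (g * κ * g⁻¹) = 1 := by
        refine hfree _ (mul_mem (inv_mem hk.1) (conj_mem_classKernel hκ)) x₀ ?_
        have hg' : g⁻¹ • x₀ = x₀ := by rw [inv_smul_eq_iff, hg]
        rw [mul_smul, mul_smul, mul_smul, hg', hgk, inv_smul_smul]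
      have h3 : k = g * κ * g⁻¹ := inv_mul_eq_one.1 h2
      refine (cnt_smul g _ _ fun B => ?_).symm
      rw [h3, mul_smul, mul_smul, inv_smul_smul, smul_left_cancel_iff]
      refine ⟨fun h => ⟨h3 ▸ hk, h⟩, fun h => h.2⟩) (fun B _ => by
      have h2 := cnt_conn_mul_card (classKernel Γ C) B
      rw [hm', hKcard] at h2
      have h3 := hcount (classKernel Γ C ⊓ stabilizer Γ B)
      refine (cnt_congr fun k => ?_).trans
        (show cnt (fun k => k ∈ classKernel Γ C ⊓ stabilizer Γ B ∧ k ≠ 1) = 1 by subst hm8; omega)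
      rw [Subgroup.mem_inf, mem_stabilizer_iff]
      tauto)
  have h2 := hcount (classKernel Γ C)
  rw [cnt_true, D.card_B] at h1
  generalize cnt (fun B : β => κ • B = B) = q at h1
  rw [show cnt (fun k => k ∈ classKernel Γ C ∧ k ≠ 1) = 15 by omega] at h1
  omega

theorem isMultiplyPretransitive_16_16 (D : ImprimDesign Γ P C β 3 16 16 2 9 45 640) :
    IsMultiplyPretransitive Γ C 2 :=
  D.isMultiplyPretransitive_two (by decide)

theorem eq_of_fixed_equations {T N N' J J' m m' : ℕ} (h : 7 * N + 10 * J + 3 = 3 * T)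
    (h' : 7 * N' + 10 * J' + 3 = 3 * T) (hN : N + 3 = m * 3) (hN' : N' + 3 = m' * 3)
    (hm : m = 1 ∨ m = 6 ∨ m = 11) (hm' : m' = 1 ∨ m' = 6 ∨ m' = 11) (hJ : J ≤ N) (hJ' : J' ≤ N') :
    m = m' := by
  omega

theorem fixed_equations_false {d m T N J J' n n' : ℕ} (hd : d = 6 ∨ d = 11)
    (hm : m = 1 ∨ m = 6 ∨ m = 11) (hT : T = d * m) (h : 7 * N + 10 * J + 3 = 3 * T)
    (hN : N + 3 = m * 3) (hJ : J + J' = N) (hd6 : d = 6 → J = 0) (hn : T * J = n * 18)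
    (hn' : T * J' = n' * 8) : False := by
  rcases hd with rfl | rfl <;> rcases hm with rfl | rfl | rfl <;> subst hT <;> omega

/-- An element of order five fixes at most one class. -/
theorem eq_of_pow_five_16_16 (D : ImprimDesign Γ P C β 3 16 16 2 9 45 640) {g : Γ} (hg : g ^ 5 = 1)
    (hg1 : g ≠ 1) {Δ Δ' : C} (hΔ : g • Δ = Δ) (hΔ' : g • Δ' = Δ') : Δ = Δ' := by
  by_contra hne
  have h5 : Nat.Prime 5 := by norm_num
  have hd := D.cnt_fixed_classes_modEq h5 hg
  have hd' := D.cnt_fixed_classes_le g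
  have hd1 := cnt_ne_add_one (p := fun Δ : C => g • Δ = Δ) hΔ
  have hd0 : 0 < cnt (fun Δ₁ : C => g • Δ₁ = Δ₁ ∧ Δ₁ ≠ Δ) := cnt_pos.2 ⟨Δ', hΔ', Ne.symm hne⟩
  have hd16 : cnt (fun Δ : C => g • Δ = Δ) ≠ 16 := fun h =>
    hg1 (D.eq_one_of_fix_classes_16_16 fun Δ₁ => eq_of_cnt_le (p := fun Δ : C => g • Δ = Δ)
      (q := fun _ => True) (fun _ _ => trivial) (by rw [cnt_true, D.card_C, h]) Δ₁ trivial)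
  unfold Nat.ModEq at hd
  have hc : ∀ Δ : C, g • Δ = Δ → cnt (fun x => D.cls x = Δ ∧ g • x = x) = 1 ∨
      cnt (fun x => D.cls x = Δ ∧ g • x = x) = 6 ∨ cnt (fun x => D.cls x = Δ ∧ g • x = x) = 11 := by
    intro Δ hΔ
    have h1 := D.cnt_fixed_class_modEq h5 hg hΔ
    have h2 := D.cnt_fixed_class_le g Δ
    have h3 : cnt (fun x => D.cls x = Δ ∧ g • x = x) ≠ 16 := fun h =>
      hg1 (D.eq_one_of_fix_class (by norm_num) h5 (by norm_num) hg (Δ := Δ) fun x hx =>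
        (eq_of_cnt_le (fun x (h : D.cls x = Δ ∧ g • x = x) => h.1)
          (by rw [h, D.card_cls]) x hx).2)
    unfold Nat.ModEq at h1
    omega
  have hu : ∀ B : β, g • B = B → cnt (fun y => D.I y B ∧ g • y = y) = 8 ∨
      cnt (fun y => D.I y B ∧ g • y = y) = 18 := by
    intro B hB
    rw [D.cnt_fixed_block h5 (by norm_num) hg hB]
    have h1 := D.cnt_fixed_meets_modEq h5 hg hB
    have h2 := D.cnt_fixed_meets_le g B
    unfold Nat.ModEq at h1
    omega
  have hu6 : cnt (fun Δ : C => g • Δ = Δ) = 6 → ∀ B : β, g • B = B →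
      cnt (fun y => D.I y B ∧ g • y = y) = 8 := by
    intro h6 B hB
    refine (hu B hB).resolve_right fun h => ?_
    rw [D.cnt_fixed_block h5 (by norm_num) hg hB] at h
    have : cnt (fun Δ => D.Meets B Δ ∧ g • Δ = Δ) ≤ cnt (fun Δ : C => g • Δ = Δ) :=
      cnt_mono fun _ h => h.2
    omega
  have hT1 : 1 < cnt (fun x : P => g • x = x) := by
    by_contra! h
    obtain ⟨x, hx, hx'⟩ := cnt_pos.1 (show 0 < cnt (fun x => D.cls x = Δ ∧ g • x = x) by
      have := hc Δ hΔ; omega)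
    obtain ⟨y, hy, hy'⟩ := cnt_pos.1 (show 0 < cnt (fun x => D.cls x = Δ' ∧ g • x = x) by
      have := hc Δ' hΔ'; omega)
    have h2 := cnt_ne_add_one (p := fun x : P => g • x = x) hx'
    have h3 : 0 < cnt (fun z : P => g • z = z ∧ z ≠ x) := cnt_pos.2 ⟨y, hy', fun e =>
      hne (by rw [← hx, ← hy, e])⟩
    omega
  have hN : ∀ x : P, g • x = x → cnt (fun B => D.I x B ∧ g • B = B) + 3 =
      cnt (fun y => D.cls y = D.cls x ∧ g • y = y) * 3 := by
    intro x hx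
    rw [D.cnt_fixed_blocks h5 (by norm_num) (by norm_num) hg hx]
    have h1 := cnt_ne_add_one (p := fun y => D.cls y = D.cls x ∧ g • y = y) (x := x) ⟨rfl, hx⟩
    omega
  have hJ : ∀ x : P, g • x = x → 7 * cnt (fun B => D.I x B ∧ g • B = B) +
      10 * cnt (fun B => (D.I x B ∧ g • B = B) ∧ cnt (fun y => D.I y B ∧ g • y = y) = 18) + 3 =
      3 * cnt (fun y : P => g • y = y) := fun x hx =>
    D.fixed_blocks_equation h5 (by norm_num) hg (by norm_num) (by norm_num) hu hx
  have hJ6 : cnt (fun Δ : C => g • Δ = Δ) = 6 → ∀ x : P,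
      cnt (fun B => (D.I x B ∧ g • B = B) ∧ cnt (fun y => D.I y B ∧ g • y = y) = 18) = 0 :=
    fun h6 x => cnt_eq_zero.2 fun B hB => by
      have := hu6 h6 B hB.1.2
      have := hB.2
      omega
  have hJle : ∀ x : P, cnt (fun B => (D.I x B ∧ g • B = B) ∧
      cnt (fun y => D.I y B ∧ g • y = y) = 18) ≤ cnt (fun B => D.I x B ∧ g • B = B) :=
    fun x => cnt_mono fun _ h => h.1
  have hconst : ∀ Δ₁ : C, g • Δ₁ = Δ₁ → cnt (fun x => D.cls x = Δ₁ ∧ g • x = x) =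
      cnt (fun x => D.cls x = Δ ∧ g • x = x) := by
    intro Δ₁ hΔ₁
    obtain ⟨x, rfl, hx'⟩ := cnt_pos.1 (show 0 < cnt (fun x => D.cls x = Δ₁ ∧ g • x = x) by
      have := hc Δ₁ hΔ₁; omega)
    obtain ⟨y, rfl, hy'⟩ := cnt_pos.1 (show 0 < cnt (fun x => D.cls x = Δ ∧ g • x = x) by
      have := hc Δ hΔ; omega)
    have h1 := hJ x hx'
    have h2 := hJ y hy'
    have h3 := hN x hx'
    have h4 := hN y hy'
    have h5 := hc _ hΔ₁
    have h6 := hc _ hΔ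
    exact eq_of_fixed_equations h1 h2 h3 h4 h5 h6 (hJle x) (hJle y)
  have hT := D.cnt_fixed_eq hconst
  obtain ⟨x₀, rfl, hx₀⟩ := cnt_pos.1 (show 0 < cnt (fun x => D.cls x = Δ ∧ g • x = x) by
    have := hc Δ hΔ; omega)
  have hdc := cnt_mul_eq_cnt_mul (fun x : P => g • x = x)
    (fun B : β => g • B = B ∧ cnt (fun y => D.I y B ∧ g • y = y) = 18)
    (fun x B => (D.I x B ∧ g • x = x) ∧ (g • B = B ∧ cnt (fun y => D.I y B ∧ g • y = y) = 18))
    (m := cnt (fun B => (D.I x₀ B ∧ g • B = B) ∧ cnt (fun y => D.I y B ∧ g • y = y) = 18)) (n := 18)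
    (fun _ _ h => h.1.2) (fun _ _ h => h.2) (fun x hx => by
      have h1 := hJ x hx
      have h2 := hJ x₀ hx₀
      have h3 := hN x hx
      have h4 := hN x₀ hx₀
      have h5 := hconst (D.cls x) (by rw [← D.cls_smul, hx])
      refine (cnt_congr fun B => ?_).trans (show cnt (fun B => (D.I x B ∧ g • B = B) ∧
        cnt (fun y => D.I y B ∧ g • y = y) = 18) = _ by omega)
      simp only [hx, and_true, and_assoc])
    (fun B hB => (cnt_congr fun x => by simp only [hB, and_true]).trans hB.2)
  have hdc8 := cnt_mul_eq_cnt_mul (fun x : P => g • x = x)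
    (fun B : β => g • B = B ∧ ¬ cnt (fun y => D.I y B ∧ g • y = y) = 18)
    (fun x B => (D.I x B ∧ g • x = x) ∧ (g • B = B ∧ ¬ cnt (fun y => D.I y B ∧ g • y = y) = 18))
    (m := cnt (fun B => (D.I x₀ B ∧ g • B = B) ∧ ¬ cnt (fun y => D.I y B ∧ g • y = y) = 18)) (n := 8)
    (fun _ _ h => h.1.2) (fun _ _ h => h.2) (fun x hx => by
      have h1 := hJ x hx
      have h2 := hJ x₀ hx₀
      have h3 := hN x hx
      have h4 := hN x₀ hx₀
      have h5 := hconst (D.cls x) (by rw [← D.cls_smul, hx])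
      have h6 := cnt_and_add_not (fun B => D.I x B ∧ g • B = B)
        (fun B => cnt (fun y => D.I y B ∧ g • y = y) = 18)
      have h7 := cnt_and_add_not (fun B => D.I x₀ B ∧ g • B = B)
        (fun B => cnt (fun y => D.I y B ∧ g • y = y) = 18)
      refine (cnt_congr fun B => ?_).trans (show cnt (fun B => (D.I x B ∧ g • B = B) ∧
        ¬ cnt (fun y => D.I y B ∧ g • y = y) = 18) = _ by omega)
      simp only [hx, and_true, and_assoc])
    (fun B hB => (cnt_congr fun x => by simp only [hB, not_false_eq_true, and_true]).trans
      ((hu B hB.1).resolve_right hB.2))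
  have h6 := cnt_and_add_not (fun B => D.I x₀ B ∧ g • B = B)
    (fun B => cnt (fun y => D.I y B ∧ g • y = y) = 18)
  have h1 := hJ x₀ hx₀
  have h2 := hN x₀ hx₀
  have h3 := hJle x₀
  have h7 := hc _ hΔ
  have hd : cnt (fun Δ : C => g • Δ = Δ) = 6 ∨ cnt (fun Δ : C => g • Δ = Δ) = 11 := by omega
  refine fixed_equations_false hd h7 hT h1 h2 h6 ?_ hdc hdc8
  exact fun h => hJ6 h x₀

theorem cnt_smul_ne_16_16 (D : ImprimDesign Γ P C β 3 16 16 2 9 45 640) {p : ℕ} (hp : p.Prime)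
    (hp13 : p ≤ 13) {g : Γ} (hg : g ^ p = 1) :
    cnt (fun Δ : C => g • Δ ≠ Δ) ≠ p := by
  intro h
  have h1 := isMultiplyPretransitive_of_prime_cycle D.isMultiplyPretransitive_16_16 hp hg h
    (by rw [D.card_C]; omega)
  rw [D.card_C] at h1
  have h2 : IsMultiplyPretransitive Γ C 4 := isMultiplyPretransitive_of_le (n := 16 - p + 1) (by omega)
    (by rw [Nat.card_eq_fintype_card, D.card_C]; have := hp.two_le; omega)
  have h3 := D.descFactorial_dvd h2
  revert h3
  decide

theorem not_dvd_card_block_16_16 (D : ImprimDesign Γ P C β 3 16 16 2 9 45 640) (B : β) :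
    ¬ 5 ∣ Nat.card (stabilizer Γ B) := by
  intro h
  have := D.finite
  obtain ⟨g, hg, hg1, hg5⟩ := exists_pow_eq_one_of_dvd_card (by norm_num) h
  have h1 := D.cnt_fixed_meets_modEq (by norm_num) hg5 hg
  unfold Nat.ModEq at h1
  obtain ⟨Δ, hΔ, hΔ'⟩ := cnt_pos.1 (show 0 < cnt (fun Δ => D.Meets B Δ ∧ g • Δ = Δ) by omega)
  obtain ⟨Δ', hΔ₁, hne⟩ := exists_ne_of_one_lt_cnt
    (show 1 < cnt (fun Δ => D.Meets B Δ ∧ g • Δ = Δ) by omega) Δ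
  exact hne (D.eq_of_pow_five_16_16 hg5 hg1 hΔ₁.2 hΔ')

end ImprimDesign

section Jordan

open MulAction

variable {Γ X : Type*} [Group Γ] [MulAction Γ X]

/-- The elements of `Y` fixing every point of `V` outside `U` move any point of `U` to any other. -/
def JordanSet (Y : Subgroup Γ) (V U : X → Prop) : Prop :=
  ∀ x y, U x → U y → ∃ g ∈ Y, g • x = y ∧ ∀ z, V z → ¬ U z → g • z = z

theorem JordanSet.union {Y : Subgroup Γ} {V U U' : X → Prop} (h : JordanSet Y V U)
    (h' : JordanSet Y V U') {p : X} (hp : U p) (hp' : U' p) : JordanSet Y V (fun x => U x ∨ U' x) := by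
  have key : ∀ x, U x ∨ U' x → ∃ g ∈ Y, g • x = p ∧ ∀ z, V z → ¬ (U z ∨ U' z) → g • z = z := by
    rintro x (hx | hx)
    · obtain ⟨g, hg, e, hz⟩ := h x p hx hp
      exact ⟨g, hg, e, fun z hV hU => hz z hV fun h => hU (Or.inl h)⟩
    · obtain ⟨g, hg, e, hz⟩ := h' x p hx hp'
      exact ⟨g, hg, e, fun z hV hU => hz z hV fun h => hU (Or.inr h)⟩
  intro x y hx hy
  obtain ⟨g, hg, e, hz⟩ := key x hx
  obtain ⟨g', hg', e', hz'⟩ := key y hy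
  refine ⟨g'⁻¹ * g, mul_mem (inv_mem hg') hg, by rw [mul_smul, e, inv_smul_eq_iff, e'], ?_⟩
  intro z hV hU
  rw [mul_smul, hz z hV hU, inv_smul_eq_iff, hz' z hV hU]

theorem JordanSet.translate {Y : Subgroup Γ} {V U : X → Prop} (h : JordanSet Y V U) {t : Γ}
    (ht : t ∈ Y) (hV : ∀ z, V (t • z) ↔ V z) : JordanSet Y V (fun x => U (t⁻¹ • x)) := by
  intro x y hx hy
  obtain ⟨g, hg, e, hz⟩ := h _ _ hx hy
  refine ⟨t * g * t⁻¹, mul_mem (mul_mem ht hg) (inv_mem ht), ?_, fun z hz1 hz2 => ?_⟩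
  · rw [mul_smul, mul_smul, e, smul_inv_smul]
  · rw [mul_smul, mul_smul, hz _ ((hV _).1 (by rwa [smul_inv_smul])) hz2, smul_inv_smul]

theorem JordanSet.exists_pow [Fintype X] [Finite Γ] {Y : Subgroup Γ} {V U : X → Prop}
    (h : JordanSet Y V U) (hV : ∀ g ∈ Y, ∀ x, V x → V (g • x)) (hU : ∀ x, U x → V x) {x : X}
    (hx : U x) {p : ℕ} (hp : p.Prime) (hdvd : p ∣ cnt U) :
    ∃ g ∈ Y, g ≠ 1 ∧ g ^ p = 1 ∧ ∀ z, V z → ¬ U z → g • z = z := by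
  set F := Y ⊓ fixingSubgroup Γ {z | V z ∧ ¬ U z} with hF
  have hFm : ∀ g, g ∈ F ↔ g ∈ Y ∧ ∀ z, V z → ¬ U z → g • z = z := fun g =>
    and_congr Iff.rfl ((mem_fixingSubgroup_iff Γ).trans
      ⟨fun h z hz hz' => h z ⟨hz, hz'⟩, fun h z hz => h z hz.1 hz.2⟩)
  have h1 : cnt (Conn F x) = cnt U := by
    refine cnt_congr fun y => ⟨?_, fun hy => ?_⟩
    · rintro ⟨g, hg, rfl⟩
      by_contra hn
      have h1 := (hFm g).1 hg
      have h2 := smul_left_cancel g (h1.2 _ (hV g h1.1 x (hU x hx)) hn)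
      exact hn (h2.symm ▸ hx)
    · obtain ⟨g, hg, e, hz⟩ := h x y hx hy
      exact ⟨g, (hFm g).2 ⟨hg, hz⟩, e⟩
  obtain ⟨g, hg, hg1, hgp⟩ := exists_pow_eq_one_of_dvd_card hp
    (hdvd.trans (h1 ▸ cnt_conn_dvd_card F x))
  exact ⟨g, ((hFm g).1 hg).1, hg1, hgp, ((hFm g).1 hg).2⟩

theorem smul_eq_smul_of_pow_three [Fintype X] {a b : Γ} (ha : a ^ 3 = 1) (hb : b ^ 3 = 1)
    {q : X → Prop} (hqa : ∀ x, q (a • x) ↔ q x) (hqb : ∀ x, q (b • x) ↔ q x) (h3 : cnt q ≤ 3)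
    {p x : X} (hp : q p) (hx : q x) (h : a • p = b • p) : a • x = b • x := by
  by_cases hap : a • p = p
  · have hfix : ∀ g : Γ, g ^ 3 = 1 → (∀ x, q (g • x) ↔ q x) → g • p = p → g • x = x := by
      intro g hg hqg hgp
      by_cases hxp : x = p
      · rw [hxp, hgp]
      have h1 := cnt_ne_add_one (p := q) hp
      refine smul_eq_of_cnt_lt (by norm_num) hg (q := fun x => q x ∧ x ≠ p) (fun z => ?_)
        (by omega) x ⟨hx, hxp⟩
      refine and_congr (hqg z) (not_congr ?_)
      conv_lhs => rw [← hgp]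
      exact smul_left_cancel_iff g
    rw [hfix a ha hqa hap, hfix b hb hqb (h.symm.trans hap)]
  · have hbp : b • p ≠ p := fun e => hap (h.trans e)
    have e : b • b • p = a • a • p := by
      rcases eq_or_eq_of_pow_three ha hqa h3 hp hap ((hqb _).2 ((hqb p).2 hp)) with e | e | e
      · exact absurd e (smul_smul_ne_of_pow hb hbp)
      · rw [h] at e
        exact absurd (smul_left_cancel b e) hbp
      · exact e
    rcases eq_or_eq_of_pow_three ha hqa h3 hp hap hx with rfl | rfl | rfl
    · exact h
    · rw [h, e, h]
    · rw [smul_smul_smul_of_pow ha, ← e, smul_smul_smul_of_pow hb]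

theorem IsPGroup.exists_cnt_conn_eq [Fintype X] [Finite Γ] {p : ℕ} (hp : p.Prime) {Q : Subgroup Γ}
    (hQ : IsPGroup p Q) (x : X) : ∃ j, cnt (Conn Q x) = p ^ j := by
  have : Fact p.Prime := ⟨hp⟩
  obtain ⟨n, hn⟩ := IsPGroup.iff_card.1 hQ
  obtain ⟨j, -, hj⟩ := (Nat.dvd_prime_pow hp).1 (hn ▸ cnt_conn_dvd_card Q x)
  exact ⟨j, hj⟩

theorem relIndex_mul_card {Q S : Subgroup Γ} (h : Q ≤ S) : Q.relIndex S * Nat.card Q = Nat.card S := by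
  rw [← Subgroup.relIndex_bot_left, ← Subgroup.relIndex_bot_left, mul_comm,
    Subgroup.relIndex_mul_relIndex _ _ _ bot_le h]

theorem SylowIn.stabilizer [Fintype X] [Finite Γ] {p n : ℕ} {Q S : Subgroup Γ} (hQ : SylowIn p Q S)
    {x : X} (h : cnt (Conn S x) = n * cnt (Conn Q x)) :
    SylowIn p (Q ⊓ stabilizer Γ x) (S ⊓ stabilizer Γ x) := by
  have hle : Q ⊓ MulAction.stabilizer Γ x ≤ S ⊓ MulAction.stabilizer Γ x := inf_le_inf_right _ hQ.le
  refine ⟨hle, hQ.isPGroup.to_le inf_le_left, fun hd => hQ.not_dvd ?_⟩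
  have h1 := cnt_conn_mul_card S x
  have h2 := cnt_conn_mul_card Q x
  have h3 := relIndex_mul_card hQ.le
  have h4 := relIndex_mul_card hle
  have h5 : 0 < Nat.card Q := Nat.card_pos
  refine hd.trans ⟨n, Nat.eq_of_mul_eq_mul_right h5 ?_⟩
  rw [h3, ← h1, h, ← h4, ← h2]
  ring

theorem SylowIn.of_card [Finite Γ] {p : ℕ} {Q S S' : Subgroup Γ} (hQ : SylowIn p Q S)
    (h : Q ≤ S') (hcard : Nat.card S' = Nat.card S) : SylowIn p Q S' := by
  refine ⟨h, hQ.isPGroup, fun hd => hQ.not_dvd ?_⟩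
  have h3 := relIndex_mul_card hQ.le
  have h4 := relIndex_mul_card h
  have h5 : 0 < Nat.card Q := Nat.card_pos
  rwa [Nat.eq_of_mul_eq_mul_right h5 (h3.trans (hcard.symm.trans h4.symm))]

theorem smul_eq_of_conn {A R : Subgroup Γ} (h : ∀ r ∈ R, ∀ a ∈ A, r⁻¹ * a * r ∈ A) {x y : X}
    (hxy : Conn R x y) (hx : ∀ a ∈ A, a • x = x) : ∀ a ∈ A, a • y = y := by
  obtain ⟨r, hr, rfl⟩ := hxy
  intro a ha
  have := hx _ (h r hr a ha)
  rwa [mul_smul, mul_smul, inv_smul_eq_iff] at this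

theorem cnt_conn_eq_of_conn [Fintype X] {A R : Subgroup Γ} (h : ∀ r ∈ R, ∀ a ∈ A, r⁻¹ * a * r ∈ A)
    {x y : X} (hxy : Conn R x y) : cnt (Conn A x) = cnt (Conn A y) := by
  obtain ⟨r, hr, rfl⟩ := hxy
  refine cnt_smul r _ _ fun z => (conn_smul (fun a ha => ?_) (h r hr) x z).symm
  simpa using h _ (inv_mem hr) a ha

theorem cnt_conn_dvd_of_conn [Fintype X] {A R : Subgroup Γ}
    (h : ∀ r ∈ R, ∀ a ∈ A, r⁻¹ * a * r ∈ A) {q : X → Prop} (hR : ∀ x y, q x → q y → Conn R x y)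
    (hA : ∀ a ∈ A, ∀ x, q x → q (a • x)) {x : X} (hx : q x) : cnt (Conn A x) ∣ cnt q := by
  refine dvd_cnt_of_equivalence (conn_equivalence A) ?_ fun y hy =>
    (cnt_conn_eq_of_conn h (hR x y hx hy)).symm
  rintro y _ ⟨a, ha, rfl⟩ hy
  exact hA a ha y hy

end Jordan

namespace ImprimDesign

open Finset MulAction

variable {Γ P C β : Type*} [Group Γ] [Fintype P] [Fintype C] [Fintype β]
    [MulAction Γ P] [MulAction Γ C] [MulAction Γ β]

section

variable (D : ImprimDesign Γ P C β 3 16 16 2 9 45 640)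

theorem exists_smul_pair_16_16 (D : ImprimDesign Γ P C β 3 16 16 2 9 45 640) {Δ Δ' E E' : C}
    (h : Δ ≠ Δ') (h' : E ≠ E') : ∃ g : Γ, g • Δ = E ∧ g • Δ' = E' :=
  (is_two_pretransitive_iff (G := Γ) (α := C)).1 D.isMultiplyPretransitive_16_16 h h'

theorem cnt_conn_stabilizer_16_16 (D : ImprimDesign Γ P C β 3 16 16 2 9 45 640) {Δ Δ' : C}
    (h : Δ ≠ Δ') : cnt (Conn (stabilizer Γ Δ) Δ') = 15 := by
  have h1 := cnt_ne_add_one (p := fun _ : C => True) (x := Δ) trivial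
  rw [cnt_true, D.card_C] at h1
  refine (cnt_congr (q := fun E : C => True ∧ E ≠ Δ) fun E => ⟨?_, fun hE => ?_⟩).trans
    (Nat.succ_injective h1)
  · rintro ⟨g, hg, rfl⟩
    exact ⟨trivial, fun e => h (smul_left_cancel g (e.trans hg.symm)).symm⟩
  · obtain ⟨g, hg, e⟩ := D.exists_smul_pair_16_16 h (Ne.symm hE.2)
    exact ⟨g, hg, e⟩

theorem card_stabilizer_pair_16_16 (D : ImprimDesign Γ P C β 3 16 16 2 9 45 640) {Δ Δ' : C}
    (h : Δ ≠ Δ') : 240 * Nat.card (stabilizer Γ Δ ⊓ stabilizer Γ Δ' : Subgroup Γ) =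
      Nat.card (⊤ : Subgroup Γ) := by
  have := D.finite
  have h1 := cnt_conn_mul_card (⊤ : Subgroup Γ) Δ
  have h2 := cnt_conn_mul_card (stabilizer Γ Δ) Δ'
  rw [D.cnt_conn_stabilizer_16_16 h] at h2
  rw [top_inf_eq, cnt_congr (q := fun _ => True) fun E => ⟨fun _ => trivial, fun _ => ?_⟩,
    cnt_true, D.card_C, ← h2] at h1
  · omega
  · obtain ⟨g, hg⟩ := D.exists_smul_class Δ E
    exact ⟨g, Subgroup.mem_top g, hg⟩

theorem cnt_fixed_ne_16_16 (D : ImprimDesign Γ P C β 3 16 16 2 9 45 640) {g : Γ} (hg : g ≠ 1) :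
    cnt (fun Δ : C => g • Δ = Δ) < 16 := by
  refine lt_of_le_of_ne (D.cnt_fixed_classes_le g) fun h => hg (D.eq_one_of_fix_classes_16_16 ?_)
  exact fun Δ => eq_of_cnt_le (p := fun Δ : C => g • Δ = Δ) (q := fun _ => True)
    (fun _ _ => trivial) (by rw [cnt_true, D.card_C, h]) Δ trivial

theorem cnt_fixed_add_ne_16_16 (D : ImprimDesign Γ P C β 3 16 16 2 9 45 640) {p : ℕ} (hp : p.Prime)
    (hp13 : p ≤ 13) {g : Γ} (hg : g ^ p = 1) : cnt (fun Δ : C => g • Δ = Δ) + p ≠ 16 := by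
  have h1 := cnt_add_not (fun Δ : C => g • Δ = Δ)
  have h2 := D.cnt_smul_ne_16_16 hp hp13 hg
  rw [D.card_C] at h1
  simp only [ne_eq] at h2
  omega

theorem cnt_fixed_seven_16_16 (D : ImprimDesign Γ P C β 3 16 16 2 9 45 640) {g : Γ} (hg : g ^ 7 = 1)
    (hg1 : g ≠ 1) : cnt (fun Δ : C => g • Δ = Δ) = 2 := by
  have h1 := D.cnt_fixed_classes_modEq (by norm_num) hg
  have h2 := D.cnt_fixed_ne_16_16 hg1
  have h3 := D.cnt_fixed_add_ne_16_16 (by norm_num) (by norm_num) hg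
  unfold Nat.ModEq at h1
  omega

theorem not_dvd_card_16_16 (D : ImprimDesign Γ P C β 3 16 16 2 9 45 640) (H : Subgroup Γ) {p : ℕ}
    (hp : p = 11 ∨ p = 13) : ¬ p ∣ Nat.card H := by
  intro h
  have := D.finite
  have hpp : p.Prime := by rcases hp with rfl | rfl <;> norm_num
  obtain ⟨g, -, hg1, hg⟩ := exists_pow_eq_one_of_dvd_card hpp h
  have h1 := D.cnt_fixed_classes_modEq hpp hg
  have h2 := D.cnt_fixed_ne_16_16 hg1
  have h3 := D.cnt_fixed_add_ne_16_16 hpp (by omega) hg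
  unfold Nat.ModEq at h1
  rcases hp with rfl | rfl <;> omega

theorem not_five_dvd_card_16_16 (D : ImprimDesign Γ P C β 3 16 16 2 9 45 640) {Δ Δ' : C}
    (h : Δ ≠ Δ') : ¬ 5 ∣ Nat.card (stabilizer Γ Δ ⊓ stabilizer Γ Δ' : Subgroup Γ) := by
  intro h5
  have := D.finite
  obtain ⟨g, hg, hg1, hg5⟩ := exists_pow_eq_one_of_dvd_card (by norm_num) h5
  exact h (D.eq_of_pow_five_16_16 hg5 hg1 hg.1 hg.2)

/-- A Sylow `3`-subgroup together with a block and a class it fixes and representatives of its two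
remaining orbits of classes not meeting the block. -/
structure Frame (D : ImprimDesign Γ P C β 3 16 16 2 9 45 640) (R : Subgroup Γ) (B : β)
    (Δ₀ w₁ w₂ : C) : Prop where
  sylow : SylowIn 3 R ⊤
  block : ∀ g ∈ R, g • B = B
  fix : ∀ g ∈ R, g • Δ₀ = Δ₀
  trans : ∀ Δ Δ', D.Meets B Δ → D.Meets B Δ' → Conn R Δ Δ'
  not_meets₀ : ¬ D.Meets B Δ₀
  not_meets₁ : ¬ D.Meets B w₁
  not_meets₂ : ¬ D.Meets B w₂
  card₁ : cnt (Conn R w₁) = 3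
  card₂ : cnt (Conn R w₂) = 3
  not_conn : ¬ Conn R w₁ w₂
  cover : ∀ Δ, ¬ D.Meets B Δ → Δ = Δ₀ ∨ Conn R w₁ Δ ∨ Conn R w₂ Δ

theorem exists_frame (D : ImprimDesign Γ P C β 3 16 16 2 9 45 640) :
    ∃ R B Δ₀ w₁ w₂, D.Frame R B Δ₀ w₁ w₂ := by
  have := D.finite
  have hp : Nat.Prime 3 := by norm_num
  obtain ⟨R, hR, -⟩ := exists_sylowIn hp (IsPGroup.of_bot (p := 3) (G := Γ)) (le_top)
  obtain ⟨B, -, hB⟩ := exists_fixed_of_isPGroup hp hR.isPGroup (X := β) (q := fun _ => True)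
    (fun _ _ _ _ => trivial) (by rw [cnt_true, D.card_B]; norm_num)
  obtain ⟨Δ₀, -, hΔ₀⟩ := exists_fixed_of_isPGroup hp hR.isPGroup (X := C) (q := fun _ => True)
    (fun _ _ _ _ => trivial) (by rw [cnt_true, D.card_C]; norm_num)
  have htr : ∀ Δ Δ', D.Meets B Δ → D.Meets B Δ' → Conn R Δ Δ' := by
    intro Δ Δ' hΔ hΔ'
    have h1 := (hR.mono (S' := stabilizer Γ B) hB le_top).pow_dvd hp (k := 2) (x := Δ)
      (by rw [cnt_congr (D.cnt_conn_stabilizer_meets hΔ), D.card_meets]; norm_num)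
    refine eq_of_cnt_le (p := Conn R Δ) (q := D.Meets B) ?_ ?_ Δ' hΔ'
    · rintro _ ⟨g, hg, rfl⟩
      exact (D.meets_smul_iff_of_eq (hB g hg) Δ).2 hΔ
    · rw [show cnt (D.Meets B) = 9 from D.card_meets B]
      exact Nat.le_of_dvd (cnt_pos.2 ⟨Δ, (conn_equivalence R).refl Δ⟩) h1
  have hn₀ : ¬ D.Meets B Δ₀ := by
    intro h
    obtain ⟨Δ, hΔ, hne⟩ := exists_ne_of_one_lt_cnt
      (show 1 < cnt (D.Meets B) from (D.card_meets B).symm ▸ (by norm_num)) Δ₀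
    obtain ⟨g, hg, e⟩ := htr _ _ h hΔ
    exact hne (e.symm.trans (hΔ₀ g hg))
  have h3 : ∀ Δ, Δ ≠ Δ₀ → 3 ∣ cnt (Conn R Δ) := fun Δ hΔ => by
    simpa using (hR.mono (S' := stabilizer Γ Δ₀) hΔ₀ le_top).pow_dvd hp (k := 1) (x := Δ)
      (by rw [D.cnt_conn_stabilizer_16_16 (Ne.symm hΔ)]; norm_num)
  have hW := D.cnt_not_meets B
  have hW1 := cnt_ne_add_one (p := fun Δ => ¬ D.Meets B Δ) hn₀
  have hsub : ∀ w, ¬ D.Meets B w ∧ w ≠ Δ₀ → ∀ Δ, Conn R w Δ → ¬ D.Meets B Δ ∧ Δ ≠ Δ₀ := by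
    rintro w hw _ ⟨g, hg, rfl⟩
    refine ⟨fun h => hw.1 ((D.meets_smul_iff_of_eq (hB g hg) w).1 h), fun e => hw.2 ?_⟩
    exact smul_left_cancel g (e.trans (hΔ₀ g hg).symm)
  have hcard : ∀ w, ¬ D.Meets B w ∧ w ≠ Δ₀ → cnt (Conn R w) = 3 := by
    intro w hw
    have h1 := cnt_mono (hsub w hw)
    obtain ⟨j, hj⟩ := hR.isPGroup.exists_cnt_conn_eq hp w
    have h2 := h3 w hw.2
    rw [hj] at h1 h2 ⊢
    rcases j with _ | _ | j
    · omega
    · rfl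
    · have : 3 ^ 2 ≤ 3 ^ (j + 1 + 1) := Nat.pow_le_pow_right (by norm_num) (by omega)
      omega
  obtain ⟨w₁, hw₁⟩ := cnt_pos.1 (show 0 < cnt (fun Δ => ¬ D.Meets B Δ ∧ Δ ≠ Δ₀) by omega)
  have h4 := cnt_and_add_not (fun Δ => ¬ D.Meets B Δ ∧ Δ ≠ Δ₀) (Conn R w₁)
  have h5 : cnt (fun Δ => (¬ D.Meets B Δ ∧ Δ ≠ Δ₀) ∧ Conn R w₁ Δ) = 3 :=
    (cnt_congr fun Δ => ⟨fun h => h.2, fun h => ⟨hsub w₁ hw₁ Δ h, h⟩⟩).trans (hcard w₁ hw₁)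
  obtain ⟨w₂, hw₂, hw⟩ := cnt_pos.1
    (show 0 < cnt (fun Δ => (¬ D.Meets B Δ ∧ Δ ≠ Δ₀) ∧ ¬ Conn R w₁ Δ) by omega)
  refine ⟨R, B, Δ₀, w₁, w₂, hR, hB, hΔ₀, htr, hn₀, hw₁.1, hw₂.1, hcard w₁ hw₁, hcard w₂ hw₂, hw, ?_⟩
  intro Δ hΔ
  by_cases hΔΔ : Δ = Δ₀
  · exact Or.inl hΔΔ
  by_cases hΔ1 : Conn R w₁ Δ
  · exact Or.inr (Or.inl hΔ1)
  refine Or.inr (Or.inr (eq_of_cnt_le (p := Conn R w₂)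
    (q := fun Δ => (¬ D.Meets B Δ ∧ Δ ≠ Δ₀) ∧ ¬ Conn R w₁ Δ) ?_ ?_ Δ ⟨⟨hΔ, hΔΔ⟩, hΔ1⟩))
  · exact fun E hE => ⟨hsub w₂ hw₂ E hE, fun h => hw ((conn_equivalence R).trans h
      ((conn_equivalence R).symm hE))⟩
  · rw [hcard w₂ hw₂]
    omega

end

variable {D : ImprimDesign Γ P C β 3 16 16 2 9 45 640} {R : Subgroup Γ} {B : β} {Δ₀ w₁ w₂ : C}

namespace Frame

theorem swap (F : D.Frame R B Δ₀ w₁ w₂) : D.Frame R B Δ₀ w₂ w₁ :=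
  { F with
    not_meets₁ := F.not_meets₂
    not_meets₂ := F.not_meets₁
    card₁ := F.card₂
    card₂ := F.card₁
    not_conn := fun h => F.not_conn ((conn_equivalence R).symm h)
    cover := fun Δ hΔ => (F.cover Δ hΔ).imp_right Or.symm }

theorem not_meets_smul (F : D.Frame R B Δ₀ w₁ w₂) {g : Γ} (hg : g ∈ R) (Δ : C) :
    ¬ D.Meets B (g • Δ) ↔ ¬ D.Meets B Δ :=
  not_congr (D.meets_smul_iff_of_eq (F.block g hg) Δ)

theorem not_meets_of_conn₁ (F : D.Frame R B Δ₀ w₁ w₂) {Δ : C} (h : Conn R w₁ Δ) :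
    ¬ D.Meets B Δ := by
  obtain ⟨g, hg, rfl⟩ := h
  exact (F.not_meets_smul hg w₁).2 F.not_meets₁

theorem not_conn₀ (F : D.Frame R B Δ₀ w₁ w₂) : ¬ Conn R w₁ Δ₀ := by
  rintro ⟨g, hg, e⟩
  have e1 : w₁ = Δ₀ := smul_left_cancel g (e.trans (F.fix g hg).symm)
  have h1 := F.card₁
  rw [cnt_eq_one_of Δ₀ ⟨g, hg, e⟩ ?_] at h1
  · omega
  · rintro _ ⟨g', hg', rfl⟩
    rw [e1, F.fix g' hg']

theorem ne₁ (F : D.Frame R B Δ₀ w₁ w₂) : Δ₀ ≠ w₁ := fun e =>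
  F.not_conn₀ (e ▸ (conn_equivalence R).refl _)

theorem ne₁₂ (F : D.Frame R B Δ₀ w₁ w₂) : w₁ ≠ w₂ := fun e =>
  F.not_conn (e ▸ (conn_equivalence R).refl _)

theorem smul_eq₁ (F : D.Frame R B Δ₀ w₁ w₂) {g : Γ} (hg : g ∈ R) {Δ Δ' : C} (hΔ : Conn R w₁ Δ)
    (hgΔ : g • Δ = Δ) (hΔ' : Conn R w₁ Δ') : g • Δ' = Δ' := by
  by_cases hne : Δ' = Δ
  · rw [hne, hgΔ]
  have h1 := cnt_ne_add_one (p := Conn R w₁) hΔ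
  rw [F.card₁] at h1
  refine smul_eq_of_isPGroup (p := 3) (by norm_num) (H := R ⊓ stabilizer Γ Δ)
    (F.sylow.isPGroup.to_le inf_le_left) (q := fun E => Conn R w₁ E ∧ E ≠ Δ) ?_ (by omega)
    ⟨hg, hgΔ⟩ ⟨hΔ', hne⟩
  rintro h hh E ⟨hE, hEΔ⟩
  exact ⟨(conn_smul_right hh.1 _ _).2 hE, fun e => hEΔ (smul_left_cancel h (e.trans hh.2.symm))⟩

/-- A subgroup normalized by `R` fixing one class meeting `B` fixes all of them. -/
theorem smul_eq_of_meets (F : D.Frame R B Δ₀ w₁ w₂) {A : Subgroup Γ}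
    (hA : ∀ r ∈ R, ∀ a ∈ A, r⁻¹ * a * r ∈ A) {Δ Δ' : C} (hΔ : D.Meets B Δ)
    (h : ∀ a ∈ A, a • Δ = Δ) (hΔ' : D.Meets B Δ') : ∀ a ∈ A, a • Δ' = Δ' :=
  smul_eq_of_conn hA (F.trans Δ Δ' hΔ hΔ') h

theorem conj₁ (F : D.Frame R B Δ₀ w₁ w₂) : ∀ r ∈ R, ∀ a ∈ R ⊓ stabilizer Γ w₁,
    r⁻¹ * a * r ∈ R ⊓ stabilizer Γ w₁ := by
  intro r hr a ha
  refine Subgroup.mem_inf.2 ⟨mul_mem (mul_mem (inv_mem hr) ha.1) hr, ?_⟩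
  have h1 := F.smul_eq₁ ha.1 ((conn_equivalence R).refl w₁) ha.2
    ((conn_smul_right hr w₁ w₁).2 ((conn_equivalence R).refl w₁))
  rw [mem_stabilizer_iff, mul_smul, mul_smul, h1, inv_smul_smul]

theorem sylow₁ (F : D.Frame R B Δ₀ w₁ w₂) :
    SylowIn 3 (R ⊓ stabilizer Γ w₁) (stabilizer Γ Δ₀ ⊓ stabilizer Γ w₁) := by
  have := D.finite
  refine (F.sylow.mono (S' := stabilizer Γ Δ₀) F.fix le_top).stabilizer (n := 5) ?_
  rw [F.card₁, D.cnt_conn_stabilizer_16_16 F.ne₁]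

theorem card_eq₁ (F : D.Frame R B Δ₀ w₁ w₂) :
    3 * Nat.card (R ⊓ stabilizer Γ w₁ : Subgroup Γ) = Nat.card R := by
  have := D.finite
  rw [← cnt_conn_mul_card R w₁, F.card₁]

theorem exists_meets (B : β) : ∃ Δ, D.Meets B Δ :=
  cnt_pos.1 (show 0 < cnt (D.Meets B) from (D.card_meets B).symm ▸ (by norm_num))

theorem nine_dvd (F : D.Frame R B Δ₀ w₁ w₂) : 9 ∣ Nat.card R := by
  have := D.finite
  obtain ⟨Δ, hΔ⟩ := exists_meets (D := D) B
  refine Eq.dvd ?_ |>.trans (cnt_conn_dvd_card R Δ)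
  refine (D.card_meets B).symm.trans (cnt_congr fun E => ⟨fun h => F.trans _ _ hΔ h, ?_⟩)
  rintro ⟨g, hg, rfl⟩
  exact (D.meets_smul_iff_of_eq (F.block g hg) Δ).2 hΔ

end Frame

end ImprimDesign

namespace ImprimDesign.Frame

open Finset MulAction

variable {Γ P C β : Type*} [Group Γ] [Fintype P] [Fintype C] [Fintype β]
    [MulAction Γ P] [MulAction Γ C] [MulAction Γ β]
    {D : ImprimDesign Γ P C β 3 16 16 2 9 45 640} {R : Subgroup Γ} {B : β} {Δ₀ w₁ w₂ : C}

theorem exists_smul_ne (F : D.Frame R B Δ₀ w₁ w₂) : ∃ g ∈ R, g • w₁ = w₁ ∧ g • w₂ ≠ w₂ := by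
  by_contra! hno
  have := D.finite
  have hp : Nat.Prime 3 := by norm_num
  have hp7 : Nat.Prime 7 := by norm_num
  set A := R ⊓ stabilizer Γ w₁ with hAdef
  have hA : IsPGroup 3 A := F.sylow.isPGroup.to_le inf_le_left
  have hAW : ∀ a ∈ A, ∀ Δ, ¬ D.Meets B Δ → a • Δ = Δ := by
    intro a ha Δ hΔ
    rcases F.cover Δ hΔ with rfl | h | h
    · exact F.fix a ha.1
    · exact F.smul_eq₁ ha.1 ((conn_equivalence R).refl _) ha.2 h
    · exact F.swap.smul_eq₁ ha.1 ((conn_equivalence R).refl _) (hno a ha.1 ha.2) h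
  have hA3 : 3 ∣ Nat.card A := by
    have h1 := F.nine_dvd
    have h2 : 3 * Nat.card A = Nat.card R := F.card_eq₁
    omega
  obtain ⟨a₀, ha₀, ha1, -⟩ := exists_pow_eq_one_of_dvd_card hp hA3
  have hone : ∀ a ∈ A, (∀ Δ, D.Meets B Δ → a • Δ = Δ) → a = 1 := fun a ha h =>
    D.eq_one_of_fix_classes_16_16 fun Δ => by
      by_cases hΔ : D.Meets B Δ
      exacts [h Δ hΔ, hAW a ha Δ hΔ]
  have hfree : ∀ Δ, D.Meets B Δ → ¬ ∀ a ∈ A, a • Δ = Δ := fun Δ hΔ h =>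
    ha1 (hone a₀ ha₀ fun Δ' hΔ' => F.smul_eq_of_meets F.conj₁ hΔ h hΔ' a₀ ha₀)
  have hfix : ∀ Δ, ¬ D.Meets B Δ ↔ ∀ a ∈ A, a • Δ = Δ := fun Δ =>
    ⟨fun h a ha => hAW a ha Δ h, fun h h' => hfree Δ h' h⟩
  set N := Subgroup.normalizer (A : Set Γ) with hN
  have hNm : ∀ n ∈ N, ∀ Δ, D.Meets B (n • Δ) ↔ D.Meets B Δ := by
    intro n hn Δ
    rw [← not_iff_not, hfix, hfix]
    rw [hN, Subgroup.mem_normalizer_iff] at hn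
    refine ⟨fun h a ha => ?_, fun h a ha => ?_⟩
    · have h1 := h _ ((hn a).1 ha)
      rwa [mul_smul, mul_smul, inv_smul_smul, smul_left_cancel_iff] at h1
    · have h1 := h (n⁻¹ * a * n) ((hn _).2 (by simpa [mul_assoc] using ha))
      rwa [mul_smul, mul_smul, inv_smul_eq_iff] at h1
  have hW := D.cnt_not_meets B
  have hNtr : cnt (Conn N Δ₀) = 7 := by
    refine (cnt_congr fun Δ => ⟨?_, fun hΔ => ?_⟩).trans hW
    · rintro ⟨n, hn, rfl⟩ h
      exact F.not_meets₀ ((hNm n hn _).1 h)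
    · obtain ⟨Δ', hΔ', hne⟩ := exists_ne_of_one_lt_cnt
        (show 1 < cnt (fun Δ => ¬ D.Meets B Δ) by omega) Δ
      obtain ⟨g, hg, hg'⟩ := D.exists_smul_pair_16_16 F.ne₁ (Ne.symm hne)
      have hS : SylowIn 3 A (⊤ ⊓ stabilizer Γ (Δ₀, w₁)) := by
        convert F.sylow₁ using 1
        ext x
        simp [mem_stabilizer_iff, Subgroup.mem_inf]
      obtain ⟨n, -, hn, hnA⟩ := hS.exists_normalizer hp (h := g) (Subgroup.mem_top g) (by
        intro a ha
        rw [show g • (Δ₀, w₁) = (Δ, Δ') from Prod.ext hg hg']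
        exact Prod.ext (hAW a ha Δ hΔ) (hAW a ha Δ' hΔ'))
      refine ⟨n, by rw [hN, Subgroup.mem_normalizer_iff]; exact hnA, ?_⟩
      exact (congrArg Prod.fst hn).trans hg
  obtain ⟨y, hyN, hy1, hy7⟩ := exists_pow_eq_one_of_dvd_card hp7 (hNtr ▸ cnt_conn_dvd_card N Δ₀)
  have hy2 := D.cnt_fixed_seven_16_16 hy7 hy1
  have hyW : ∀ Δ, y • Δ = Δ → D.Meets B Δ := by
    intro Δ hΔ
    by_contra hB
    have h1 := cnt_modEq_cnt_fixed_of_pow hp7 hy7 (q := fun Δ => ¬ D.Meets B Δ)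
      fun Δ => not_congr (hNm y hyN Δ)
    have h2 : cnt (fun Δ => ¬ D.Meets B Δ ∧ y • Δ = Δ) ≤ cnt (fun Δ : C => y • Δ = Δ) :=
      cnt_mono fun _ h => h.2
    have h3 : 0 < cnt (fun Δ => ¬ D.Meets B Δ ∧ y • Δ = Δ) := cnt_pos.2 ⟨Δ, hB, hΔ⟩
    unfold Nat.ModEq at h1
    omega
  obtain ⟨p, hyp⟩ := cnt_pos.1 (hy2.symm ▸ (by norm_num) : 0 < cnt (fun Δ : C => y • Δ = Δ))
  obtain ⟨q, hyq, hqp⟩ := exists_ne_of_one_lt_cnt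
    (hy2.symm ▸ (by norm_num) : 1 < cnt (fun Δ : C => y • Δ = Δ)) p
  have hpq : ∀ Δ, y • Δ = Δ → Δ = p ∨ Δ = q := by
    intro Δ hΔ
    by_contra! h
    have h1 := cnt_ne_add_one (p := fun Δ : C => y • Δ = Δ) hyp
    have h2 := cnt_ne_add_one (p := fun Δ : C => y • Δ = Δ ∧ Δ ≠ p) (x := q) ⟨hyq, hqp⟩
    have h3 : 0 < cnt (fun Δ : C => (y • Δ = Δ ∧ Δ ≠ p) ∧ Δ ≠ q) := cnt_pos.2 ⟨Δ, ⟨hΔ, h.1⟩, h.2⟩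
    omega
  have hmeet : ∀ a ∈ A, ∀ Δ, D.Meets B Δ → D.Meets B (a • Δ) := fun a ha Δ hΔ =>
    (D.meets_smul_iff_of_eq (F.block a ha.1) Δ).2 hΔ
  have h9 := cnt_conn_dvd_of_conn F.conj₁ F.trans hmeet (hyW p hyp)
  rw [show cnt (D.Meets B) = 9 from D.card_meets B] at h9
  obtain ⟨j, hj⟩ := hA.exists_cnt_conn_eq hp p
  have hj2 : j ≤ 2 := by
    rw [hj, show 9 = 3 ^ 2 by norm_num] at h9
    exact (Nat.pow_dvd_pow_iff_le_right (by norm_num)).1 h9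
  interval_cases j
  · obtain ⟨z, hz, hz'⟩ := exists_of_cnt_eq_one hj
    exact hfree p (hyW p hyp) fun a ha => (hz' _ ⟨a, ha, rfl⟩).trans
      (hz' p ((conn_equivalence A).refl p)).symm
  · have h1 : cnt (Conn A p) ≤ cnt (fun Δ : C => y • Δ = Δ) := cnt_mono fun z hz =>
      smul_eq_of_normalizes hp hp7 (by norm_num) hA hyN hy7 hyp (by simpa using hj) hz
    omega
  · have htr : ∀ Δ, D.Meets B Δ → Conn A p Δ := eq_of_cnt_le (p := Conn A p) (by
      rintro _ ⟨a, ha, rfl⟩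
      exact hmeet a ha p (hyW p hyp)) (by
      rw [hj, show cnt (D.Meets B) = 9 from D.card_meets B]; norm_num)
    set q' : C → Prop := fun Δ => D.Meets B Δ ∧ ∀ a ∈ A, a • p = p → a • Δ = Δ with hq'
    rw [hN, Subgroup.mem_normalizer_iff] at hyN
    have hyq' : ∀ Δ, q' (y • Δ) ↔ q' Δ := by
      intro Δ
      refine and_congr (hNm y (by rw [hN, Subgroup.mem_normalizer_iff]; exact hyN) Δ) ?_
      have hyp' : y⁻¹ • p = p := by rw [inv_smul_eq_iff, hyp]
      refine ⟨fun h a ha hap => ?_, fun h a ha hap => ?_⟩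
      · have h1 := h _ ((hyN a).1 ha) (by rw [mul_smul, mul_smul, hyp', hap, hyp])
        rwa [mul_smul, mul_smul, inv_smul_smul, smul_left_cancel_iff] at h1
      · have h1 := h (y⁻¹ * a * y) ((hyN _).2 (by simpa [mul_assoc] using ha))
          (by rw [mul_smul, mul_smul, hyp, hap, hyp'])
        rwa [mul_smul, mul_smul, inv_smul_eq_iff] at h1
    have h1 := cnt_modEq_cnt_fixed_of_pow hp7 hy7 hyq'
    have h2 : cnt (fun Δ => q' Δ ∧ y • Δ = Δ) ≤ cnt (fun Δ : C => y • Δ = Δ) :=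
      cnt_mono fun _ h => h.2
    have hq'p : q' p := ⟨hyW p hyp, fun a _ h => h⟩
    have h3 : 0 < cnt (fun Δ => q' Δ ∧ y • Δ = Δ) := cnt_pos.2 ⟨p, hq'p, hyp⟩
    have : Fact (Nat.Prime 3) := ⟨hp⟩
    have h4 := cnt_modEq_cnt_fixed (H := A ⊓ stabilizer Γ p) (hA.to_le inf_le_left)
      (q := D.Meets B) fun a ha Δ hΔ => hmeet a ha.1 Δ hΔ
    have h5 : cnt (fun Δ => D.Meets B Δ ∧ ∀ a ∈ A ⊓ stabilizer Γ p, a • Δ = Δ) = cnt q' :=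
      cnt_congr fun Δ => and_congr_right fun _ =>
        ⟨fun h a ha hap => h a ⟨ha, hap⟩, fun h a ha => h a ha.1 ha.2⟩
    have h6 : cnt q' ≤ cnt (D.Meets B) := cnt_mono fun _ h => h.1
    rw [h5] at h4
    rw [hy2] at h2
    rw [show cnt (D.Meets B) = 9 from D.card_meets B] at h4 h6
    have hreg : ∀ a ∈ A, a • p = p → a = 1 := fun a ha hap => hone a ha fun Δ hΔ =>
      (eq_of_cnt_le (p := q') (q := D.Meets B) (fun _ h => h.1) (by
        rw [show cnt (D.Meets B) = 9 from D.card_meets B]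
        have h7 : cnt q' ≡ cnt (fun Δ => q' Δ ∧ y • Δ = Δ) [MOD 7] := h1
        have h8 : 9 ≡ cnt q' [MOD 3] := h4
        generalize cnt (fun Δ => q' Δ ∧ y • Δ = Δ) = t at h2 h3 h7
        generalize cnt q' = f at h6 h7 h8 ⊢
        unfold Nat.ModEq at h7 h8
        clear h4 h1 h5
        interval_cases f <;> omega) Δ hΔ).2 a ha hap
    obtain ⟨r, hr, rfl⟩ := htr q (hyW q hyq)
    have hyp' : y⁻¹ • p = p := by rw [inv_smul_eq_iff, hyp]
    have hcomm : y * r * y⁻¹ = r := by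
      refine (inv_mul_eq_one.1 (hreg _ (mul_mem (inv_mem hr) ((hyN r).1 hr)) ?_)).symm
      rw [mul_smul, mul_smul, mul_smul, hyp', hyq, inv_smul_smul]
    have hcomm' : y * r = r * y := mul_inv_eq_iff_eq_mul.1 hcomm
    have hr2 : y • r • r • p = r • r • p := by
      rw [← mul_smul, hcomm', mul_smul, hyq]
    rcases hpq _ hr2 with h | h
    · obtain ⟨k, hk⟩ := (IsPGroup.iff_orderOf.1 hA) ⟨r, hr⟩
      rw [Subgroup.orderOf_mk] at hk
      have h2 : r ^ 2 = 1 := by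
        rw [pow_two]
        exact hreg _ (mul_mem hr hr) (by rw [mul_smul, h])
      have h8 := orderOf_dvd_of_pow_eq_one h2
      rw [hk] at h8
      have h10 : Nat.Coprime (3 ^ k) 2 := Nat.Coprime.pow_left k (by norm_num)
      rw [h10.eq_one_of_dvd h8, orderOf_eq_one_iff] at hk
      exact hqp (by rw [hk, one_smul])
    · exact hqp (smul_left_cancel r h)

end ImprimDesign.Frame

open MulAction in
theorem zpow_smul_eq_iff_of_pow_seven {Γ X : Type*} [Group Γ] [MulAction Γ X] {y : Γ}
    (hy : y ^ 7 = 1) {p : X} (hp : y • p ≠ p) (i j : ℤ) :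
    y ^ i • p = y ^ j • p ↔ i % 7 = j % 7 := by
  have h7 : y ^ (7 : ℤ) = 1 := by exact_mod_cast hy
  constructor
  · intro h
    have h1 : y ^ (i - j) ∈ stabilizer Γ p := by
      rw [mem_stabilizer_iff, sub_eq_neg_add, zpow_add, mul_smul, h, ← mul_smul, ← zpow_add,
        neg_add_cancel, zpow_zero, one_smul]
    by_contra hn
    refine hp (mem_stabilizer_iff.1 ?_)
    have hcop : IsCoprime (7 : ℤ) (i - j) :=
      (Int.prime_ofNat_iff.2 Nat.prime_seven).coprime_iff_not_dvd.2 (by omega)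
    obtain ⟨u, v, huv⟩ := hcop
    rw [← zpow_one y, ← huv, zpow_add, mul_comm u, zpow_mul, h7, one_zpow, one_mul, mul_comm v,
      zpow_mul]
    exact zpow_mem h1 v
  · intro h
    have h1 : i = j + 7 * (i / 7 - j / 7) := by omega
    rw [h1, zpow_add, zpow_mul, h7, one_zpow, mul_one]

theorem exists_of_cnt_eq_three {X : Type*} [Fintype X] {q : X → Prop} (h : cnt q = 3) {p : X}
    (hp : q p) : ∃ a b, q a ∧ q b ∧ a ≠ p ∧ b ≠ p ∧ a ≠ b ∧ ∀ x, q x → x = p ∨ x = a ∨ x = b := by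
  have h1 := cnt_ne_add_one hp
  obtain ⟨a, ha⟩ := cnt_pos.1 (show 0 < cnt (fun x => q x ∧ x ≠ p) by omega)
  have h2 := cnt_ne_add_one (p := fun x => q x ∧ x ≠ p) ha
  have h3 : cnt (fun x => (q x ∧ x ≠ p) ∧ x ≠ a) = 1 := by omega
  obtain ⟨b, hb, hb'⟩ := exists_of_cnt_eq_one h3
  refine ⟨a, b, ha.1, hb.1.1, ha.2, hb.1.2, Ne.symm hb.2, fun x hx => ?_⟩
  by_contra! hn
  exact hn.2.2 (hb' x ⟨⟨hx, hn.1⟩, hn.2.1⟩)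

namespace ImprimDesign.Frame

open Finset MulAction

variable {Γ P C β : Type*} [Group Γ] [Fintype P] [Fintype C] [Fintype β]
    [MulAction Γ P] [MulAction Γ C] [MulAction Γ β]
    {D : ImprimDesign Γ P C β 3 16 16 2 9 45 640} {R : Subgroup Γ} {B : β} {Δ₀ w₁ w₂ : C}

theorem conn₂ (F : D.Frame R B Δ₀ w₁ w₂) {Δ Δ' : C} (h : Conn R w₂ Δ) (h' : Conn R w₂ Δ') :
    Conn (R ⊓ stabilizer Γ w₁) Δ Δ' := by
  have := D.finite
  have h1 : ∀ E, Conn R w₂ E → Conn (R ⊓ stabilizer Γ w₁) w₂ E := by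
    have hsub : ∀ E, Conn (R ⊓ stabilizer Γ w₁) w₂ E → Conn R w₂ E := fun E ⟨g, hg, e⟩ => ⟨g, hg.1, e⟩
    refine eq_of_cnt_le hsub ?_
    obtain ⟨j, hj⟩ := (F.sylow.isPGroup.to_le
      (inf_le_left : R ⊓ stabilizer Γ w₁ ≤ R)).exists_cnt_conn_eq (by norm_num) w₂
    rw [F.card₂, hj]
    rcases j with _ | j
    · obtain ⟨z, hz, hz'⟩ := exists_of_cnt_eq_one hj
      obtain ⟨g, hg, hg1, hg2⟩ := F.exists_smul_ne
      exact absurd ((hz' _ ⟨g, ⟨hg, hg1⟩, rfl⟩).trans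
        (hz' _ ((conn_equivalence _).refl w₂)).symm) hg2
    · exact Nat.le_self_pow (by omega) 3
  exact (conn_equivalence _).trans ((conn_equivalence _).symm (h1 Δ h)) (h1 Δ' h')

theorem jordan₂ (F : D.Frame R B Δ₀ w₁ w₂) :
    JordanSet (stabilizer Γ B) (fun Δ => ¬ D.Meets B Δ) (Conn R w₂) := by
  intro x y hx hy
  obtain ⟨g, hg, e⟩ := F.conn₂ hx hy
  refine ⟨g, F.block g hg.1, e, fun z hz hz' => ?_⟩
  rcases F.cover z hz with rfl | h | h
  · exact F.fix g hg.1
  · exact F.smul_eq₁ hg.1 ((conn_equivalence R).refl _) hg.2 h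
  · exact absurd h hz'

theorem meets_smul_iff (D : ImprimDesign Γ P C β 3 16 16 2 9 45 640) {B : β} {g : Γ}
    (hg : g ∈ stabilizer Γ B) (Δ : C) : ¬ D.Meets B (g • Δ) ↔ ¬ D.Meets B Δ :=
  not_congr (D.meets_smul_iff_of_eq hg Δ)

theorem cnt_inter_ne_one (D : ImprimDesign Γ P C β 3 16 16 2 9 45 640) {B : β} {U U' : C → Prop}
    (h : JordanSet (stabilizer Γ B) (fun Δ => ¬ D.Meets B Δ) U)
    (h' : JordanSet (stabilizer Γ B) (fun Δ => ¬ D.Meets B Δ) U')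
    (hU : ∀ Δ, U Δ → ¬ D.Meets B Δ) (hU' : ∀ Δ, U' Δ → ¬ D.Meets B Δ)
    (h3 : cnt U = 3) (h3' : cnt U' = 3) : cnt (fun Δ => U Δ ∧ U' Δ) ≠ 1 := by
  intro h1
  have := D.finite
  obtain ⟨p, hp, -⟩ := exists_of_cnt_eq_one h1
  have h2 := cnt_and_add_not U U'
  have h4 : cnt (fun Δ => U Δ ∨ U' Δ) = cnt (fun Δ => U Δ ∧ ¬ U' Δ) + cnt U' := by
    rw [← cnt_or]
    · refine cnt_congr fun Δ => ?_
      tauto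
    · rintro x h h'
      exact h.2 h'
  obtain ⟨g, hg, hg1, hg5, -⟩ := (h.union h' hp.1 hp.2).exists_pow
    (fun g hg x => (meets_smul_iff D hg x).2) (fun x hx => hx.elim (hU x) (hU' x))
    (Or.inl hp.1) (p := 5) (by norm_num) (by rw [h4]; omega)
  exact D.not_dvd_card_block_16_16 B (prime_dvd_card_of_mem (by norm_num) hg5 hg1 hg)

theorem pow_seven_eq_one (F : D.Frame R B Δ₀ w₁ w₂) {y : Γ} (hy : y ^ 7 = 1) : y = 1 := by
  by_contra hy1
  have := D.finite
  have hp : Nat.Prime 7 := by norm_num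
  wlog hyB : y • B = B generalizing y
  · obtain ⟨B', -, hB'⟩ := exists_fixed_of_pow hp hy (X := β) (q := fun _ => True)
      (fun _ => Iff.rfl) (by rw [cnt_true, D.card_B]; norm_num)
    obtain ⟨g, hg⟩ := D.exists_smul_block B' B
    refine this (y := g * y * g⁻¹) (by rw [conj_pow, hy, mul_one, mul_inv_cancel])
      (fun e => hy1 (conj_eq_one_iff.1 e)) ?_
    rw [← hg, mul_smul, mul_smul, inv_smul_smul, hB']
  have hyV := D.meets_smul_iff_of_eq hyB
  have hVy : ∀ Δ, ¬ D.Meets B Δ → y • Δ ≠ Δ := by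
    intro Δ hB hΔ
    have hy2 := D.cnt_fixed_seven_16_16 hy hy1
    have h1 := cnt_modEq_cnt_fixed_of_pow hp hy (q := fun Δ => ¬ D.Meets B Δ)
      fun Δ => not_congr (hyV Δ)
    have h2 : cnt (fun Δ => ¬ D.Meets B Δ ∧ y • Δ = Δ) ≤ cnt (fun Δ : C => y • Δ = Δ) :=
      cnt_mono fun _ h => h.2
    have h3 : 0 < cnt (fun Δ => ¬ D.Meets B Δ ∧ y • Δ = Δ) := cnt_pos.2 ⟨Δ, hB, hΔ⟩
    have h4 := D.cnt_not_meets B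
    unfold Nat.ModEq at h1
    omega
  have htr : ∀ Δ, ¬ D.Meets B Δ → ∃ i : ℤ, y ^ i • w₂ = Δ := fun Δ hΔ =>
    exists_zpow_smul_eq hp hy (q := fun Δ => ¬ D.Meets B Δ) (fun Δ => not_congr (hyV Δ))
      (by rw [D.cnt_not_meets B]) F.not_meets₂ (hVy _ F.not_meets₂) hΔ
  have heq := zpow_smul_eq_iff_of_pow_seven hy (hVy _ F.not_meets₂)
  obtain ⟨_, _, hA, hB, ha, hb, hab, hU⟩ := exists_of_cnt_eq_three F.card₂ ((conn_equivalence R).refl w₂)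
  obtain ⟨a, rfl⟩ := htr _ (F.swap.not_meets_of_conn₁ hA)
  obtain ⟨b, rfl⟩ := htr _ (F.swap.not_meets_of_conn₁ hB)
  have ha' : a % 7 ≠ 0 := fun e => ha (((heq a 0).2 (by omega)).trans (by simp))
  have hb' : b % 7 ≠ 0 := fun e => hb (((heq b 0).2 (by omega)).trans (by simp))
  have hab' : a % 7 ≠ b % 7 := fun e => hab ((heq a b).2 e)
  have hUi : ∀ i : ℤ, Conn R w₂ (y ^ i • w₂) ↔ i % 7 = 0 ∨ i % 7 = a % 7 ∨ i % 7 = b % 7 := by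
    intro i
    rw [← heq, ← heq, show (0 : ℤ) = 0 % 7 from rfl, ← heq, zpow_zero, one_smul]
    refine ⟨hU _, ?_⟩
    rintro (h | h | h) <;> rw [h]
    exacts [(conn_equivalence R).refl w₂, hA, hB]
  have hyz : ∀ n : ℤ, y ^ n ∈ stabilizer Γ B := fun n => zpow_mem (K := stabilizer Γ B) hyB n
  have key : ∀ n m : ℤ, ¬ (∀ i : ℤ, ((i % 7 = 0 ∨ i % 7 = a % 7 ∨ i % 7 = b % 7) ∧
      ((i - n) % 7 = 0 ∨ (i - n) % 7 = a % 7 ∨ (i - n) % 7 = b % 7)) ↔ i % 7 = m % 7) := by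
    intro n m h
    refine cnt_inter_ne_one D F.jordan₂ (F.jordan₂.translate (hyz n) (meets_smul_iff D (hyz n)))
      (fun Δ => F.swap.not_meets_of_conn₁) (fun Δ hΔ => ?_) F.card₂ ?_ ?_
    · have := (meets_smul_iff D (hyz n) _).2 (F.swap.not_meets_of_conn₁ hΔ)
      rwa [smul_inv_smul] at this
    · rw [← F.card₂]
      exact (cnt_smul (y ^ n) _ _ fun Δ => by rw [inv_smul_smul]).symm
    · have hy' : ∀ i : ℤ, (y ^ n)⁻¹ • y ^ i • w₂ = y ^ (i - n) • w₂ := fun i => by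
        rw [← mul_smul, ← zpow_neg, ← _root_.zpow_add, neg_add_eq_sub]
      refine cnt_eq_one_of (y ^ m • w₂) ?_ fun x hx => ?_
      · rw [hy', hUi, hUi]
        exact (h m).2 rfl
      · obtain ⟨i, rfl⟩ := htr _ (F.swap.not_meets_of_conn₁ hx.1)
        rw [hy', hUi, hUi] at hx
        exact (heq i m).2 ((h i).1 hx)
  by_cases h1 : b % 7 = (2 * a) % 7
  · exact key b b fun i => by omega
  by_cases h2 : a % 7 = (2 * b) % 7
  · exact key a a fun i => by omega
  · exact key (b - a) b fun i => by omega

end ImprimDesign.Frame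

section Actions

open MulAction

theorem cnt_and_of_conn {Γ X : Type*} [Group Γ] [MulAction Γ X] [Fintype X] {A : Subgroup Γ}
    {q T : X → Prop} (hq : ∀ g ∈ A, ∀ x, q x → q (g • x)) {z : X} (hT : ∀ x, T x → Conn A z x) :
    (q z ∧ cnt (fun x => q x ∧ T x) = cnt T) ∨ (¬ q z ∧ cnt (fun x => q x ∧ T x) = 0) := by
  by_cases hz : q z
  · refine Or.inl ⟨hz, cnt_congr fun x => ⟨fun h => h.2, fun h => ⟨?_, h⟩⟩⟩
    obtain ⟨g, hg, rfl⟩ := hT x h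
    exact hq g hg z hz
  · refine Or.inr ⟨hz, cnt_eq_zero.2 fun x h => hz ?_⟩
    obtain ⟨g, hg, rfl⟩ := hT x h.2
    simpa using hq _ (inv_mem hg) _ h.1

end Actions

namespace ImprimDesign.Frame

open Finset MulAction

variable {Γ P C β : Type*} [Group Γ] [Fintype P] [Fintype C] [Fintype β]
    [MulAction Γ P] [MulAction Γ C] [MulAction Γ β]
    {D : ImprimDesign Γ P C β 3 16 16 2 9 45 640} {R : Subgroup Γ} {B : β} {Δ₀ w₁ w₂ : C}

theorem cnt_closed (F : D.Frame R B Δ₀ w₁ w₂) {z a b : C} (hz : ∀ Δ, D.Meets B Δ →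
    Conn (R ⊓ stabilizer Γ w₁) z Δ) (ha : Conn R w₁ a) (hb : Conn R w₁ b) (hab : a ≠ b)
    (hcov : ∀ x, Conn R w₁ x → x = w₁ ∨ x = a ∨ x = b) {q : C → Prop}
    (hq : ∀ g ∈ R ⊓ stabilizer Γ w₁, ∀ x, q x → q (g • x)) (hq₀ : ¬ q Δ₀) (hq₁ : ¬ q w₁) :
    ∃ i j m n, cnt q = i + j + m + n ∧ (q a ∧ i = 1 ∨ ¬ q a ∧ i = 0) ∧
      (q b ∧ j = 1 ∨ ¬ q b ∧ j = 0) ∧ (q w₂ ∧ m = 3 ∨ ¬ q w₂ ∧ m = 0) ∧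
      (q z ∧ n = 9 ∨ ¬ q z ∧ n = 0) := by
  have h1 := cnt_and_add_not q (D.Meets B)
  have h2 := cnt_and_add_not (fun x => q x ∧ ¬ D.Meets B x) (Conn R w₂)
  have h3 := cnt_and_add_not (fun x => (q x ∧ ¬ D.Meets B x) ∧ ¬ Conn R w₂ x) (fun x => x = a)
  have hw : ∀ x, Conn R w₁ x → ¬ Conn R w₂ x := fun x h h' =>
    F.not_conn ((conn_equivalence R).trans h ((conn_equivalence R).symm h'))
  have e1 : cnt (fun x => (q x ∧ ¬ D.Meets B x) ∧ Conn R w₂ x) = cnt (fun x => q x ∧ Conn R w₂ x) :=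
    cnt_congr fun x => ⟨fun h => ⟨h.1.1, h.2⟩, fun h => ⟨⟨h.1, F.swap.not_meets_of_conn₁ h.2⟩, h.2⟩⟩
  have e2 : cnt (fun x => ((q x ∧ ¬ D.Meets B x) ∧ ¬ Conn R w₂ x) ∧ x = a) =
      cnt (fun x => q x ∧ x = a) :=
    cnt_congr fun x => ⟨fun h => ⟨h.1.1.1, h.2⟩, fun ⟨h, h'⟩ => by
      subst h'
      exact ⟨⟨⟨h, F.not_meets_of_conn₁ ha⟩, hw _ ha⟩, rfl⟩⟩
  have e3 : cnt (fun x => ((q x ∧ ¬ D.Meets B x) ∧ ¬ Conn R w₂ x) ∧ ¬ x = a) =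
      cnt (fun x => q x ∧ x = b) :=
    cnt_congr fun x => ⟨fun h => ⟨h.1.1.1, by
      rcases F.cover x h.1.1.2 with rfl | h' | h'
      · exact absurd h.1.1.1 hq₀
      · rcases hcov x h' with rfl | h'' | h''
        exacts [absurd h.1.1.1 hq₁, absurd h'' h.2, h'']
      · exact absurd h' h.1.2⟩, fun ⟨h, h'⟩ => by
      subst h'
      exact ⟨⟨⟨h, F.not_meets_of_conn₁ hb⟩, hw _ hb⟩, Ne.symm hab⟩⟩
  have t1 := cnt_and_of_conn hq (T := fun x => x = a) (z := a) fun x hx =>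
    hx ▸ (conn_equivalence _).refl _
  have t2 := cnt_and_of_conn hq (T := fun x => x = b) (z := b) fun x hx =>
    hx ▸ (conn_equivalence _).refl _
  have t3 := cnt_and_of_conn hq (T := Conn R w₂) (z := w₂) fun x hx =>
    F.conn₂ ((conn_equivalence _).refl _) hx
  have t4 := cnt_and_of_conn hq hz
  rw [cnt_eq_one_of (p := fun x => x = a) a rfl fun y hy => hy] at t1
  rw [cnt_eq_one_of (p := fun x => x = b) b rfl fun y hy => hy] at t2
  rw [F.card₂] at t3
  rw [show cnt (D.Meets B) = 9 from D.card_meets B] at t4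
  refine ⟨_, _, _, _, ?_, t1, t2, t3, t4⟩
  omega

theorem cnt_conn_ne (F : D.Frame R B Δ₀ w₁ w₂) (x : C) :
    cnt (Conn (stabilizer Γ Δ₀ ⊓ stabilizer Γ w₁) x) ∉ [5, 10, 11, 13, 14] := by
  intro h
  have := D.finite
  have h1 := cnt_conn_dvd_card (stabilizer Γ Δ₀ ⊓ stabilizer Γ w₁) x
  have h5 := D.not_five_dvd_card_16_16 F.ne₁
  have h11 := D.not_dvd_card_16_16 (stabilizer Γ Δ₀ ⊓ stabilizer Γ w₁) (Or.inl rfl)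
  have h13 := D.not_dvd_card_16_16 (stabilizer Γ Δ₀ ⊓ stabilizer Γ w₁) (Or.inr rfl)
  have h7 : ¬ 7 ∣ Nat.card (stabilizer Γ Δ₀ ⊓ stabilizer Γ w₁ : Subgroup Γ) := fun h => by
    obtain ⟨g, -, hg1, hg⟩ := exists_pow_eq_one_of_dvd_card (by norm_num) h
    exact hg1 (F.pow_seven_eq_one hg)
  simp only [List.mem_cons, List.not_mem_nil, or_false] at h
  rcases h with h | h | h | h | h <;> rw [h] at h1
  · exact h5 h1
  · exact h5 (Dvd.dvd.trans (by norm_num) h1)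
  · exact h11 h1
  · exact h13 h1
  · exact h7 (Dvd.dvd.trans (by norm_num) h1)

/-- If `R ⊓ stabilizer Γ w₁` is transitive on the classes meeting `B`, then the set consisting of
`Δ₀` and the orbit of `w₁` is invariant under the common stabilizer of `Δ₀` and `w₁`. -/
theorem smul_conn₁ (F : D.Frame R B Δ₀ w₁ w₂) {z : C} (hz : ∀ Δ, D.Meets B Δ →
    Conn (R ⊓ stabilizer Γ w₁) z Δ) {h : Γ} (h0 : h • Δ₀ = Δ₀) (h1 : h • w₁ = w₁) {Δ : C}
    (hΔ : Conn R w₁ Δ) : Conn R w₁ (h • Δ) := by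
  set H := stabilizer Γ Δ₀ ⊓ stabilizer Γ w₁ with hH
  have hAH : R ⊓ stabilizer Γ w₁ ≤ H := inf_le_inf_right _ F.fix
  have hhH : h ∈ H := ⟨h0, h1⟩
  by_cases hne : Δ = w₁
  · rw [hne, h1]
    exact (conn_equivalence R).refl _
  obtain ⟨b, hb, hb1, hab, hcov⟩ : ∃ b, Conn R w₁ b ∧ b ≠ w₁ ∧ Δ ≠ b ∧
      ∀ x, Conn R w₁ x → x = w₁ ∨ x = Δ ∨ x = b := by
    obtain ⟨a, b, ha, hb, ha1, hb1, hab, hcov⟩ := exists_of_cnt_eq_three F.card₁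
      ((conn_equivalence R).refl w₁)
    rcases hcov Δ hΔ with rfl | rfl | rfl
    · exact absurd rfl hne
    · exact ⟨b, hb, hb1, hab, hcov⟩
    · exact ⟨a, ha, ha1, hab.symm, fun x hx => (hcov x hx).imp_right Or.symm⟩
  have count : ∀ x, Conn R w₁ x → x ≠ w₁ → _ := fun x hx hx1 => F.cnt_closed hz hΔ hb hab hcov
    (q := Conn H x) (fun g hg y hy => (conn_smul_right (hAH hg) x y).2 hy)
    (fun ⟨g, hg, e⟩ => F.not_conn₀ (smul_left_cancel g (e.trans hg.1.symm) ▸ hx))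
    (fun ⟨g, hg, e⟩ => hx1 (smul_left_cancel g (e.trans hg.2.symm)))
  obtain ⟨i, j, m, n, hc, hi, hj, hm, hn⟩ := count Δ hΔ hne
  have hcn := F.cnt_conn_ne Δ
  rw [← hH, hc] at hcn
  simp only [List.mem_cons, List.not_mem_nil, or_false, not_or] at hcn
  have hi1 : i = 1 := (hi.resolve_right fun h => h.1 ((conn_equivalence H).refl _)).2
  have hzn : ¬ Conn H Δ z := by
    rcases hn with hn | hn
    · exfalso
      omega
    · exact hn.1
  have hwn : ¬ Conn H Δ w₂ := by
    intro hw
    have hbn : ¬ Conn H Δ b := by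
      rcases hj with hj | hj
      · have := (hm.resolve_right fun h => h.1 hw).2
        have := (hn.resolve_left fun h => hzn h.1).2
        omega
      · exact hj.1
    obtain ⟨i', j', m', n', hc', hi', hj', hm', hn'⟩ := count b hb hb1
    have hcn' := F.cnt_conn_ne b
    rw [← hH, hc'] at hcn'
    simp only [List.mem_cons, List.not_mem_nil, or_false, not_or] at hcn'
    have hi'0 := (hi'.resolve_left fun h => hbn ((conn_equivalence H).symm h.1)).2
    have hm'0 := (hm'.resolve_left fun h => hbn ((conn_equivalence H).trans hw
      ((conn_equivalence H).symm h.1))).2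
    have hj'1 := (hj'.resolve_right fun h => h.1 ((conn_equivalence H).refl b)).2
    have hn'0 : n' = 0 := by
      rcases hn' with hn' | hn'
      · exfalso
        omega
      · exact hn'.2
    have hc1 : cnt (Conn H b) = 1 := by rw [hc', hi'0, hj'1, hm'0, hn'0]
    obtain ⟨b', hb', hbu⟩ := exists_of_cnt_eq_one hc1
    have hbfix : ∀ g ∈ H, g • b = b := fun g hg => (hbu _ ⟨g, hg, rfl⟩).trans
      (hbu _ ((conn_equivalence H).refl b)).symm
    obtain ⟨ρ, hρ, hρb⟩ := hb
    have hρ1 : ρ • w₁ ≠ w₁ := by rwa [hρb]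
    have hmove : ∀ x, Conn R w₁ x → ρ • x ≠ x := fun x hx e =>
      hρ1 (F.smul_eq₁ hρ hx e ((conn_equivalence R).refl _))
    have hρΔ : ρ • b = Δ := by
      have hbR : Conn R w₁ b := ⟨ρ, hρ, hρb⟩
      rcases hcov _ ((conn_smul_right hρ w₁ b).2 hbR) with e | e | e
      · rcases hcov _ ((conn_smul_right hρ w₁ Δ).2 hΔ) with e' | e' | e'
        · exact absurd (smul_left_cancel ρ (e'.trans e.symm)) hab
        · exact absurd e' (hmove Δ hΔ)
        · exact absurd (smul_left_cancel ρ (e'.trans hρb.symm)) hne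
      · exact e
      · exact absurd e (hmove b hbR)
    obtain ⟨g, hg, e⟩ := hw
    have hgΔ : g • Δ = Δ := by
      have h2 := hbfix (ρ⁻¹ * g * ρ) (Subgroup.mem_inf.2 ⟨?_, ?_⟩)
      · rwa [mul_smul, mul_smul, hρΔ, inv_smul_eq_iff, hρΔ] at h2
      · rw [mem_stabilizer_iff, mul_smul, mul_smul, F.fix ρ hρ, hg.1, inv_smul_eq_iff, F.fix ρ hρ]
      · rw [mem_stabilizer_iff, mul_smul, mul_smul, hρb, hbfix g hg, inv_smul_eq_iff, hρb]
    exact F.not_conn (e.symm.trans hgΔ ▸ hΔ)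
  have hhΔ : Conn H Δ (h • Δ) := ⟨h, hhH, rfl⟩
  have hmono : ∀ x y : C, Conn (R ⊓ stabilizer Γ w₁) x y → Conn H x y := fun x y ⟨g, hg, e⟩ =>
    ⟨g, hAH hg, e⟩
  by_cases hB : D.Meets B (h • Δ)
  · exact absurd ((conn_equivalence H).trans hhΔ
      ((conn_equivalence H).symm (hmono _ _ (hz _ hB)))) hzn
  rcases F.cover _ hB with e | e | e
  · exact absurd (smul_left_cancel h (e.trans h0.symm) ▸ hΔ) F.not_conn₀
  · exact e
  · exact absurd ((conn_equivalence H).trans hhΔ (hmono _ _ (F.conn₂ e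
      ((conn_equivalence R).refl w₂)))) hwn

/-- Under the assumptions of `smul_conn₁`, Sylow `3`-subgroups of the stabilizer of two classes
fix the same classes. -/
theorem smul_eq_of_sylow (F : D.Frame R B Δ₀ w₁ w₂) {z : C} (hz : ∀ Δ, D.Meets B Δ →
    Conn (R ⊓ stabilizer Γ w₁) z Δ) {E E' : C} (hE : E ≠ E') {Q Q' : Subgroup Γ}
    (hQ : SylowIn 3 Q (stabilizer Γ E ⊓ stabilizer Γ E'))
    (hQ' : SylowIn 3 Q' (stabilizer Γ E ⊓ stabilizer Γ E')) {x : C} (hx : ∀ g ∈ Q, g • x = x) :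
    ∀ g ∈ Q', g • x = x := by
  have := D.finite
  have hp : Nat.Prime 3 := by norm_num
  set A := R ⊓ stabilizer Γ w₁ with hA
  have hfixA : ∀ y, (∀ g ∈ A, g • y = y) ↔ y = Δ₀ ∨ Conn R w₁ y := by
    intro y
    constructor
    · intro h
      by_cases hy : D.Meets B y
      · exfalso
        obtain ⟨y', hy', hne⟩ := exists_ne_of_one_lt_cnt
          (show 1 < cnt (D.Meets B) from (D.card_meets B).symm ▸ (by norm_num)) y
        obtain ⟨g, hg, e⟩ := (conn_equivalence A).trans ((conn_equivalence A).symm (hz y hy)) (hz y' hy')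
        exact hne (e.symm.trans (h g hg))
      rcases F.cover y hy with e | e | e
      · exact Or.inl e
      · exact Or.inr e
      · exfalso
        obtain ⟨g, hg, hg1, hg2⟩ := F.exists_smul_ne
        refine hg2 (F.swap.smul_eq₁ hg e (h g ⟨hg, hg1⟩) ((conn_equivalence R).refl _))
    · rintro (rfl | h) g hg
      · exact F.fix g hg.1
      · exact F.smul_eq₁ hg.1 ((conn_equivalence R).refl _) hg.2 h
  obtain ⟨t, ht, ht'⟩ := D.exists_smul_pair_16_16 F.ne₁ hE
  have hconj : conjSubgroup t (stabilizer Γ Δ₀ ⊓ stabilizer Γ w₁) =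
      stabilizer Γ E ⊓ stabilizer Γ E' := by
    ext g
    rw [mem_conjSubgroup, Subgroup.mem_inf, Subgroup.mem_inf, mem_stabilizer_iff,
      mem_stabilizer_iff, mem_stabilizer_iff, mem_stabilizer_iff, mul_smul, mul_smul, mul_smul,
      mul_smul, inv_smul_eq_iff, inv_smul_eq_iff, ht, ht']
  have hAt := F.sylow₁.conj t
  rw [hconj] at hAt
  have key : ∀ Q, SylowIn 3 Q (stabilizer Γ E ⊓ stabilizer Γ E') →
      ((∀ g ∈ Q, g • x = x) ↔ ∀ g ∈ A, g • t⁻¹ • x = t⁻¹ • x) := by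
    intro Q hQ
    obtain ⟨u, hu, huQ⟩ := hAt.exists_conj hp hQ
    have h1 : (∀ g ∈ Q, g • x = x) ↔ ∀ g ∈ A, g • (u * t)⁻¹ • x = (u * t)⁻¹ • x := by
      constructor
      · intro h g hg
        have h2 := h _ ((huQ (t * g * t⁻¹)).1 (mem_conjSubgroup.2 (by
          rwa [show t⁻¹ * (t * g * t⁻¹) * t = g by group])))
        rw [eq_inv_smul_iff, ← mul_smul, ← mul_smul]
        convert h2 using 2
        group
      · intro h g hg
        have h2 := h (t⁻¹ * (u⁻¹ * g * u) * t) (mem_conjSubgroup.1 ((huQ _).2 (by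
          simpa [mul_assoc] using hg)))
        rw [eq_inv_smul_iff, ← mul_smul, ← mul_smul] at h2
        convert h2 using 2
        group
    rw [h1, hfixA, hfixA]
    set n := t⁻¹ * u * t with hn
    have hn0 : n • Δ₀ = Δ₀ := by
      rw [hn, mul_smul, mul_smul, ht, hu.1, inv_smul_eq_iff, ht]
    have hn1 : n • w₁ = w₁ := by
      rw [hn, mul_smul, mul_smul, ht', hu.2, inv_smul_eq_iff, ht']
    have hn0' : n⁻¹ • Δ₀ = Δ₀ := by rw [inv_smul_eq_iff, hn0]
    have hn1' : n⁻¹ • w₁ = w₁ := by rw [inv_smul_eq_iff, hn1]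
    have e : (u * t)⁻¹ • x = n⁻¹ • t⁻¹ • x := by
      rw [← mul_smul, hn]
      congr 1
      group
    rw [e]
    refine or_congr ?_ ⟨fun h => ?_, F.smul_conn₁ hz hn0' hn1'⟩
    · rw [inv_smul_eq_iff, hn0]
    · simpa using F.smul_conn₁ hz hn0 hn1 h
  exact (key Q' hQ').2 ((key Q hQ).1 hx)

theorem not_transitive (F : D.Frame R B Δ₀ w₁ w₂) {z : C} (hz : ∀ Δ, D.Meets B Δ →
    Conn (R ⊓ stabilizer Γ w₁) z Δ) {M : Subgroup Γ} (hM : M = R ⊓ stabilizer Γ w₁ ⊓ stabilizer Γ w₂)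
    (hfree : ∀ Δ, D.Meets B Δ → ∃ g ∈ M, g • Δ ≠ Δ) : False := by
  have := D.finite
  have hp : Nat.Prime 3 := by norm_num
  obtain ⟨Q, hQ, hMQ⟩ := exists_sylowIn hp (R := M) (S := stabilizer Γ w₁ ⊓ stabilizer Γ w₂)
    (F.sylow.isPGroup.to_le (by rw [hM]; exact inf_le_left.trans inf_le_left))
    (by rw [hM]; exact inf_le_inf_right _ inf_le_right)
  have hcard : cnt (fun Δ : C => Δ ≠ w₁ ∧ Δ ≠ w₂) = 14 := by
    have h1 := cnt_ne_add_one (p := fun _ : C => True) (x := w₁) trivial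
    have h2 := cnt_ne_add_one (p := fun Δ : C => True ∧ Δ ≠ w₁) (x := w₂) ⟨trivial, F.ne₁₂.symm⟩
    rw [cnt_true, D.card_C] at h1
    simp only [true_and] at h1 h2
    omega
  obtain ⟨u, ⟨hu1, hu2⟩, hu⟩ := exists_fixed_of_isPGroup hp hQ.isPGroup
    (q := fun Δ : C => Δ ≠ w₁ ∧ Δ ≠ w₂) (fun g hg x hx =>
      ⟨fun e => hx.1 (smul_left_cancel g (e.trans (hQ.le hg).1.symm)),
        fun e => hx.2 (smul_left_cancel g (e.trans (hQ.le hg).2.symm))⟩) (by rw [hcard]; norm_num)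
  have move : ∀ {E E' E₁ E₁' : C} {Q : Subgroup Γ}, E ≠ E' → E₁ ≠ E₁' →
      SylowIn 3 Q (stabilizer Γ E ⊓ stabilizer Γ E') → (∀ g ∈ Q, g • E₁ = E₁) →
      (∀ g ∈ Q, g • E₁' = E₁') → SylowIn 3 Q (stabilizer Γ E₁ ⊓ stabilizer Γ E₁') := by
    intro E E' E₁ E₁' Q hE hE₁ hQ h1 h2
    refine hQ.of_card (fun g hg => ⟨h1 g hg, h2 g hg⟩) ?_
    have h3 := D.card_stabilizer_pair_16_16 hE
    have h4 := D.card_stabilizer_pair_16_16 hE₁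
    omega
  have hQ1 : ∀ g ∈ Q, g • w₁ = w₁ := fun g hg => (hQ.le hg).1
  have hQ2 : ∀ g ∈ Q, g • w₂ = w₂ := fun g hg => (hQ.le hg).2
  have case1 : ¬ ∀ g ∈ R ⊓ stabilizer Γ w₁, g • u = u := by
    intro h
    obtain ⟨g, hg, hg1, hg2⟩ := F.exists_smul_ne
    exact hg2 (F.smul_eq_of_sylow hz (Ne.symm hu1) (move F.ne₁₂ (Ne.symm hu1) hQ hQ1 hu)
      (move F.ne₁ (Ne.symm hu1) F.sylow₁ (fun g hg => hg.2) h) hQ2 g ⟨hg, hg1⟩)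
  by_cases hB : D.Meets B u
  · obtain ⟨g, hg, hgu⟩ := hfree u hB
    exact hgu (hu g (hMQ hg))
  rcases F.cover u hB with rfl | h | h
  · exact case1 fun g hg => F.fix g hg.1
  · exact case1 fun g hg => F.smul_eq₁ hg.1 ((conn_equivalence R).refl _) hg.2 h
  · obtain ⟨g, hg, hg1, hg2⟩ := F.swap.exists_smul_ne
    exact hg2 (F.smul_eq_of_sylow hz (Ne.symm hu2) (move F.ne₁₂ (Ne.symm hu2) hQ hQ2 hu)
      (move F.swap.ne₁ (Ne.symm hu2) F.swap.sylow₁ (fun g hg => hg.2) fun g hg =>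
        F.swap.smul_eq₁ hg.1 ((conn_equivalence R).refl _) hg.2 h) hQ1 g ⟨hg, hg1⟩)

/-- An element of `R` is determined by its action on the classes not meeting `B`. -/
theorem eq_one_of_smul_eq (F : D.Frame R B Δ₀ w₁ w₂) {m : Γ} (hm : m ∈ R) (hm1 : m • w₁ = w₁)
    (hm2 : m • w₂ = w₂) : m = 1 := by
  by_contra hne
  have := D.finite
  have hp : Nat.Prime 3 := by norm_num
  set M := R ⊓ stabilizer Γ w₁ ⊓ stabilizer Γ w₂ with hM
  have hMconj : ∀ r ∈ R, ∀ a ∈ M, r⁻¹ * a * r ∈ M := fun r hr a ha =>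
    ⟨F.conj₁ r hr a ha.1, (F.swap.conj₁ r hr a ⟨ha.1.1, ha.2⟩).2⟩
  have hMV : ∀ a ∈ M, ∀ Δ, ¬ D.Meets B Δ → a • Δ = Δ := by
    intro a ha Δ hΔ
    rcases F.cover Δ hΔ with rfl | h | h
    · exact F.fix a ha.1.1
    · exact F.smul_eq₁ ha.1.1 ((conn_equivalence R).refl _) ha.1.2 h
    · exact F.swap.smul_eq₁ ha.1.1 ((conn_equivalence R).refl _) ha.2 h
  have hfree : ∀ Δ, D.Meets B Δ → ∃ g ∈ M, g • Δ ≠ Δ := by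
    intro Δ hΔ
    by_contra! h
    refine hne (D.eq_one_of_fix_classes_16_16 fun Δ' => ?_)
    by_cases hΔ' : D.Meets B Δ'
    · exact F.smul_eq_of_meets hMconj hΔ h hΔ' m ⟨⟨hm, hm1⟩, hm2⟩
    · exact hMV m ⟨⟨hm, hm1⟩, hm2⟩ Δ' hΔ'
  obtain ⟨z, hz⟩ := exists_meets (D := D) B
  have hS : ∀ A ≤ R, M ≤ A → (∀ r ∈ R, ∀ a ∈ A, r⁻¹ * a * r ∈ A) →
      ¬ (∀ Δ, D.Meets B Δ → Conn A z Δ) → ∀ a ∈ A, Conn M z (a • z) := by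
    intro A hA hMA hconj hnt a ha
    have hAm : ∀ a ∈ A, ∀ Δ, D.Meets B Δ → D.Meets B (a • Δ) := fun a ha Δ hΔ =>
      (D.meets_smul_iff_of_eq (F.block a (hA ha)) Δ).2 hΔ
    have h9 := cnt_conn_dvd_of_conn hconj F.trans hAm hz
    rw [show cnt (D.Meets B) = 9 from D.card_meets B] at h9
    have hsub : ∀ x, Conn M z x → Conn A z x := fun x ⟨g, hg, e⟩ => ⟨g, hMA hg, e⟩
    obtain ⟨i, hi⟩ := (F.sylow.isPGroup.to_le (hMA.trans hA)).exists_cnt_conn_eq hp z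
    obtain ⟨j, hj⟩ := (F.sylow.isPGroup.to_le hA).exists_cnt_conn_eq hp z
    refine eq_of_cnt_le hsub ?_ _ ⟨a, ha, rfl⟩
    have hi0 : i ≠ 0 := by
      rintro rfl
      obtain ⟨y, -, hy⟩ := exists_of_cnt_eq_one hi
      obtain ⟨g, hg, hgz⟩ := hfree z hz
      exact hgz ((hy _ ⟨g, hg, rfl⟩).trans (hy _ ((conn_equivalence M).refl z)).symm)
    have hj2 : j < 2 := by
      by_contra! hj2
      refine hnt (eq_of_cnt_le ?_ ?_)
      · rintro _ ⟨g, hg, rfl⟩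
        exact hAm g hg z hz
      · rw [show cnt (D.Meets B) = 9 from D.card_meets B, hj]
        exact Nat.pow_le_pow_right (n := 3) (by norm_num) hj2
    rw [hi, hj]
    exact Nat.pow_le_pow_right (by norm_num) (by omega)
  by_cases h2 : ∀ Δ, D.Meets B Δ → Conn (R ⊓ stabilizer Γ w₁) z Δ
  · exact F.not_transitive h2 hM hfree
  by_cases h3 : ∀ Δ, D.Meets B Δ → Conn (R ⊓ stabilizer Γ w₂) z Δ
  · exact F.swap.not_transitive h3 (by rw [hM, inf_right_comm]) hfree
  have h2' := hS _ inf_le_left inf_le_left F.conj₁ h2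
  have h3' := hS _ inf_le_left (by rw [hM, inf_right_comm]; exact inf_le_left) F.swap.conj₁ h3
  have hRM : ∀ r ∈ R, Conn M z (r • z) := by
    intro r hr
    obtain ⟨a, ha, e⟩ := F.conn₂ ((conn_equivalence R).refl w₂) ⟨r, hr, rfl⟩
    obtain ⟨m', hm', e'⟩ := h3' (a⁻¹ * r) (Subgroup.mem_inf.2 ⟨mul_mem (inv_mem ha.1) hr, by
      rw [mem_stabilizer_iff, mul_smul, ← e, inv_smul_smul]⟩)
    have h4 := h2' (a * m') (mul_mem ha hm'.1)
    rwa [mul_smul, e', ← mul_smul, mul_inv_cancel_left] at h4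
  refine h2 fun Δ hΔ => ?_
  obtain ⟨r, hr, rfl⟩ := F.trans z Δ hz hΔ
  obtain ⟨g, hg, e⟩ := hRM r hr
  exact ⟨g, hg.1, e⟩

end ImprimDesign.Frame

section Actions

open MulAction

theorem smul_smul_comm_of_pow_three {Γ X : Type*} [Group Γ] [MulAction Γ X] [Fintype X] {a b : Γ}
    (ha : a ^ 3 = 1) (hb : b ^ 3 = 1) {q : X → Prop} (hqa : ∀ x, q (a • x) ↔ q x)
    (hqb : ∀ x, q (b • x) ↔ q x) (h3 : cnt q ≤ 3) {x : X} (hx : q x) : a • b • x = b • a • x := by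
  have key : ∀ g : Γ, g ^ 3 = 1 → (∀ x, q (g • x) ↔ q x) → g • x = x → ∀ y, q y → g • y = y := by
    intro g hg hqg hgx y hy
    have h1 := smul_eq_smul_of_pow_three hg (one_pow 3 : (1 : Γ) ^ 3 = 1) hqg
      (fun x => by rw [one_smul]) h3 hx hy (by rw [hgx, one_smul])
    rw [h1, one_smul]
  by_cases hax : a • x = x
  · rw [hax, key a ha hqa hax _ ((hqb x).2 hx)]
  rcases eq_or_eq_of_pow_three ha hqa h3 hx hax ((hqb x).2 hx) with e | e | e
  · rw [e, key b hb hqb e _ ((hqa x).2 hx)]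
  · have h1 := smul_eq_smul_of_pow_three ha hb hqa hqb h3 hx ((hqa x).2 hx) e.symm
    rw [e, h1]
  · have ha2 : (a * a) ^ 3 = 1 := by
      rw [← pow_two, ← pow_mul, mul_comm, pow_mul, ha, one_pow]
    have h1 := smul_eq_smul_of_pow_three ha2 hb (fun y => by rw [mul_smul, hqa, hqa]) hqb h3 hx
      ((hqa x).2 hx) (by rw [mul_smul, e])
    rw [e, ← h1, mul_smul]

end Actions

namespace ImprimDesign.Frame

open Finset MulAction

variable {Γ P C β : Type*} [Group Γ] [Fintype P] [Fintype C] [Fintype β]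
    [MulAction Γ P] [MulAction Γ C] [MulAction Γ β]
    {D : ImprimDesign Γ P C β 3 16 16 2 9 45 640} {R : Subgroup Γ} {B : β} {Δ₀ w₁ w₂ : C}

theorem card_stabilizer₁ (F : D.Frame R B Δ₀ w₁ w₂) :
    Nat.card (R ⊓ stabilizer Γ w₁ : Subgroup Γ) = 3 := by
  have := D.finite
  have h1 := cnt_conn_mul_card (R ⊓ stabilizer Γ w₁) w₂
  rw [cnt_congr (q := Conn R w₂) fun x => ⟨fun ⟨g, hg, e⟩ => ⟨g, hg.1, e⟩,
    F.conn₂ ((conn_equivalence R).refl w₂)⟩, F.card₂] at h1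
  rw [← h1, (Subgroup.eq_bot_iff_forall (R ⊓ stabilizer Γ w₁ ⊓ stabilizer Γ w₂)).2
    fun g hg => F.eq_one_of_smul_eq hg.1.1 hg.1.2 hg.2, Subgroup.card_bot]

theorem card_eq_nine (F : D.Frame R B Δ₀ w₁ w₂) : Nat.card R = 9 := by
  rw [← F.card_eq₁, F.card_stabilizer₁]

theorem pow_three₁ (F : D.Frame R B Δ₀ w₁ w₂) {g : Γ} (hg : g ∈ R) (hg1 : g • w₁ = w₁) :
    g ^ 3 = 1 := by
  have h1 : (⟨g, hg, hg1⟩ : (R ⊓ stabilizer Γ w₁ : Subgroup Γ)) ^ 3 = 1 := by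
    rw [← F.card_stabilizer₁, pow_card_eq_one']
  exact congrArg Subtype.val h1

/-- `R` is regular on the classes meeting `B`. -/
theorem eq_one_of_meets (F : D.Frame R B Δ₀ w₁ w₂) {g : Γ} (hg : g ∈ R) {Δ : C}
    (hΔ : D.Meets B Δ) (h : g • Δ = Δ) : g = 1 := by
  have := D.finite
  have h1 := cnt_conn_mul_card R Δ
  rw [cnt_congr (q := D.Meets B) fun x => ⟨?_, F.trans Δ x hΔ⟩,
    show cnt (D.Meets B) = 9 from D.card_meets B, F.card_eq_nine] at h1
  · have h2 : Nat.card (R ⊓ stabilizer Γ Δ : Subgroup Γ) = 1 := by omega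
    exact (Subgroup.eq_bot_iff_forall _).1 (Subgroup.card_eq_one.1 h2) g
      (Subgroup.mem_inf.2 ⟨hg, h⟩)
  · rintro ⟨g, hg, rfl⟩
    exact (D.meets_smul_iff_of_eq (F.block g hg) Δ).2 hΔ

theorem cnt_fixed_le_four (F : D.Frame R B Δ₀ w₁ w₂) {g : Γ} (hg : g ^ 3 = 1) (hg1 : g ≠ 1) :
    cnt (fun Δ : C => g • Δ = Δ) ≤ 4 := by
  have := D.finite
  have hp : Nat.Prime 3 := by norm_num
  have hR : ∀ r ∈ R, r ≠ 1 → cnt (fun Δ : C => r • Δ = Δ) ≤ 4 := by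
    intro r hr hr1
    wlog h2 : r • w₂ ≠ w₂ generalizing w₁ w₂
    · push Not at h2
      exact this F.swap fun h => hr1 (F.eq_one_of_smul_eq hr h h2)
    have h1 : cnt (fun Δ : C => r • Δ = Δ) ≤ cnt (fun Δ : C => Δ = Δ₀ ∨ Conn R w₁ Δ) := by
      refine cnt_mono fun Δ hΔ => ?_
      by_cases hB : D.Meets B Δ
      · exact absurd (F.eq_one_of_meets hr hB hΔ) hr1
      rcases F.cover Δ hB with h | h | h
      · exact Or.inl h
      · exact Or.inr h
      · exact absurd (F.swap.smul_eq₁ hr h hΔ ((conn_equivalence R).refl _)) h2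
    rw [cnt_or (p := fun Δ => Δ = Δ₀) (fun Δ h h' => F.not_conn₀ (h ▸ h')), F.card₁,
      cnt_eq_one_of (p := fun Δ : C => Δ = Δ₀) Δ₀ rfl fun _ h => h] at h1
    exact h1
  have : Fact (Nat.Prime 3) := ⟨hp⟩
  obtain ⟨Q, hQ, hgQ⟩ := exists_sylowIn hp (isPGroup_zpowers hg) (le_top (a := Subgroup.zpowers g))
  obtain ⟨t, -, ht⟩ := hQ.exists_conj hp F.sylow
  have h1 := hR _ ((ht g).1 (hgQ (Subgroup.mem_zpowers g))) fun e => hg1 (conj_eq_one_iff.1 e)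
  refine Eq.trans_le ?_ h1
  refine cnt_smul t _ _ fun Δ => ?_
  rw [mul_smul, mul_smul, inv_smul_smul, smul_left_cancel_iff]

theorem eq_one_of_fix_not_meets (F : D.Frame R B Δ₀ w₁ w₂) {g : Γ} (hgB : g • B = B)
    (hg : ∀ Δ, ¬ D.Meets B Δ → g • Δ = Δ) : g = 1 := by
  have := D.finite
  have hp : Nat.Prime 3 := by norm_num
  set Y := stabilizer Γ B ⊓ fixingSubgroup Γ {Δ | ¬ D.Meets B Δ} with hY
  have hYm : ∀ g, g ∈ Y ↔ g • B = B ∧ ∀ Δ, ¬ D.Meets B Δ → g • Δ = Δ := fun g =>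
    and_congr Iff.rfl (mem_fixingSubgroup_iff Γ)
  have h3 : ¬ 3 ∣ Nat.card Y := by
    intro h
    obtain ⟨y, hy, hy1, hy3⟩ := exists_pow_eq_one_of_dvd_card hp h
    have h1 := F.cnt_fixed_le_four hy3 hy1
    have h2 := cnt_mono ((hYm y).1 hy).2
    rw [D.cnt_not_meets B] at h2
    omega
  have hconj : ∀ r ∈ R, ∀ a ∈ Y, r⁻¹ * a * r ∈ Y := by
    intro r hr a ha
    have ha' := (hYm a).1 ha
    refine (hYm _).2 ⟨?_, fun Δ hΔ => ?_⟩
    · rw [mul_smul, mul_smul, F.block r hr, ha'.1, inv_smul_eq_iff, F.block r hr]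
    · rw [mul_smul, mul_smul, ha'.2 _ ((F.not_meets_smul hr Δ).2 hΔ), inv_smul_smul]
  refine D.eq_one_of_fix_classes_16_16 fun Δ => ?_
  by_cases hΔ : D.Meets B Δ
  · have h1 := cnt_conn_dvd_of_conn hconj F.trans (fun a ha Δ hΔ =>
      (D.meets_smul_iff_of_eq ((hYm a).1 ha).1 Δ).2 hΔ) hΔ
    rw [show cnt (D.Meets B) = 3 ^ 2 from D.card_meets B] at h1
    obtain ⟨j, -, hj⟩ := (Nat.dvd_prime_pow hp).1 h1
    rcases j with _ | j
    · obtain ⟨y, -, hy⟩ := exists_of_cnt_eq_one hj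
      exact (hy _ ⟨g, (hYm g).2 ⟨hgB, hg⟩, rfl⟩).trans (hy _ ((conn_equivalence Y).refl Δ)).symm
    · exact absurd ((Dvd.intro_left _ (pow_succ 3 j).symm).trans (hj ▸ cnt_conn_dvd_card Y Δ)) h3
  · exact hg Δ hΔ

theorem conn_smul_iff (F : D.Frame R B Δ₀ w₁ w₂) {k : Γ} (hkB : k • B = B)
    (hk : ∀ Δ, ¬ D.Meets B Δ → ¬ Conn R w₂ Δ → k • Δ = Δ) (x : C) :
    Conn R w₂ (k • x) ↔ Conn R w₂ x := by
  constructor <;> intro h <;> by_contra hn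
  · have h1 := (meets_smul_iff D hkB x).1 (F.swap.not_meets_of_conn₁ h)
    rw [hk x h1 hn] at h
    exact hn h
  · have h1 := (meets_smul_iff D hkB x).2 (F.swap.not_meets_of_conn₁ h)
    exact hn ((smul_left_cancel k (hk _ h1 hn)).symm ▸ h)

theorem mem_of_pow_three (F : D.Frame R B Δ₀ w₁ w₂) {k : Γ} (hkB : k • B = B) (hk3 : k ^ 3 = 1)
    (hk : ∀ Δ, ¬ D.Meets B Δ → ¬ Conn R w₂ Δ → k • Δ = Δ) : k ∈ R := by
  have hkW := F.conn_smul_iff hkB hk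
  have hrefl : Conn R w₂ w₂ := (conn_equivalence R).refl w₂
  obtain ⟨a, ha, e⟩ := F.conn₂ hrefl ((hkW w₂).2 hrefl)
  have h1 : a⁻¹ * k = 1 := by
    refine F.eq_one_of_fix_not_meets ?_ fun Δ hΔ => ?_
    · rw [mul_smul, hkB, inv_smul_eq_iff, F.block a ha.1]
    · rw [mul_smul, inv_smul_eq_iff]
      rcases F.cover Δ hΔ with rfl | h | h
      · rw [hk _ hΔ F.swap.not_conn₀, F.fix a ha.1]
      · rw [hk _ hΔ fun h' => F.not_conn ((conn_equivalence R).trans h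
          ((conn_equivalence R).symm h')),
          F.smul_eq₁ ha.1 ((conn_equivalence R).refl _) ha.2 h]
      · exact smul_eq_smul_of_pow_three hk3 (F.pow_three₁ ha.1 ha.2) hkW
          (conn_smul_right ha.1 w₂) F.card₂.le hrefl h e.symm
  rw [← inv_mul_eq_one.1 h1]
  exact ha.1

theorem exists_mul_eq (F : D.Frame R B Δ₀ w₁ w₂) {r : Γ} (hr : r ∈ R) :
    ∃ a ∈ R, ∃ b ∈ R, a * b = r ∧ a • w₁ = w₁ ∧ b • w₂ = w₂ := by
  obtain ⟨a, ha, e⟩ := F.conn₂ ((conn_equivalence R).refl w₂) ⟨r, hr, rfl⟩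
  refine ⟨a, ha.1, a⁻¹ * r, mul_mem (inv_mem ha.1) hr, mul_inv_cancel_left a r, ha.2, ?_⟩
  rw [mul_smul, ← e, inv_smul_smul]

theorem cnt_jordan (F : D.Frame R B Δ₀ w₁ w₂) {U : C → Prop}
    (hU : JordanSet (stabilizer Γ B) (fun Δ => ¬ D.Meets B Δ) U) (hUV : ∀ Δ, U Δ → ¬ D.Meets B Δ)
    (hU3 : cnt U = 3) :
    (∀ Δ, U Δ → ¬ Conn R w₁ Δ) ∨ (∀ Δ, U Δ → ¬ Conn R w₂ Δ) := by
  have h1 := cnt_inter_ne_one D hU F.swap.jordan₂ hUV (fun Δ => F.not_meets_of_conn₁) hU3 F.card₁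
  have h2 := cnt_inter_ne_one D hU F.jordan₂ hUV (fun Δ => F.swap.not_meets_of_conn₁) hU3 F.card₂
  have h3 := cnt_and_add_not U (Conn R w₁)
  have h4 : cnt (fun Δ => U Δ ∧ Conn R w₂ Δ) ≤ cnt (fun Δ => U Δ ∧ ¬ Conn R w₁ Δ) :=
    cnt_mono fun Δ h => ⟨h.1, fun h' => F.not_conn ((conn_equivalence R).trans h'
      ((conn_equivalence R).symm h.2))⟩
  have h5 : cnt (fun Δ => U Δ ∧ Conn R w₁ Δ) = 0 ∨ cnt (fun Δ => U Δ ∧ Conn R w₂ Δ) = 0 := by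
    omega
  rcases h5 with h | h
  · exact Or.inl fun Δ h1 h2 => cnt_eq_zero.1 h Δ ⟨h1, h2⟩
  · exact Or.inr fun Δ h1 h2 => cnt_eq_zero.1 h Δ ⟨h1, h2⟩

theorem card_translate {U : C → Prop} (g : Γ) :
    cnt (fun Δ => U (g⁻¹ • Δ)) = cnt U :=
  (cnt_smul g _ _ fun Δ => by rw [inv_smul_smul]).symm

/-- The stabilizer of the block does not fix the class fixed by `R`. -/
theorem exists_smul_ne_class (F : D.Frame R B Δ₀ w₁ w₂) : ∃ g : Γ, g • B = B ∧ g • Δ₀ ≠ Δ₀ := by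
  by_contra! hfix
  have := D.finite
  have hp : Nat.Prime 3 := by norm_num
  have htri : ∀ {w₁ w₂ : C}, D.Frame R B Δ₀ w₁ w₂ → ∀ g : Γ, g • B = B → ∀ r ∈ R, r • w₁ = w₁ →
      g * r * g⁻¹ ∈ R := by
    intro w₁ w₂ F g hg r hr hr1
    have hg' : g⁻¹ • B = B := by rw [inv_smul_eq_iff, hg]
    have hU := F.jordan₂.translate (t := g) hg (meets_smul_iff D hg)
    have hUV : ∀ Δ, Conn R w₂ (g⁻¹ • Δ) → ¬ D.Meets B Δ := fun Δ h =>
      (meets_smul_iff D hg' Δ).1 (F.swap.not_meets_of_conn₁ h)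
    have hUcard : cnt (fun Δ => Conn R w₂ (g⁻¹ • Δ)) = 3 := (card_translate g).trans F.card₂
    have hU0 : ∀ Δ, Conn R w₂ (g⁻¹ • Δ) → Δ ≠ Δ₀ := by
      rintro Δ h rfl
      rw [hfix _ hg'] at h
      exact F.swap.not_conn₀ h
    have hkB : (g * r * g⁻¹) • B = B := by
      rw [mul_smul, mul_smul, hg', F.block r hr, hg]
    have hk3 : (g * r * g⁻¹) ^ 3 = 1 := by
      rw [conj_pow, F.pow_three₁ hr hr1, mul_one, mul_inv_cancel]
    have hk : ∀ Δ, ¬ D.Meets B Δ → ¬ Conn R w₂ (g⁻¹ • Δ) → (g * r * g⁻¹) • Δ = Δ := by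
      intro Δ hΔ hn
      rw [mul_smul, mul_smul, ← eq_inv_smul_iff]
      rcases F.cover _ ((meets_smul_iff D hg' Δ).2 hΔ) with h | h | h
      · rw [h, F.fix r hr]
      · exact F.smul_eq₁ hr ((conn_equivalence R).refl _) hr1 h
      · exact absurd h hn
    rcases F.cnt_jordan hU hUV hUcard with h | h
    · have hall : ∀ Δ, Conn R w₂ Δ → Conn R w₂ (g⁻¹ • Δ) :=
        eq_of_cnt_le (p := fun Δ => Conn R w₂ (g⁻¹ • Δ)) (fun Δ hΔ =>
          ((F.cover Δ (hUV Δ hΔ)).resolve_left (hU0 Δ hΔ)).resolve_left (h Δ hΔ))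
          (by rw [hUcard, F.card₂])
      refine F.mem_of_pow_three hkB hk3 fun Δ hΔ hn => hk Δ hΔ fun h' => hn ?_
      exact ((F.cover Δ hΔ).resolve_left (hU0 Δ h')).resolve_left (h Δ h')
    · refine F.swap.mem_of_pow_three hkB hk3 fun Δ hΔ hn => hk Δ hΔ fun h' => hn ?_
      exact ((F.cover Δ hΔ).resolve_left (hU0 Δ h')).resolve_right (h Δ h')
  have hnorm : ∀ g : Γ, g • B = B → ∀ r ∈ R, g * r * g⁻¹ ∈ R := by
    intro g hg r hr
    obtain ⟨a, ha, b, hb, rfl, ha1, hb2⟩ := F.exists_mul_eq hr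
    have h1 := mul_mem (htri F g hg a ha ha1) (htri F.swap g hg b hb hb2)
    simpa [mul_assoc] using h1
  obtain ⟨x, hx, hxR⟩ := exists_fixed_of_isPGroup hp F.sylow.isPGroup (X := P)
    (q := fun x => D.cls x = Δ₀) (fun g hg x hx => by rw [D.cls_smul, hx, F.fix g hg])
    (by rw [show cnt (fun x => D.cls x = Δ₀) = 16 from D.card_cls Δ₀]; norm_num)
  have hu : ∀ y, D.cls y = Δ₀ → (∀ g ∈ R, g • y = y) → y = x := by
    intro y hy hyR
    by_contra hne
    have h1 : cnt (Conn (stabilizer Γ x) y) = 15 := by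
      have h2 := cnt_ne_add_one (p := fun z => D.cls z = Δ₀) hx
      rw [show cnt (fun x => D.cls x = Δ₀) = 16 from D.card_cls Δ₀] at h2
      refine (cnt_congr (q := fun z => D.cls z = Δ₀ ∧ z ≠ x) fun z => ⟨?_, fun hz => ?_⟩).trans
        (Nat.succ_injective h2)
      · rintro ⟨g, hg, rfl⟩
        refine ⟨?_, fun e => hne (smul_left_cancel g (e.trans hg.symm))⟩
        rw [D.cls_smul, hy, ← hx, ← D.cls_smul, hg]
      · obtain ⟨g, hg, e⟩ := D.exists_smul_eq_of_cls_16_16 (hy.trans hx.symm) hne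
          (hz.1.trans hx.symm) hz.2
        exact ⟨g, hg, e⟩
    obtain ⟨g, hg, hgy⟩ := (F.sylow.mono (S' := stabilizer Γ x) hxR le_top).exists_ne hp
      (x := y) (by rw [h1]; norm_num)
    exact hgy (hyR g hg)
  have hle : stabilizer Γ B ≤ stabilizer Γ x := by
    intro g hg
    refine hu _ (by rw [D.cls_smul, hx, hfix g hg]) fun r hr => ?_
    have h1 := hnorm g⁻¹ (by rw [inv_smul_eq_iff, hg]) r hr
    have h2 := hxR _ h1
    rwa [inv_inv, mul_smul, mul_smul, inv_smul_eq_iff] at h2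
  have h1 := cnt_conn_mul_card (⊤ : Subgroup Γ) B
  have h2 := cnt_conn_mul_card (⊤ : Subgroup Γ) x
  rw [top_inf_eq, cnt_congr (q := fun _ => True) fun E => ⟨fun _ => trivial, fun _ => ?_⟩,
    cnt_true, D.card_B] at h1
  rw [top_inf_eq, cnt_congr (q := fun _ => True) fun E => ⟨fun _ => trivial, fun _ => ?_⟩,
    cnt_true, D.card_P] at h2
  · obtain ⟨n, hn⟩ := Subgroup.card_dvd_of_le hle
    rw [hn, ← h1] at h2
    have h3 : 0 < Nat.card (stabilizer Γ B) := Nat.card_pos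
    have h4 : 256 * n = 640 := Nat.eq_of_mul_eq_mul_left h3 (by linarith)
    omega
  · obtain ⟨g, hg⟩ := D.exists_smul_point x E
    exact ⟨g, Subgroup.mem_top g, hg⟩
  · obtain ⟨g, hg⟩ := D.exists_smul_block B E
    exact ⟨g, Subgroup.mem_top g, hg⟩

theorem eq_of_fixed (F : D.Frame R B Δ₀ w₁ w₂) {u : C} (hu : ∀ g ∈ R, g • u = u) : u = Δ₀ := by
  obtain ⟨g, hg, hg2, hg1⟩ := F.swap.exists_smul_ne
  obtain ⟨g', hg', hg1', hg2'⟩ := F.exists_smul_ne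
  by_cases hm : D.Meets B u
  · exact absurd (by rw [F.eq_one_of_meets hg hm (hu g hg), one_smul]) hg1
  rcases F.cover u hm with h | h | h
  · exact h
  · exact absurd (F.smul_eq₁ hg h (hu g hg) ((conn_equivalence R).refl _)) hg1
  · exact absurd (F.swap.smul_eq₁ hg' h (hu g' hg') ((conn_equivalence R).refl _)) hg2'

theorem not_nine_dvd (F : D.Frame R B Δ₀ w₁ w₂) {Y : Subgroup Γ}
    (hY : ∀ g ∈ Y, ∀ x, Conn R w₂ x → g • x = x) : ¬ 9 ∣ Nat.card Y := by
  intro h9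
  have := D.finite
  have hp : Nat.Prime 3 := by norm_num
  obtain ⟨Q, hQY, hQ⟩ := exists_subgroup_card hp (k := 2) (H := Y) (by simpa using h9)
  have hQs : SylowIn 3 Q ⊤ := by
    refine ⟨le_top, IsPGroup.of_card hQ, fun hd => F.sylow.not_dvd ?_⟩
    have h1 := relIndex_mul_card (le_top : Q ≤ ⊤)
    have h2 := relIndex_mul_card (le_top : R ≤ ⊤)
    rw [F.card_eq_nine, ← h1, hQ] at h2
    rwa [Nat.eq_of_mul_eq_mul_right (by norm_num) h2]
  obtain ⟨t, -, ht⟩ := F.sylow.exists_conj hp hQs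
  have key : ∀ x, Conn R w₂ x → t⁻¹ • x = Δ₀ := fun x hx => F.eq_of_fixed fun g hg => by
    have h1 := hY _ (hQY ((ht g).1 hg)) x hx
    rwa [mul_smul, mul_smul, ← eq_inv_smul_iff] at h1
  obtain ⟨x, hx, hne⟩ := exists_ne_of_one_lt_cnt (show 1 < cnt (Conn R w₂) by rw [F.card₂]; norm_num) w₂
  exact hne (smul_left_cancel t⁻¹ ((key x hx).trans (key w₂ ((conn_equivalence R).refl _)).symm))

theorem not_jordan_four (F : D.Frame R B Δ₀ w₁ w₂) {U : C → Prop}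
    (hU : JordanSet (⊤ : Subgroup Γ) (fun _ => True) U) (h4 : cnt U = 4) : False := by
  have := D.finite
  obtain ⟨x, hx⟩ := cnt_pos.1 (show 0 < cnt U by omega)
  obtain ⟨y, hy, hyx⟩ := exists_ne_of_one_lt_cnt (show 1 < cnt U by omega) x
  have h1 := cnt_add_not U
  rw [D.card_C] at h1
  obtain ⟨w, hw⟩ := cnt_pos.1 (show 0 < cnt (fun z => ¬ U z) by omega)
  obtain ⟨t, htx, hty⟩ := D.exists_smul_pair_16_16 hyx.symm (E := x) (E' := w) (by rintro rfl; exact hw hx)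
  have hx' : U (t⁻¹ • x) := by rwa [← htx, inv_smul_smul]
  have hw' : U (t⁻¹ • w) := by rwa [← hty, inv_smul_smul]
  have hJ := hU.union (hU.translate (t := t) (Subgroup.mem_top t) fun _ => Iff.rfl) hx hx'
  have h2 := cnt_or (p := U) (q := fun z => U (t⁻¹ • z) ∧ ¬ U z) fun z h h' => h'.2 h
  have h3 : cnt (fun z => U (t⁻¹ • z)) = 4 := (card_translate t).trans h4
  have h5 := cnt_and_add_not (fun z => U (t⁻¹ • z)) U
  have h6 : 0 < cnt (fun z => U (t⁻¹ • z) ∧ U z) := cnt_pos.2 ⟨x, hx', hx⟩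
  have h7 : 0 < cnt (fun z => U (t⁻¹ • z) ∧ ¬ U z) := cnt_pos.2 ⟨w, hw', hw⟩
  have h8 : cnt (fun z => U z ∨ U (t⁻¹ • z)) = cnt (fun z => U z ∨ (U (t⁻¹ • z) ∧ ¬ U z)) :=
    cnt_congr fun z => by tauto
  have h9 := cnt_add_not (fun z => U z ∨ U (t⁻¹ • z))
  rw [D.card_C] at h9
  have hpow : ∀ p : ℕ, p.Prime → p ∣ cnt (fun z => U z ∨ U (t⁻¹ • z)) →
      ∃ g : Γ, g ≠ 1 ∧ g ^ p = 1 ∧ 9 ≤ cnt (fun z : C => g • z = z) := by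
    intro p hp hd
    obtain ⟨g, -, hg1, hgp, hg⟩ := hJ.exists_pow (fun _ _ _ _ => trivial) (fun _ _ => trivial)
      (Or.inl hx) hp hd
    refine ⟨g, hg1, hgp, le_trans ?_ (cnt_mono fun z hz => hg z trivial hz)⟩
    omega
  have h10 : cnt (fun z => U z ∨ U (t⁻¹ • z)) = 5 ∨ cnt (fun z => U z ∨ U (t⁻¹ • z)) = 6 ∨
      cnt (fun z => U z ∨ U (t⁻¹ • z)) = 7 := by omega
  rcases h10 with h | h | h
  · obtain ⟨g, hg1, hg, h9⟩ := hpow 5 (by norm_num) (by rw [h])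
    obtain ⟨z, hz⟩ := cnt_pos.1 (show 0 < cnt (fun z : C => g • z = z) by omega)
    obtain ⟨z', hz', hne⟩ := exists_ne_of_one_lt_cnt
      (show 1 < cnt (fun z : C => g • z = z) by omega) z
    exact hne (D.eq_of_pow_five_16_16 hg hg1 hz' hz)
  · obtain ⟨g, hg1, hg, h9⟩ := hpow 3 (by norm_num) (by rw [h]; norm_num)
    have := F.cnt_fixed_le_four hg hg1
    omega
  · obtain ⟨g, hg1, hg, -⟩ := hpow 7 (by norm_num) (by rw [h])
    exact hg1 (F.pow_seven_eq_one hg)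

theorem not_jordan (F : D.Frame R B Δ₀ w₁ w₂) {U : C → Prop}
    (hJ : JordanSet (stabilizer Γ B) (fun Δ => ¬ D.Meets B Δ) U)
    (hUV : ∀ Δ, U Δ → ¬ D.Meets B Δ) (hU3 : cnt U = 3) (hU0 : U Δ₀)
    (hU2 : ∀ x, U x → ¬ Conn R w₂ x) : False := by
  have := D.finite
  have hrefl : ∀ w : C, Conn R w w := (conn_equivalence R).refl
  obtain ⟨k, hkB, hk1, hk3, hk⟩ := hJ.exists_pow (fun g hg x => (meets_smul_iff D hg x).2) hUV hU0
    Nat.prime_three (by rw [hU3])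
  have hkU : ∀ x, U (k • x) ↔ U x := by
    intro x
    constructor <;> intro h <;> by_contra hn
    · rw [hk x ((meets_smul_iff D hkB x).1 (hUV _ h)) hn] at h
      exact hn h
    · exact hn ((smul_left_cancel k (hk _ ((meets_smul_iff D hkB x).2 (hUV _ h)) hn)).symm ▸ h)
  have hkW : ∀ x, Conn R w₂ x → k • x = x := fun x hx =>
    hk x (F.swap.not_meets_of_conn₁ hx) fun h => hU2 x h hx
  have hk0 : k • Δ₀ ≠ Δ₀ := fun h0 => hk1 <| F.eq_one_of_fix_not_meets hkB fun Δ hΔ => by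
    by_cases hU : U Δ
    · have := smul_eq_smul_of_pow_three hk3 (one_pow 3) hkU (fun x => by rw [one_smul]) hU3.le hU0 hU
        (by rw [h0, one_smul])
      rwa [one_smul] at this
    · exact hk Δ hΔ hU
  have hUW : ∀ x, U x → x ≠ Δ₀ → Conn R w₁ x := fun x hx h0 =>
    ((F.cover x (hUV x hx)).resolve_left h0).resolve_right (hU2 x hx)
  have hq := hUW (k • Δ₀) ((hkU _).2 hU0) hk0
  have hkk0 : k • k • Δ₀ ≠ Δ₀ := smul_smul_ne_of_pow hk3 hk0
  have hq' := hUW (k • k • Δ₀) ((hkU _).2 ((hkU _).2 hU0)) hkk0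
  obtain ⟨h, hhR, hh2, hh1⟩ := F.swap.exists_smul_ne
  have hh3 := F.swap.pow_three₁ hhR hh2
  have hhB := F.block h hhR
  have hhW : ∀ x, Conn R w₂ x → h • x = x := fun x hx => F.swap.smul_eq₁ hhR (hrefl _) hh2 hx
  have hhq : h • k • Δ₀ ≠ k • Δ₀ := fun e => hh1 (F.smul_eq₁ hhR hq e (hrefl _))
  -- `h` and `k` commute on the classes meeting `B`
  have hcomm : ∀ z, D.Meets B z → k • h • z = h • k • z := by
    intro z hz
    set Y := stabilizer Γ B ⊓ fixingSubgroup Γ {x | Conn R w₂ x} with hY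
    have hYm : ∀ g, g ∈ Y ↔ g • B = B ∧ ∀ x, Conn R w₂ x → g • x = x := fun g =>
      and_congr Iff.rfl (mem_fixingSubgroup_iff Γ)
    have hkY : k ∈ Y := (hYm k).2 ⟨hkB, hkW⟩
    have hhY : h ∈ Y := (hYm h).2 ⟨hhB, hhW⟩
    have hconj : ∀ r ∈ R, ∀ a ∈ Y, r⁻¹ * a * r ∈ Y := by
      intro r hr a ha
      rw [hYm] at ha ⊢
      refine ⟨?_, fun x hx => ?_⟩
      · rw [mul_smul, mul_smul, F.block r hr, ha.1, inv_smul_eq_iff, F.block r hr]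
      · rw [mul_smul, mul_smul, ha.2 _ ((conn_smul_right hr w₂ x).2 hx), inv_smul_smul]
    have h1 : cnt (Conn Y z) ∣ 9 := by
      have := cnt_conn_dvd_of_conn hconj F.trans (fun a ha x hx => by
        have := meets_smul_iff D ((hYm a).1 ha).1 x
        tauto) hz
      rwa [show cnt (D.Meets B) = 9 from D.card_meets B] at this
    have h2 : cnt (Conn Y z) ≠ 9 := fun h9 =>
      F.not_nine_dvd (fun g hg => ((hYm g).1 hg).2) (h9 ▸ cnt_conn_dvd_card Y z)
    have h3 : cnt (Conn Y z) ≤ 3 := by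
      have h4 := Nat.le_of_dvd (by norm_num) h1
      generalize cnt (Conn Y z) = n at *
      interval_cases n <;> omega
    exact smul_smul_comm_of_pow_three hk3 hh3 (conn_smul_right hkY z) (conn_smul_right hhY z) h3
      ((conn_equivalence Y).refl z)
  set T := fixingSubgroup Γ {x | D.Meets B x ∨ Conn R w₂ x} with hT
  have hTm : ∀ g, g ∈ T ↔ ∀ x, D.Meets B x ∨ Conn R w₂ x → g • x = x := fun g =>
    mem_fixingSubgroup_iff Γ
  have hconj : ∀ g : Γ, g • B = B → (∀ x, Conn R w₂ x → g • x = x) →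
      ∀ a ∈ T, g⁻¹ * a * g ∈ T := by
    intro g hgB hgW a ha
    rw [hTm] at ha ⊢
    intro x hx
    rw [mul_smul, mul_smul, ha, inv_smul_smul]
    rcases hx with hx | hx
    · have := meets_smul_iff D hgB x
      tauto
    · rw [hgW x hx]
      exact Or.inr hx
  have hconn : ∀ g : Γ, g • B = B → (∀ x, Conn R w₂ x → g • x = x) →
      ∀ x y : C, Conn T (g • x) (g • y) ↔ Conn T x y := by
    intro g hgB hgW x y
    refine conn_smul (fun a ha => ?_) (hconj g hgB hgW) x y
    have := hconj g⁻¹ (by rw [inv_smul_eq_iff, hgB])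
      (fun x hx => by rw [inv_smul_eq_iff, hgW x hx]) a ha
    rwa [inv_inv] at this
  have hbase : Conn T (h • k • Δ₀) (k • Δ₀) := by
    refine ⟨k * h * k⁻¹ * h⁻¹, (hTm _).2 fun x hx => ?_, ?_⟩
    · have e : k • h • k⁻¹ • h⁻¹ • x = x := by
        rcases hx with hx | hx
        · have hx' : D.Meets B (k⁻¹ • h⁻¹ • x) := by
            have h1 := meets_smul_iff D hkB (k⁻¹ • h⁻¹ • x)
            have h2 := meets_smul_iff D hhB (h⁻¹ • x)
            rw [smul_inv_smul] at h1 h2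
            tauto
          rw [hcomm _ hx', smul_inv_smul, smul_inv_smul]
        · have e1 : h⁻¹ • x = x := by rw [inv_smul_eq_iff, hhW x hx]
          have e2 : k⁻¹ • x = x := by rw [inv_smul_eq_iff, hkW x hx]
          rw [e1, e2, hhW x hx, hkW x hx]
      rw [mul_smul, mul_smul, mul_smul, e]
    · rw [mul_smul, mul_smul, mul_smul, inv_smul_smul, inv_smul_smul, F.fix h hhR]
  have hE := conn_equivalence (X := C) T
  have hW : ∀ x, Conn R w₁ x → Conn T (k • Δ₀) x := by
    intro x hx
    rcases eq_or_eq_of_pow_three hh3 (conn_smul_right hhR w₁) F.card₁.le hq hhq hx with e | e | e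
    · rw [e]; exact hE.refl _
    · rw [e]; exact hE.symm hbase
    · rw [e]
      exact hE.trans (hE.symm hbase) (hE.symm ((hconn h hhB hhW _ _).2 hbase))
  have hZ : ∀ x, (x = Δ₀ ∨ Conn R w₁ x) → Conn T (k • Δ₀) x := by
    rintro x (rfl | hx)
    · exact hE.symm ((hconn k hkB hkW _ _).1 (hW _ hq'))
    · exact hW x hx
  have hJ' : JordanSet (⊤ : Subgroup Γ) (fun _ => True) (fun x => x = Δ₀ ∨ Conn R w₁ x) := by
    intro x y hx hy
    obtain ⟨g, hg, e⟩ := hE.trans (hE.symm (hZ x hx)) (hZ y hy)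
    refine ⟨g, Subgroup.mem_top g, e, fun z _ hz => (hTm g).1 hg z ?_⟩
    by_contra! hn
    rcases F.cover z hn.1 with h' | h' | h'
    · exact hz (Or.inl h')
    · exact hz (Or.inr h')
    · exact hn.2 h'
  refine F.not_jordan_four hJ' ?_
  rw [cnt_or (p := fun x => x = Δ₀) (q := Conn R w₁) (by rintro _ rfl; exact F.not_conn₀), F.card₁,
    cnt_eq_one_of (p := fun x => x = Δ₀) Δ₀ rfl fun _ => id]

end ImprimDesign.Frame

namespace ImprimDesign

open MulAction

theorem no_3_16_16 {Γ P C β : Type*} [Group Γ] [Fintype P] [Fintype C] [Fintype β]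
    [MulAction Γ P] [MulAction Γ C] [MulAction Γ β]
    (D : ImprimDesign Γ P C β 3 16 16 2 9 45 640) : False := by
  obtain ⟨R, B, Δ₀, w₁, w₂, F⟩ := D.exists_frame
  obtain ⟨g, hg, hg0⟩ := F.exists_smul_ne_class
  have hg' : g⁻¹ • B = B := by rw [inv_smul_eq_iff, hg]
  have key : ∀ {w₁ w₂ : C}, D.Frame R B Δ₀ w₁ w₂ → Conn R w₂ (g⁻¹ • Δ₀) → False := by
    intro w₁ w₂ F h
    have hU := F.jordan₂.translate (t := g) hg (Frame.meets_smul_iff D hg)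
    have hUV : ∀ Δ, Conn R w₂ (g⁻¹ • Δ) → ¬ D.Meets B Δ := fun Δ h =>
      (Frame.meets_smul_iff D hg' Δ).1 (F.swap.not_meets_of_conn₁ h)
    have hU3 : cnt (fun Δ => Conn R w₂ (g⁻¹ • Δ)) = 3 := (Frame.card_translate g).trans F.card₂
    rcases F.cnt_jordan hU hUV hU3 with h1 | h1
    · exact F.swap.not_jordan hU hUV hU3 h h1
    · exact F.not_jordan hU hUV hU3 h h1
  rcases F.cover (g⁻¹ • Δ₀) ((Frame.meets_smul_iff D hg' Δ₀).2 F.not_meets₀) with h | h | h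
  · exact hg0 (inv_smul_eq_iff.1 h).symm
  · exact key F.swap h
  · exact key F h

end ImprimDesign

namespace ImprimDesign

open MulAction

variable {Γ P C β : Type*} [Group Γ] [Fintype P] [Fintype C] [Fintype β]
    [MulAction Γ P] [MulAction Γ C] [MulAction Γ β]

theorem card_points_mem {lam c d l s r b : ℕ} (D : ImprimDesign Γ P C β lam c d l s r b)
    (hlam4 : lam ≤ 4) (hk : s * l < d * c) : d * c ∈ [15, 16, 36, 45, 96] := by
  have hl : 1 < l := by
    by_contra hl
    have h1 := D.r_mul_pred_l
    rw [Nat.sub_eq_zero_of_le (not_lt.1 hl), mul_zero] at h1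
    have h2 := D.two_le_c
    exact (Nat.mul_pos D.lam_pos (by omega : 0 < c - 1)).ne h1
  obtain ⟨Δ⟩ := D.nonempty_C
  have h5 : l * l ∣ c * c * lam := by
    obtain ⟨Δ', -, hne⟩ := exists_ne_of_one_lt_cnt (p := fun _ : C => True)
      (by rw [cnt_true, D.card_C]; exact D.two_le_d) Δ
    exact Dvd.intro_left _ (D.card_blocks_meets₂ Δ Δ' hne.symm)
  refine (parameters_mem D.lam_pos hlam4 hl (D.l_lt_c hk) D.two_le_d D.s_pos hk D.r_mul_pred_l
    D.r_mul_pred_k (D.k_le_r hk) D.b_mul_eq h5).resolve_right fun h => ?_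
  simp only [exceptionalParameters, List.mem_cons, Prod.mk.injEq, List.not_mem_nil, or_false] at h
  rcases h with ⟨rfl, rfl, rfl, rfl, rfl, rfl, rfl⟩ | h
  · exact D.no_2_10_10
  rcases h with ⟨rfl, rfl, rfl, rfl, rfl, rfl, rfl⟩ | h
  · exact D.no_2_22_22
  rcases h with ⟨rfl, rfl, rfl, rfl, rfl, rfl, rfl⟩ | h
  · exact D.no_3_10_10
  rcases h with ⟨rfl, rfl, rfl, rfl, rfl, rfl, rfl⟩ | h
  · exact D.no_3_16_16
  rcases h with ⟨rfl, rfl, rfl, rfl, rfl, rfl, rfl⟩ | h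
  · exact D.no_3_34_34
  rcases h with ⟨rfl, rfl, rfl, rfl, rfl, rfl, rfl⟩ | h
  · exact D.no_3_8_15
  rcases h with ⟨rfl, rfl, rfl, rfl, rfl, rfl, rfl⟩ | h
  · exact D.no_15_8
  rcases h with ⟨rfl, rfl, rfl, rfl, rfl, rfl, rfl⟩ | h
  · exact D.no_3_33_17
  rcases h with ⟨rfl, rfl, rfl, rfl, rfl, rfl, rfl⟩ | h
  · exact D.no_4_10_10
  rcases h with ⟨rfl, rfl, rfl, rfl, rfl, rfl, rfl⟩ | h
  · exact D.no_4_14_14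
  rcases h with ⟨rfl, rfl, rfl, rfl, rfl, rfl, rfl⟩ | h
  · exact D.no_4_22_22
  rcases h with ⟨rfl, rfl, rfl, rfl, rfl, rfl, rfl⟩ | h
  · exact D.no_4_46_46
  rcases h with ⟨rfl, rfl, rfl, rfl, rfl, rfl, rfl⟩ | h
  · exact D.no_4_11_21
  rcases h with ⟨rfl, rfl, rfl, rfl, rfl, rfl, rfl⟩ | h
  · exact D.no_4_10_28
  rcases h with ⟨rfl, rfl, rfl, rfl, rfl, rfl, rfl⟩ | h
  · exact D.no_4_26_76
  rcases h with ⟨rfl, rfl, rfl, rfl, rfl, rfl, rfl⟩ | h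
  · exact D.no_4_21_11
  rcases h with ⟨rfl, rfl, rfl, rfl, rfl, rfl, rfl⟩ | h
  · exact D.no_28_10
  obtain ⟨rfl, rfl, rfl, rfl, rfl, rfl, rfl⟩ := h
  exact D.no_4_76_26

/-- Flag-transitivity makes the remaining parameters well defined. -/
theorem exists_of_flag {lam : ℕ} (I : P → β → Prop) (cls : P → C)
    (I_smul : ∀ (g : Γ) x B, I (g • x) (g • B) ↔ I x B)
    (cls_smul : ∀ (g : Γ) x, cls (g • x) = g • cls x)
    (faithful : ∀ g : Γ, (∀ x : P, g • x = x) → g = 1)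
    (flag : ∀ x B y B', I x B → I y B' → ∃ g : Γ, g • x = y ∧ g • B = B')
    (pair : ∀ x y, x ≠ y → cnt (fun B => I x B ∧ I y B) = lam)
    (hcls : ∀ Δ, 2 ≤ cnt (fun x => cls x = Δ)) (hC : 2 ≤ Fintype.card C)
    (hβ : ∀ B, ∃ x, I x B) (hlam : 0 < lam) :
    ∃ c l s r, ∃ D : ImprimDesign Γ P C β lam c (Fintype.card C) l s r (Fintype.card β), D.I = I := by
  have hP : ∀ x, ∃ B, I x B := by
    intro x
    obtain ⟨y, -, hy⟩ := exists_ne_of_one_lt_cnt (hcls (cls x)) x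
    obtain ⟨B, hB, -⟩ := cnt_pos.1 ((pair x y hy.symm).symm ▸ hlam)
    exact ⟨B, hB⟩
  obtain ⟨Δ₀⟩ : Nonempty C := Fintype.card_pos_iff.1 (by omega)
  have hsurj : ∀ Δ, ∃ x, cls x = Δ := fun Δ => cnt_pos.1 (by have := hcls Δ; omega)
  obtain ⟨x₀, rfl⟩ := hsurj Δ₀
  obtain ⟨B₀, h₀⟩ := hP x₀
  have hcls' : ∀ (g : Γ) x y, cls x = cls y ↔ cls (g • x) = cls (g • y) := fun g x y => by
    rw [cls_smul, cls_smul, smul_left_cancel_iff]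
  refine ⟨cnt (fun x => cls x = cls x₀), cnt (fun y => I y B₀ ∧ cls y = cls x₀),
    cnt (fun Δ => ∃ x, I x B₀ ∧ cls x = Δ), cnt (fun B => I x₀ B),
    ⟨I, cls, I_smul, cls_smul, faithful, flag, pair, fun Δ => ?_, rfl, rfl, fun x => ?_,
      fun x B h => ?_, fun B => ?_, hlam, hcls _, hC⟩, rfl⟩
  · obtain ⟨x, rfl⟩ := hsurj Δ
    obtain ⟨B, h⟩ := hP x
    obtain ⟨g, rfl, rfl⟩ := flag x B x₀ B₀ h h₀
    exact cnt_smul g _ _ fun y => hcls' g y x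
  · obtain ⟨B, h⟩ := hP x
    obtain ⟨g, rfl, rfl⟩ := flag x B x₀ B₀ h h₀
    exact cnt_smul g _ _ fun B => (I_smul g x B).symm
  · obtain ⟨g, rfl, rfl⟩ := flag x B x₀ B₀ h h₀
    exact cnt_smul g _ _ fun y => and_congr (I_smul g y B).symm (hcls' g y x)
  · obtain ⟨x, h⟩ := hβ B
    obtain ⟨g, rfl, rfl⟩ := flag x B x₀ B₀ h h₀
    refine cnt_smul g _ _ fun Δ => ⟨?_, ?_⟩
    · rintro ⟨y, hy, rfl⟩
      exact ⟨g • y, (I_smul g y B).2 hy, cls_smul g y⟩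
    · rintro ⟨y, hy, e⟩
      refine ⟨g⁻¹ • y, (I_smul g _ B).1 (by rwa [smul_inv_smul]), ?_⟩
      rw [cls_smul, e, inv_smul_smul]

end ImprimDesign

theorem cnt_subtype_finset {X : Type*} (s : Finset X) (p : X → Prop) [DecidablePred p] :
    cnt (fun x : {x // x ∈ s} => p x) = (s.filter p).card := by
  classical
  unfold cnt
  refine Finset.card_bij (fun x _ => x.1) (fun x hx => ?_) (fun x _ y _ => Subtype.ext) fun x hx => ?_
  · simpa using hx
  · have := Finset.mem_filter.1 hx
    exact ⟨⟨x, this.1⟩, by simpa using this.2, rfl⟩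

theorem cnt_mem_finset {X : Type*} [Fintype X] (s : Finset X) : cnt (fun x => x ∈ s) = s.card := by
  classical
  unfold cnt
  congr 1
  ext x
  simp

/-- The action of a permutation group on an invariant family of subsets. -/
@[reducible] def invariantFamilyAction {Ω : Type*} [DecidableEq Ω] {G : Subgroup (Equiv.Perm Ω)}
    {𝓕 : Finset (Finset Ω)} (h : ∀ g ∈ G, ∀ B ∈ 𝓕, B.image ⇑g ∈ 𝓕) : MulAction G {B // B ∈ 𝓕} where
  smul g B := ⟨B.1.image g.1, h g.1 g.2 B.1 B.2⟩
  one_smul B := Subtype.ext (show B.1.image ⇑(1 : Equiv.Perm Ω) = B.1 by simp)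
  mul_smul g g' B := Subtype.ext
    (show B.1.image ⇑(g.1 * g'.1) = (B.1.image g'.1).image g.1 by
      rw [Finset.image_image, Equiv.Perm.coe_mul])

/-- A nontrivial 2-(v,k,λ) design with λ ≤ 4 admitting a flag-transitive,
point-imprimitive automorphism group has v ∈ {15, 16, 36, 45, 96}. -/
theorem stmt_0
    {Ω : Type*} [Fintype Ω] [DecidableEq Ω]
    (v k lam : ℕ)
    (𝓑 : Finset (Finset Ω))
    (G : Subgroup (Equiv.Perm Ω))
    (hv : Fintype.card Ω = v)
    (hlam1 : 1 ≤ lam) (hlam4 : lam ≤ 4)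
    (hkcard : ∀ B ∈ 𝓑, B.card = k)
    (hpairs : ∀ α β : Ω, α ≠ β → (𝓑.filter (fun B => α ∈ B ∧ β ∈ B)).card = lam)
    (hk2 : 2 < k) (hkv : k < v)
    (hGB : ∀ g ∈ G, ∀ B ∈ 𝓑, B.image ⇑g ∈ 𝓑)
    (hflag : ∀ B₁ ∈ 𝓑, ∀ B₂ ∈ 𝓑, ∀ α₁ ∈ B₁, ∀ α₂ ∈ B₂,
        ∃ g ∈ G, B₁.image ⇑g = B₂ ∧ g α₁ = α₂)
    (𝓒 : Finset (Finset Ω))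
    (hpart : ∀ ω : Ω, ∃! Δ, Δ ∈ 𝓒 ∧ ω ∈ Δ)
    (hd2 : 2 ≤ 𝓒.card)
    (hc2 : ∀ Δ ∈ 𝓒, 2 ≤ Δ.card)
    (hGC : ∀ g ∈ G, ∀ Δ ∈ 𝓒, Δ.image ⇑g ∈ 𝓒) :
    v ∈ ({15, 16, 36, 45, 96} : Set ℕ) := by
  let := invariantFamilyAction hGB
  let := invariantFamilyAction hGC
  choose cls hcls hcls' using hpart
  have hcls_iff : ∀ x (Δ : {Δ // Δ ∈ 𝓒}),
      (⟨cls x, (hcls x).1⟩ : {Δ // Δ ∈ 𝓒}) = Δ ↔ x ∈ Δ.1 := by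
    refine fun x Δ => ⟨?_, fun h => Subtype.ext (hcls' x Δ.1 ⟨Δ.2, h⟩).symm⟩
    rintro rfl
    exact (hcls x).2
  obtain ⟨c, l, s, r, D, hD⟩ := ImprimDesign.exists_of_flag (Γ := G) (P := Ω) (C := {Δ // Δ ∈ 𝓒})
    (β := {B // B ∈ 𝓑}) (lam := lam) (fun x B => x ∈ B.1) (fun x => ⟨cls x, (hcls x).1⟩)
    (fun g x B => show g.1 x ∈ B.1.image g.1 ↔ x ∈ B.1 from
      ⟨fun h => by
        obtain ⟨y, hy, e⟩ := Finset.mem_image.1 h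
        rwa [← g.1.injective e], Finset.mem_image_of_mem _⟩)
    (fun g x => (hcls_iff _ _).2 (Finset.mem_image_of_mem _ (hcls x).2))
    (fun g hg => Subtype.ext (Equiv.ext hg))
    (fun x B y B' hx hy => by
      obtain ⟨g, hg, e, e'⟩ := hflag B.1 B.2 B'.1 B'.2 x hx y hy
      exact ⟨⟨g, hg⟩, e', Subtype.ext e⟩)
    (fun x y h => (cnt_subtype_finset 𝓑 fun B => x ∈ B ∧ y ∈ B).trans (hpairs x y h))
    (fun Δ => by
      rw [cnt_congr fun x => hcls_iff x Δ, cnt_mem_finset]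
      exact hc2 Δ.1 Δ.2)
    (by rwa [Fintype.card_coe])
    (fun B => Finset.card_pos.1 (by rw [hkcard B.1 B.2]; omega))
    hlam1
  obtain ⟨B⟩ := D.nonempty_β
  have hB : s * l = k := by
    rw [← D.card_block B, hD, ← hkcard B.1 B.2, cnt_mem_finset]
  have h := D.card_points_mem hlam4 (by rwa [hB, ← D.card_P, hv])
  rw [← D.card_P, hv] at h
  simpa using h
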